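/- Let d≥2, γ>1, α>1/3 and 3≤p,q≤(3γ−1)/(γ−1). Let (ρ,v) be a weak solution of the isentropic compressible Euler equations on (0,T)×𝕋^d with ρ≥c>0 a.e. for some constant c. If ρ ∈ L^{p/(p−3)}(0,T;L^{q/(q−3)}(𝕋^d)), ∂_t ρ ∈ L^{p/(p−3)}(0,T;L^{q/(q−3)}(𝕋^d)), ∇ρ ∈ L^{p/(p−3)}(0,T;L^{q/(q−3)}(𝕋^d)) and v ∈ L^p(0,T;B^α_{q,∞}(𝕋^d)), then the energy is locally conserved: for every φ ∈ C_c^∞((0,T)), ∫₀^T φ'(t) ∫_{𝕋^d} (½ρ|v|² + κρ^γ/(γ−1)) dx dt = 0. -/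

import Mathlib

open MeasureTheory ENNReal

noncomputable section

namespace CompressibleEuler

variable {d : ℕ} {E : Type*} [NormedAddCommGroup E]

/-- Euclidean norm on `Fin d → ℝ`. -/
def euNorm (x : Fin d → ℝ) : ℝ := Real.sqrt (∑ i, x i ^ 2)

/-- The fundamental domain `[0,1)^d` of the torus `𝕋^d = [0,1]^d`. -/
def unitCube (d : ℕ) : Set (Fin d → ℝ) := Set.univ.pi fun _ => Set.Ico (0 : ℝ) 1

/-- Lebesgue measure on the torus `𝕋^d`, realized on the fundamental domain. -/
def cubeVol (d : ℕ) : Measure (Fin d → ℝ) := volume.restrict (unitCube d)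

/-- Product measure on `(0,T) × 𝕋^d`. -/
def spaceTime (d : ℕ) (T : ℝ) : Measure (ℝ × (Fin d → ℝ)) :=
  (volume.restrict (Set.Ioo 0 T)).prod (cubeVol d)

/-- `ℤ^d`-periodicity of a function on `ℝ^d` (i.e. a function on the torus `𝕋^d`). -/
def SpacePeriodic (f : (Fin d → ℝ) → E) : Prop :=
  ∀ (x : Fin d → ℝ) (n : Fin d → ℤ), f (x + fun i => (n i : ℝ)) = f x

/-- The `L^p` norm in time (exponent possibly `∞`) of an `ℝ≥0∞`-valued quantity,
over a time set `s`. -/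
def timeLpOn (s : Set ℝ) (p : ℝ≥0∞) (F : ℝ → ℝ≥0∞) : ℝ≥0∞ :=
  if p = ∞ then essSup F (volume.restrict s)
  else (∫⁻ t in s, F t ^ p.toReal) ^ (1 / p.toReal)

/-- The `L^p(0,T;L^q(𝕋^d))` norm. -/
def LpLqNorm (T : ℝ) (p q : ℝ≥0∞) (u : ℝ → (Fin d → ℝ) → E) : ℝ≥0∞ :=
  timeLpOn (Set.Ioo 0 T) p fun t => eLpNorm (u t) q (cubeVol d)

/-- `u ∈ L^p(0,T;L^q(𝕋^d))`. -/
def MemLpLq (T : ℝ) (p q : ℝ≥0∞) (u : ℝ → (Fin d → ℝ) → E) : Prop :=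
  LpLqNorm T p q u < ∞

/-- The homogeneous Besov seminorm `‖·‖_{Ḃ^α_{q,∞}(𝕋^d)}`. -/
def besovSeminorm (α : ℝ) (q : ℝ≥0∞) (f : (Fin d → ℝ) → E) : ℝ≥0∞ :=
  ⨆ (y : Fin d → ℝ) (_ : y ≠ 0),
    eLpNorm (fun x => f (x - y) - f x) q (cubeVol d) / ENNReal.ofReal (euNorm y ^ α)

/-- The Besov norm of `B^α_{q,∞}(𝕋^d)`. -/
def besovNorm (α : ℝ) (q : ℝ≥0∞) (f : (Fin d → ℝ) → E) : ℝ≥0∞ :=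
  eLpNorm f q (cubeVol d) + besovSeminorm α q f

/-- The `L^p(0,T;B^α_{q,∞}(𝕋^d))` norm. -/
def LpBesovNorm (T : ℝ) (p : ℝ≥0∞) (α : ℝ) (q : ℝ≥0∞) (u : ℝ → (Fin d → ℝ) → E) : ℝ≥0∞ :=
  timeLpOn (Set.Ioo 0 T) p fun t => besovNorm α q (u t)

/-- `u ∈ L^p(0,T;B^α_{q,∞}(𝕋^d))`. -/
def MemLpBesov (T : ℝ) (p : ℝ≥0∞) (α : ℝ) (q : ℝ≥0∞) (u : ℝ → (Fin d → ℝ) → E) : Prop :=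
  LpBesovNorm T p α q u < ∞

/-- The norm of the space-time Besov space `B^β_{p,∞}((0,T);B^α_{q,∞}(𝕋^d))`:
the `L^p(0,T;B^α_{q,∞})` norm plus the time-translation seminorm
`sup_{τ≠0} |τ|^{-β} ‖u(·-τ)-u(·)‖_{L^p(B^α_{q,∞})}`, the inner norm being taken
over the times where both terms are defined. -/
def besovBesovNorm (T β : ℝ) (p : ℝ≥0∞) (α : ℝ) (q : ℝ≥0∞)
    (u : ℝ → (Fin d → ℝ) → E) : ℝ≥0∞ :=
  LpBesovNorm T p α q u
    + ⨆ (τ : ℝ) (_ : τ ≠ 0),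
        timeLpOn (Set.Ioo (max 0 τ) (min T (T + τ))) p
            (fun t => besovNorm α q fun x => u (t - τ) x - u t x)
          / ENNReal.ofReal (|τ| ^ β)

/-- `u ∈ B^β_{p,∞}((0,T);B^α_{q,∞}(𝕋^d))`. -/
def MemBesovBesov (T β : ℝ) (p : ℝ≥0∞) (α : ℝ) (q : ℝ≥0∞)
    (u : ℝ → (Fin d → ℝ) → E) : Prop :=
  besovBesovNorm T β p α q u < ∞

/-- Classical partial derivative in time of a space-time function. -/
def pderivT (φ : ℝ → (Fin d → ℝ) → ℝ) (t : ℝ) (x : Fin d → ℝ) : ℝ :=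
  deriv (fun s => φ s x) t

/-- Classical partial derivative in the `i`-th space direction of a space-time function. -/
def pderivX (i : Fin d) (φ : ℝ → (Fin d → ℝ) → ℝ) (t : ℝ) (x : Fin d → ℝ) : ℝ :=
  fderiv ℝ (φ t) x (Pi.single i 1)

/-- Smooth test functions on `(0,T) × 𝕋^d`, compactly supported away from `t = 0` and
`t = T`, and periodic in space. -/
structure IsTestFunction (T : ℝ) (φ : ℝ → (Fin d → ℝ) → ℝ) : Prop where
  smooth : ContDiff ℝ (⊤ : ℕ∞) (Function.uncurry φ)
  periodic : ∀ t, SpacePeriodic (φ t)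
  supp : ∃ a b : ℝ, 0 < a ∧ b < T ∧ ∀ t x, t ∉ Set.Icc a b → φ t x = 0

/-- Smooth test functions on `[0,T) × 𝕋^d` (allowed to be nonzero at the initial time),
vanishing near `t = T`, and periodic in space. -/
structure IsTestFunctionIC (T : ℝ) (φ : ℝ → (Fin d → ℝ) → ℝ) : Prop where
  smooth : ContDiff ℝ (⊤ : ℕ∞) (Function.uncurry φ)
  periodic : ∀ t, SpacePeriodic (φ t)
  supp : ∃ b : ℝ, b < T ∧ ∀ t x, b ≤ t → φ t x = 0

/-- `g` is the weak time derivative of `f` on `(0,T) × 𝕋^d`. -/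
def HasWeakDerivT (T : ℝ) (f g : ℝ → (Fin d → ℝ) → ℝ) : Prop :=
  ∀ φ : ℝ → (Fin d → ℝ) → ℝ, IsTestFunction T φ →
    ∫ t in Set.Ioo 0 T, ∫ x in unitCube d, f t x * pderivT φ t x
      = - ∫ t in Set.Ioo 0 T, ∫ x in unitCube d, g t x * φ t x

/-- `g` is the weak `i`-th spatial derivative of `f` on `(0,T) × 𝕋^d`. -/
def HasWeakDerivX (T : ℝ) (i : Fin d) (f g : ℝ → (Fin d → ℝ) → ℝ) : Prop :=
  ∀ φ : ℝ → (Fin d → ℝ) → ℝ, IsTestFunction T φ →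
    ∫ t in Set.Ioo 0 T, ∫ x in unitCube d, f t x * pderivX i φ t x
      = - ∫ t in Set.Ioo 0 T, ∫ x in unitCube d, g t x * φ t x

/-- The weak time derivative of `f` belongs to `L^a(0,T;L^b(𝕋^d))`. -/
def DtInLpLq (T : ℝ) (a b : ℝ≥0∞) (f : ℝ → (Fin d → ℝ) → ℝ) : Prop :=
  ∃ g : ℝ → (Fin d → ℝ) → ℝ, HasWeakDerivT T f g ∧ MemLpLq T a b g

/-- The weak spatial gradient of `f` belongs to `L^a(0,T;L^b(𝕋^d))`. -/
def GradInLpLq (T : ℝ) (a b : ℝ≥0∞) (f : ℝ → (Fin d → ℝ) → ℝ) : Prop :=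
  ∃ G : ℝ → (Fin d → ℝ) → Fin d → ℝ,
    (∀ i, HasWeakDerivX T i f fun t x => G t x i) ∧ MemLpLq T a b G

/-- The constant `κ = (γ-1)²/(4γ)` in the pressure law `π(ρ) = κ ρ^γ`. -/
def kappa (γ : ℝ) : ℝ := (γ - 1) ^ 2 / (4 * γ)

/-- The total energy `E(t) = ∫_{𝕋^d} (½ ρ|v|² + κργ/(γ-1)) dx` at time `t`. -/
def energyAt (d : ℕ) (γ : ℝ) (ρ : ℝ → (Fin d → ℝ) → ℝ)
    (v : ℝ → (Fin d → ℝ) → Fin d → ℝ) (t : ℝ) : ℝ :=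
  ∫ x in unitCube d,
    ((1 / 2 : ℝ) * ρ t x * euNorm (v t x) ^ 2 + (kappa γ / (γ - 1)) * ρ t x ^ γ)

/-- The initial energy `E(0)`. -/
def energyInit (d : ℕ) (γ : ℝ) (ρ₀ : (Fin d → ℝ) → ℝ)
    (v₀ : (Fin d → ℝ) → Fin d → ℝ) : ℝ :=
  ∫ x in unitCube d,
    ((1 / 2 : ℝ) * ρ₀ x * euNorm (v₀ x) ^ 2 + (kappa γ / (γ - 1)) * ρ₀ x ^ γ)

/-- A weak solution of the isentropic compressible Euler equations
`∂ₜρ + div(ρv) = 0`, `∂ₜ(ρv) + div(ρv⊗v) + ∇(κρ^γ) = 0` on `(0,T) × 𝕋^d`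
with initial data `ρ(0) = ρ₀`, `(ρv)(0) = ρ₀v₀`:
both equations hold in the sense of distributions, `ρ^γ, ρ|v|² ∈ L^∞(0,T;L¹(𝕋^d))`,
`ρ` is a renormalized solution of the continuity equation, and the energy
inequality `E(t) ≤ E(0)` holds. -/
structure IsWeakSolution (d : ℕ) (T γ : ℝ) (ρ : ℝ → (Fin d → ℝ) → ℝ)
    (v : ℝ → (Fin d → ℝ) → Fin d → ℝ) (ρ₀ : (Fin d → ℝ) → ℝ)
    (v₀ : (Fin d → ℝ) → Fin d → ℝ) : Prop where
  rho_meas : Measurable (Function.uncurry ρ)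
  v_meas : Measurable (Function.uncurry v)
  rho_periodic : ∀ t, SpacePeriodic (ρ t)
  v_periodic : ∀ t, SpacePeriodic (v t)
  rho0_periodic : SpacePeriodic ρ₀
  v0_periodic : SpacePeriodic v₀
  rho_nonneg : ∀ t x, 0 ≤ ρ t x
  rho0_nonneg : ∀ x, 0 ≤ ρ₀ x
  v0_vacuum : ∀ x, ρ₀ x = 0 → v₀ x = 0
  pressure_int : MemLpLq T ∞ 1 fun t x => ρ t x ^ γ
  kinetic_int : MemLpLq T ∞ 1 fun t x => ρ t x * euNorm (v t x) ^ 2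
  mass : ∀ φ : ℝ → (Fin d → ℝ) → ℝ, IsTestFunctionIC T φ →
    (∫ t in Set.Ioo 0 T, ∫ x in unitCube d,
        (ρ t x * pderivT φ t x + ρ t x * (∑ i, v t x i * pderivX i φ t x)))
      + (∫ x in unitCube d, ρ₀ x * φ 0 x) = 0
  momentum : ∀ Φ : ℝ → (Fin d → ℝ) → Fin d → ℝ,
    (∀ j, IsTestFunctionIC T fun s y => Φ s y j) →
    (∫ t in Set.Ioo 0 T, ∫ x in unitCube d,
        ((∑ j, ρ t x * v t x j * pderivT (fun s y => Φ s y j) t x)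
          + (∑ i, ∑ j, ρ t x * v t x i * v t x j * pderivX i (fun s y => Φ s y j) t x)
          + kappa γ * ρ t x ^ γ * (∑ j, pderivX j (fun s y => Φ s y j) t x)))
      + (∫ x in unitCube d, (∑ j, ρ₀ x * v₀ x j * Φ 0 x j)) = 0
  renormalized : ∃ w : ℝ → (Fin d → ℝ) → ℝ,
    (∀ φ : ℝ → (Fin d → ℝ) → ℝ, IsTestFunction T φ →
      ∫ t in Set.Ioo 0 T, ∫ x in unitCube d, (∑ i, v t x i * pderivX i φ t x)
        = - ∫ t in Set.Ioo 0 T, ∫ x in unitCube d, w t x * φ t x) ∧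
    ∀ b : ℝ → ℝ, ContDiff ℝ 1 b → HasCompactSupport (deriv b) →
      ∀ φ : ℝ → (Fin d → ℝ) → ℝ, IsTestFunctionIC T φ →
        (∫ t in Set.Ioo 0 T, ∫ x in unitCube d,
            (b (ρ t x) * pderivT φ t x + b (ρ t x) * (∑ i, v t x i * pderivX i φ t x)
              - (deriv b (ρ t x) * ρ t x - b (ρ t x)) * w t x * φ t x))
          + (∫ x in unitCube d, b (ρ₀ x) * φ 0 x) = 0
  energy_ineq : ∀ᵐ t ∂(volume.restrict (Set.Ioo 0 T)),
    energyAt d γ ρ v t ≤ energyInit d γ ρ₀ v₀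

/-- The exponent `p/(p-3)`, read as `∞` when `p ≤ 3`. -/
def div3Exp (p : ℝ) : ℝ≥0∞ := if p ≤ 3 then ∞ else ENNReal.ofReal (p / (p - 3))

/-- The standard (non-normalized) spatial bump `e^{-1/(1-|x|²)}` for `|x| < 1`. -/
def bump (d : ℕ) (x : Fin d → ℝ) : ℝ :=
  if euNorm x < 1 then Real.exp (-(1 - euNorm x ^ 2)⁻¹) else 0

/-- The normalizing constant `C₀` with `∫ C₀ e^{-1/(1-|x|²)} dx = 1`. -/
def bumpConst (d : ℕ) : ℝ := (∫ x : Fin d → ℝ, bump d x)⁻¹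

/-- The rescaled standard spatial mollifier `η_ε(x) = ε^{-d} η(x/ε)`,
`η(x) = C₀ e^{-1/(1-|x|²)}`. -/
def sKer (d : ℕ) (ε : ℝ) (x : Fin d → ℝ) : ℝ :=
  (ε ^ d)⁻¹ * (bumpConst d * bump d (ε⁻¹ • x))

/-- Mollification in the space variable: `f^ε = f * η_ε`. -/
def sMollify {d : ℕ} {E : Type*} [NormedAddCommGroup E] [NormedSpace ℝ E]
    (ε : ℝ) (f : (Fin d → ℝ) → E) (x : Fin d → ℝ) : E :=
  ∫ y : Fin d → ℝ, sKer d ε (x - y) • f y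

/-- A space-time mollifying kernel: nonnegative, smooth, supported in the unit ball of
`ℝ^{1+d}`, with integral 1. -/
structure IsSTMollifier (d : ℕ) (η : ℝ → (Fin d → ℝ) → ℝ) : Prop where
  smooth : ContDiff ℝ (⊤ : ℕ∞) (Function.uncurry η)
  nonneg : ∀ t x, 0 ≤ η t x
  supp : ∀ t x, 1 ≤ t ^ 2 + euNorm x ^ 2 → η t x = 0
  integral_one : (∫ z : ℝ × (Fin d → ℝ), η z.1 z.2) = 1

/-- The rescaled space-time kernel `η_ε(t,x) = ε^{-(d+1)} η(t/ε, x/ε)`. -/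
def stKer (d : ℕ) (η : ℝ → (Fin d → ℝ) → ℝ) (ε : ℝ) (t : ℝ) (x : Fin d → ℝ) : ℝ :=
  (ε ^ (d + 1))⁻¹ * η (t / ε) (ε⁻¹ • x)

/-- Space-time mollification `f^ε(t,x) = ∫∫ η_ε(t-s, x-y) f(s,y) dy ds`. -/
def stMollify {d : ℕ} {E : Type*} [NormedAddCommGroup E] [NormedSpace ℝ E]
    (η : ℝ → (Fin d → ℝ) → ℝ) (ε : ℝ) (f : ℝ → (Fin d → ℝ) → E)
    (t : ℝ) (x : Fin d → ℝ) : E :=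
  ∫ z : ℝ × (Fin d → ℝ), stKer d η ε (t - z.1) (x - z.2) • f z.1 z.2


/-- `L^p` norm of an `ℝ≥0∞`-valued function. -/
def nLp {α : Type*} [MeasurableSpace α] (μ : Measure α) (p : ℝ≥0∞) (F : α → ℝ≥0∞) : ℝ≥0∞ :=
  if p = ∞ then essSup F μ else (∫⁻ t, F t ^ p.toReal ∂μ) ^ (1 / p.toReal)

theorem timeLpOn_eq_nLp (s : Set ℝ) (p : ℝ≥0∞) (F : ℝ → ℝ≥0∞) :
    timeLpOn s p F = nLp (volume.restrict s) p F := rfl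

theorem eLpNorm_eq_nLp {α F : Type*} [MeasurableSpace α] [NormedAddCommGroup F] (μ : Measure α)
    (p : ℝ≥0∞) (hp : p ≠ 0) (f : α → F) : eLpNorm f p μ = nLp μ p (fun x => ‖f x‖ₑ) := by
  unfold nLp eLpNorm
  simp only [hp, if_false]
  split_ifs with h
  · rfl
  · rfl

theorem nLp_mono_ae {α : Type*} [MeasurableSpace α] (μ : Measure α) (p : ℝ≥0∞)
    {F G : α → ℝ≥0∞} (h : ∀ᵐ x ∂μ, F x ≤ G x) : nLp μ p F ≤ nLp μ p G := by
  unfold nLp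
  split_ifs with hp
  · exact essSup_mono_ae h
  · refine ENNReal.rpow_le_rpow (lintegral_mono_ae ?_) (by positivity)
    filter_upwards [h] with x hx
    exact ENNReal.rpow_le_rpow hx ENNReal.toReal_nonneg

theorem div3Exp_ne_zero (q : ℝ) : div3Exp q ≠ 0 := by
  unfold div3Exp
  split_ifs with h
  · simp
  · push Not at h
    have : 0 < q / (q - 3) := by apply div_pos <;> linarith
    simp only [ne_eq, ENNReal.ofReal_eq_zero, not_le]; exact this

theorem lint_two {α : Type*} [MeasurableSpace α] (μ : Measure α) {f g : α → ℝ≥0∞}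
    (hf : AEMeasurable f μ) (hg : AEMeasurable g μ) (b q s r : ℝ) (hb : 0 < b) (hq : 0 < q)
    (hs : 0 ≤ s) (hr : 0 ≤ r) (h : s / b + r / q ≤ 1) :
    ∫⁻ x, f x ^ s * g x ^ r ∂μ ≤ ((∫⁻ x, f x ^ b ∂μ) ^ (1 / b)) ^ s *
      ((∫⁻ x, g x ^ q ∂μ) ^ (1 / q)) ^ r * μ Set.univ ^ (1 - s / b - r / q) := by
  have key := ENNReal.lintegral_prod_norm_pow_le (μ := μ) (Finset.univ : Finset (Fin 3))
    (f := ![fun x => f x ^ b, fun x => g x ^ q, fun _ => 1])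
    (by intro i _
        fin_cases i
        · exact hf.pow_const b
        · exact hg.pow_const q
        · exact aemeasurable_const)
    (p := ![s / b, r / q, 1 - s / b - r / q])
    (by simp [Fin.sum_univ_three])
    (by intro i _
        fin_cases i
        · simp; positivity
        · simp; positivity
        · simp; linarith)
  simp only [Fin.prod_univ_three, Matrix.cons_val_zero, Matrix.cons_val_one, Matrix.cons_val,
    ENNReal.one_rpow, mul_one, lintegral_const, one_mul] at key
  have e : ∀ x, (f x ^ b) ^ (s / b) * (g x ^ q) ^ (r / q) = f x ^ s * g x ^ r := by
    intro x
    rw [← ENNReal.rpow_mul, ← ENNReal.rpow_mul]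
    congr 2 <;> field_simp
  simp only [e] at key
  refine key.trans (le_of_eq ?_)
  rw [← ENNReal.rpow_mul, ← ENNReal.rpow_mul]
  congr 3 <;> ring

/-- General Hölder inequality for the pair of exponents `q/(q-3)`, `q`. -/
theorem holder_gen {α : Type*} [MeasurableSpace α] (μ : Measure α) {f g : α → ℝ≥0∞}
    (hf : AEMeasurable f μ) (hg : AEMeasurable g μ) (q s r : ℝ) (hq : 3 ≤ q)
    (hs : 0 ≤ s) (hr : 0 ≤ r) (h : s * (q - 3) + r ≤ q) :
    ∫⁻ x, f x ^ s * g x ^ r ∂μ ≤ nLp μ (div3Exp q) f ^ s *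
      nLp μ (ENNReal.ofReal q) g ^ r * μ Set.univ ^ (1 - s * (q - 3) / q - r / q) := by
  have hq0 : (0 : ℝ) < q := by linarith
  have e1 : nLp μ (ENNReal.ofReal q) g = (∫⁻ x, g x ^ q ∂μ) ^ (1 / q) := by
    unfold nLp
    simp [ENNReal.toReal_ofReal hq0.le]
  rw [e1]
  rcases eq_or_lt_of_le hq with h3 | h3
  · subst h3
    have e2 : nLp μ (div3Exp 3) f = essSup f μ := by
      unfold nLp div3Exp; simp
    rw [e2]
    have hle : ∫⁻ x, f x ^ s * g x ^ r ∂μ ≤ essSup f μ ^ s * ∫⁻ x, g x ^ r ∂μ := by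
      rw [← lintegral_const_mul'' _ (hg.pow_const r)]
      apply lintegral_mono_ae
      filter_upwards [ENNReal.ae_le_essSup f] with x hx
      gcongr
    refine hle.trans ?_
    have := lint_two μ (f := fun _ => 1) (g := g) aemeasurable_const hg 1 3 0 r one_pos
      (by norm_num) le_rfl hr (by norm_num at h ⊢; linarith)
    simp only [ENNReal.rpow_zero, one_mul] at this
    rw [mul_assoc]
    gcongr
    refine this.trans (le_of_eq ?_)
    norm_num
  · have hb : 0 < q / (q - 3) := div_pos hq0 (by linarith)
    have e2 : nLp μ (div3Exp q) f = (∫⁻ x, f x ^ (q / (q - 3)) ∂μ) ^ (1 / (q / (q - 3))) := by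
      unfold nLp div3Exp
      simp [ENNReal.toReal_ofReal hb.le, not_le.mpr h3]
    rw [e2]
    have h3' : q - 3 ≠ 0 := by linarith
    have e3 : s / (q / (q - 3)) = s * (q - 3) / q := by field_simp
    have := lint_two μ hf hg (q / (q - 3)) q s r hb hq0 hs hr (by
      rw [e3, ← add_div, div_le_one hq0]; exact h)
    rw [e3] at this
    exact this

theorem holder_31 {α : Type*} [MeasurableSpace α] (μ : Measure α) [IsProbabilityMeasure μ]
    {f g : α → ℝ≥0∞} (hf : AEMeasurable f μ) (hg : AEMeasurable g μ) (q : ℝ) (hq : 3 ≤ q) :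
    ∫⁻ x, f x * g x ^ (3 : ℝ) ∂μ ≤ nLp μ (div3Exp q) f * nLp μ (ENNReal.ofReal q) g ^ (3 : ℝ) := by
  have := holder_gen μ hf hg q 1 3 hq zero_le_one (by norm_num) (by linarith)
  simpa using this

theorem holder_11 {α : Type*} [MeasurableSpace α] (μ : Measure α) [IsProbabilityMeasure μ]
    {f g : α → ℝ≥0∞} (hf : AEMeasurable f μ) (hg : AEMeasurable g μ) (q : ℝ) (hq : 3 ≤ q) :
    ∫⁻ x, f x * g x ∂μ ≤ nLp μ (div3Exp q) f * nLp μ (ENNReal.ofReal q) g := by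
  have := holder_gen μ hf hg q 1 1 hq zero_le_one (by norm_num) (by linarith)
  simpa using this

theorem holder_10 {α : Type*} [MeasurableSpace α] (μ : Measure α) [IsProbabilityMeasure μ]
    {f : α → ℝ≥0∞} (hf : AEMeasurable f μ) (q : ℝ) (hq : 3 ≤ q) :
    ∫⁻ x, f x ∂μ ≤ nLp μ (div3Exp q) f := by
  have := holder_gen μ hf (aemeasurable_const (b := (1 : ℝ≥0∞))) q 1 0 hq zero_le_one
    (by norm_num) (by linarith)
  simpa using this

theorem holder_01 {α : Type*} [MeasurableSpace α] (μ : Measure α) [IsProbabilityMeasure μ]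
    {g : α → ℝ≥0∞} (hg : AEMeasurable g μ) (q : ℝ) (hq : 3 ≤ q) :
    ∫⁻ x, g x ∂μ ≤ nLp μ (ENNReal.ofReal q) g := by
  have := holder_gen μ (aemeasurable_const (b := (1 : ℝ≥0∞))) hg q 0 1 hq le_rfl
    (by norm_num) (by linarith)
  simpa using this

theorem gamma_exp {γ q : ℝ} (hγ : 1 < γ) (hq : q ≤ (3 * γ - 1) / (γ - 1)) :
    γ * (q - 3) + 1 ≤ q := by
  rw [le_div_iff₀ (by linarith)] at hq
  nlinarith

theorem holder_g1 {α : Type*} [MeasurableSpace α] (μ : Measure α) [IsProbabilityMeasure μ]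
    {f g : α → ℝ≥0∞} (hf : AEMeasurable f μ) (hg : AEMeasurable g μ) (γ q : ℝ) (hγ : 1 < γ)
    (hq : 3 ≤ q) (hq' : q ≤ (3 * γ - 1) / (γ - 1)) :
    ∫⁻ x, f x ^ γ * g x ∂μ ≤ nLp μ (div3Exp q) f ^ γ * nLp μ (ENNReal.ofReal q) g := by
  have := holder_gen μ hf hg q γ 1 hq (by linarith) (by norm_num) (gamma_exp hγ hq')
  simpa using this

/-- time integrability without measurability of `B`. -/
theorem time_fin {α : Type*} [MeasurableSpace α] (μ : Measure α) [IsFiniteMeasure μ]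
    {R B : α → ℝ≥0∞} (hR : Measurable R) (hR1 : ∀ x, 1 ≤ R x) (hRt : ∀ x, R x ≠ ∞)
    (q s r : ℝ) (hq : 3 ≤ q)
    (hs : 0 ≤ s) (hr : 0 < r) (h : s * (q - 3) + r ≤ q)
    (hRf : nLp μ (div3Exp q) R < ∞) (hBf : nLp μ (ENNReal.ofReal q) B < ∞) :
    ∫⁻ x, R x ^ s * B x ^ r ∂μ < ∞ := by
  obtain ⟨m, hm, hmle, hmeq⟩ := exists_measurable_le_lintegral_eq μ (fun x => R x ^ s * B x ^ r)
  rw [hmeq]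
  set B' : α → ℝ≥0∞ := fun x => (m x / R x ^ s) ^ (1 / r) with hB'
  have hB'm : Measurable B' := (hm.div (hR.pow_const s)).pow_const _
  have hRs0 : ∀ x, R x ^ s ≠ 0 := fun x => by
    have := ENNReal.one_le_rpow (hR1 x) (z := s)
    rcases hs.eq_or_lt with h0 | h0
    · simp [← h0]
    · exact (lt_of_lt_of_le one_pos (this h0)).ne'
  have hRst : ∀ x, R x ^ s ≠ ∞ := fun x => ENNReal.rpow_ne_top_of_nonneg hs (hRt x)
  have hle : ∀ x, B' x ≤ B x := by
    intro x
    have h1 : m x / R x ^ s ≤ B x ^ r := by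
      rw [ENNReal.div_le_iff (hRs0 x) (hRst x), mul_comm]; exact hmle x
    calc B' x ≤ (B x ^ r) ^ (1 / r) := ENNReal.rpow_le_rpow h1 (by positivity)
      _ = B x := by rw [← ENNReal.rpow_mul]; field_simp; simp
  have hmB : ∀ x, m x = R x ^ s * B' x ^ r := by
    intro x
    simp only [hB']
    rw [← ENNReal.rpow_mul, one_div, inv_mul_cancel₀ hr.ne', ENNReal.rpow_one,
      ENNReal.mul_div_cancel (hRs0 x) (hRst x)]
  simp only [hmB]
  have hmono := nLp_mono_ae μ (ENNReal.ofReal q) (Filter.Eventually.of_forall hle)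
  refine (holder_gen μ hR.aemeasurable hB'm.aemeasurable q s r hq hs hr.le h).trans_lt ?_
  refine ENNReal.mul_lt_top (ENNReal.mul_lt_top ?_ ?_) ?_
  · exact ENNReal.rpow_lt_top_of_nonneg hs hRf.ne
  · exact ENNReal.rpow_lt_top_of_nonneg hr.le (hmono.trans_lt hBf).ne
  · refine ENNReal.rpow_lt_top_of_nonneg ?_ (measure_ne_top _ _)
    have : (0 : ℝ) < q := by linarith
    rw [sub_sub, ← add_div, sub_nonneg, div_le_one this]; exact h

/-- Dominated convergence with a possibly non measurable dominating function. -/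
theorem dct_nm {α : Type*} [MeasurableSpace α] (μ : Measure α) (b : α → ℝ≥0∞)
    (hb : ∫⁻ x, b x ∂μ < ∞) (f : ℕ → α → ℝ) (g : α → ℝ)
    (hf : ∀ n, AEStronglyMeasurable (f n) μ)
    (hfb : ∀ n, ∀ᵐ x ∂μ, ‖f n x‖ₑ ≤ b x)
    (hlim : ∀ᵐ x ∂μ, Filter.Tendsto (fun n => f n x) Filter.atTop (nhds (g x))) :
    Filter.Tendsto (fun n => ∫ x, f n x ∂μ) Filter.atTop (nhds (∫ x, g x ∂μ)) := by
  set F : α → ℝ≥0∞ := fun x => ⨆ n, ‖f n x‖ₑ with hF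
  have hFm : AEMeasurable F μ := AEMeasurable.iSup fun n => (hf n).enorm
  have hFb : ∀ᵐ x ∂μ, F x ≤ b x := by
    filter_upwards [ae_all_iff.2 hfb] with x hx
    exact iSup_le hx
  have hFi : ∫⁻ x, F x ∂μ < ∞ := (lintegral_mono_ae hFb).trans_lt hb
  have hFt : ∀ᵐ x ∂μ, F x < ∞ := ae_lt_top' hFm hFi.ne
  refine tendsto_integral_of_dominated_convergence (fun x => (F x).toReal) hf
    (integrable_toReal_of_lintegral_ne_top hFm hFi.ne) (fun n => ?_) hlim
  filter_upwards [hFt] with x hx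
  have h1 : ‖f n x‖ₑ ≤ F x := le_iSup (fun n => ‖f n x‖ₑ) n
  have := ENNReal.toReal_mono hx.ne h1
  simpa using this

open Real in
/-- one-dimensional profile -/
def k0 (ε s : ℝ) : ℝ := ((1 + (sin (π * s) / ε) ^ 2) ^ 2)⁻¹

def kN (ε : ℝ) : ℝ := ∫ s in Set.Ico (0 : ℝ) 1, k0 ε s

open Real in
def lk (ε s : ℝ) : ℝ :=
  -(4 * π * sin (π * s) * cos (π * s) / ε ^ 2) / (1 + (sin (π * s) / ε) ^ 2)

/-- the periodic kernel -/
def ker (ε : ℝ) (y : Fin d → ℝ) : ℝ := ∏ i, ((kN ε)⁻¹ * k0 ε (y i))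

def dker (ε : ℝ) (i : Fin d) (y : Fin d → ℝ) : ℝ := lk ε (y i) * ker ε y

def sg (y : Fin d → ℝ) : ℝ := euNorm (fun i => Real.sin (Real.pi * y i))

theorem k0_pos (ε s : ℝ) : 0 < k0 ε s := by unfold k0; positivity

theorem k0_le_one (ε s : ℝ) : k0 ε s ≤ 1 := by
  unfold k0
  apply inv_le_one_of_one_le₀
  have : 0 ≤ (Real.sin (Real.pi * s) / ε) ^ 2 := sq_nonneg _
  nlinarith

theorem k0_contDiff (ε : ℝ) : ContDiff ℝ (⊤ : ℕ∞) (k0 ε) := by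
  unfold k0
  refine ContDiff.inv ?_ ?_
  · refine (contDiff_const.add (ContDiff.pow (ContDiff.div_const ?_ _) 2)).pow 2
    exact Real.contDiff_sin.comp (contDiff_const.mul contDiff_id)
  · intro s; positivity

theorem k0_hasDerivAt {ε : ℝ} (hε : 0 < ε) (s : ℝ) :
    HasDerivAt (k0 ε) (lk ε s * k0 ε s) s := by
  have h1 : HasDerivAt (fun s : ℝ => Real.pi * s) Real.pi s := by
    simpa using (hasDerivAt_id s).const_mul Real.pi
  have h2 := (((h1.sin.div_const ε).fun_pow 2).const_add 1).fun_pow 2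
  have hpos : (1 + (Real.sin (Real.pi * s) / ε) ^ 2) ^ 2 ≠ 0 := by positivity
  have h3 := h2.fun_inv hpos
  refine HasDerivAt.congr_deriv (f := k0 ε) h3 ?_
  unfold lk k0
  have : (1 + (Real.sin (Real.pi * s) / ε) ^ 2) ≠ 0 := by positivity
  simp only [Nat.reduceSub, Nat.cast_ofNat, pow_one]
  field_simp
  ring

theorem k0_continuous (ε : ℝ) : Continuous (k0 ε) := (k0_contDiff ε).continuous

theorem k0_int (ε : ℝ) (s : ℝ) (n : ℤ) : k0 ε (s + n) = k0 ε s := by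
  unfold k0
  have : Real.pi * (s + n) = Real.pi * s + n * Real.pi := by ring
  rw [this, Real.sin_add_int_mul_pi]
  have h : ((-1 : ℝ) ^ n) ^ 2 = 1 := by
    rw [← zpow_natCast, ← zpow_mul, mul_comm, zpow_mul]; simp
  rw [div_pow, div_pow, mul_pow, h, one_mul]

theorem k0_neg (ε : ℝ) (s : ℝ) : k0 ε (-s) = k0 ε s := by
  unfold k0; simp [neg_div]

theorem lk_continuous (ε : ℝ) : Continuous (lk ε) := by
  unfold lk
  refine Continuous.div (by fun_prop) (by fun_prop) ?_
  intro s; positivity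

theorem lk_int (ε : ℝ) (s : ℝ) (n : ℤ) : lk ε (s + n) = lk ε s := by
  unfold lk
  have : Real.pi * (s + n) = Real.pi * s + n * Real.pi := by ring
  rw [this, Real.sin_add_int_mul_pi, Real.cos_add_int_mul_pi]
  have h : ((-1 : ℝ) ^ n) ^ 2 = 1 := by
    rw [← zpow_natCast, ← zpow_mul, mul_comm, zpow_mul]; simp
  have e : 4 * Real.pi * ((-1) ^ n * Real.sin (Real.pi * s)) * ((-1) ^ n * Real.cos (Real.pi * s))
    = ((-1 : ℝ) ^ n) ^ 2 * (4 * Real.pi * Real.sin (Real.pi * s) * Real.cos (Real.pi * s)) := by ring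
  rw [div_pow, div_pow, mul_pow, e, h, one_mul, one_mul]

theorem lk_bound {ε : ℝ} (hε : 0 < ε) (s : ℝ) : |lk ε s| ≤ 2 * Real.pi / ε := by
  unfold lk
  set u := Real.sin (Real.pi * s) / ε with hu
  have hsu : Real.sin (Real.pi * s) = u * ε := by rw [hu]; field_simp
  rw [hsu]
  have h1 : |Real.cos (Real.pi * s)| ≤ 1 := Real.abs_cos_le_one _
  have hp : 0 < 1 + u ^ 2 := by positivity
  rw [abs_div, abs_of_pos hp, div_le_iff₀ hp]
  have e : -(4 * Real.pi * (u * ε) * Real.cos (Real.pi * s) / ε ^ 2)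
      = -(4 * Real.pi / ε) * (u * Real.cos (Real.pi * s)) := by field_simp
  rw [e, abs_mul, abs_neg, abs_of_pos (by positivity : 0 < 4 * Real.pi / ε), abs_mul]
  have h2 : |u| * |Real.cos (Real.pi * s)| ≤ |u| := by
    nlinarith [abs_nonneg u]
  have h3 : |u| ≤ (1 + u ^ 2) / 2 := by
    have := sq_abs u
    nlinarith [sq_nonneg (|u| - 1)]
  calc 4 * Real.pi / ε * (|u| * |Real.cos (Real.pi * s)|) ≤ 4 * Real.pi / ε * ((1 + u ^ 2) / 2) := by
        gcongr; linarith
    _ = _ := by ring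

theorem k0_integrableOn (ε : ℝ) : IntegrableOn (k0 ε) (Set.Ico (0 : ℝ) 1) :=
  ((k0_continuous ε).integrableOn_Icc).mono_set Set.Ico_subset_Icc_self

theorem kN_pos (ε : ℝ) : 0 < kN ε := by
  unfold kN
  rw [integral_pos_iff_support_of_nonneg (fun s => (k0_pos ε s).le) (k0_integrableOn ε)]
  have : Function.support (k0 ε) = Set.univ := by
    ext s; simp [(k0_pos ε s).ne']
  rw [this]; simp

theorem k0_moment {ε : ℝ} (hε : 0 < ε) :
    ∫ s in Set.Ico (0 : ℝ) 1, k0 ε s * Real.sin (Real.pi * s) ^ 2 ≤ ε ^ 2 * kN ε := by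
  set A : ℝ → ℝ := fun s => Real.sin (Real.pi * s) * Real.cos (Real.pi * s) /
    (1 + (Real.sin (Real.pi * s) / ε) ^ 2) with hA
  have hd : ∀ s, HasDerivAt A (Real.pi * (k0 ε s - (1 / ε ^ 2 + 2) *
      (k0 ε s * Real.sin (Real.pi * s) ^ 2))) s := by
    intro s
    have h1 : HasDerivAt (fun s : ℝ => Real.pi * s) Real.pi s := by
      simpa using (hasDerivAt_id s).const_mul Real.pi
    have hpos : (1 + (Real.sin (Real.pi * s) / ε) ^ 2) ≠ 0 := by positivity
    have h2 := (h1.sin.fun_mul h1.cos).fun_div (((h1.sin.div_const ε).fun_pow 2).const_add 1) hpos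
    refine HasDerivAt.congr_deriv (f := A) h2 ?_
    unfold k0
    have hc : Real.cos (Real.pi * s) ^ 2 = 1 - Real.sin (Real.pi * s) ^ 2 := by
      rw [Real.cos_sq']
    have hpos' : ε ^ 2 + Real.sin (Real.pi * s) ^ 2 ≠ 0 := by positivity
    simp only [Nat.reduceSub, Nat.cast_ofNat, pow_one]
    field_simp
    generalize Real.sin (Real.pi * s) = S at *
    generalize Real.cos (Real.pi * s) = C at *
    rw [hc]
    ring
  have hk : Continuous (k0 ε) := k0_continuous ε
  have hIg : Continuous (fun s => Real.pi * (k0 ε s - (1 / ε ^ 2 + 2) *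
      (k0 ε s * Real.sin (Real.pi * s) ^ 2))) := by fun_prop
  have h0 := intervalIntegral.integral_eq_sub_of_hasDerivAt (a := 0) (b := 1)
    (fun s _ => hd s) (hIg.intervalIntegrable _ _)
  have hA1 : A 1 - A 0 = 0 := by simp [hA]
  rw [hA1, intervalIntegral.integral_const_mul, intervalIntegral.integral_sub
    (hk.intervalIntegrable _ _) ((by fun_prop : Continuous _).intervalIntegrable _ _),
    intervalIntegral.integral_const_mul] at h0
  have h1 := (mul_eq_zero.1 h0).resolve_left Real.pi_ne_zero
  have conv : ∀ f : ℝ → ℝ, ∫ s in Set.Ico (0 : ℝ) 1, f s = ∫ s in (0 : ℝ)..1, f s := by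
    intro f
    rw [intervalIntegral.integral_of_le zero_le_one, integral_Ico_eq_integral_Ioo,
      integral_Ioc_eq_integral_Ioo]
  unfold kN
  rw [conv, conv]
  have hnn : 0 ≤ ∫ s in (0 : ℝ)..1, k0 ε s * Real.sin (Real.pi * s) ^ 2 :=
    intervalIntegral.integral_nonneg zero_le_one fun s _ =>
      mul_nonneg (k0_pos ε s).le (sq_nonneg _)
  set I := ∫ s in (0 : ℝ)..1, k0 ε s * Real.sin (Real.pi * s) ^ 2
  set J := ∫ s in (0 : ℝ)..1, k0 ε s
  have h2 : J = (1 / ε ^ 2 + 2) * I := by linarith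
  rw [h2]
  have : ε ^ 2 * ((1 / ε ^ 2 + 2) * I) = I + 2 * ε ^ 2 * I := by field_simp
  rw [this]
  have : 0 ≤ 2 * ε ^ 2 * I := by positivity
  linarith

theorem cubeVol_eq_pi (d : ℕ) :
    cubeVol d = Measure.pi (fun _ : Fin d => volume.restrict (Set.Ico (0 : ℝ) 1)) := by
  unfold cubeVol unitCube
  rw [volume_pi, Measure.restrict_pi_pi]

instance cubeVol_prob (d : ℕ) : IsProbabilityMeasure (cubeVol d) := by
  rw [cubeVol_eq_pi]
  have : IsProbabilityMeasure (volume.restrict (Set.Ico (0 : ℝ) 1)) := ⟨by simp⟩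
  infer_instance

theorem ker_pos (ε : ℝ) (y : Fin d → ℝ) : 0 < ker ε y :=
  Finset.prod_pos fun i _ => mul_pos (inv_pos.2 (kN_pos ε)) (k0_pos ε _)

theorem ker_contDiff (ε : ℝ) : ContDiff ℝ (⊤ : ℕ∞) (ker ε : (Fin d → ℝ) → ℝ) := by
  unfold ker
  refine contDiff_prod fun i _ => contDiff_const.mul ?_
  exact (k0_contDiff ε).comp (contDiff_apply ℝ ℝ i)

theorem ker_continuous (ε : ℝ) : Continuous (ker ε : (Fin d → ℝ) → ℝ) := (ker_contDiff ε).continuous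

theorem dker_continuous (ε : ℝ) (i : Fin d) : Continuous (dker ε i) := by
  unfold dker
  exact ((lk_continuous ε).comp (continuous_apply i)).mul (ker_continuous ε)

theorem ker_periodic (ε : ℝ) : SpacePeriodic (ker ε : (Fin d → ℝ) → ℝ) := by
  intro x n
  unfold ker
  simp [k0_int]

theorem dker_periodic (ε : ℝ) (i : Fin d) : SpacePeriodic (dker ε i) := by
  intro x n
  unfold dker
  rw [ker_periodic]
  simp [lk_int]

theorem ker_neg (ε : ℝ) (y : Fin d → ℝ) : ker ε (-y) = ker ε y := by
  unfold ker; simp [k0_neg]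

theorem dker_bound {ε : ℝ} (hε : 0 < ε) (i : Fin d) (y : Fin d → ℝ) :
    |dker ε i y| ≤ 2 * Real.pi / ε * ker ε y := by
  unfold dker
  rw [abs_mul, abs_of_pos (ker_pos ε y)]
  exact mul_le_mul_of_nonneg_right (lk_bound hε _) (ker_pos ε y).le

theorem ker_le (ε : ℝ) (y : Fin d → ℝ) : ker ε y ≤ ((kN ε)⁻¹) ^ d := by
  unfold ker
  have h := Finset.prod_le_prod (s := (Finset.univ : Finset (Fin d)))
    (f := fun i => (kN ε)⁻¹ * k0 ε (y i)) (g := fun _ => (kN ε)⁻¹)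
    (fun i _ => mul_nonneg (inv_pos.2 (kN_pos ε)).le (k0_pos ε _).le)
    (fun i _ => mul_le_of_le_one_right (inv_pos.2 (kN_pos ε)).le (k0_le_one ε _))
  simpa using h

theorem ker_line {ε : ℝ} (hε : 0 < ε) (i : Fin d) (y : Fin d → ℝ) :
    HasDerivAt (fun s : ℝ => ker ε (y + s • Pi.single i (1 : ℝ))) (dker ε i y) 0 := by
  unfold ker dker
  have h : ∀ j ∈ (Finset.univ : Finset (Fin d)),
      HasDerivAt (fun s : ℝ => (kN ε)⁻¹ * k0 ε ((y + s • (Pi.single i (1 : ℝ) : Fin d → ℝ)) j))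
        (if j = i then (kN ε)⁻¹ * (lk ε (y j) * k0 ε (y j)) else 0) 0 := by
    intro j _
    split_ifs with hj
    · subst hj
      have h1 : HasDerivAt (fun s : ℝ => y j + s) 1 0 := by
        simpa using (hasDerivAt_id (0 : ℝ)).const_add (y j)
      have h2 : HasDerivAt (k0 ε) (lk ε (y j) * k0 ε (y j)) (y j + 0) := by
        simpa using k0_hasDerivAt hε (y j)
      have h3 := (HasDerivAt.comp (0 : ℝ) h2 h1).const_mul (kN ε)⁻¹
      simpa [Function.comp_def] using h3
    · simp only [Pi.add_apply, Pi.smul_apply, Pi.single_apply, hj, if_false, smul_zero, add_zero]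
      exact hasDerivAt_const _ _
  refine (HasDerivAt.fun_finsetProd h).congr_deriv ?_
  simp only [smul_eq_mul, mul_ite, mul_zero, Finset.sum_ite_eq', Finset.mem_univ, if_true,
    zero_smul, add_zero]
  unfold ker
  rw [← Finset.mul_prod_erase Finset.univ _ (Finset.mem_univ i)]
  ring

theorem ker_fderiv_single {ε : ℝ} (hε : 0 < ε) (i : Fin d) (y : Fin d → ℝ) :
    fderiv ℝ (ker ε) y (Pi.single i 1) = dker ε i y := by
  have hdiff : DifferentiableAt ℝ (ker ε : (Fin d → ℝ) → ℝ) y :=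
    (ker_contDiff ε).differentiable (by simp) y
  have h1 : HasDerivAt (fun s : ℝ => y + s • (Pi.single i (1 : ℝ) : Fin d → ℝ))
      (Pi.single i 1) 0 := by
    simpa using ((hasDerivAt_id (0 : ℝ)).smul_const (Pi.single i (1 : ℝ) : Fin d → ℝ)).const_add y
  have hf : HasFDerivAt (ker ε) (fderiv ℝ (ker ε) y)
      (y + (0 : ℝ) • (Pi.single i (1 : ℝ) : Fin d → ℝ)) := by
    simpa using hdiff.hasFDerivAt
  have h2 := hf.comp_hasDerivAt (0 : ℝ) h1
  exact h2.unique (ker_line hε i y)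

theorem ker_fderiv {ε : ℝ} (hε : 0 < ε) (y h : Fin d → ℝ) :
    fderiv ℝ (ker ε) y h = ∑ i, h i * dker ε i y := by
  conv_lhs => rw [pi_eq_sum_univ' h]
  rw [map_sum]
  refine Finset.sum_congr rfl fun i _ => ?_
  rw [map_smul, smul_eq_mul, ← ker_fderiv_single hε i y]

theorem ker_hasDerivAt {ε : ℝ} (hε : 0 < ε) (y h : Fin d → ℝ) (s : ℝ) :
    HasDerivAt (fun s : ℝ => ker ε (y + s • h)) (∑ i, h i * dker ε i (y + s • h)) s := by
  have hdiff : DifferentiableAt ℝ (ker ε : (Fin d → ℝ) → ℝ) (y + s • h) :=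
    (ker_contDiff ε).differentiable (by simp) _
  have h1 : HasDerivAt (fun s : ℝ => y + s • h) h s := by
    simpa using ((hasDerivAt_id s).smul_const h).const_add y
  have h2 := hdiff.hasFDerivAt.comp_hasDerivAt s h1
  rw [ker_fderiv hε] at h2
  exact h2

theorem ker_integral (ε : ℝ) : ∫ y, ker ε y ∂(cubeVol d) = 1 := by
  unfold ker
  rw [cubeVol_eq_pi, integral_fintype_prod_eq_prod (fun _ s => (kN ε)⁻¹ * k0 ε s)]
  refine Finset.prod_eq_one fun i _ => ?_
  rw [integral_const_mul]
  exact inv_mul_cancel₀ (kN_pos ε).ne'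

theorem bdd_integrable {f : (Fin d → ℝ) → ℝ} (hf : AEStronglyMeasurable f (cubeVol d)) (C : ℝ)
    (h : ∀ x, |f x| ≤ C) : Integrable f (cubeVol d) :=
  Integrable.of_bound hf C (Filter.Eventually.of_forall h)

theorem ker_integrable (ε : ℝ) : Integrable (ker ε) (cubeVol d) :=
  bdd_integrable (ker_continuous ε).aestronglyMeasurable _ fun x => by
    rw [abs_of_pos (ker_pos ε x)]; exact ker_le ε x

theorem ker_moment_i {ε : ℝ} (hε : 0 < ε) (i : Fin d) :
    ∫ y, ker ε y * Real.sin (Real.pi * y i) ^ 2 ∂(cubeVol d) ≤ ε ^ 2 := by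
  have e : ∀ y : Fin d → ℝ, ker ε y * Real.sin (Real.pi * y i) ^ 2 =
      ∏ j, ((fun j s => (kN ε)⁻¹ * k0 ε s * (if j = i then Real.sin (Real.pi * s) ^ 2 else 1) :
        Fin d → ℝ → ℝ) j (y j)) := by
    intro y
    unfold ker
    simp only []
    rw [Finset.prod_mul_distrib (g := fun j => if j = i then Real.sin (Real.pi * y j) ^ 2 else 1)]
    rw [Finset.prod_ite_eq']
    simp
  rw [integral_congr_ae (Filter.Eventually.of_forall e), cubeVol_eq_pi,
    integral_fintype_prod_eq_prod (fun j s => (kN ε)⁻¹ * k0 ε s *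
      (if j = i then Real.sin (Real.pi * s) ^ 2 else 1) : Fin d → ℝ → ℝ)]
  rw [Finset.prod_eq_single i]
  · simp only [if_true, mul_assoc]
    rw [integral_const_mul, inv_mul_le_iff₀ (kN_pos ε), mul_comm (kN ε)]
    exact k0_moment hε
  · intro j _ hj
    simp only [hj, if_false, mul_one]
    rw [integral_const_mul]
    exact inv_mul_cancel₀ (kN_pos ε).ne'
  · simp

theorem sg_sq (y : Fin d → ℝ) : sg y ^ 2 = ∑ i, Real.sin (Real.pi * y i) ^ 2 := by
  unfold sg euNorm
  rw [Real.sq_sqrt (Finset.sum_nonneg fun i _ => sq_nonneg _)]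

theorem sg_nonneg (y : Fin d → ℝ) : 0 ≤ sg y := Real.sqrt_nonneg _

theorem sg_continuous : Continuous (sg : (Fin d → ℝ) → ℝ) := by
  unfold sg euNorm; fun_prop

theorem ker_moment {ε : ℝ} (hε : 0 < ε) {s : ℝ} (hs : 0 ≤ s) (hs2 : s ≤ 2) :
    ∫⁻ y, ENNReal.ofReal (ker ε y) * ENNReal.ofReal (sg y) ^ s ∂(cubeVol d)
      ≤ ENNReal.ofReal ε ^ s * ENNReal.ofReal (1 + d) := by
  have h1 : ∀ y : Fin d → ℝ, ENNReal.ofReal (ker ε y) * ENNReal.ofReal (sg y) ^ s ≤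
      ENNReal.ofReal ε ^ s * ENNReal.ofReal (ker ε y * (1 + (ε ^ 2)⁻¹ * ∑ i, Real.sin (Real.pi * y i) ^ 2)) := by
    intro y
    have hk := (ker_pos ε y).le
    rw [ENNReal.ofReal_rpow_of_nonneg (sg_nonneg y) hs, ENNReal.ofReal_rpow_of_nonneg hε.le hs,
      ← ENNReal.ofReal_mul hk, ← ENNReal.ofReal_mul (by positivity)]
    apply ENNReal.ofReal_le_ofReal
    have e : sg y = ε * (sg y / ε) := by field_simp
    have hu : 0 ≤ sg y / ε := div_nonneg (sg_nonneg y) hε.le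
    rw [← sg_sq]
    have e2 : (ε ^ 2)⁻¹ * sg y ^ 2 = (sg y / ε) ^ 2 := by field_simp
    rw [e2]
    have h2 : (sg y / ε) ^ s ≤ 1 + (sg y / ε) ^ 2 := by
      rcases le_total (sg y / ε) 1 with h | h
      · have := Real.rpow_le_one hu h hs
        nlinarith [sq_nonneg (sg y / ε)]
      · have := Real.rpow_le_rpow_of_exponent_le h hs2
        rw [Real.rpow_two] at this
        linarith
    calc ker ε y * sg y ^ s = ker ε y * (ε ^ s * (sg y / ε) ^ s) := by
          rw [← Real.mul_rpow hε.le hu, ← e]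
      _ ≤ ker ε y * (ε ^ s * (1 + (sg y / ε) ^ 2)) := by gcongr
      _ = _ := by ring
  refine (lintegral_mono h1).trans ?_
  rw [lintegral_const_mul' _ _ (ENNReal.rpow_ne_top_of_nonneg hs ENNReal.ofReal_ne_top)]
  gcongr
  have hi : ∀ i, Integrable (fun y : Fin d → ℝ => ker ε y * Real.sin (Real.pi * y i) ^ 2) (cubeVol d) := by
    intro i
    refine bdd_integrable (by have := ker_continuous (d := d) ε; fun_prop) (((kN ε)⁻¹) ^ d) fun x => ?_
    rw [abs_mul, abs_of_pos (ker_pos ε x), abs_of_nonneg (sq_nonneg _)]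
    have := ker_le ε x
    have h2 := Real.sin_sq_le_one (Real.pi * x i)
    have h3 := (ker_pos ε x).le
    nlinarith [sq_nonneg (Real.sin (Real.pi * x i))]
  have e : ∀ y : Fin d → ℝ, ker ε y * (1 + (ε ^ 2)⁻¹ * ∑ i, Real.sin (Real.pi * y i) ^ 2)
      = ker ε y + (ε ^ 2)⁻¹ * ∑ i, ker ε y * Real.sin (Real.pi * y i) ^ 2 := by
    intro y; rw [← Finset.mul_sum]; ring
  simp only [e]
  rw [← ofReal_integral_eq_lintegral_ofReal]
  · apply ENNReal.ofReal_le_ofReal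
    rw [integral_add (ker_integrable ε) ((integrable_finsetSum _ fun i _ => hi i).const_mul _),
      ker_integral, integral_const_mul, integral_finsetSum _ fun i _ => hi i]
    have : ∑ i, ∫ y, ker ε y * Real.sin (Real.pi * y i) ^ 2 ∂(cubeVol d) ≤ ∑ i : Fin d, ε ^ 2 :=
      Finset.sum_le_sum fun i _ => ker_moment_i hε i
    simp only [Finset.sum_const, Finset.card_univ, Fintype.card_fin, nsmul_eq_mul] at this
    have h4 : (ε ^ 2)⁻¹ * ∑ i, ∫ y, ker ε y * Real.sin (Real.pi * y i) ^ 2 ∂(cubeVol d)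
        ≤ (ε ^ 2)⁻¹ * (d * ε ^ 2) := by gcongr
    have h5 : (ε ^ 2)⁻¹ * (d * ε ^ 2) = d := by field_simp
    linarith
  · exact (ker_integrable ε).add ((integrable_finsetSum _ fun i _ => hi i).const_mul _)
  · refine Filter.Eventually.of_forall fun y => ?_
    have := (ker_pos ε y).le
    have h : 0 ≤ ∑ i, ker ε y * Real.sin (Real.pi * y i) ^ 2 :=
      Finset.sum_nonneg fun i _ => mul_nonneg this (sq_nonneg _)
    positivity

/-- periodicity for functions with values in any type -/
def Per {β : Type*} (f : (Fin d → ℝ) → β) : Prop :=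
  ∀ (x : Fin d → ℝ) (n : Fin d → ℤ), f (x + fun i => (n i : ℝ)) = f x

theorem Per.comp {β β' : Type*} {f : (Fin d → ℝ) → β} (hf : Per f) (g : β → β') :
    Per (fun x => g (f x)) := fun x n => by simp only [hf x n]

theorem Per.comp2 {β β' β'' : Type*} {f : (Fin d → ℝ) → β} {g : (Fin d → ℝ) → β'}
    (hf : Per f) (hg : Per g) (F : β → β' → β'') :
    Per (fun x => F (f x) (g x)) := fun x n => by simp only [hf x n, hg x n]

theorem Per.shift {β : Type*} {f : (Fin d → ℝ) → β} (hf : Per f) (y : Fin d → ℝ) :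
    Per (fun x => f (x + y)) := fun x n => by
  simp only [add_right_comm x _ y, hf _ n]

theorem Per.shiftl {β : Type*} {f : (Fin d → ℝ) → β} (hf : Per f) (y : Fin d → ℝ) :
    Per (fun x => f (y + x)) := fun x n => by
  simp only [← add_assoc, hf _ n]

theorem Per.shiftsub {β : Type*} {f : (Fin d → ℝ) → β} (hf : Per f) (y : Fin d → ℝ) :
    Per (fun x => f (x - y)) := by simpa only [sub_eq_add_neg] using hf.shift (-y)

instance cntSpan (d : ℕ) : Countable
    (Submodule.span ℤ (Set.range (Pi.basisFun ℝ (Fin d)))).toAddSubgroup :=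
  inferInstanceAs (Countable (Submodule.span ℤ (Set.range (Pi.basisFun ℝ (Fin d)))))

theorem isFD (d : ℕ) : IsAddFundamentalDomain
    (Submodule.span ℤ (Set.range (Pi.basisFun ℝ (Fin d)))).toAddSubgroup (unitCube d) volume := by
  have h := ZSpan.isAddFundamentalDomain' (Pi.basisFun ℝ (Fin d)) (volume : Measure (Fin d → ℝ))
  have e : ZSpan.fundamentalDomain (Pi.basisFun ℝ (Fin d)) = unitCube d := by
    ext x
    simp [ZSpan.mem_fundamentalDomain, unitCube]
  rwa [e] at h

theorem per_vadd {β : Type*} {f : (Fin d → ℝ) → β} (hf : Per f)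
    (g : (Submodule.span ℤ (Set.range (Pi.basisFun ℝ (Fin d)))).toAddSubgroup) (x : Fin d → ℝ) :
    f (g +ᵥ x) = f x := by
  obtain ⟨g, hg⟩ := g
  have hg' : g ∈ Submodule.span ℤ (Set.range (Pi.basisFun ℝ (Fin d))) := hg
  rw [Module.Basis.mem_span_iff_repr_mem] at hg'
  choose n hn using hg'
  have : (⟨g, hg⟩ : (Submodule.span ℤ (Set.range (Pi.basisFun ℝ (Fin d)))).toAddSubgroup) +ᵥ x
      = x + fun i => (n i : ℝ) := by
    change g + x = _
    rw [add_comm]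
    congr 1
    ext i
    have := hn i
    simp at this
    exact this.symm
  rw [this, hf]

open scoped Pointwise in
theorem isFD_shift (d : ℕ) (y : Fin d → ℝ) : IsAddFundamentalDomain
    (Submodule.span ℤ (Set.range (Pi.basisFun ℝ (Fin d)))).toAddSubgroup
    (y +ᵥ unitCube d) volume := (isFD d).vadd_of_comm y

theorem meas_unitCube (d : ℕ) : MeasurableSet (unitCube d) :=
  MeasurableSet.univ_pi fun _ => measurableSet_Ico

open scoped Pointwise in
theorem lint_shift {f : (Fin d → ℝ) → ℝ≥0∞} (hf : Per f) (y : Fin d → ℝ) :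
    ∫⁻ x, f (x + y) ∂(cubeVol d) = ∫⁻ x, f x ∂(cubeVol d) := by
  unfold cubeVol
  rw [(isFD d).setLIntegral_eq (isFD_shift d y) f (per_vadd hf)]
  have h := (measurePreserving_add_right (volume : Measure (Fin d → ℝ)) y).setLIntegral_comp_emb
    (MeasurableEquiv.addRight y).measurableEmbedding f (unitCube d)
  have : Set.image (fun x => x + y) (unitCube d) = y +ᵥ unitCube d := by
    rw [← Set.image_vadd]; simp only [vadd_eq_add, add_comm]
  rw [h, this]

open scoped Pointwise in
theorem int_shift {f : (Fin d → ℝ) → ℝ} (hf : Per f) (y : Fin d → ℝ) :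
    ∫ x, f (x + y) ∂(cubeVol d) = ∫ x, f x ∂(cubeVol d) := by
  unfold cubeVol
  rw [(isFD d).setIntegral_eq (isFD_shift d y) (per_vadd hf)]
  have h := (measurePreserving_add_right (volume : Measure (Fin d → ℝ)) y).setIntegral_image_emb
    (MeasurableEquiv.addRight y).measurableEmbedding f (unitCube d)
  have : Set.image (fun x => x + y) (unitCube d) = y +ᵥ unitCube d := by
    rw [← Set.image_vadd]; simp only [vadd_eq_add, add_comm]
  rw [← h, this]

/-- measurable, periodic, integrable -/
structure PI (f : (Fin d → ℝ) → ℝ) : Prop where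
  meas : Measurable f
  per : Per f
  int : Integrable f (cubeVol d)

theorem PI.mk' {f : (Fin d → ℝ) → ℝ} (h1 : Measurable f) (h2 : Per f)
    (h3 : ∫⁻ x, ‖f x‖ₑ ∂(cubeVol d) < ∞) : PI f := ⟨h1, h2, h1.aestronglyMeasurable, h3⟩

theorem PI.bdd {f : (Fin d → ℝ) → ℝ} (h1 : Measurable f) (h2 : Per f) (C : ℝ)
    (h3 : ∀ x, |f x| ≤ C) : PI f :=
  ⟨h1, h2, bdd_integrable h1.aestronglyMeasurable C h3⟩

theorem PI.shift {f : (Fin d → ℝ) → ℝ} (h : PI f) (y : Fin d → ℝ) : PI (fun x => f (x + y)) := by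
  refine PI.mk' (h.meas.comp (measurable_id.add_const y)) (h.per.shift y) ?_
  rw [lint_shift (f := fun x => ‖f x‖ₑ) (h.per.comp _)]
  exact h.int.2

theorem PI.shiftl {f : (Fin d → ℝ) → ℝ} (h : PI f) (y : Fin d → ℝ) : PI (fun x => f (y + x)) := by
  simpa only [add_comm] using h.shift y

theorem PI.abs {f : (Fin d → ℝ) → ℝ} (h : PI f) : PI (fun x => |f x|) :=
  ⟨h.meas.abs, h.per.comp _, h.int.abs⟩

theorem PI.add {f g : (Fin d → ℝ) → ℝ} (h : PI f) (h' : PI g) : PI (fun x => f x + g x) :=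
  ⟨h.meas.add h'.meas, h.per.comp2 h'.per _, h.int.add h'.int⟩

theorem PI.sub {f g : (Fin d → ℝ) → ℝ} (h : PI f) (h' : PI g) : PI (fun x => f x - g x) :=
  ⟨h.meas.sub h'.meas, h.per.comp2 h'.per _, h.int.sub h'.int⟩

theorem PI.const_mul {f : (Fin d → ℝ) → ℝ} (h : PI f) (c : ℝ) : PI (fun x => c * f x) :=
  ⟨h.meas.const_mul c, h.per.comp _, h.int.const_mul c⟩

theorem PI.mul_bdd {f g : (Fin d → ℝ) → ℝ} (h : PI f) (hg : Measurable g) (hgp : Per g) (C : ℝ)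
    (hC : ∀ x, |g x| ≤ C) : PI (fun x => g x * f x) :=
  ⟨hg.mul h.meas, hgp.comp2 h.per _, h.int.bdd_mul hg.aestronglyMeasurable
    (Filter.Eventually.of_forall hC)⟩

/-- mollification by the periodic kernel -/
def mol (ε : ℝ) (f : (Fin d → ℝ) → ℝ) (x : Fin d → ℝ) : ℝ :=
  ∫ y, ker ε y * f (x + y) ∂(cubeVol d)

/-- its partial derivatives -/
def dmol (ε : ℝ) (i : Fin d) (f : (Fin d → ℝ) → ℝ) (x : Fin d → ℝ) : ℝ :=
  - ∫ y, dker ε i (y - x) * f y ∂(cubeVol d)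

theorem conv_eq {g f : (Fin d → ℝ) → ℝ} (hg : Per g) (hf : Per f) (x : Fin d → ℝ) :
    ∫ y, g y * f (x + y) ∂(cubeVol d) = ∫ y, g (y - x) * f y ∂(cubeVol d) := by
  rw [← int_shift (f := fun y => g (y - x) * f y) ((hg.shiftsub x).comp2 hf _) x]
  simp [add_comm]

theorem mol_eq (ε : ℝ) {f : (Fin d → ℝ) → ℝ} (hf : Per f) (x : Fin d → ℝ) :
    mol ε f x = ∫ y, ker ε (y - x) * f y ∂(cubeVol d) :=
  conv_eq (ker_periodic ε) hf x

theorem dmol_eq (ε : ℝ) (i : Fin d) {f : (Fin d → ℝ) → ℝ} (hf : Per f) (x : Fin d → ℝ) :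
    dmol ε i f x = - ∫ y, dker ε i y * f (x + y) ∂(cubeVol d) := by
  rw [conv_eq (dker_periodic ε i) hf x]; rfl

theorem kf_int (ε : ℝ) {f : (Fin d → ℝ) → ℝ} (hf : PI f) (x : Fin d → ℝ) :
    Integrable (fun y => ker ε y * f (x + y)) (cubeVol d) :=
  (hf.shiftl x).int.bdd_mul (c := ((kN ε)⁻¹) ^ d) (ker_continuous ε).aestronglyMeasurable
    (Filter.Eventually.of_forall fun y => by
      rw [Real.norm_eq_abs, abs_of_pos (ker_pos ε y)]; exact ker_le ε y)

theorem dker_le {ε : ℝ} (hε : 0 < ε) (i : Fin d) (y : Fin d → ℝ) :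
    |dker ε i y| ≤ 2 * Real.pi / ε * ((kN ε)⁻¹) ^ d :=
  (dker_bound hε i y).trans (by gcongr; exact ker_le ε y)

theorem dkf_int {ε : ℝ} (hε : 0 < ε) (i : Fin d) {f : (Fin d → ℝ) → ℝ} (hf : PI f)
    (x : Fin d → ℝ) : Integrable (fun y => dker ε i y * f (x + y)) (cubeVol d) :=
  (hf.shiftl x).int.bdd_mul (dker_continuous ε i).aestronglyMeasurable
    (Filter.Eventually.of_forall fun y => dker_le hε i y)

theorem dkf_int' {ε : ℝ} (hε : 0 < ε) (i : Fin d) {f : (Fin d → ℝ) → ℝ} (hf : PI f)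
    (x : Fin d → ℝ) : Integrable (fun y => dker ε i (y - x) * f y) (cubeVol d) :=
  hf.int.bdd_mul ((dker_continuous ε i).comp (continuous_id.sub continuous_const)).aestronglyMeasurable
    (Filter.Eventually.of_forall fun y => dker_le hε i _)

theorem kf_int' (ε : ℝ) {f : (Fin d → ℝ) → ℝ} (hf : PI f) (x : Fin d → ℝ) :
    Integrable (fun y => ker ε (y - x) * f y) (cubeVol d) :=
  hf.int.bdd_mul (c := ((kN ε)⁻¹) ^ d)
    ((ker_continuous ε).comp (continuous_id.sub continuous_const)).aestronglyMeasurable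
    (Filter.Eventually.of_forall fun y => by
      rw [Real.norm_eq_abs, abs_of_pos (ker_pos ε _)]; exact ker_le ε _)

theorem mol_hasDerivAt {ε : ℝ} (hε : 0 < ε) {f : (Fin d → ℝ) → ℝ} (hf : PI f)
    (x h : Fin d → ℝ) (s : ℝ) :
    HasDerivAt (fun s : ℝ => mol ε f (x + s • h)) (∑ i, h i * dmol ε i f (x + s • h)) s := by
  simp only [mol_eq ε hf.per]
  have key := hasDerivAt_integral_of_dominated_loc_of_deriv_le (μ := cubeVol d) (𝕜 := ℝ)
    (F := fun s y => ker ε (y - (x + s • h)) * f y)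
    (F' := fun s y => (∑ i, (-h) i * dker ε i ((y - x) + s • (-h))) * f y) (x₀ := s)
    (s := Set.univ) (bound := fun y => (∑ i, |h i| * (2 * Real.pi / ε * ((kN ε)⁻¹) ^ d)) * |f y|)
    Filter.univ_mem
    (Filter.Eventually.of_forall fun s => (kf_int' ε hf _).1) (kf_int' ε hf _)
    (by
      refine AEStronglyMeasurable.mul ?_ hf.int.1
      refine Continuous.aestronglyMeasurable ?_
      refine continuous_finsetSum _ fun i _ => continuous_const.mul ?_
      exact (dker_continuous ε i).comp (by fun_prop))
    (Filter.Eventually.of_forall fun y s _ => by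
      rw [norm_mul, Real.norm_eq_abs, Real.norm_eq_abs]
      gcongr
      refine (Finset.abs_sum_le_sum_abs _ _).trans (Finset.sum_le_sum fun i _ => ?_)
      rw [abs_mul, Pi.neg_apply, abs_neg]
      gcongr
      exact dker_le hε i _)
    (hf.int.abs.const_mul _)
    (Filter.Eventually.of_forall fun y s _ => by
      have := (ker_hasDerivAt hε (y - x) (-h) s).mul_const (f y)
      refine this.congr_of_eventuallyEq (Filter.Eventually.of_forall fun s => ?_)
      have : y - (x + s • h) = y - x + s • -h := by simp [sub_eq_add_neg, add_assoc, add_comm]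
      simp only [this])
  refine key.2.congr_deriv ?_
  unfold dmol
  have e : ∀ y, (∑ i, (-h) i * dker ε i ((y - x) + s • (-h))) * f y
      = ∑ i, (-(h i)) * (dker ε i (y - (x + s • h)) * f y) := by
    intro y
    have : y - (x + s • h) = y - x + s • -h := by simp [sub_eq_add_neg, add_assoc, add_comm]
    rw [this, Finset.sum_mul]
    simp [mul_assoc]
  simp only [e]
  rw [integral_finsetSum _ fun i _ => (dkf_int' hε i hf _).const_mul _]
  refine Finset.sum_congr rfl fun i _ => ?_
  rw [integral_const_mul]; ring

theorem mol_hasDerivAt_i {ε : ℝ} (hε : 0 < ε) {f : (Fin d → ℝ) → ℝ} (hf : PI f)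
    (x : Fin d → ℝ) (i : Fin d) :
    HasDerivAt (fun s : ℝ => mol ε f (x + s • Pi.single i 1)) (dmol ε i f x) 0 := by
  refine (mol_hasDerivAt hε hf x (Pi.single i 1) 0).congr_deriv ?_
  rw [Finset.sum_eq_single i]
  · simp
  · intro j _ hj; simp [hj]
  · simp

theorem mol_abs_le (ε : ℝ) {f : (Fin d → ℝ) → ℝ} (hf : PI f) (x : Fin d → ℝ) :
    |mol ε f x| ≤ mol ε (fun x => |f x|) x := by
  unfold mol
  refine (abs_integral_le_integral_abs).trans (le_of_eq ?_)
  refine integral_congr_ae (Filter.Eventually.of_forall fun y => ?_)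
  simp only [abs_mul, abs_of_pos (ker_pos ε y)]

theorem mol_mono (ε : ℝ) {f g : (Fin d → ℝ) → ℝ} (hf : PI f) (hg : PI g) (h : ∀ x, f x ≤ g x)
    (x : Fin d → ℝ) : mol ε f x ≤ mol ε g x :=
  integral_mono (kf_int ε hf x) (kf_int ε hg x) fun y =>
    mul_le_mul_of_nonneg_left (h _) (ker_pos ε y).le

theorem mol_const (ε c : ℝ) (x : Fin d → ℝ) : mol ε (fun _ => c) x = c := by
  unfold mol
  rw [integral_mul_const, ker_integral, one_mul]

theorem PI_const (c : ℝ) : PI (fun _ : Fin d → ℝ => c) :=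
  PI.bdd measurable_const (fun _ _ => rfl) |c| fun _ => le_rfl

theorem le_mol (ε : ℝ) {f : (Fin d → ℝ) → ℝ} (hf : PI f) (c : ℝ) (h : ∀ x, c ≤ f x)
    (x : Fin d → ℝ) : c ≤ mol ε f x := by
  have := mol_mono ε (PI_const c) hf h x
  rwa [mol_const] at this

theorem mol_le (ε : ℝ) {f : (Fin d → ℝ) → ℝ} (hf : PI f) (c : ℝ) (h : ∀ x, f x ≤ c)
    (x : Fin d → ℝ) : mol ε f x ≤ c := by
  have := mol_mono ε hf (PI_const c) h x
  rwa [mol_const] at this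

theorem mol_nonneg (ε : ℝ) {f : (Fin d → ℝ) → ℝ} (h : ∀ x, 0 ≤ f x)
    (x : Fin d → ℝ) : 0 ≤ mol ε f x :=
  integral_nonneg fun y => mul_nonneg (ker_pos ε y).le (h _)

theorem mol_sub (ε : ℝ) {f g : (Fin d → ℝ) → ℝ} (hf : PI f) (hg : PI g) (x : Fin d → ℝ) :
    mol ε (fun x => f x - g x) x = mol ε f x - mol ε g x := by
  unfold mol
  rw [← integral_sub (kf_int ε hf x) (kf_int ε hg x)]
  simp only [mul_sub]

theorem mol_bdd (ε : ℝ) {f : (Fin d → ℝ) → ℝ} (hf : PI f) (x : Fin d → ℝ) :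
    |mol ε f x| ≤ ((kN ε)⁻¹) ^ d * ∫ y, |f y| ∂(cubeVol d) := by
  refine (mol_abs_le ε hf x).trans ?_
  unfold mol
  rw [← int_shift hf.abs.per x, ← integral_const_mul]
  refine integral_mono (kf_int ε hf.abs x) ((hf.abs.shift x).int.const_mul _) fun y => ?_
  simp only [add_comm x y]
  exact mul_le_mul_of_nonneg_right (ker_le ε y) (abs_nonneg _)

theorem dmol_le_mol {ε : ℝ} (hε : 0 < ε) (i : Fin d) {f : (Fin d → ℝ) → ℝ} (hf : PI f)
    (x : Fin d → ℝ) : |dmol ε i f x| ≤ 2 * Real.pi / ε * mol ε (fun x => |f x|) x := by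
  rw [dmol_eq ε i hf.per, abs_neg]
  refine (abs_integral_le_integral_abs).trans ?_
  unfold mol
  rw [← integral_const_mul]
  refine integral_mono (dkf_int hε i hf x).abs ((kf_int ε hf.abs x).const_mul _) fun y => ?_
  simp only [abs_mul, ← mul_assoc]
  exact mul_le_mul_of_nonneg_right (dker_bound hε i y) (abs_nonneg _)

theorem dmol_bdd {ε : ℝ} (hε : 0 < ε) (i : Fin d) {f : (Fin d → ℝ) → ℝ} (hf : PI f)
    (x : Fin d → ℝ) :
    |dmol ε i f x| ≤ 2 * Real.pi / ε * (((kN ε)⁻¹) ^ d * ∫ y, |f y| ∂(cubeVol d)) := by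
  refine (dmol_le_mol hε i hf x).trans ?_
  gcongr
  refine (le_abs_self _).trans ?_
  simpa using mol_bdd ε hf.abs x

theorem mol_continuous (ε : ℝ) {f : (Fin d → ℝ) → ℝ} (hf : PI f) : Continuous (mol ε f) := by
  have : mol ε f = fun x => ∫ y, ker ε (y - x) * f y ∂(cubeVol d) := funext (mol_eq ε hf.per)
  rw [this]
  refine continuous_of_dominated (bound := fun y => ((kN ε)⁻¹) ^ d * |f y|)
    (fun x => (kf_int' ε hf x).1) (fun x => Filter.Eventually.of_forall fun y => ?_)
    (hf.int.abs.const_mul _) (Filter.Eventually.of_forall fun y => ?_)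
  · rw [norm_mul, Real.norm_eq_abs, Real.norm_eq_abs, abs_of_pos (ker_pos ε _)]
    exact mul_le_mul_of_nonneg_right (ker_le ε _) (abs_nonneg _)
  · exact ((ker_continuous ε).comp (by fun_prop)).mul continuous_const

theorem dmol_continuous {ε : ℝ} (hε : 0 < ε) (i : Fin d) {f : (Fin d → ℝ) → ℝ} (hf : PI f) :
    Continuous (dmol ε i f) := by
  unfold dmol
  refine Continuous.neg ?_
  refine continuous_of_dominated (bound := fun y => (2 * Real.pi / ε * ((kN ε)⁻¹) ^ d) * |f y|)
    (fun x => (dkf_int' hε i hf x).1) (fun x => Filter.Eventually.of_forall fun y => ?_)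
    (hf.int.abs.const_mul _) (Filter.Eventually.of_forall fun y => ?_)
  · rw [norm_mul, Real.norm_eq_abs, Real.norm_eq_abs]
    exact mul_le_mul_of_nonneg_right (dker_le hε i _) (abs_nonneg _)
  · exact ((dker_continuous ε i).comp (by fun_prop)).mul continuous_const

theorem mol_per (ε : ℝ) {f : (Fin d → ℝ) → ℝ} (hf : Per f) : Per (mol ε f) := by
  intro x n
  unfold mol
  simp only [add_right_comm x _ _, hf _ n]

theorem dmol_per (ε : ℝ) (i : Fin d) {f : (Fin d → ℝ) → ℝ} (hf : Per f) : Per (dmol ε i f) := by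
  intro x n
  rw [dmol_eq ε i hf, dmol_eq ε i hf]
  simp only [add_right_comm x _ _, hf _ n]

theorem mol_PI (ε : ℝ) {f : (Fin d → ℝ) → ℝ} (hf : PI f) : PI (mol ε f) :=
  PI.bdd (mol_continuous ε hf).measurable (mol_per ε hf.per) _ (mol_bdd ε hf)

theorem dmol_PI {ε : ℝ} (hε : 0 < ε) (i : Fin d) {f : (Fin d → ℝ) → ℝ} (hf : PI f) :
    PI (dmol ε i f) :=
  PI.bdd (dmol_continuous hε i hf).measurable (dmol_per ε i hf.per) _ (dmol_bdd hε i hf)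

/-- Tonelli for kernel averages. -/
theorem lint_swap (ε : ℝ) {H : (Fin d → ℝ) → (Fin d → ℝ) → ℝ≥0∞}
    (hH : Measurable (Function.uncurry H)) :
    ∫⁻ x, ∫⁻ y, ENNReal.ofReal (ker ε y) * H x y ∂(cubeVol d) ∂(cubeVol d) =
    ∫⁻ y, ENNReal.ofReal (ker ε y) * ∫⁻ x, H x y ∂(cubeVol d) ∂(cubeVol d) := by
  rw [lintegral_lintegral_swap]
  · refine lintegral_congr fun y => ?_
    rw [lintegral_const_mul' _ _ ENNReal.ofReal_ne_top]
  · refine Measurable.aemeasurable ?_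
    exact (((ker_continuous ε).measurable.comp measurable_snd).ennreal_ofReal).mul hH

theorem lint_ker (ε : ℝ) : ∫⁻ y, ENNReal.ofReal (ker ε y) ∂(cubeVol d) = 1 := by
  rw [← ofReal_integral_eq_lintegral_ofReal (ker_integrable ε)
    (Filter.Eventually.of_forall fun y => (ker_pos ε y).le), ker_integral, ENNReal.ofReal_one]

theorem mol_enorm_le (ε : ℝ) (f : (Fin d → ℝ) → ℝ) (x : Fin d → ℝ) :
    ‖mol ε f x‖ₑ ≤ ∫⁻ y, ENNReal.ofReal (ker ε y) * ‖f (x + y)‖ₑ ∂(cubeVol d) := by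
  refine (enorm_integral_le_lintegral_enorm _).trans (le_of_eq (lintegral_congr fun y => ?_))
  rw [enorm_mul, Real.enorm_eq_ofReal (ker_pos ε y).le]

theorem mol_L1 (ε : ℝ) {f : (Fin d → ℝ) → ℝ} (hfm : Measurable f) (hfp : Per f) :
    ∫⁻ x, ‖mol ε f x‖ₑ ∂(cubeVol d) ≤ ∫⁻ x, ‖f x‖ₑ ∂(cubeVol d) := by
  refine (lintegral_mono (mol_enorm_le ε f)).trans ?_
  rw [lint_swap ε (H := fun x y => ‖f (x + y)‖ₑ) (by
    exact (hfm.comp (measurable_fst.add measurable_snd)).enorm)]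
  have e : ∀ y, ∫⁻ x, ‖f (x + y)‖ₑ ∂(cubeVol d) = ∫⁻ x, ‖f x‖ₑ ∂(cubeVol d) := fun y =>
    lint_shift (f := fun x => ‖f x‖ₑ) (hfp.comp _) y
  simp only [e]
  rw [lintegral_mul_const _ ((ker_continuous ε).measurable.ennreal_ofReal), lint_ker, one_mul]

theorem kf_prod_int (ε : ℝ) {f : (Fin d → ℝ) → ℝ} (hf : PI f) :
    Integrable (fun z : (Fin d → ℝ) × (Fin d → ℝ) => ker ε z.2 * f (z.1 + z.2))
      ((cubeVol d).prod (cubeVol d)) := by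
  have hm : Measurable (fun z : (Fin d → ℝ) × (Fin d → ℝ) => ker ε z.2 * f (z.1 + z.2)) :=
    ((ker_continuous ε).measurable.comp measurable_snd).mul
      (hf.meas.comp (measurable_fst.add measurable_snd))
  refine ⟨hm.aestronglyMeasurable, ?_⟩
  unfold HasFiniteIntegral
  rw [lintegral_prod _ hm.enorm.aemeasurable]
  simp only [enorm_mul, Real.enorm_eq_ofReal (ker_pos ε _).le]
  rw [lint_swap ε (H := fun x y => ‖f (x + y)‖ₑ) (by
    exact (hf.meas.comp (measurable_fst.add measurable_snd)).enorm)]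
  have e : ∀ y, ∫⁻ x, ‖f (x + y)‖ₑ ∂(cubeVol d) = ∫⁻ x, ‖f x‖ₑ ∂(cubeVol d) := fun y =>
    lint_shift (f := fun x => ‖f x‖ₑ) (hf.per.comp _) y
  simp only [e]
  rw [lintegral_mul_const _ ((ker_continuous ε).measurable.ennreal_ofReal), lint_ker, one_mul]
  exact hf.int.2

theorem integral_mol (ε : ℝ) {f : (Fin d → ℝ) → ℝ} (hf : PI f) :
    ∫ x, mol ε f x ∂(cubeVol d) = ∫ x, f x ∂(cubeVol d) := by
  unfold mol
  rw [integral_integral_swap (kf_prod_int ε hf)]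
  simp only [integral_const_mul]
  have e : ∀ y, ∫ x, f (x + y) ∂(cubeVol d) = ∫ x, f x ∂(cubeVol d) := fun y => int_shift hf.per y
  simp only [e]
  rw [integral_mul_const, ker_integral, one_mul]

/-- integral of a derivative over the torus vanishes -/
theorem ibp_zero {f f' : (Fin d → ℝ) → ℝ} (e : Fin d → ℝ) (hfm : Measurable f) (hfp : Per f)
    (C : ℝ) (hC : ∀ x, |f x| ≤ C) (hf'm : Measurable f') (C' : ℝ) (hC' : ∀ x, |f' x| ≤ C')
    (hd : ∀ x, HasDerivAt (fun s : ℝ => f (x + s • e)) (f' x) 0) :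
    ∫ x, f' x ∂(cubeVol d) = 0 := by
  have hd' : ∀ x (s : ℝ), HasDerivAt (fun s : ℝ => f (x + s • e)) (f' (x + s • e)) s := by
    intro x s
    have h1 : HasDerivAt (fun r : ℝ => f (x + s • e + r • e)) (f' (x + s • e)) (s - s) := by
      rw [sub_self]; exact hd (x + s • e)
    have h2 := h1.comp_sub_const s s
    refine h2.congr_of_eventuallyEq (Filter.Eventually.of_forall fun r => ?_)
    simp only [Function.comp, id]
    rw [add_assoc, ← add_smul]; simp
  have key := hasDerivAt_integral_of_dominated_loc_of_deriv_le (μ := cubeVol d) (𝕜 := ℝ)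
    (F := fun s x => f (x + s • e)) (F' := fun s x => f' (x + s • e)) (x₀ := 0) (s := Set.univ)
    (bound := fun _ => C') Filter.univ_mem
    (Filter.Eventually.of_forall fun s => (hfm.comp (measurable_id.add_const _)).aestronglyMeasurable)
    (bdd_integrable (hfm.comp (measurable_id.add_const _)).aestronglyMeasurable C fun x => hC _)
    (hf'm.comp (measurable_id.add_const _)).aestronglyMeasurable
    (Filter.Eventually.of_forall fun x s _ => hC' _) (integrable_const _)
    (Filter.Eventually.of_forall fun x s _ => hd' x s)
  have h2 := key.2
  simp only [int_shift hfp, zero_smul, add_zero] at h2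
  exact h2.unique (hasDerivAt_const _ _)

/-- centred representative -/
def cen (y : Fin d → ℝ) : Fin d → ℝ := fun i => y i - round (y i)

theorem Per.cenf {β : Type*} {f : (Fin d → ℝ) → β} (hf : Per f) (x y : Fin d → ℝ) :
    f (x + cen y) = f (x + y) := by
  rw [← hf (x + cen y) (fun i => round (y i))]
  congr 1
  ext i
  simp [CompressibleEuler.cen, add_assoc]

theorem cen_le (y : Fin d → ℝ) (i : Fin d) : |cen y i| ≤ 1 / 2 := abs_sub_round _

theorem cen_sin (y : Fin d → ℝ) (i : Fin d) : |cen y i| ≤ |Real.sin (Real.pi * y i)| := by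
  have h1 : |Real.sin (Real.pi * cen y i)| = |Real.sin (Real.pi * y i)| := by
    have : Real.pi * cen y i = Real.pi * y i - round (y i) * Real.pi := by
      unfold cen; ring
    rw [this, Real.sin_sub_int_mul_pi, abs_mul, abs_zpow]
    simp
  have hp := Real.pi_pos
  have h2 := Real.mul_abs_le_abs_sin (x := Real.pi * cen y i) (by
    rw [abs_mul, abs_of_pos hp]
    nlinarith [cen_le y i])
  rw [h1, abs_mul, abs_of_pos hp] at h2
  refine le_trans ?_ h2
  have : 2 / Real.pi * (Real.pi * |cen y i|) = 2 * |cen y i| := by field_simp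
  rw [this]
  nlinarith [abs_nonneg (cen y i)]

theorem euNorm_cen (y : Fin d → ℝ) : euNorm (cen y) ≤ sg y := by
  unfold sg euNorm
  apply Real.sqrt_le_sqrt
  refine Finset.sum_le_sum fun i _ => ?_
  exact sq_le_sq.2 (cen_sin y i)

theorem abs_le_euNorm (y : Fin d → ℝ) (i : Fin d) : |y i| ≤ euNorm y := by
  unfold euNorm
  apply Real.abs_le_sqrt
  exact Finset.single_le_sum (f := fun i => y i ^ 2) (fun i _ => sq_nonneg _) (Finset.mem_univ i)

theorem cen_abs_le_sg (y : Fin d → ℝ) (i : Fin d) : |cen y i| ≤ sg y :=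
  (abs_le_euNorm _ i).trans (euNorm_cen y)

theorem sg_le (y : Fin d → ℝ) : sg y ≤ d + 1 := by
  have h : sg y ^ 2 ≤ d := by
    rw [sg_sq]
    refine (Finset.sum_le_card_nsmul _ _ 1 fun i _ => Real.sin_sq_le_one _).trans ?_
    simp
  have hd : (0 : ℝ) ≤ d := Nat.cast_nonneg _
  nlinarith [sg_nonneg y]

theorem euNorm_pos {y : Fin d → ℝ} (hy : y ≠ 0) : 0 < euNorm y := by
  obtain ⟨i, hi⟩ := Function.ne_iff.1 hy
  exact lt_of_lt_of_le (abs_pos.2 hi) (abs_le_euNorm y i)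

theorem euNorm_neg (y : Fin d → ℝ) : euNorm (-y) = euNorm y := by
  simp [euNorm]

theorem besov_shift {α α' : ℝ} (hα' : 0 < α') (h : α' ≤ α) (q : ℝ≥0∞) (hq : q ≠ 0)
    {u : (Fin d → ℝ) → Fin d → ℝ} (hu : Per u) (y : Fin d → ℝ) :
    nLp (cubeVol d) q (fun x => ‖u (x + y) - u x‖ₑ) ≤
      ENNReal.ofReal ((d + 1 : ℝ) ^ α) * besovNorm α q u * ENNReal.ofReal (sg y) ^ α' := by
  rw [← eLpNorm_eq_nLp _ _ hq]
  by_cases hy : cen y = 0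
  · have : (fun x => u (x + y) - u x) = fun _ => 0 := by
      ext1 x
      rw [← hu.cenf, hy]; simp
    rw [this]; simp
  · have h0 := euNorm_pos hy
    have e : (fun x => u (x + y) - u x) = fun x => u (x - (-cen y)) - u x := by
      ext1 x
      rw [sub_neg_eq_add, hu.cenf]
    rw [e]
    have h1 : eLpNorm (fun x => u (x - (-cen y)) - u x) q (cubeVol d) /
        ENNReal.ofReal (euNorm (-cen y) ^ α) ≤ besovNorm α q u :=
      (le_iSup₂ (f := fun (y : Fin d → ℝ) (_ : y ≠ 0) =>
        eLpNorm (fun x => u (x - y) - u x) q (cubeVol d) / ENNReal.ofReal (euNorm y ^ α))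
        (-cen y) (neg_ne_zero.2 hy)).trans le_add_self
    rw [euNorm_neg, ENNReal.div_le_iff (by simpa using Real.rpow_pos_of_pos h0 α)
      ENNReal.ofReal_ne_top] at h1
    refine h1.trans ?_
    rw [mul_right_comm, mul_comm _ (besovNorm α q u)]
    gcongr
    have hs : 0 < sg y := h0.trans_le (euNorm_cen y)
    have hd : (0 : ℝ) ≤ d := Nat.cast_nonneg _
    rw [ENNReal.ofReal_rpow_of_pos hs, ← ENNReal.ofReal_mul (by positivity)]
    apply ENNReal.ofReal_le_ofReal
    calc euNorm (cen y) ^ α ≤ sg y ^ α :=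
          Real.rpow_le_rpow h0.le (euNorm_cen y) (hα'.le.trans h)
      _ = sg y ^ (α - α') * sg y ^ α' := by rw [← Real.rpow_add hs]; simp
      _ ≤ (d + 1 : ℝ) ^ α * sg y ^ α' := by
          gcongr
          calc sg y ^ (α - α') ≤ (d + 1 : ℝ) ^ (α - α') :=
                Real.rpow_le_rpow hs.le (sg_le y) (by linarith)
            _ ≤ _ := Real.rpow_le_rpow_of_exponent_le (by linarith) (by linarith)

/-- modulus of continuity in L1 -/
theorem l1_modulus {f : (Fin d → ℝ) → ℝ} (hf : PI f) (δ : ℝ) (hδ : 0 < δ) :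
    ∃ η : ℝ, 0 < η ∧ ∀ y, ∫⁻ x, ‖f (x + y) - f x‖ₑ ∂(cubeVol d) ≤ ENNReal.ofReal δ +
      ENNReal.ofReal η * ENNReal.ofReal (sg y) ^ (2 : ℝ) := by
  set K : Set (Fin d → ℝ) := Set.univ.pi fun _ => Set.Ico (-1 : ℝ) 2 with hK
  have hKm : MeasurableSet K := MeasurableSet.univ_pi fun _ => measurableSet_Ico
  set F := K.indicator f with hF
  have hFi : Integrable F volume := by
    rw [hF, integrable_indicator_iff hKm]
    have hsub : K ⊆ ⋃ n ∈ (Fintype.piFinset fun _ : Fin d => Finset.Icc (-1 : ℤ) 1),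
        (fun x => x + (fun i => ((-n i : ℤ) : ℝ))) ⁻¹' (unitCube d) := by
      intro x hx
      simp only [Set.mem_iUnion, Set.mem_preimage, unitCube, Set.mem_univ_pi, Fintype.mem_piFinset,
        Finset.mem_Icc, Set.mem_Ico, Pi.add_apply]
      refine ⟨fun i => ⌊x i⌋, fun i => ?_, fun i => ?_⟩
      · have := hx i (Set.mem_univ i)
        constructor
        · rw [Int.le_floor]; push_cast; exact this.1
        · rw [← Int.lt_add_one_iff, Int.floor_lt]; push_cast; linarith [this.2]
      · push_cast
        constructor
        · linarith [Int.floor_le (x i)]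
        · linarith [Int.lt_floor_add_one (x i)]
    refine IntegrableOn.mono_set ?_ hsub
    rw [integrableOn_finset_iUnion]
    intro n _
    have := (measurePreserving_add_right (volume : Measure (Fin d → ℝ))
      (fun i => ((-n i : ℤ) : ℝ))).integrableOn_comp_preimage
      (MeasurableEquiv.addRight _).measurableEmbedding (f := f) (s := unitCube d)
    have h2 := this.2 hf.int
    refine h2.congr_fun ?_ ((measurable_id.add_const _) (meas_unitCube d))
    intro x _
    exact hf.per x (fun i => -n i)
  obtain ⟨g, hgs, hgint, hgc, hgi⟩ := hFi.exists_hasCompactSupport_lintegral_sub_le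
    (ε := ENNReal.ofReal (δ / 3)) (by simp [hδ])
  have huc := hgs.uniformContinuous_of_continuous hgc
  rw [Metric.uniformContinuous_iff] at huc
  obtain ⟨η, hη, hη2⟩ := huc (δ / 3) (by positivity)
  set N := ∫⁻ x, ‖f x‖ₑ ∂(cubeVol d) with hN
  have hNf : N ≠ ∞ := hf.int.2.ne
  refine ⟨2 * N.toReal / η ^ 2 + 1, by positivity, fun y => ?_⟩
  by_cases hy : sg y < η
  · refine le_trans ?_ le_self_add
    have e : ∀ x, ‖f (x + y) - f x‖ₑ = ‖f (x + cen y) - f x‖ₑ := fun x => by rw [hf.per.cenf]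
    simp only [e]
    have hmem : ∀ x ∈ unitCube d, x ∈ K ∧ x + cen y ∈ K := by
      intro x hx
      constructor
      · intro i _
        have := hx i (Set.mem_univ i)
        exact ⟨by linarith [this.1], by linarith [this.2]⟩
      · intro i _
        have := hx i (Set.mem_univ i)
        have h2 := abs_le.1 (cen_le y i)
        simp only [Pi.add_apply]
        exact ⟨by linarith [this.1, h2.1], by linarith [this.2, h2.2]⟩
    calc ∫⁻ x, ‖f (x + cen y) - f x‖ₑ ∂(cubeVol d)
        ≤ ∫⁻ x, (‖F (x + cen y) - g (x + cen y)‖ₑ + ENNReal.ofReal (δ / 3) + ‖F x - g x‖ₑ)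
            ∂(cubeVol d) := by
          refine setLIntegral_mono' (meas_unitCube d) fun x hx => ?_
          obtain ⟨h1, h2⟩ := hmem x hx
          have e1 : F x = f x := Set.indicator_of_mem h1 f
          have e2 : F (x + cen y) = f (x + cen y) := Set.indicator_of_mem h2 f
          rw [← e1, ← e2]
          have h3 : ‖g (x + cen y) - g x‖ₑ ≤ ENNReal.ofReal (δ / 3) := by
            rw [← ofReal_norm_eq_enorm]
            apply ENNReal.ofReal_le_ofReal
            rw [← dist_eq_norm]
            refine (hη2 ?_).le
            rw [dist_eq_norm, add_sub_cancel_left]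
            refine lt_of_le_of_lt ((pi_norm_le_iff_of_nonneg (sg_nonneg y)).2 fun i => ?_) hy
            exact cen_abs_le_sg y i
          calc ‖F (x + cen y) - F x‖ₑ = ‖(F (x + cen y) - g (x + cen y)) +
                (g (x + cen y) - g x) - (F x - g x)‖ₑ := by congr 1; ring
            _ ≤ ‖F (x + cen y) - g (x + cen y)‖ₑ + ‖g (x + cen y) - g x‖ₑ + ‖F x - g x‖ₑ :=
                (enorm_sub_le).trans (by gcongr; exact enorm_add_le _ _)
            _ ≤ _ := by gcongr
      _ ≤ ENNReal.ofReal (δ / 3) + ENNReal.ofReal (δ / 3) + ENNReal.ofReal (δ / 3) := by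
          have hFm : Measurable F := hf.meas.indicator hKm
          have hm : Measurable fun x => ‖F x - g x‖ₑ := (hFm.sub hgc.measurable).enorm
          have hm2 : Measurable fun x => ‖F (x + cen y) - g (x + cen y)‖ₑ :=
            hm.comp (measurable_id.add_const _)
          rw [lintegral_add_right _ hm, lintegral_add_right _ measurable_const]
          gcongr
          · calc _ ≤ ∫⁻ x, ‖F (x + cen y) - g (x + cen y)‖ₑ := setLIntegral_le_lintegral _ _
              _ = ∫⁻ x, ‖F x - g x‖ₑ := lintegral_add_right_eq_self (fun x => ‖F x - g x‖ₑ) _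
              _ ≤ _ := hgint
          · simp
          · exact (setLIntegral_le_lintegral _ _).trans hgint
      _ = ENNReal.ofReal δ := by
          rw [← ENNReal.ofReal_add (by positivity) (by positivity),
            ← ENNReal.ofReal_add (by positivity) (by positivity)]
          congr 1; ring
  · push Not at hy
    refine le_trans ?_ le_add_self
    have h1 : ∫⁻ x, ‖f (x + y) - f x‖ₑ ∂(cubeVol d) ≤ N + N := by
      calc _ ≤ ∫⁻ x, (‖f (x + y)‖ₑ + ‖f x‖ₑ) ∂(cubeVol d) := lintegral_mono fun x => enorm_sub_le
        _ = N + N := by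
          rw [lintegral_add_right _ hf.meas.enorm,
            lint_shift (f := fun x => ‖f x‖ₑ) (hf.per.comp _)]
    refine h1.trans ?_
    have hs : 0 < sg y := hη.trans_le hy
    rw [ENNReal.ofReal_rpow_of_pos hs, ← ENNReal.ofReal_mul (by positivity), ← two_mul,
      ← ENNReal.ofReal_toReal hNf, ← ENNReal.ofReal_ofNat, ← ENNReal.ofReal_mul (by positivity)]
    apply ENNReal.ofReal_le_ofReal
    rw [ENNReal.toReal_ofReal ENNReal.toReal_nonneg, Real.rpow_two]
    have h2 : η ^ 2 ≤ sg y ^ 2 := by gcongr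
    have h3 : 2 * N.toReal ≤ 2 * N.toReal / η ^ 2 * sg y ^ 2 := by
      rw [div_mul_eq_mul_div, le_div_iff₀ (by positivity)]
      gcongr
    nlinarith [sq_nonneg (sg y)]

theorem mol_sub_self (ε : ℝ) {f : (Fin d → ℝ) → ℝ} (hf : PI f) (x : Fin d → ℝ) :
    mol ε f x - f x = ∫ y, ker ε y * (f (x + y) - f x) ∂(cubeVol d) := by
  have : (fun y => ker ε y * (f (x + y) - f x)) =
    fun y => ker ε y * f (x + y) - ker ε y * f x := by ext y; ring
  rw [this, integral_sub (kf_int ε hf x) ((ker_integrable ε).mul_const _), integral_mul_const,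
    ker_integral, one_mul]
  rfl

theorem mol_sub_L1 (ε : ℝ) {f : (Fin d → ℝ) → ℝ} (hf : PI f) :
    ∫⁻ x, ‖mol ε f x - f x‖ₑ ∂(cubeVol d) ≤
      ∫⁻ y, ENNReal.ofReal (ker ε y) * ∫⁻ x, ‖f (x + y) - f x‖ₑ ∂(cubeVol d) ∂(cubeVol d) := by
  rw [← lint_swap ε (H := fun x y => ‖f (x + y) - f x‖ₑ)]
  · refine lintegral_mono fun x => ?_
    rw [mol_sub_self ε hf]
    refine (enorm_integral_le_lintegral_enorm _).trans (lintegral_mono fun y => ?_)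
    simp only [enorm_mul]
    gcongr
    rw [Real.enorm_eq_ofReal (ker_pos ε y).le]
  · exact ((hf.meas.comp (measurable_fst.add measurable_snd)).sub
      (hf.meas.comp measurable_fst)).enorm

/-- the sequence of scales -/
def ep (n : ℕ) : ℝ := 1 / ((n : ℝ) + 1)

theorem ep_pos (n : ℕ) : 0 < ep n := by unfold ep; positivity

theorem ep_tendsto : Filter.Tendsto ep Filter.atTop (nhds 0) := tendsto_one_div_add_atTop_nhds_zero_nat

theorem ep_rpow (s : ℝ) (hs : 0 < s) :
    Filter.Tendsto (fun n => ENNReal.ofReal (ep n) ^ s) Filter.atTop (nhds 0) := by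
  have h := (ENNReal.tendsto_ofReal ep_tendsto).ennrpow_const s
  rwa [ENNReal.ofReal_zero, ENNReal.zero_rpow_of_pos hs] at h

theorem mol_tendsto {f : (Fin d → ℝ) → ℝ} (hf : PI f) :
    Filter.Tendsto (fun n => ∫⁻ x, ‖mol (ep n) f x - f x‖ₑ ∂(cubeVol d)) Filter.atTop
      (nhds 0) := by
  rw [ENNReal.tendsto_nhds_zero]
  intro δ hδ
  by_cases hδt : δ = ∞
  · rw [hδt]; exact Filter.Eventually.of_forall fun _ => le_top
  set δ' := δ.toReal with hδ'
  have hp : 0 < δ' := ENNReal.toReal_pos hδ.ne' hδt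
  obtain ⟨η, hη, H⟩ := l1_modulus hf (δ' / 2) (by positivity)
  have hl : Filter.Tendsto (fun n => ENNReal.ofReal η * (ENNReal.ofReal (ep n) ^ (2 : ℝ) *
      ENNReal.ofReal (1 + d))) Filter.atTop (nhds 0) := by
    have := (ENNReal.Tendsto.const_mul (a := ENNReal.ofReal η) (ENNReal.Tendsto.mul_const
      (b := ENNReal.ofReal (1 + d)) (ep_rpow 2 two_pos) (Or.inr ENNReal.ofReal_ne_top))
      (Or.inr ENNReal.ofReal_ne_top))
    simpa using this
  rw [ENNReal.tendsto_nhds_zero] at hl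
  filter_upwards [hl (ENNReal.ofReal (δ' / 2)) (by simp [hp])] with n hn
  refine (mol_sub_L1 _ hf).trans ?_
  calc _ ≤ ∫⁻ y, (ENNReal.ofReal (δ' / 2) * ENNReal.ofReal (ker (ep n) y) +
        ENNReal.ofReal η * (ENNReal.ofReal (ker (ep n) y) * ENNReal.ofReal (sg y) ^ (2 : ℝ)))
          ∂(cubeVol d) := by
        refine lintegral_mono fun y => ?_
        refine (mul_le_mul_right (H y) _).trans (le_of_eq ?_)
        ring
    _ ≤ ENNReal.ofReal (δ' / 2) + ENNReal.ofReal (δ' / 2) := by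
        rw [lintegral_add_left (by
          exact ((ker_continuous (ep n)).measurable.ennreal_ofReal.const_mul _)),
          lintegral_const_mul _ (ker_continuous (ep n)).measurable.ennreal_ofReal, lint_ker,
          mul_one, lintegral_const_mul' _ _ ENNReal.ofReal_ne_top]
        gcongr
        refine le_trans ?_ hn
        gcongr
        exact ker_moment (ep_pos n) (by norm_num) le_rfl
    _ = δ := by
        rw [← ENNReal.ofReal_add (by positivity) (by positivity), add_halves, hδ',
          ENNReal.ofReal_toReal hδt]

/-- bounded times L1 convergence -/
theorem bl_tendsto {α : Type*} [MeasurableSpace α] (μ : Measure α)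
    (X : ℕ → α → ℝ) (X' : α → ℝ) (Q : ℕ → α → ℝ) (Q' : α → ℝ) (M : ℝ)
    (hX : ∀ n, AEStronglyMeasurable (X n) μ) (hX' : AEStronglyMeasurable X' μ)
    (hXM : ∀ n x, |X n x| ≤ M) (hQ : ∀ n, Integrable (Q n) μ) (hQ' : Integrable Q' μ)
    (hXl : Filter.Tendsto (fun n => ∫⁻ x, ‖X n x - X' x‖ₑ ∂μ) Filter.atTop (nhds 0))
    (hQl : Filter.Tendsto (fun n => ∫⁻ x, ‖Q n x - Q' x‖ₑ ∂μ) Filter.atTop (nhds 0)) :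
    Filter.Tendsto (fun n => ∫ x, X n x * Q n x ∂μ) Filter.atTop
      (nhds (∫ x, X' x * Q' x ∂μ)) := by
  have hA : Filter.Tendsto (fun n => ∫ x, X n x * Q' x ∂μ) Filter.atTop
      (nhds (∫ x, X' x * Q' x ∂μ)) := by
    refine Filter.tendsto_of_subseq_tendsto fun ns hns => ?_
    have htm : TendstoInMeasure μ (fun n => X (ns n)) Filter.atTop X' := by
      refine tendstoInMeasure_of_tendsto_eLpNorm (p := 1) one_ne_zero (fun n => hX _) hX' ?_
      simp only [eLpNorm_one_eq_lintegral_enorm]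
      exact hXl.comp hns
    obtain ⟨ms, hms, hms2⟩ := htm.exists_seq_tendsto_ae
    refine ⟨ms, ?_⟩
    refine tendsto_integral_of_dominated_convergence (fun x => M * |Q' x|)
      (fun n => (hX _).mul hQ'.1) (hQ'.abs.const_mul M) ?_ ?_
    · intro n
      refine Filter.Eventually.of_forall fun x => ?_
      rw [Real.norm_eq_abs, abs_mul]
      gcongr
      exact hXM _ _
    · filter_upwards [hms2] with x hx
      exact hx.mul_const _
  have hXQ : ∀ n, ∀ {q : α → ℝ}, Integrable q μ → Integrable (fun x => X n x * q x) μ :=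
    fun n q hq => hq.bdd_mul (hX n) (c := M) (Filter.Eventually.of_forall fun x => hXM n x)
  have hB : Filter.Tendsto (fun n => ∫ x, X n x * (Q n x - Q' x) ∂μ) Filter.atTop (nhds 0) := by
    rw [tendsto_zero_iff_enorm_tendsto_zero]
    have hM : Filter.Tendsto (fun n => ENNReal.ofReal M * ∫⁻ x, ‖Q n x - Q' x‖ₑ ∂μ) Filter.atTop
      (nhds 0) := by
      have := ENNReal.Tendsto.const_mul (a := ENNReal.ofReal M) hQl (Or.inr ENNReal.ofReal_ne_top)
      simpa using this
    refine tendsto_of_tendsto_of_tendsto_of_le_of_le tendsto_const_nhds hM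
      (fun _ => zero_le) fun n => ?_
    refine (enorm_integral_le_lintegral_enorm _).trans ?_
    rw [← lintegral_const_mul' _ _ ENNReal.ofReal_ne_top]
    refine lintegral_mono fun x => ?_
    simp only [enorm_mul]
    gcongr
    rw [Real.enorm_eq_ofReal_abs]
    exact ENNReal.ofReal_le_ofReal (hXM n x)
  have := hA.add hB
  rw [add_zero] at this
  refine this.congr fun n => ?_
  rw [← integral_add (hXQ n hQ') (hXQ n (q := fun x => Q n x - Q' x) ((hQ n).sub hQ'))]
  congr 1; ext x; ring

/-- time test functions -/
def IsTT (T : ℝ) (χ : ℝ → ℝ) : Prop := ContDiff ℝ (⊤ : ℕ∞) χ ∧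
  ∃ a b : ℝ, 0 < a ∧ b < T ∧ ∀ t, t ∉ Set.Icc a b → χ t = 0

theorem IsTT.zero {T : ℝ} {χ : ℝ → ℝ} (h : IsTT T χ) {t : ℝ} (ht : t ≤ 0 ∨ T ≤ t) : χ t = 0 := by
  obtain ⟨-, a, b, ha, hb, h⟩ := h
  refine h t fun hm => ?_
  rcases ht with ht | ht
  · linarith [hm.1]
  · linarith [hm.2]

theorem IsTT.cont {T : ℝ} {χ : ℝ → ℝ} (h : IsTT T χ) : Continuous χ := h.1.continuous

theorem IsTT.compSupp {T : ℝ} {χ : ℝ → ℝ} (h : IsTT T χ) : HasCompactSupport χ := by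
  obtain ⟨-, a, b, ha, hb, h⟩ := h
  exact HasCompactSupport.intro isCompact_Icc h

theorem IsTT.bound {T : ℝ} {χ : ℝ → ℝ} (h : IsTT T χ) : ∃ C, 0 ≤ C ∧ ∀ t, |χ t| ≤ C := by
  obtain ⟨C, hC⟩ := h.compSupp.exists_bound_of_continuous h.cont
  exact ⟨C, (norm_nonneg _).trans (hC 0), hC⟩

theorem IsTT.deriv {T : ℝ} {χ : ℝ → ℝ} (h : IsTT T χ) : IsTT T (deriv χ) := by
  refine ⟨(contDiff_infty_iff_deriv.1 h.1).2, ?_⟩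
  obtain ⟨-, a, b, ha, hb, h⟩ := h
  refine ⟨a, b, ha, hb, fun t ht => ?_⟩
  have hev : χ =ᶠ[nhds t] fun _ => 0 := by
    filter_upwards [isClosed_Icc.isOpen_compl.mem_nhds ht] with s hs
    exact h s hs
  rw [hev.deriv_eq]; simp

theorem IsTT.smul {T : ℝ} {χ : ℝ → ℝ} (h : IsTT T χ) (c : ℝ) : IsTT T (fun t => c * χ t) := by
  refine ⟨contDiff_const.mul h.1, ?_⟩
  obtain ⟨-, a, b, ha, hb, h⟩ := h
  exact ⟨a, b, ha, hb, fun t ht => by simp only [h t ht, mul_zero]⟩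

theorem IsTT.add {T : ℝ} {χ ψ : ℝ → ℝ} (h : IsTT T χ) (h' : IsTT T ψ) :
    IsTT T (fun t => χ t + ψ t) := by
  refine ⟨h.1.add h'.1, ?_⟩
  obtain ⟨-, a, b, ha, hb, h⟩ := h
  obtain ⟨-, a', b', ha', hb', h'⟩ := h'
  refine ⟨min a a', max b b', lt_min ha ha', max_lt hb hb', fun t ht => ?_⟩
  change χ t + ψ t = 0
  rw [h t, h' t, add_zero]
  · exact fun hm => ht ⟨(min_le_right _ _).trans hm.1, hm.2.trans (le_max_right _ _)⟩
  · exact fun hm => ht ⟨(min_le_left _ _).trans hm.1, hm.2.trans (le_max_left _ _)⟩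

theorem IsTT.prim {T : ℝ} {ψ : ℝ → ℝ} (h : IsTT T ψ) (h0 : ∫ t in (0 : ℝ)..T, ψ t = 0) :
    IsTT T (fun t => ∫ s in (0 : ℝ)..t, ψ s) ∧
      ∀ t, HasDerivAt (fun t => ∫ s in (0 : ℝ)..t, ψ s) (ψ t) t := by
  have hd : ∀ t, HasDerivAt (fun t => ∫ s in (0 : ℝ)..t, ψ s) (ψ t) t := fun t =>
    intervalIntegral.integral_hasDerivAt_right (h.cont.intervalIntegrable _ _)
      (h.cont.stronglyMeasurableAtFilter _ _) h.cont.continuousAt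
  refine ⟨⟨?_, ?_⟩, hd⟩
  · rw [contDiff_infty_iff_deriv]
    refine ⟨fun t => (hd t).differentiableAt, ?_⟩
    rw [show _root_.deriv (fun t => ∫ s in (0 : ℝ)..t, ψ s) = ψ from funext fun t => (hd t).deriv]
    exact h.1
  · obtain ⟨hc, a, b, ha, hb, hz⟩ := h
    refine ⟨a, b, ha, hb, fun t ht => ?_⟩
    have hi := fun x y => hc.continuous.intervalIntegrable (μ := volume) x y
    by_cases hta : t < a
    · change ∫ s in (0 : ℝ)..t, ψ s = 0
      rw [intervalIntegral.integral_congr (g := fun _ => (0 : ℝ))]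
      · simp
      · intro s hs
        refine hz s fun hm => ?_
        rw [Set.uIcc, Set.mem_Icc] at hs
        have := hs.2.trans (max_le ha.le hta.le)
        have := lt_of_le_of_lt hs.2 (max_lt ha hta)
        linarith [hm.1]
    · have htb : b < t := by
        by_contra hh
        exact ht ⟨not_lt.1 hta, not_lt.1 hh⟩
      have e := intervalIntegral.integral_add_adjacent_intervals (hi 0 t) (hi t T)
      rw [h0] at e
      have e2 : ∫ s in t..T, ψ s = 0 := by
        rw [intervalIntegral.integral_congr (g := fun _ => (0 : ℝ))]
        · simp
        · intro s hs
          refine hz s fun hm => ?_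
          rw [Set.uIcc, Set.mem_Icc] at hs
          have := lt_of_lt_of_le (lt_min htb hb) hs.1
          linarith [hm.2]
      simpa [e2] using e

theorem Ioo_eq_interval {T : ℝ} (hT : 0 < T) (f : ℝ → ℝ) :
    ∫ t in Set.Ioo 0 T, f t = ∫ t in (0 : ℝ)..T, f t := by
  rw [intervalIntegral.integral_of_le hT.le, integral_Ioc_eq_integral_Ioo]

theorem tt_ibp {T : ℝ} (hT : 0 < T) {φ : ℝ → ℝ} (hφ : IsTT T φ) (f f' : ℝ → ℝ) (L : NNReal)
    (hL : LipschitzOnWith L f (Set.Icc 0 T))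
    (hd : ∀ᵐ t, t ∈ Set.Ioo 0 T → HasDerivAt f (f' t) t) :
    ∫ t in Set.Ioo 0 T, deriv φ t * f t = - ∫ t in Set.Ioo 0 T, φ t * f' t := by
  have h1 : AbsolutelyContinuousOnInterval f 0 T := by
    apply LipschitzOnWith.absolutelyContinuousOnInterval (K := L)
    rwa [Set.uIcc_of_le hT.le]
  have h2 : AbsolutelyContinuousOnInterval φ 0 T :=
    ContDiffOn.absolutelyContinuousOnInterval ((hφ.1.of_le (by exact_mod_cast le_top)).contDiffOn)
  have := h2.integral_mul_deriv_eq_deriv_mul h1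
  rw [hφ.zero (Or.inl le_rfl), hφ.zero (Or.inr le_rfl)] at this
  rw [Ioo_eq_interval hT]
  have e : ∫ t in Set.Ioo 0 T, φ t * f' t = ∫ x in (0 : ℝ)..T, φ x * deriv f x := by
    rw [← Ioo_eq_interval hT]
    apply setIntegral_congr_ae measurableSet_Ioo
    filter_upwards [hd] with t ht hm
    rw [(ht hm).deriv]
  rw [e, this]; simp

theorem bdd_intInt {a : ℝ → ℝ} (ha : Measurable a) {K : ℝ} (hK : ∀ t, |a t| ≤ K) (x y : ℝ) :
    IntervalIntegrable a volume x y := by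
  rw [intervalIntegrable_iff]
  exact Measure.integrableOn_of_bounded (M := K) (by simp [Set.uIoc]) ha.aestronglyMeasurable
    (Filter.Eventually.of_forall hK)

theorem prim_lip {a : ℝ → ℝ} (ha : Measurable a) {K : ℝ} (hK : ∀ t, |a t| ≤ K) (s t : ℝ) :
    |(∫ r in (0 : ℝ)..s, a r) - ∫ r in (0 : ℝ)..t, a r| ≤ K * |s - t| := by
  rw [intervalIntegral.integral_interval_sub_left (bdd_intInt ha hK _ _) (bdd_intInt ha hK _ _)]
  exact intervalIntegral.norm_integral_le_of_norm_le_const (f := a) fun x _ => hK x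

/-- du Bois-Reymond -/
theorem weak_const {T : ℝ} (hT : 0 < T) {w : ℝ → ℝ} (hw : Measurable w) {K : ℝ}
    (hK : ∀ t ∈ Set.Ioo 0 T, |w t| ≤ K)
    (h : ∀ χ, IsTT T χ → ∫ t in Set.Ioo 0 T, deriv χ t * w t = 0) :
    ∃ C, ∀ᵐ t, t ∈ Set.Ioo 0 T → w t = C := by
  have hwi : IntegrableOn w (Set.Ioo 0 T) :=
    Measure.integrableOn_of_bounded (M := K) (by simp) hw.aestronglyMeasurable
      ((ae_restrict_iff' measurableSet_Ioo).2 (Filter.Eventually.of_forall hK))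
  let b0 : ContDiffBump (T / 2) := ⟨T / 8, T / 4, by positivity, by linarith⟩
  have hb0 : IsTT T b0 := by
    refine ⟨b0.contDiff, T / 4, 3 * T / 4, by positivity, by linarith, fun t ht => ?_⟩
    apply b0.zero_of_le_dist
    change T / 4 ≤ dist t (T / 2)
    rw [Real.dist_eq]
    by_contra hh
    push Not at hh
    rw [abs_lt] at hh
    exact ht ⟨by linarith [hh.1], by linarith [hh.2]⟩
  have hI0 : 0 < ∫ t in (0 : ℝ)..T, b0 t := by
    rw [← Ioo_eq_interval hT]
    rw [setIntegral_eq_integral_of_forall_compl_eq_zero]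
    · exact b0.integral_pos
    · intro t ht
      apply hb0.zero
      simp only [Set.mem_Ioo, not_and_or, not_lt] at ht
      exact ht
  set I0 := ∫ t in (0 : ℝ)..T, b0 t with hI0'
  set C := (∫ t in Set.Ioo 0 T, b0 t * w t) / I0 with hC
  refine ⟨C, ?_⟩
  have hmulw : ∀ g, IsTT T g → IntegrableOn (fun t => g t * w t) (Set.Ioo 0 T) := by
    intro g hg
    obtain ⟨B, -, hB⟩ := hg.bound
    exact hwi.bdd_mul hg.cont.aestronglyMeasurable (c := B) (Filter.Eventually.of_forall hB)
  have hz := IsOpen.ae_eq_zero_of_integral_contDiff_smul_eq_zero (E := ℝ) (μ := volume)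
    (f := fun t => w t - C) (U := Set.Ioo 0 T) isOpen_Ioo
    ((hwi.sub (integrableOn_const (by simp))).locallyIntegrableOn) (by
    intro g hg hgc hgs
    have hgT : IsTT T g := by
      refine ⟨hg, ?_⟩
      by_cases hne : (tsupport g).Nonempty
      · refine ⟨sInf (tsupport g), sSup (tsupport g), (hgs (hgc.isCompact.sInf_mem hne)).1,
          (hgs (hgc.isCompact.sSup_mem hne)).2, fun t ht => ?_⟩
        by_contra hh
        have := subset_tsupport g hh
        exact ht ⟨csInf_le hgc.isCompact.bddBelow this, le_csSup hgc.isCompact.bddAbove this⟩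
      · refine ⟨T / 2, T / 2, by positivity, by linarith, fun t ht => ?_⟩
        by_contra hh
        exact hne ⟨t, subset_tsupport g hh⟩
    rw [← setIntegral_eq_integral_of_forall_compl_eq_zero (s := Set.Ioo 0 T)]
    swap
    · intro t ht
      rw [hgT.zero, zero_smul]
      simp only [Set.mem_Ioo, not_and_or, not_lt] at ht
      exact ht
    set Ig := ∫ t in (0 : ℝ)..T, g t with hIg
    have hψ : IsTT T (fun t => g t + (-(Ig / I0)) * b0 t) := hgT.add (hb0.smul _)
    obtain ⟨hp1, hp2⟩ := hψ.prim (by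
      rw [intervalIntegral.integral_add (hgT.cont.intervalIntegrable _ _)
        ((hb0.smul _).cont.intervalIntegrable _ _), intervalIntegral.integral_const_mul]
      rw [← hI0', ← hIg]; field_simp; ring)
    have := h _ hp1
    rw [show deriv (fun t => ∫ s in (0 : ℝ)..t, (g s + (-(Ig / I0)) * b0 s)) =
      (fun t => g t + (-(Ig / I0)) * b0 t) from funext fun t => (hp2 t).deriv] at this
    have e1 : (fun t => (g t + -(Ig / I0) * b0 t) * w t) =
      fun t => g t * w t + (-(Ig / I0)) * (b0 t * w t) := by ext t; ring
    rw [e1, integral_add (hmulw g hgT) ((hmulw b0 hb0).const_mul _), integral_const_mul] at this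
    have e2 : (fun t => g t • (w t - C)) = fun t => g t * w t - C * g t := by
      ext t; rw [smul_eq_mul]; ring
    have hgi : IntegrableOn g (Set.Ioo 0 T) :=
      (hgT.cont.integrable_of_hasCompactSupport hgc).integrableOn
    rw [e2, integral_sub (hmulw g hgT) (hgi.const_mul _), integral_const_mul, Ioo_eq_interval hT g,
      ← hIg, hC]
    linear_combination this)
  filter_upwards [hz] with t ht hm
  linarith [ht hm]

theorem weak_prim {T : ℝ} (hT : 0 < T) {u a : ℝ → ℝ} (hu : Measurable u) (ha : Measurable a) {K : ℝ}
    (hK : ∀ t, |u t| ≤ K) (hKa : ∀ t, |a t| ≤ K)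
    (h : ∀ χ, IsTT T χ → ∫ t in Set.Ioo 0 T, deriv χ t * u t = - ∫ t in Set.Ioo 0 T, χ t * a t) :
    ∃ C, ∀ᵐ t, t ∈ Set.Ioo 0 T → u t = C + ∫ r in (0 : ℝ)..t, a r := by
  have hK0 : 0 ≤ K := (abs_nonneg _).trans (hK 0)
  have hUc : Continuous fun t => ∫ r in (0 : ℝ)..t, a r :=
    intervalIntegral.continuous_primitive (fun x y => bdd_intInt ha hKa x y) 0
  obtain ⟨C, hC⟩ := weak_const hT (w := fun t => u t - ∫ r in (0 : ℝ)..t, a r)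
    (hu.sub hUc.measurable) (K := K + K * T) (by
      intro t ht
      have h1 := prim_lip ha hKa t 0
      simp only [intervalIntegral.integral_same, sub_zero] at h1
      refine (abs_sub _ _).trans (add_le_add (hK t) (h1.trans ?_))
      gcongr
      rw [abs_of_pos ht.1]; exact ht.2.le) (by
    intro χ hχ
    have e : (fun t => deriv χ t * (u t - ∫ r in (0 : ℝ)..t, a r)) =
      fun t => deriv χ t * u t - deriv χ t * ∫ r in (0 : ℝ)..t, a r := by ext t; ring
    obtain ⟨B, -, hB⟩ := hχ.deriv.bound
    have hui : IntegrableOn u (Set.Ioo 0 T) :=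
      Measure.integrableOn_of_bounded (M := K) (by simp) hu.aestronglyMeasurable
      (Filter.Eventually.of_forall hK)
    have i1 : IntegrableOn (fun t => deriv χ t * u t) (Set.Ioo 0 T) :=
      hui.bdd_mul hχ.deriv.cont.aestronglyMeasurable (c := B) (Filter.Eventually.of_forall hB)
    have i2 : IntegrableOn (fun t => deriv χ t * ∫ r in (0 : ℝ)..t, a r) (Set.Ioo 0 T) :=
      ((hχ.deriv.cont.mul hUc).integrableOn_Icc).mono_set Set.Ioo_subset_Icc_self
    rw [e, integral_sub i1 i2, h χ hχ, tt_ibp hT hχ _ a ⟨K, hK0⟩]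
    · ring
    · refine LipschitzOnWith.of_dist_le_mul fun s _ t _ => ?_
      rw [Real.dist_eq, Real.dist_eq]
      exact prim_lip ha hKa s t
    · have hloc : LocallyIntegrable a volume := by
        rw [locallyIntegrable_iff]
        intro k hk
        exact Measure.integrableOn_of_bounded (M := K) hk.measure_lt_top.ne ha.aestronglyMeasurable
          (Filter.Eventually.of_forall hKa)
      filter_upwards [LocallyIntegrable.ae_hasDerivAt_integral hloc] with t ht _
      exact ht 0)
  refine ⟨C, ?_⟩
  filter_upwards [hC] with t ht hm
  linarith [ht hm]

/-- chain rule in time -/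
theorem time_chain {T : ℝ} (hT : 0 < T) {u₁ u₂ a₁ a₂ : ℝ → ℝ} (hu₁ : Measurable u₁)
    (hu₂ : Measurable u₂) (ha₁ : Measurable a₁) (ha₂ : Measurable a₂) {K c : ℝ}
    (hK₁ : ∀ t, |u₁ t| ≤ K) (hK₂ : ∀ t, |u₂ t| ≤ K) (hKa₁ : ∀ t, |a₁ t| ≤ K)
    (hKa₂ : ∀ t, |a₂ t| ≤ K) (hc : ∀ t, c ≤ u₁ t)
    (h₁ : ∀ χ, IsTT T χ →
      ∫ t in Set.Ioo 0 T, deriv χ t * u₁ t = - ∫ t in Set.Ioo 0 T, χ t * a₁ t)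
    (h₂ : ∀ χ, IsTT T χ →
      ∫ t in Set.Ioo 0 T, deriv χ t * u₂ t = - ∫ t in Set.Ioo 0 T, χ t * a₂ t)
    (F Fr Fm : ℝ → ℝ → ℝ) {L : ℝ} (hL0 : 0 ≤ L)
    (hFL : ∀ r m r' m', c ≤ r → c ≤ r' → |F r m - F r' m'| ≤ L * |r - r'| + L * |m - m'|)
    (hF : ∀ (f₁ f₂ : ℝ → ℝ) (b₁ b₂ t : ℝ), HasDerivAt f₁ b₁ t → HasDerivAt f₂ b₂ t → c ≤ f₁ t →
      HasDerivAt (fun s => F (f₁ s) (f₂ s)) (Fr (f₁ t) (f₂ t) * b₁ + Fm (f₁ t) (f₂ t) * b₂) t)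
    {φ : ℝ → ℝ} (hφ : IsTT T φ) :
    ∫ t in Set.Ioo 0 T, deriv φ t * F (u₁ t) (u₂ t) =
      - ∫ t in Set.Ioo 0 T, φ t * (Fr (u₁ t) (u₂ t) * a₁ t + Fm (u₁ t) (u₂ t) * a₂ t) := by
  obtain ⟨C₁, hC₁⟩ := weak_prim hT hu₁ ha₁ hK₁ hKa₁ h₁
  obtain ⟨C₂, hC₂⟩ := weak_prim hT hu₂ ha₂ hK₂ hKa₂ h₂
  have hK0 : 0 ≤ K := (abs_nonneg _).trans (hK₁ 0)
  set U₁ : ℝ → ℝ := fun t => C₁ + ∫ r in (0 : ℝ)..t, a₁ r with hU₁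
  set U₂ : ℝ → ℝ := fun t => C₂ + ∫ r in (0 : ℝ)..t, a₂ r with hU₂
  have hUc : Continuous U₁ := continuous_const.add
    (intervalIntegral.continuous_primitive (fun x y => bdd_intInt ha₁ hKa₁ x y) 0)
  have hcU : ∀ t ∈ Set.Icc 0 T, c ≤ U₁ t := by
    have hV : Set.Ioo 0 T ∩ {t | U₁ t < c} = ∅ := by
      apply IsOpen.eq_empty_of_measure_zero (μ := volume)
      · exact isOpen_Ioo.inter (isOpen_lt hUc continuous_const)
      · rw [measure_eq_zero_iff_ae_notMem]
        filter_upwards [hC₁] with t ht hm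
        have := hc t
        rw [ht hm.1] at this
        exact absurd hm.2 (not_lt.2 this)
    have hsub : Set.Ioo 0 T ⊆ {t | c ≤ U₁ t} := by
      intro t ht
      by_contra hh
      have hlt : U₁ t < c := lt_of_not_ge hh
      have : t ∈ Set.Ioo 0 T ∩ {t | U₁ t < c} := ⟨ht, hlt⟩
      rw [hV] at this
      exact this
    have := closure_minimal hsub (isClosed_le continuous_const hUc)
    rwa [closure_Ioo hT.ne] at this
  have hloc : ∀ a : ℝ → ℝ, Measurable a → (∀ t, |a t| ≤ K) → LocallyIntegrable a volume := by
    intro a ha hKa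
    rw [locallyIntegrable_iff]
    intro k hk
    exact Measure.integrableOn_of_bounded (M := K) hk.measure_lt_top.ne ha.aestronglyMeasurable
      (Filter.Eventually.of_forall hKa)
  have key := tt_ibp hT hφ (fun t => F (U₁ t) (U₂ t))
    (fun t => Fr (U₁ t) (U₂ t) * a₁ t + Fm (U₁ t) (U₂ t) * a₂ t) ⟨2 * (L * K), by positivity⟩ (by
      refine LipschitzOnWith.of_dist_le_mul fun s hs t ht => ?_
      rw [Real.dist_eq, Real.dist_eq]
      refine (hFL _ _ _ _ (hcU s hs) (hcU t ht)).trans ?_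
      have e1 := prim_lip ha₁ hKa₁ s t
      have e2 := prim_lip ha₂ hKa₂ s t
      simp only [hU₁, hU₂, add_sub_add_left_eq_sub]
      change _ ≤ 2 * (L * K) * |s - t|
      nlinarith [mul_le_mul_of_nonneg_left e1 hL0, mul_le_mul_of_nonneg_left e2 hL0]) (by
      filter_upwards [LocallyIntegrable.ae_hasDerivAt_integral (hloc a₁ ha₁ hKa₁),
        LocallyIntegrable.ae_hasDerivAt_integral (hloc a₂ ha₂ hKa₂)] with t ht1 ht2 hm
      exact hF U₁ U₂ _ _ t ((ht1 0).const_add _) ((ht2 0).const_add _)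
        (hcU t (Set.Ioo_subset_Icc_self hm)))
  have e1 : ∫ t in Set.Ioo 0 T, deriv φ t * F (u₁ t) (u₂ t) =
      ∫ t in Set.Ioo 0 T, deriv φ t * F (U₁ t) (U₂ t) := by
    apply setIntegral_congr_ae measurableSet_Ioo
    filter_upwards [hC₁, hC₂] with t h1 h2 hm
    rw [h1 hm, h2 hm]
  have e2 : ∫ t in Set.Ioo 0 T, φ t * (Fr (u₁ t) (u₂ t) * a₁ t + Fm (u₁ t) (u₂ t) * a₂ t) =
      ∫ t in Set.Ioo 0 T, φ t * (Fr (U₁ t) (U₂ t) * a₁ t + Fm (U₁ t) (U₂ t) * a₂ t) := by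
    apply setIntegral_congr_ae measurableSet_Ioo
    filter_upwards [hC₁, hC₂] with t h1 h2 hm
    rw [h1 hm, h2 hm]
  rw [e1, e2, key]

theorem isTT_of_tsupport {T : ℝ} (hT : 0 < T) {g : ℝ → ℝ} (hg : ContDiff ℝ (⊤ : ℕ∞) g)
    (hgc : HasCompactSupport g) (hgs : tsupport g ⊆ Set.Ioo 0 T) : IsTT T g := by
  refine ⟨hg, ?_⟩
  by_cases hne : (tsupport g).Nonempty
  · refine ⟨sInf (tsupport g), sSup (tsupport g), (hgs (hgc.isCompact.sInf_mem hne)).1,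
      (hgs (hgc.isCompact.sSup_mem hne)).2, fun t ht => ?_⟩
    by_contra hh
    have := subset_tsupport g hh
    exact ht ⟨csInf_le hgc.isCompact.bddBelow this, le_csSup hgc.isCompact.bddAbove this⟩
  · refine ⟨T / 2, T / 2, by positivity, by linarith, fun t ht => ?_⟩
    by_contra hh
    exact hne ⟨t, subset_tsupport g hh⟩

/-- smooth time cutoffs -/
theorem cutoff {T : ℝ} (hT : 0 < T) {a b : ℝ} (ha : 0 < a) (hb : b < T) :
    ∃ χ, IsTT T χ ∧ (∀ t, 0 ≤ χ t) ∧ ∀ t ∈ Set.Icc a b, χ t = 1 := by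
  set r := max (max (T / 2 - a) (b - T / 2)) (T / 4) with hr
  have hr1 : T / 2 - a ≤ r := (le_max_left _ _).trans (le_max_left _ _)
  have hr2 : b - T / 2 ≤ r := (le_max_right _ _).trans (le_max_left _ _)
  have hr3 : T / 4 ≤ r := le_max_right _ _
  have hr4 : r < T / 2 := by
    rw [hr]; refine max_lt (max_lt ?_ ?_) ?_ <;> linarith
  let b0 : ContDiffBump (T / 2) := ⟨r, (r + T / 2) / 2, by linarith, by linarith⟩
  refine ⟨b0, ⟨b0.contDiff, T / 2 - (r + T / 2) / 2, T / 2 + (r + T / 2) / 2, by linarith,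
    by linarith, fun t ht => ?_⟩, fun t => b0.nonneg, fun t ht => ?_⟩
  · apply b0.zero_of_le_dist
    change (r + T / 2) / 2 ≤ dist t (T / 2)
    rw [Real.dist_eq]
    by_contra hh
    push Not at hh
    rw [abs_lt] at hh
    exact ht ⟨by linarith [hh.1], by linarith [hh.2]⟩
  · apply b0.one_of_mem_closedBall
    change dist t (T / 2) ≤ r
    rw [Real.dist_eq, abs_le]
    exact ⟨by linarith [ht.1], by linarith [ht.2]⟩

theorem int_iff {θ : (Fin d → ℝ) → ℝ} (hθ : Continuous θ) (hpos : ∀ x, 0 < θ x)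
    {m M : ℝ} (hm : 0 < m) (hmθ : ∀ x, m ≤ θ x) (hM : ∀ x, θ x ≤ M)
    (g : (Fin d → ℝ) → ℝ) :
    Integrable (fun y => g y * θ y) (cubeVol d) ↔ Integrable g (cubeVol d) := by
  constructor
  · intro h
    have hinv : Continuous fun y => (θ y)⁻¹ := hθ.inv₀ fun x => (hpos x).ne'
    have := h.mul_bdd (c := m⁻¹) hinv.aestronglyMeasurable
      (Filter.Eventually.of_forall fun x => by
        rw [Real.norm_eq_abs, abs_of_pos (inv_pos.2 (hpos x))]
        exact inv_anti₀ hm (hmθ x))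
    refine this.congr (Filter.Eventually.of_forall fun x => ?_)
    change g x * θ x * (θ x)⁻¹ = g x
    have := (hpos x).ne'
    field_simp
  · intro h
    exact h.mul_bdd (c := M) hθ.aestronglyMeasurable (Filter.Eventually.of_forall fun x => by
        rw [Real.norm_eq_abs, abs_of_pos (hpos x)]
        exact hM x)

theorem k0_lower (ε : ℝ) : ∃ m, 0 < m ∧ ∀ y : Fin d → ℝ, m ≤ ker ε y := by
  obtain ⟨z, -, hz⟩ := (isCompact_Icc (a := (0 : Fin d → ℝ)) (b := 1)).exists_isMinOn
    ⟨0, by simp⟩ (ker_continuous ε).continuousOn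
  refine ⟨ker ε z, ker_pos _ _, fun y => ?_⟩
  have h1 := ker_periodic ε y (fun i => -⌊y i⌋)
  rw [← h1]
  apply hz
  refine ⟨fun i => ?_, fun i => ?_⟩
  · simp only [Pi.zero_apply, Pi.add_apply, Int.cast_neg]
    have := Int.floor_le (y i); linarith
  · simp only [Pi.one_apply, Pi.add_apply, Int.cast_neg]
    have := Int.lt_floor_add_one (y i); linarith

theorem tf_sum {T : ℝ} {χ₀ χ : ℝ → ℝ} (h₀ : IsTT T χ₀) (h : IsTT T χ) (ε₀ ε : ℝ)
    (x₀ x : Fin d → ℝ) :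
    IsTestFunction T (fun s y => χ₀ s * ker ε₀ (y - x₀) + χ s * ker ε (y - x)) where
  smooth := by
    have e1 : ContDiff ℝ (⊤ : ℕ∞) (fun z : ℝ × (Fin d → ℝ) => ker ε₀ (z.2 - x₀)) :=
      (ker_contDiff ε₀).comp (contDiff_snd.sub contDiff_const)
    have e2 : ContDiff ℝ (⊤ : ℕ∞) (fun z : ℝ × (Fin d → ℝ) => ker ε (z.2 - x)) :=
      (ker_contDiff ε).comp (contDiff_snd.sub contDiff_const)
    exact ((h₀.1.comp contDiff_fst).mul e1).add ((h.1.comp contDiff_fst).mul e2)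
  periodic := fun t y n => by
    have e1 := Per.shiftsub (ker_periodic ε₀ : Per (ker ε₀ : (Fin d → ℝ) → ℝ)) x₀ y n
    have e2 := Per.shiftsub (ker_periodic ε : Per (ker ε : (Fin d → ℝ) → ℝ)) x y n
    simp only at e1 e2 ⊢
    rw [e1, e2]
  supp := by
    obtain ⟨-, a, b, ha, hb, h⟩ := h
    obtain ⟨-, a', b', ha', hb', h'⟩ := h₀
    refine ⟨min a a', max b b', lt_min ha ha', max_lt hb hb', fun t y ht => ?_⟩
    rw [h t fun h => ht ⟨(min_le_left _ _).trans h.1, h.2.trans (le_max_left _ _)⟩,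
      h' t fun h => ht ⟨(min_le_right _ _).trans h.1, h.2.trans (le_max_right _ _)⟩]
    simp

theorem pdX_sum {χ₀ χ : ℝ → ℝ} {ε₀ ε : ℝ} (hε₀ : 0 < ε₀) (hε : 0 < ε)
    (x₀ x : Fin d → ℝ) (i : Fin d) (t : ℝ) (y : Fin d → ℝ) :
    pderivX i (fun s y => χ₀ s * ker ε₀ (y - x₀) + χ s * ker ε (y - x)) t y =
      χ₀ t * dker ε₀ i (y - x₀) + χ t * dker ε i (y - x) := by
  have key : ∀ (ε : ℝ) (hε : 0 < ε) (x : Fin d → ℝ),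
      HasFDerivAt (fun y : Fin d → ℝ => ker ε (y - x)) (fderiv ℝ (ker ε) (y - x)) y := by
    intro ε hε x
    have h1 : DifferentiableAt ℝ (ker ε) (y - x) :=
      (ker_contDiff ε).differentiable (by simp) _
    have := h1.hasFDerivAt.comp y ((hasFDerivAt_id y).sub_const x)
    rw [ContinuousLinearMap.comp_id] at this
    exact this
  unfold pderivX
  have := ((key ε₀ hε₀ x₀).const_mul (χ₀ t)).add ((key ε hε x).const_mul (χ t))
  have e := HasFDerivAt.fderiv this
  change fderiv ℝ (fun y => χ₀ t * ker ε₀ (y - x₀) + χ t * ker ε (y - x)) y = _ at e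
  rw [show (fun s y => χ₀ s * ker ε₀ (y - x₀) + χ s * ker ε (y - x)) t = fun y => χ₀ t * ker ε₀ (y - x₀) + χ t * ker ε (y - x) from rfl, e]
  simp [ker_fderiv_single hε₀, ker_fderiv_single hε]

theorem mol_meas (ε : ℝ) {f : ℝ → (Fin d → ℝ) → ℝ} (hf : Measurable (Function.uncurry f)) :
    Measurable (fun z : ℝ × (Fin d → ℝ) => mol ε (f z.1) z.2) := by
  have h : StronglyMeasurable (fun w : (ℝ × (Fin d → ℝ)) × (Fin d → ℝ) =>
      ker ε w.2 * f w.1.1 (w.1.2 + w.2)) := by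
    apply Measurable.stronglyMeasurable
    refine ((ker_continuous ε).measurable.comp measurable_snd).mul ?_
    exact hf.comp ((measurable_fst.comp measurable_fst).prodMk
      ((measurable_snd.comp measurable_fst).add measurable_snd))
  exact (h.integral_prod_right' (ν := cubeVol d)).measurable

theorem dmol_meas (ε : ℝ) (i : Fin d) {f : ℝ → (Fin d → ℝ) → ℝ}
    (hf : Measurable (Function.uncurry f)) :
    Measurable (fun z : ℝ × (Fin d → ℝ) => dmol ε i (f z.1) z.2) := by
  have h : StronglyMeasurable (fun w : (ℝ × (Fin d → ℝ)) × (Fin d → ℝ) =>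
      dker ε i (w.2 - w.1.2) * f w.1.1 w.2) := by
    apply Measurable.stronglyMeasurable
    refine ((dker_continuous ε i).measurable.comp
      (measurable_snd.sub (measurable_snd.comp measurable_fst))).mul ?_
    exact hf.comp ((measurable_fst.comp measurable_fst).prodMk measurable_snd)
  exact (h.integral_prod_right' (ν := cubeVol d)).measurable.neg

/-- for nonmeasurable functions -/
theorem lint_fin_of_nLp {α : Type*} [MeasurableSpace α] (μ : Measure α) [IsFiniteMeasure μ]
    {p : ℝ≥0∞} (hp : 1 ≤ p) {F : α → ℝ≥0∞} (h : nLp μ p F < ∞) : ∫⁻ x, F x ∂μ < ∞ := by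
  unfold nLp at h
  split_ifs at h with hpt
  · calc ∫⁻ x, F x ∂μ ≤ ∫⁻ _, essSup F μ ∂μ := lintegral_mono_ae (ae_le_essSup)
      _ < ∞ := by rw [lintegral_const]; exact ENNReal.mul_lt_top h (measure_lt_top _ _)
  · have hp1 : 1 ≤ p.toReal := by
      rw [← ENNReal.toReal_one]; exact ENNReal.toReal_mono hpt hp
    have h' : ∫⁻ x, F x ^ p.toReal ∂μ < ∞ := by
      by_contra hh
      rw [not_lt, top_le_iff] at hh
      rw [hh, ENNReal.top_rpow_of_pos (by positivity)] at h
      exact lt_irrefl _ h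
    calc ∫⁻ x, F x ∂μ ≤ ∫⁻ x, (1 + F x ^ p.toReal) ∂μ := by
          apply lintegral_mono; intro x
          rcases le_total (F x) 1 with h1 | h1
          · exact h1.trans le_self_add
          · refine le_trans ?_ le_add_self
            calc F x = F x ^ (1 : ℝ) := by simp
              _ ≤ _ := ENNReal.rpow_le_rpow_of_exponent_le h1 hp1
      _ = μ Set.univ + ∫⁻ x, F x ^ p.toReal ∂μ := by
          rw [lintegral_add_left measurable_const]; simp
      _ < ∞ := ENNReal.add_lt_top.2 ⟨measure_lt_top _ _, h'⟩

theorem one_le_div3Exp (q : ℝ) : 1 ≤ div3Exp q := by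
  unfold div3Exp
  split_ifs with h
  · exact le_top
  · push Not at h
    rw [← ENNReal.ofReal_one]
    apply ENNReal.ofReal_le_ofReal
    rw [le_div_iff₀ (by linarith)]; linarith

theorem per_version {g : (Fin d → ℝ) → ℝ} (hg : Integrable g (cubeVol d)) :
    ∃ g', PI g' ∧ g' =ᵐ[cubeVol d] g := by
  have hsm := hg.aestronglyMeasurable
  have hfm : Measurable (fun x : Fin d → ℝ => fun i => Int.fract (x i)) :=
    measurable_pi_lambda _ fun i => measurable_fract.comp (measurable_pi_apply i)
  have hae : (fun x : Fin d → ℝ => hsm.mk g (fun i => Int.fract (x i))) =ᵐ[cubeVol d] g := by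
    have h1 : ∀ᵐ x ∂(cubeVol d), x ∈ unitCube d := ae_restrict_mem (meas_unitCube d)
    filter_upwards [h1, hsm.ae_eq_mk] with x hx hx2
    rw [hx2]
    congr 1
    ext i
    have := hx i trivial
    exact Int.fract_eq_self.2 ⟨this.1, this.2⟩
  refine ⟨_, ⟨hsm.stronglyMeasurable_mk.measurable.comp hfm, fun x n => ?_,
    (integrable_congr hae).2 hg⟩, hae⟩
  simp

theorem ell_bound {ρ : ℝ → (Fin d → ℝ) → ℝ}
    (hPI : ∀ t, PI (ρ t)) {K : ℝ} (hK : ∀ t, ∫ x, |ρ t x| ∂(cubeVol d) ≤ K) (i : Fin d)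
    {ε : ℝ} (hε : 0 < ε) (x : Fin d → ℝ) (t : ℝ) :
    |dmol ε i (ρ t) x| ≤ 2 * Real.pi / ε * (((kN ε)⁻¹) ^ d * K) := by
  refine (dmol_bdd hε i (hPI t) x).trans ?_
  have := (kN_pos ε)
  have := Real.pi_pos
  have := hK t
  gcongr

theorem ell_int {T : ℝ} {ρ : ℝ → (Fin d → ℝ) → ℝ} (hρ : Measurable (Function.uncurry ρ))
    (hPI : ∀ t, PI (ρ t)) {K : ℝ} (hK : ∀ t, ∫ x, |ρ t x| ∂(cubeVol d) ≤ K) (i : Fin d)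
    {ε : ℝ} (hε : 0 < ε) (x : Fin d → ℝ) :
    IntegrableOn (fun t => dmol ε i (ρ t) x) (Set.Ioo 0 T) :=
  Measure.integrableOn_of_bounded (M := 2 * Real.pi / ε * (((kN ε)⁻¹) ^ d * K)) (by simp)
    ((dmol_meas ε i hρ).comp (measurable_id.prodMk measurable_const)).aestronglyMeasurable
    (Filter.Eventually.of_forall fun t => ell_bound hPI hK i hε x t)

theorem tt_mul_int {T : ℝ} {χ f : ℝ → ℝ} (hχ : IsTT T χ) (hf : IntegrableOn f (Set.Ioo 0 T)) :
    IntegrableOn (fun t => χ t * f t) (Set.Ioo 0 T) := by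
  obtain ⟨B, -, hB⟩ := hχ.bound
  exact hf.bdd_mul hχ.cont.aestronglyMeasurable (c := B) (Filter.Eventually.of_forall hB)

theorem gk_undef {g : (Fin d → ℝ) → ℝ} (hg : ¬ Integrable g (cubeVol d)) (ε : ℝ)
    (x : Fin d → ℝ) : ∫ y, g y * ker ε (y - x) ∂(cubeVol d) = 0 := by
  apply integral_undef
  obtain ⟨m, hm, hm'⟩ := k0_lower (d := d) ε
  have ck : Continuous fun y : Fin d → ℝ => ker ε (y - x) :=
    (ker_continuous ε).comp (continuous_id.sub continuous_const)
  rwa [int_iff ck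
    (fun y => ker_pos ε _) hm (fun y => hm' _) (fun y => ker_le ε _)]

/-- test identity with two bumps -/
theorem test2 {T : ℝ} {ρ g : ℝ → (Fin d → ℝ) → ℝ} (hρ : Measurable (Function.uncurry ρ))
    (hPI : ∀ t, PI (ρ t)) {K : ℝ} (hK : ∀ t, ∫ x, |ρ t x| ∂(cubeVol d) ≤ K) {i : Fin d}
    (hw : HasWeakDerivX T i ρ g) {χ₀ χ : ℝ → ℝ} (h₀ : IsTT T χ₀) (h : IsTT T χ)
    (hp₀ : ∀ t, 0 ≤ χ₀ t) (hp : ∀ t, 0 ≤ χ t) {ε₀ ε : ℝ} (hε₀ : 0 < ε₀) (hε : 0 < ε)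
    (x₀ x : Fin d → ℝ) :
    (∫ t in Set.Ioo 0 T, χ₀ t * dmol ε₀ i (ρ t) x₀) + (∫ t in Set.Ioo 0 T, χ t * dmol ε i (ρ t) x) =
    ∫ t in Set.Ioo 0 T, (χ₀ t * (∫ y, g t y * ker ε₀ (y - x₀) ∂(cubeVol d))
      + χ t * ∫ y, g t y * ker ε (y - x) ∂(cubeVol d)) := by
  have hh := hw _ (tf_sum h₀ h ε₀ ε x₀ x)
  simp only [pdX_sum hε₀ hε] at hh
  rw [← integral_add (tt_mul_int h₀ (ell_int hρ hPI hK i hε₀ x₀))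
    (tt_mul_int h (ell_int hρ hPI hK i hε x))]
  have e1 : ∀ t, ∫ y in unitCube d, ρ t y * (χ₀ t * dker ε₀ i (y - x₀) + χ t * dker ε i (y - x)) =
      -(χ₀ t * dmol ε₀ i (ρ t) x₀ + χ t * dmol ε i (ρ t) x) := by
    intro t
    change ∫ y, _ ∂(cubeVol d) = _
    have e : (fun y => ρ t y * (χ₀ t * dker ε₀ i (y - x₀) + χ t * dker ε i (y - x))) =
      fun y => χ₀ t * (dker ε₀ i (y - x₀) * ρ t y) + χ t * (dker ε i (y - x) * ρ t y) := by
      ext y; ring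
    rw [e, integral_add ((dkf_int' hε₀ i (hPI t) x₀).const_mul _)
      ((dkf_int' hε i (hPI t) x).const_mul _), integral_const_mul, integral_const_mul]
    unfold dmol
    ring
  have e2 : ∀ t, ∫ y in unitCube d, g t y * (χ₀ t * ker ε₀ (y - x₀) + χ t * ker ε (y - x)) =
      (χ₀ t * (∫ y, g t y * ker ε₀ (y - x₀) ∂(cubeVol d))
      + χ t * ∫ y, g t y * ker ε (y - x) ∂(cubeVol d)) := by
    intro t
    change ∫ y, _ ∂(cubeVol d) = _
    obtain ⟨m, hm, hm'⟩ := k0_lower (d := d) ε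
    obtain ⟨m₀, hm₀, hm₀'⟩ := k0_lower (d := d) ε₀
    have ck : Continuous fun y : Fin d → ℝ => ker ε (y - x) :=
      (ker_continuous ε).comp (continuous_id.sub continuous_const)
    have ck₀ : Continuous fun y : Fin d → ℝ => ker ε₀ (y - x₀) :=
      (ker_continuous ε₀).comp (continuous_id.sub continuous_const)
    by_cases hg : Integrable (g t) (cubeVol d)
    · have i1 := (int_iff ck (fun y => ker_pos ε _) hm (fun y => hm' _) (fun y => ker_le ε _) (g t)).2 hg
      have i2 := (int_iff ck₀ (fun y => ker_pos ε₀ _) hm₀ (fun y => hm₀' _)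
        (fun y => ker_le ε₀ _) (g t)).2 hg
      rw [← integral_const_mul, ← integral_const_mul, ← integral_add (i2.const_mul _) (i1.const_mul _)]
      congr 1; ext y; ring
    · rw [gk_undef hg, gk_undef hg]
      simp only [mul_zero, add_zero]
      by_cases hz : χ₀ t + χ t = 0
      · have z1 : χ₀ t = 0 := by linarith [hp₀ t, hp t]
        have z2 : χ t = 0 := by linarith [hp₀ t, hp t]
        simp [z1, z2]
      · have hpos : 0 < χ₀ t + χ t := lt_of_le_of_ne (by linarith [hp₀ t, hp t]) (Ne.symm hz)
        apply integral_undef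
        have hlow : ∀ y : Fin d → ℝ, (χ₀ t + χ t) * min m m₀ ≤
            χ₀ t * ker ε₀ (y - x₀) + χ t * ker ε (y - x) := by
          intro y
          rw [add_mul]
          exact add_le_add (mul_le_mul_of_nonneg_left ((min_le_right _ _).trans (hm₀' _)) (hp₀ t))
            (mul_le_mul_of_nonneg_left ((min_le_left _ _).trans (hm' _)) (hp t))
        have hmm : 0 < (χ₀ t + χ t) * min m m₀ := mul_pos hpos (lt_min hm hm₀)
        rwa [int_iff (by fun_prop) (fun y => hmm.trans_le (hlow y)) hmm hlow
          (M := χ₀ t * ((kN ε₀)⁻¹) ^ d + χ t * ((kN ε)⁻¹) ^ d)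
          (fun y => add_le_add (mul_le_mul_of_nonneg_left (ker_le _ _) (hp₀ t))
            (mul_le_mul_of_nonneg_left (ker_le _ _) (hp t)))]
  simp only [e1, e2, integral_neg] at hh
  linarith

theorem isTT_zero {T : ℝ} (hT : 0 < T) : IsTT T (fun _ => 0) :=
  ⟨contDiff_const, T / 2, T / 2, by linarith, by linarith, fun _ _ => rfl⟩

theorem test1 {T : ℝ} {ρ g : ℝ → (Fin d → ℝ) → ℝ} (hρ : Measurable (Function.uncurry ρ))
    (hPI : ∀ t, PI (ρ t)) {K : ℝ} (hK : ∀ t, ∫ x, |ρ t x| ∂(cubeVol d) ≤ K) {i : Fin d}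
    (hw : HasWeakDerivX T i ρ g) (hT : 0 < T) {χ : ℝ → ℝ} (h : IsTT T χ)
    (hp : ∀ t, 0 ≤ χ t) {ε : ℝ} (hε : 0 < ε) (x : Fin d → ℝ) :
    (∫ t in Set.Ioo 0 T, χ t * dmol ε i (ρ t) x) =
    ∫ t in Set.Ioo 0 T, χ t * ∫ y, g t y * ker ε (y - x) ∂(cubeVol d) := by
  have := test2 hρ hPI hK hw (isTT_zero hT) h (fun _ => le_rfl) hp hε hε x x
  simpa using this

/-- fundamental lemma with nonnegative test functions -/
theorem fund_lemma {T : ℝ} (hT : 0 < T) {f : ℝ → ℝ}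
    (hf : ∀ χ, IsTT T χ → (∀ t, 0 ≤ χ t) → IntegrableOn (fun t => χ t * f t) (Set.Ioo 0 T))
    (h : ∀ χ, IsTT T χ → (∀ t, 0 ≤ χ t) → ∫ t in Set.Ioo 0 T, χ t * f t = 0) :
    ∀ᵐ t ∂(volume.restrict (Set.Ioo 0 T)), f t = 0 := by
  have hli : LocallyIntegrableOn f (Set.Ioo 0 T) := by
    rw [locallyIntegrableOn_iff isOpen_Ioo.isLocallyClosed]
    intro k hk hkc
    by_cases hne : k.Nonempty
    · obtain ⟨χ, hχ, hχ0, hχ1⟩ := cutoff hT (hk (hkc.sInf_mem hne)).1 (hk (hkc.sSup_mem hne)).2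
      refine ((hf χ hχ hχ0).mono_set hk).congr_fun (fun t ht => ?_) hkc.measurableSet
      change χ t * f t = f t
      rw [hχ1 t ⟨csInf_le hkc.bddBelow ht, le_csSup hkc.bddAbove ht⟩, one_mul]
    · rw [Set.not_nonempty_iff_eq_empty.1 hne]; simp
  have hz := IsOpen.ae_eq_zero_of_integral_contDiff_smul_eq_zero (E := ℝ) (μ := volume)
    isOpen_Ioo hli (by
    intro g hg hgc hgs
    have hgT := isTT_of_tsupport hT hg hgc hgs
    rw [← setIntegral_eq_integral_of_forall_compl_eq_zero (s := Set.Ioo 0 T)]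
    swap
    · intro t ht
      rw [hgT.zero, zero_smul]
      simp only [Set.mem_Ioo, not_and_or, not_lt] at ht
      exact ht
    obtain ⟨a, b, ha, hb, hab⟩ := hgT.2
    obtain ⟨η, hη, hη0, hη1⟩ := cutoff hT ha hb
    obtain ⟨C, hC0, hC⟩ := hgT.bound
    have hs : IsTT T (fun t => g t + C * η t) := hgT.add (hη.smul C)
    have hs0 : ∀ t, 0 ≤ g t + C * η t := by
      intro t
      by_cases ht : t ∈ Set.Icc a b
      · rw [hη1 t ht]; have := neg_le_of_abs_le (hC t); linarith
      · rw [hab t ht]; have := hη0 t; positivity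
    have e : ∀ t, g t • f t = (g t + C * η t) * f t - C * (η t * f t) := by
      intro t; rw [smul_eq_mul]; ring
    simp_rw [e]
    rw [integral_sub (hf _ hs hs0) ((hf _ hη hη0).const_mul C), integral_const_mul, h _ hs hs0,
      h _ hη hη0]
    simp)
  rw [ae_restrict_iff' measurableSet_Ioo]
  exact hz

theorem grad_slice {T : ℝ} (hT : 0 < T) {ρ g : ℝ → (Fin d → ℝ) → ℝ}
    (hρ : Measurable (Function.uncurry ρ))
    (hPI : ∀ t, PI (ρ t)) {K : ℝ} (hK : ∀ t, ∫ x, |ρ t x| ∂(cubeVol d) ≤ K) {i : Fin d}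
    (hw : HasWeakDerivX T i ρ g) :
    ∃ g' : ℝ → (Fin d → ℝ) → ℝ, (∀ t, PI (g' t)) ∧
      (∀ t, ∀ᵐ x ∂(cubeVol d), ‖g' t x‖ₑ ≤ ‖g t x‖ₑ) ∧
      ∀ᵐ t ∂(volume.restrict (Set.Ioo 0 T)), ∀ n x,
        dmol (ep n) i (ρ t) x = mol (ep n) (g' t) x := by
  classical
  have dense : ∀ g' : ℝ → (Fin d → ℝ) → ℝ, (∀ t, PI (g' t)) →
      (∀ n x, ∀ᵐ t ∂(volume.restrict (Set.Ioo 0 T)),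
        dmol (ep n) i (ρ t) x = mol (ep n) (g' t) x) →
      ∀ᵐ t ∂(volume.restrict (Set.Ioo 0 T)), ∀ n x,
        dmol (ep n) i (ρ t) x = mol (ep n) (g' t) x := by
    intro g' hg' h
    have : ∀ᵐ t ∂(volume.restrict (Set.Ioo 0 T)), ∀ n k,
        dmol (ep n) i (ρ t) (TopologicalSpace.denseSeq (Fin d → ℝ) k)
          = mol (ep n) (g' t) (TopologicalSpace.denseSeq (Fin d → ℝ) k) := by
      rw [ae_all_iff]; intro n
      rw [ae_all_iff]; intro k
      exact h n _
    filter_upwards [this] with t ht n x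
    refine congrFun (Continuous.ext_on (TopologicalSpace.denseRange_denseSeq (Fin d → ℝ))
      (dmol_continuous (ep_pos n) i (hPI t)) (mol_continuous (ep n) (hg' t)) ?_) x
    rintro _ ⟨k, rfl⟩
    exact ht n k
  set h : ℕ → (Fin d → ℝ) → ℝ → ℝ := fun n x t => ∫ y, g t y * ker (ep n) (y - x) ∂(cubeVol d)
    with hh
  by_cases hA : ∀ χ, IsTT T χ → (∀ t, 0 ≤ χ t) → ∀ n x,
      IntegrableOn (fun t => χ t * h n x t) (Set.Ioo 0 T)
  · choose! gp hgp using fun t (ht : Integrable (g t) (cubeVol d)) => per_version ht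
    let g' : ℝ → (Fin d → ℝ) → ℝ := fun t => if Integrable (g t) (cubeVol d) then gp t else fun _ => 0
    have hg' : ∀ t, PI (g' t) := by
      intro t
      by_cases ht : Integrable (g t) (cubeVol d)
      · simp only [g', if_pos ht]; exact (hgp t ht).1
      · simp only [g', if_neg ht]; exact PI_const 0
    refine ⟨g', hg', fun t => ?_, dense g' hg' fun n x => ?_⟩
    · by_cases ht : Integrable (g t) (cubeVol d)
      · simp only [g', if_pos ht]
        filter_upwards [(hgp t ht).2] with x hx
        rw [hx]
      · simp [g', if_neg ht]
    have hz := fund_lemma hT (f := fun t => dmol (ep n) i (ρ t) x - h n x t) (by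
      intro χ hχ hχ0
      have := (tt_mul_int hχ (ell_int hρ hPI hK i (ep_pos n) x)).sub (hA χ hχ hχ0 n x)
      refine this.congr (Filter.Eventually.of_forall fun t => ?_)
      simp only [Pi.sub_apply]; ring) (by
      intro χ hχ hχ0
      have e : ∀ t, χ t * (dmol (ep n) i (ρ t) x - h n x t) =
        χ t * dmol (ep n) i (ρ t) x - χ t * h n x t := fun t => by ring
      simp_rw [e]
      rw [integral_sub (tt_mul_int hχ (ell_int hρ hPI hK i (ep_pos n) x)) (hA χ hχ hχ0 n x),
        test1 hρ hPI hK hw hT hχ hχ0 (ep_pos n) x]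
      simp [hh])
    filter_upwards [hz] with t ht
    rw [sub_eq_zero.1 ht, mol_eq _ (hg' t).per]
    by_cases hi : Integrable (g t) (cubeVol d)
    · simp only [g', if_pos hi, hh]
      apply integral_congr_ae
      filter_upwards [(hgp t hi).2] with y hy
      rw [hy]; ring
    · simp only [g', if_neg hi, hh]
      rw [gk_undef hi]; simp
  · push Not at hA
    obtain ⟨χ₀, hχ₀, hχ₀0, n₀, x₀, hno⟩ := hA
    refine ⟨fun _ _ => 0, fun t => PI_const 0, fun t => by simp, dense _ (fun t => PI_const 0)
      fun n x => ?_⟩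
    have hz := fund_lemma hT (f := fun t => dmol (ep n) i (ρ t) x) (by
      intro χ hχ hχ0
      exact (tt_mul_int hχ (ell_int hρ hPI hK i (ep_pos n) x))) (by
      intro χ hχ hχ0
      by_cases hi : IntegrableOn (fun t => χ t * h n x t) (Set.Ioo 0 T)
      · have h2 := test2 hρ hPI hK hw hχ₀ hχ hχ₀0 hχ0 (ep_pos n₀) (ep_pos n) x₀ x
        have h1 := test1 hρ hPI hK hw hT hχ₀ hχ₀0 (ep_pos n₀) x₀
        have u1 : ∫ t in Set.Ioo 0 T, χ₀ t * h n₀ x₀ t = 0 := integral_undef hno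
        have u2 : ∫ t in Set.Ioo 0 T, (χ₀ t * h n₀ x₀ t + χ t * h n x t) = 0 := by
          apply integral_undef
          intro hs
          apply hno
          refine (hs.sub hi).congr (Filter.Eventually.of_forall fun t => ?_)
          simp
        simp only [hh] at u1 u2
        rw [u1] at h1
        rw [u2] at h2
        linarith
      · rw [test1 hρ hPI hK hw hT hχ hχ0 (ep_pos n) x]
        exact integral_undef hi)
    filter_upwards [hz] with t ht
    rw [ht, mol_const]

open Classical in
/-- limit of a sequence, `0` if there is none -/
def seqLim (s : ℕ → ℝ) : ℝ :=
  if h : ∃ c, Filter.Tendsto s Filter.atTop (nhds c) then h.choose else 0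

theorem seqLim_spec {s : ℕ → ℝ} (h : ∃ c, Filter.Tendsto s Filter.atTop (nhds c)) :
    Filter.Tendsto s Filter.atTop (nhds (seqLim s)) := by
  unfold seqLim; rw [dif_pos h]; exact h.choose_spec

theorem seqLim_meas {α : Type*} [MeasurableSpace α] {F : ℕ → α → ℝ} (hF : ∀ k, Measurable (F k)) :
    Measurable (fun z => seqLim (fun k => F k z)) := by
  have hS : MeasurableSet {z | ∃ c, Filter.Tendsto (fun k => F k z) Filter.atTop (nhds c)} :=
    MeasureTheory.measurableSet_exists_tendsto hF
  refine measurable_of_tendsto_metrizable (fun k => (hF k).indicator hS) ?_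
  rw [tendsto_pi_nhds]
  intro z
  by_cases hz : ∃ c, Filter.Tendsto (fun k => F k z) Filter.atTop (nhds c)
  · have : ∀ k, Set.indicator {z | ∃ c, Filter.Tendsto (fun k => F k z) Filter.atTop (nhds c)}
      (F k) z = F k z := fun k => Set.indicator_of_mem (by exact hz) _
    simp_rw [this]
    exact seqLim_spec hz
  · have : ∀ k, Set.indicator {z | ∃ c, Filter.Tendsto (fun k => F k z) Filter.atTop (nhds c)}
      (F k) z = 0 := fun k => Set.indicator_of_notMem (by exact hz) _
    simp_rw [this]
    unfold seqLim; rw [dif_neg hz]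
    exact tendsto_const_nhds

theorem mol_congr_ae (ε : ℝ) {f g : (Fin d → ℝ) → ℝ} (hf : Per f) (hg : Per g)
    (h : f =ᵐ[cubeVol d] g) (x : Fin d → ℝ) : mol ε f x = mol ε g x := by
  rw [mol_eq ε hf, mol_eq ε hg]
  apply integral_congr_ae
  filter_upwards [h] with y hy
  rw [hy]

theorem l1_ae_lim {α : Type*} [MeasurableSpace α] {μ : Measure α} {F : ℕ → α → ℝ} {f g : α → ℝ}
    (hF : ∀ k, Measurable (F k)) (hg : Measurable g)
    (h1 : ∀ᵐ x ∂μ, Filter.Tendsto (fun k => F k x) Filter.atTop (nhds (f x)))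
    (h2 : Filter.Tendsto (fun k => ∫⁻ x, ‖F k x - g x‖ₑ ∂μ) Filter.atTop (nhds 0)) :
    f =ᵐ[μ] g := by
  have hm : ∀ k, Measurable (fun x => ‖F k x - g x‖ₑ) := fun k => ((hF k).sub hg).enorm
  have h3 : ∀ᵐ x ∂μ, Filter.liminf (fun k => ‖F k x - g x‖ₑ) Filter.atTop = 
      ‖f x - g x‖ₑ := by
    filter_upwards [h1] with x hx
    exact ((hx.sub_const (g x)).enorm).liminf_eq
  have h4 : ∫⁻ x, Filter.liminf (fun k => ‖F k x - g x‖ₑ) Filter.atTop ∂μ = 0 := by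
    refine le_antisymm ?_ zero_le
    refine (lintegral_liminf_le hm).trans ?_
    rw [h2.liminf_eq]
  rw [lintegral_eq_zero_iff (.liminf hm)] at h4
  filter_upwards [h3, h4] with x hx hx4
  rw [hx4] at hx
  simpa [sub_eq_zero] using hx.symm

theorem meas_grad {T : ℝ} (hT : 0 < T) {ρ g : ℝ → (Fin d → ℝ) → ℝ}
    (hρ : Measurable (Function.uncurry ρ))
    (hPI : ∀ t, PI (ρ t)) {K : ℝ} (hK : ∀ t, ∫ x, |ρ t x| ∂(cubeVol d) ≤ K) {i : Fin d}
    (hw : HasWeakDerivX T i ρ g) {q : ℝ} (hq : 3 ≤ q)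
    (hfin : ∫⁻ t in Set.Ioo 0 T, nLp (cubeVol d) (div3Exp q) (fun x => ‖g t x‖ₑ) < ∞) :
    ∃ G : ℝ → (Fin d → ℝ) → ℝ, Measurable (Function.uncurry G) ∧ (∀ t, Per (G t)) ∧
      ∀ᵐ t ∂(volume.restrict (Set.Ioo 0 T)), PI (G t) ∧
        (∀ n x, dmol (ep n) i (ρ t) x = mol (ep n) (G t) x) ∧
        ∀ᵐ x ∂(cubeVol d), ‖G t x‖ₑ ≤ ‖g t x‖ₑ := by
  obtain ⟨g', hg'PI, hg'le, hg'⟩ := grad_slice hT hρ hPI hK hw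
  set f : ℕ → ℝ × (Fin d → ℝ) → ℝ := fun n z => dmol (ep n) i (ρ z.1) z.2 with hf
  have hfm : ∀ n, Measurable (f n) := fun n => dmol_meas (ep n) i hρ
  set D : ℕ → ℕ → ℝ → ℝ≥0∞ := fun n m t => ∫⁻ x, ‖f n (t, x) - f m (t, x)‖ₑ ∂(cubeVol d) with hD
  have hDm : ∀ n m, Measurable (D n m) := fun n m =>
    Measurable.lintegral_prod_right' (f := fun z => ‖f n z - f m z‖ₑ) ((hfm n).sub (hfm m)).enorm
  set N : ℕ → ℝ → ℝ≥0∞ := fun n t => ⨆ m, ⨆ k, D (n + m) (n + k) t with hN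
  have hNm : ∀ n, Measurable (N n) := fun n =>
    Measurable.iSup fun m => Measurable.iSup fun k => hDm _ _
  have hmolm : ∀ n t, Measurable (mol (ep n) (g' t)) := fun n t => (mol_PI _ (hg'PI t)).meas
  -- pointwise bounds
  have hN0 : ∀ᵐ t ∂(volume.restrict (Set.Ioo 0 T)),
      N 0 t ≤ 2 * nLp (cubeVol d) (div3Exp q) (fun x => ‖g t x‖ₑ) := by
    filter_upwards [hg'] with t ht
    refine iSup_le fun m => iSup_le fun k => ?_
    have hb : ∫⁻ x, ‖g' t x‖ₑ ∂(cubeVol d) ≤ nLp (cubeVol d) (div3Exp q) (fun x => ‖g t x‖ₑ) :=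
      (holder_10 _ (hg'PI t).meas.enorm.aemeasurable q hq).trans (nLp_mono_ae _ _ (hg'le t))
    calc D (0 + m) (0 + k) t ≤ ∫⁻ x, (‖mol (ep (0+m)) (g' t) x‖ₑ + ‖mol (ep (0+k)) (g' t) x‖ₑ) ∂(cubeVol d) := by
          apply lintegral_mono; intro x
          simp only [hf, ht]
          exact enorm_sub_le
      _ = (∫⁻ x, ‖mol (ep (0+m)) (g' t) x‖ₑ ∂(cubeVol d)) + ∫⁻ x, ‖mol (ep (0+k)) (g' t) x‖ₑ ∂(cubeVol d) :=
          lintegral_add_left (hmolm _ _).enorm _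
      _ ≤ _ := by
          rw [two_mul]
          exact add_le_add ((mol_L1 _ (hg'PI t).meas (hg'PI t).per).trans hb)
            ((mol_L1 _ (hg'PI t).meas (hg'PI t).per).trans hb)
  have hlim : ∀ᵐ t ∂(volume.restrict (Set.Ioo 0 T)),
      Filter.Tendsto (fun n => N n t) Filter.atTop (nhds 0) := by
    filter_upwards [hg'] with t ht
    have h1 := mol_tendsto (hg'PI t)
    rw [ENNReal.tendsto_nhds_zero] at h1 ⊢
    intro δ hδ
    have hδ2 : 0 < δ / 2 := ENNReal.half_pos hδ.ne'
    obtain ⟨n0, hn0⟩ := Filter.eventually_atTop.1 (h1 _ hδ2)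
    refine Filter.eventually_atTop.2 ⟨n0, fun n hn => iSup_le fun m => iSup_le fun k => ?_⟩
    calc D (n + m) (n + k) t ≤ ∫⁻ x, (‖mol (ep (n+m)) (g' t) x - g' t x‖ₑ
            + ‖mol (ep (n+k)) (g' t) x - g' t x‖ₑ) ∂(cubeVol d) := by
          apply lintegral_mono; intro x
          simp only [hf, ht]
          have : mol (ep (n+m)) (g' t) x - mol (ep (n+k)) (g' t) x =
            (mol (ep (n+m)) (g' t) x - g' t x) - (mol (ep (n+k)) (g' t) x - g' t x) := by ring
          rw [this]
          exact enorm_sub_le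
      _ = (∫⁻ x, ‖mol (ep (n+m)) (g' t) x - g' t x‖ₑ ∂(cubeVol d))
            + ∫⁻ x, ‖mol (ep (n+k)) (g' t) x - g' t x‖ₑ ∂(cubeVol d) :=
          lintegral_add_left ((hmolm _ _).sub (hg'PI t).meas).enorm _
      _ ≤ δ / 2 + δ / 2 := add_le_add (hn0 _ (by omega)) (hn0 _ (by omega))
      _ = δ := ENNReal.add_halves δ
  have hanti : ∀ n t, N n t ≤ N 0 t := by
    intro n t
    refine iSup_le fun m => iSup_le fun k => ?_
    have := le_iSup_of_le (f := fun m => ⨆ k, D (0 + m) (0 + k) t) (n + m)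
      (le_iSup (fun k => D (0 + (n + m)) (0 + k) t) (n + k))
    simpa [hN] using this
  have hNint : Filter.Tendsto (fun n => ∫⁻ t in Set.Ioo 0 T, N n t) Filter.atTop (nhds 0) := by
    have := tendsto_lintegral_of_dominated_convergence (μ := volume.restrict (Set.Ioo 0 T))
      (F := N) (f := fun _ => 0) (N 0) hNm (fun n => Filter.Eventually.of_forall (hanti n)) (by
      refine ((lintegral_mono_ae hN0).trans_lt ?_).ne
      rw [lintegral_const_mul' _ _ (by simp)]
      exact ENNReal.mul_lt_top (by simp) hfin) hlim
    simpa using this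
  obtain ⟨φ, hφ, hφN⟩ := Filter.extraction_forall_of_eventually
    (P := fun k n => ∫⁻ t in Set.Ioo 0 T, N n t < (2⁻¹ : ℝ≥0∞) ^ k) (fun k => by
      have : (0 : ℝ≥0∞) < (2⁻¹) ^ k := ENNReal.pow_pos (by simp) k
      exact hNint.eventually (gt_mem_nhds this))
  have hcau := Lp.ae_tendsto_of_cauchy_eLpNorm (μ := (volume.restrict (Set.Ioo 0 T)).prod (cubeVol d))
    (p := 1) (f := fun k => f (φ k)) (fun k => (hfm _).aestronglyMeasurable) le_rfl
    (B := fun k => (2⁻¹ : ℝ≥0∞) ^ k) (by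
      rw [ENNReal.tsum_geometric, ENNReal.one_sub_inv_two, inv_inv]; simp) (by
      intro M n m hn hm
      refine lt_of_le_of_lt ?_ (hφN M)
      rw [eLpNorm_one_eq_lintegral_enorm, lintegral_prod _ (by
        exact ((hfm _).sub (hfm _)).enorm.aemeasurable)]
      apply lintegral_mono; intro t
      have hn' := hφ.monotone hn
      have hm' := hφ.monotone hm
      have := le_iSup_of_le (f := fun m => ⨆ k, D (φ M + m) (φ M + k) t) (φ n - φ M)
        (le_iSup (fun k => D (φ M + (φ n - φ M)) (φ M + k) t) (φ m - φ M))
      rw [Nat.add_sub_cancel' hn', Nat.add_sub_cancel' hm'] at this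
      exact this)
  have hcau2 := Measure.ae_ae_of_ae_prod hcau
  refine ⟨fun t x => seqLim (fun k => f (φ k) (t, x)), seqLim_meas (fun k => hfm _), ?_, ?_⟩
  · intro t x n
    change seqLim _ = seqLim _
    congr 1
    ext k
    exact dmol_per _ _ (hPI t).per x n
  · filter_upwards [hg', hcau2] with t ht htc
    have hPer : Per (fun x => seqLim (fun k => f (φ k) (t, x))) := by
      intro x n
      change seqLim _ = seqLim _
      congr 1
      ext k
      exact dmol_per _ _ (hPI t).per x n
    have hms : Measurable (fun x => seqLim (fun k => f (φ k) (t, x))) :=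
      (seqLim_meas (fun k => hfm (φ k))).comp (measurable_const.prodMk measurable_id)
    have hae : (fun x => seqLim (fun k => f (φ k) (t, x))) =ᵐ[cubeVol d] g' t := by
      refine l1_ae_lim (F := fun k x => f (φ k) (t, x))
        (fun k => (hfm (φ k)).comp (measurable_const.prodMk measurable_id)) (hg'PI t).meas ?_ ?_
      · filter_upwards [htc] with x hx
        exact seqLim_spec hx
      · have := (mol_tendsto (hg'PI t)).comp hφ.tendsto_atTop
        simp only [hf, ht]
        exact this
    refine ⟨⟨hms, hPer, (integrable_congr hae).2 (hg'PI t).int⟩, fun n x => ?_, ?_⟩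
    · rw [ht, mol_congr_ae (ep n) hPer (hg'PI t).per hae]
    · filter_upwards [hae, hg'le t] with x hx hx2
      rw [hx]; exact hx2

theorem essSup_meas {α β : Type*} [MeasurableSpace α] [MeasurableSpace β] (μ : Measure β)
    [SFinite μ] {F : α → β → ℝ≥0∞} (hF : Measurable (Function.uncurry F)) :
    Measurable (fun t => essSup (F t) μ) := by
  apply measurable_of_Ioi
  intro a
  have hset : MeasurableSet {z : α × β | a < Function.uncurry F z} := hF measurableSet_Ioi
  have h := measurable_measure_prodMk_left (ν := μ) hset
  have e : (fun t => essSup (F t) μ) ⁻¹' Set.Ioi a =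
      (fun x => μ (Prod.mk x ⁻¹' {z : α × β | a < Function.uncurry F z})) ⁻¹' Set.Ioi 0 := by
    ext t
    simp only [Set.mem_preimage, Set.mem_Ioi]
    constructor
    · intro ht
      by_contra hh
      have h0 := le_antisymm (not_lt.1 hh) zero_le
      refine absurd ht (not_lt.2 (essSup_le_of_ae_le a ?_))
      change ∀ᵐ x ∂μ, F t x ≤ a
      rw [ae_iff]
      simpa [not_le] using h0
    · intro ht
      by_contra hh
      push Not at hh
      have : ∀ᵐ x ∂μ, F t x ≤ a := by
        filter_upwards [ENNReal.ae_le_essSup (F t)] with x hx using hx.trans hh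
      rw [ae_iff] at this
      simp only [not_le] at this
      exact ht.ne' this
  rw [e]
  exact h measurableSet_Ioi

theorem nLp_meas {α β : Type*} [MeasurableSpace α] [MeasurableSpace β] (μ : Measure β)
    [SFinite μ] (p : ℝ≥0∞) {F : α → β → ℝ≥0∞} (hF : Measurable (Function.uncurry F)) :
    Measurable (fun t => nLp μ p (F t)) := by
  unfold nLp
  split_ifs
  · exact essSup_meas μ hF
  · exact (Measurable.lintegral_prod_right' (f := fun z : α × β => F z.1 z.2 ^ p.toReal)
      (hF.pow_const _)).pow_const _

theorem per_bdd {f : (Fin d → ℝ) → ℝ} (hf : Continuous f) (hp : Per f) :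
    ∃ C, 0 ≤ C ∧ ∀ x, |f x| ≤ C := by
  obtain ⟨C, hC⟩ := (isCompact_Icc (a := (0 : Fin d → ℝ)) (b := 1)).exists_bound_of_continuousOn
    hf.continuousOn
  have h : ∀ x, |f x| ≤ C := by
    intro y
    have h1 := hp y (fun i => -⌊y i⌋)
    rw [← h1]
    apply hC
    refine ⟨fun i => ?_, fun i => ?_⟩
    · simp only [Pi.zero_apply, Pi.add_apply, Int.cast_neg]
      have := Int.floor_le (y i); linarith
    · simp only [Pi.one_apply, Pi.add_apply, Int.cast_neg]
      have := Int.lt_floor_add_one (y i); linarith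
  exact ⟨C, (abs_nonneg _).trans (h 0), h⟩

theorem nLp_shift {q : ℝ} {w : (Fin d → ℝ) → ℝ≥0∞} (hw : Per w) (y : Fin d → ℝ) :
    nLp (cubeVol d) (ENNReal.ofReal q) (fun x => w (x + y)) =
      nLp (cubeVol d) (ENNReal.ofReal q) w := by
  unfold nLp
  simp only [ENNReal.ofReal_ne_top, if_false]
  rw [lint_shift (f := fun x => w x ^ (ENNReal.ofReal q).toReal) (hw.comp (fun a => a ^ (ENNReal.ofReal q).toReal)) y]

theorem hs3 {q : ℝ} (hq : 3 ≤ q) {f w : (Fin d → ℝ) → ℝ≥0∞} (hf : Measurable f) (hfp : Per f)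
    (hw : Measurable w) (hwp : Per w) (y : Fin d → ℝ) :
    ∫⁻ x, f (x + y) * w x ^ (3 : ℝ) ∂(cubeVol d) ≤
      nLp (cubeVol d) (div3Exp q) f * nLp (cubeVol d) (ENNReal.ofReal q) w ^ (3 : ℝ) := by
  have h := lint_shift (f := fun x => f x * w (x + -y) ^ (3 : ℝ))
    (hfp.comp2 (hwp.shift (-y)) (fun a b => a * b ^ (3 : ℝ))) y
  simp only [add_neg_cancel_right] at h
  rw [h, ← nLp_shift hwp (-y)]
  exact holder_31 _ hf.aemeasurable (hw.comp (measurable_id.add_const _)).aemeasurable q hq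

theorem hs1 {q : ℝ} (hq : 3 ≤ q) {f w : (Fin d → ℝ) → ℝ≥0∞} (hf : Measurable f) (hfp : Per f)
    (hw : Measurable w) (hwp : Per w) (y : Fin d → ℝ) :
    ∫⁻ x, f (x + y) * w x ∂(cubeVol d) ≤
      nLp (cubeVol d) (div3Exp q) f * nLp (cubeVol d) (ENNReal.ofReal q) w := by
  have h := lint_shift (f := fun x => f x * w (x + -y))
    (hfp.comp2 (hwp.shift (-y)) (fun a b => a * b)) y
  simp only [add_neg_cancel_right] at h
  rw [h, ← nLp_shift hwp (-y)]
  exact holder_11 _ hf.aemeasurable (hw.comp (measurable_id.add_const _)).aemeasurable q hq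

/-- parameters -/
structure Par (γ c q al : ℝ) : Prop where
  hγ : 1 < γ
  hc : 0 < c
  hq : 3 ≤ q
  hq' : q ≤ (3 * γ - 1) / (γ - 1)
  hal : 1 / 3 < al
  hal' : al ≤ 1 / 2

/-- the regularity class on one time slice -/
structure Slice (c q al : ℝ) (r : (Fin d → ℝ) → ℝ) (u : (Fin d → ℝ) → Fin d → ℝ)
    (G : Fin d → (Fin d → ℝ) → ℝ) (R B : ℝ≥0∞) : Prop where
  rm : Measurable r
  rp : Per r
  rc : ∀ x, c ≤ r x
  um : Measurable u
  up : Per u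
  GP : ∀ i, PI (G i)
  rR : nLp (cubeVol d) (div3Exp q) (fun x => ‖r x‖ₑ) ≤ R
  GR : ∀ i, nLp (cubeVol d) (div3Exp q) (fun x => ‖G i x‖ₑ) ≤ R
  uB : nLp (cubeVol d) (ENNReal.ofReal q) (fun x => ‖u x‖ₑ) ≤ B
  uS : ∀ᵐ y ∂(cubeVol d), nLp (cubeVol d) (ENNReal.ofReal q) (fun x => ‖u (x + y) - u x‖ₑ) ≤
    B * ENNReal.ofReal (sg y) ^ al
  R1 : 1 ≤ R
  RT : R ≠ ∞
  B1 : 1 ≤ B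
  BT : B ≠ ∞
  grad : ∀ n i x, dmol (ep n) i r x = mol (ep n) (G i) x

section moments
variable {c q al γ : ℝ} {r : (Fin d → ℝ) → ℝ} {u : (Fin d → ℝ) → Fin d → ℝ}
    {G : Fin d → (Fin d → ℝ) → ℝ} {R B : ℝ≥0∞}

theorem Slice.Dm (S : Slice c q al r u G R B) :
    Measurable (fun z : (Fin d → ℝ) × (Fin d → ℝ) => ‖u (z.1 + z.2) - u z.1‖ₑ) :=
  ((S.um.comp (measurable_fst.add measurable_snd)).sub (S.um.comp measurable_fst)).enorm

theorem Slice.Dp (S : Slice c q al r u G R B) (y : Fin d → ℝ) :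
    Per (fun x => ‖u (x + y) - u x‖ₑ) :=
  (S.up.shift y).comp2 S.up (fun a b => ‖a - b‖ₑ)

theorem Slice.Dmy (S : Slice c q al r u G R B) (y : Fin d → ℝ) :
    Measurable (fun x => ‖u (x + y) - u x‖ₑ) :=
  ((S.um.comp (measurable_id.add_const y)).sub S.um).enorm

theorem Slice.Dmx (S : Slice c q al r u G R B) (x : Fin d → ℝ) :
    Measurable (fun y => ‖u (x + y) - u x‖ₑ) :=
  ((S.um.comp (measurable_id.const_add x)).sub measurable_const).enorm

theorem Slice.mom3 (S : Slice c q al r u G R B) (P : Par γ c q al) {ε : ℝ} (hε : 0 < ε)  :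
    ∫⁻ x, ∫⁻ y, ENNReal.ofReal (ker ε y) * (‖r (x + y)‖ₑ * ‖u (x + y) - u x‖ₑ ^ (3 : ℝ))
      ∂(cubeVol d) ∂(cubeVol d) ≤
    R * B ^ (3 : ℝ) * (ENNReal.ofReal ε ^ (3 * al) * ENNReal.ofReal (1 + d)) := by
  rw [lint_swap ε (H := fun x y => ‖r (x + y)‖ₑ * ‖u (x + y) - u x‖ₑ ^ (3 : ℝ))
    ((S.rm.comp (measurable_fst.add measurable_snd)).enorm.mul (S.Dm.pow_const _))]
  calc _ ≤ ∫⁻ y, R * B ^ (3 : ℝ) * (ENNReal.ofReal (ker ε y) * ENNReal.ofReal (sg y) ^ (3 * al)) ∂(cubeVol d) := by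
        apply lintegral_mono_ae
        filter_upwards [S.uS] with y hy
        calc _ ≤ ENNReal.ofReal (ker ε y) * (R * (B * ENNReal.ofReal (sg y) ^ al) ^ (3 : ℝ)) := by
              gcongr
              refine (hs3 P.hq S.rm.enorm (S.rp.comp _) (S.Dmy y) (S.Dp y) y).trans ?_
              gcongr
              exact S.rR
          _ = _ := by
              rw [ENNReal.mul_rpow_of_nonneg _ _ (by norm_num), ← ENNReal.rpow_mul, mul_comm al 3]
              ring
    _ = R * B ^ (3 : ℝ) * ∫⁻ y, (ENNReal.ofReal (ker ε y) * ENNReal.ofReal (sg y) ^ (3 * al)) ∂(cubeVol d) := by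
        rw [lintegral_const_mul]
        exact (ker_continuous ε).measurable.ennreal_ofReal.mul
          (sg_continuous.measurable.ennreal_ofReal.pow_const _)
    _ ≤ _ := by
        gcongr
        exact ker_moment hε (by linarith [P.hal]) (by linarith [P.hal'])

theorem Slice.mom1 (S : Slice c q al r u G R B) (P : Par γ c q al) {ε : ℝ} (hε : 0 < ε)
    {f : (Fin d → ℝ) → ℝ} (hf : Measurable f) (hfp : Per f)
    (hfR : nLp (cubeVol d) (div3Exp q) (fun x => ‖f x‖ₑ) ≤ R) :
    ∫⁻ x, ∫⁻ y, ENNReal.ofReal (ker ε y) * (‖f (x + y)‖ₑ * ‖u (x + y) - u x‖ₑ)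
      ∂(cubeVol d) ∂(cubeVol d) ≤
    R * B * (ENNReal.ofReal ε ^ al * ENNReal.ofReal (1 + d)) := by
  rw [lint_swap ε (H := fun x y => ‖f (x + y)‖ₑ * ‖u (x + y) - u x‖ₑ)
    ((hf.comp (measurable_fst.add measurable_snd)).enorm.mul S.Dm)]
  calc _ ≤ ∫⁻ y, R * B * (ENNReal.ofReal (ker ε y) * ENNReal.ofReal (sg y) ^ al) ∂(cubeVol d) := by
        apply lintegral_mono_ae
        filter_upwards [S.uS] with y hy
        calc _ ≤ ENNReal.ofReal (ker ε y) * (R * (B * ENNReal.ofReal (sg y) ^ al)) := by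
              gcongr
              refine (hs1 P.hq hf.enorm (hfp.comp _) (S.Dmy y) (S.Dp y) y).trans ?_
              gcongr
          _ = _ := by ring
    _ = R * B * ∫⁻ y, (ENNReal.ofReal (ker ε y) * ENNReal.ofReal (sg y) ^ al) ∂(cubeVol d) := by
        rw [lintegral_const_mul]
        exact (ker_continuous ε).measurable.ennreal_ofReal.mul
          (sg_continuous.measurable.ennreal_ofReal.pow_const _)
    _ ≤ _ := by
        gcongr
        exact ker_moment hε (by linarith [P.hal]) (by linarith [P.hal'])

/-- averaged oscillation of `u` -/
def osc (ε : ℝ) (u : (Fin d → ℝ) → Fin d → ℝ) (x : Fin d → ℝ) : ℝ≥0∞ :=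
  ∫⁻ z, ENNReal.ofReal (ker ε z) * ‖u (x + z) - u x‖ₑ ∂(cubeVol d)

theorem Slice.osc_meas (S : Slice c q al r u G R B) (ε : ℝ) : Measurable (osc ε u) :=
  Measurable.lintegral_prod_right'
    (f := fun z : (Fin d → ℝ) × (Fin d → ℝ) => ENNReal.ofReal (ker ε z.2) * ‖u (z.1 + z.2) - u z.1‖ₑ)
    (((ker_continuous ε).measurable.comp measurable_snd).ennreal_ofReal.mul S.Dm)

theorem Slice.osc_per (S : Slice c q al r u G R B) (ε : ℝ) : Per (osc ε u) := by
  intro x n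
  unfold osc
  congr 1; ext z
  have := S.Dp z x n
  simp only at this
  rw [this]

/-- a general bound for `∫ w(x) osc(x)` where `w` pairs well with `L^q` -/
theorem Slice.osc_pair (S : Slice c q al r u G R B) (P : Par γ c q al) {ε : ℝ} (hε : 0 < ε)
    {w : (Fin d → ℝ) → ℝ≥0∞} (hw : Measurable w) (A : ℝ≥0∞)
    (hA : ∀ w' : (Fin d → ℝ) → ℝ≥0∞, Measurable w' → Per w' → (∀ x, w' x ≠ ∞) →
      ∫⁻ x, w x * w' x ∂(cubeVol d) ≤ A * nLp (cubeVol d) (ENNReal.ofReal q) w') :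
    ∫⁻ x, w x * osc ε u x ∂(cubeVol d) ≤
      A * B * (ENNReal.ofReal ε ^ al * ENNReal.ofReal (1 + d)) := by
  have e : ∀ x, w x * osc ε u x = ∫⁻ z, ENNReal.ofReal (ker ε z) * (w x * ‖u (x + z) - u x‖ₑ) ∂(cubeVol d) := by
    intro x
    unfold osc
    rw [← lintegral_const_mul]
    · congr 1; ext z; ring
    · exact (ker_continuous ε).measurable.ennreal_ofReal.mul
        (S.Dmx x)
  simp_rw [e]
  rw [lint_swap ε (H := fun x z => w x * ‖u (x + z) - u x‖ₑ)
    ((hw.comp measurable_fst).mul S.Dm)]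
  calc _ ≤ ∫⁻ y, A * B * (ENNReal.ofReal (ker ε y) * ENNReal.ofReal (sg y) ^ al) ∂(cubeVol d) := by
        apply lintegral_mono_ae
        filter_upwards [S.uS] with y hy
        calc _ ≤ ENNReal.ofReal (ker ε y) * (A * (B * ENNReal.ofReal (sg y) ^ al)) := by
              gcongr
              refine (hA _ (S.Dmy y) (S.Dp y) (fun x => enorm_ne_top)).trans ?_
              gcongr
          _ = _ := by ring
    _ = A * B * ∫⁻ y, (ENNReal.ofReal (ker ε y) * ENNReal.ofReal (sg y) ^ al) ∂(cubeVol d) := by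
        rw [lintegral_const_mul]
        exact (ker_continuous ε).measurable.ennreal_ofReal.mul
          (sg_continuous.measurable.ennreal_ofReal.pow_const _)
    _ ≤ _ := by
        gcongr
        exact ker_moment hε (by linarith [P.hal]) (by linarith [P.hal'])

theorem Slice.osc_L1 (S : Slice c q al r u G R B) (P : Par γ c q al) {ε : ℝ} (hε : 0 < ε) :
    ∫⁻ x, osc ε u x ∂(cubeVol d) ≤ B * (ENNReal.ofReal ε ^ al * ENNReal.ofReal (1 + d)) := by
  have := S.osc_pair P hε (w := fun _ => 1) measurable_const 1 (fun w' h1 h2 _ => by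
    simpa using holder_01 _ h1.aemeasurable q P.hq)
  simpa using this

/-- averaged modulus -/
def lmol (ε : ℝ) (f : (Fin d → ℝ) → ℝ) (x : Fin d → ℝ) : ℝ≥0∞ :=
  ∫⁻ y, ENNReal.ofReal (ker ε y) * ‖f (x + y)‖ₑ ∂(cubeVol d)

theorem lmol_meas (ε : ℝ) {f : (Fin d → ℝ) → ℝ} (hf : Measurable f) : Measurable (lmol ε f) :=
  Measurable.lintegral_prod_right'
    (f := fun z : (Fin d → ℝ) × (Fin d → ℝ) => ENNReal.ofReal (ker ε z.2) * ‖f (z.1 + z.2)‖ₑ)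
    (((ker_continuous ε).measurable.comp measurable_snd).ennreal_ofReal.mul
      (hf.comp (measurable_fst.add measurable_snd)).enorm)

theorem lmol_pair {ε : ℝ} (hq : 3 ≤ q)
    {f : (Fin d → ℝ) → ℝ} (hf : Measurable f) (hfp : Per f) (z : Fin d → ℝ)
    {w : (Fin d → ℝ) → ℝ≥0∞} (hw : Measurable w) (hwp : Per w) :
    ∫⁻ x, lmol ε f (x + z) * w x ∂(cubeVol d) ≤
      nLp (cubeVol d) (div3Exp q) (fun x => ‖f x‖ₑ) * nLp (cubeVol d) (ENNReal.ofReal q) w := by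
  have e : ∀ x, lmol ε f (x + z) * w x = ∫⁻ y, ENNReal.ofReal (ker ε y) * (‖f (x + z + y)‖ₑ * w x) ∂(cubeVol d) := by
    intro x
    unfold lmol
    rw [← lintegral_mul_const]
    · congr 1; ext z; ring
    · exact (ker_continuous ε).measurable.ennreal_ofReal.mul
        (hf.comp (measurable_const.add measurable_id)).enorm
  simp_rw [e]
  rw [lint_swap ε (H := fun x y => ‖f (x + z + y)‖ₑ * w x)
    ((hf.comp ((measurable_fst.add_const z).add measurable_snd)).enorm.mul (hw.comp measurable_fst))]
  calc _ ≤ ∫⁻ y, ENNReal.ofReal (ker ε y) * (nLp (cubeVol d) (div3Exp q) (fun x => ‖f x‖ₑ) * nLp (cubeVol d) (ENNReal.ofReal q) w) ∂(cubeVol d) := by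
        apply lintegral_mono
        intro y
        dsimp only
        gcongr
        simp_rw [add_assoc]
        exact hs1 hq hf.enorm (hfp.comp _) hw hwp (z + y)
    _ = _ := by
        rw [lintegral_mul_const, lint_ker, one_mul]
        exact (ker_continuous ε).measurable.ennreal_ofReal

end moments

theorem isub {α : Type*} [MeasurableSpace α] {μ : Measure α} {f g : α → ℝ} (hf : Integrable f μ)
    (hg : Integrable g μ) : Integrable (fun x => f x - g x) μ := hf.sub hg

theorem iadd {α : Type*} [MeasurableSpace α] {μ : Measure α} {f g : α → ℝ} (hf : Integrable f μ)
    (hg : Integrable g μ) : Integrable (fun x => f x + g x) μ := hf.add hg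

theorem favre_mom {α : Type*} [MeasurableSpace α] {μ : Measure α} {w D : α → ℝ}
    (hw : ∀ y, 0 ≤ w y) (hD : ∀ y, 0 ≤ D y)
    (i0 : Integrable w μ) (i1 : Integrable (fun y => w y * D y) μ)
    (i2 : Integrable (fun y => w y * D y ^ 2) μ) (i3 : Integrable (fun y => w y * D y ^ 3) μ)
    (hW : 0 < ∫ y, w y ∂μ) :
    (∫ y, w y * D y ∂μ) / (∫ y, w y ∂μ) * (∫ y, w y * D y ∂μ) ≤ ∫ y, w y * D y ^ 2 ∂μ ∧
    (∫ y, w y * D y ∂μ) / (∫ y, w y ∂μ) * (∫ y, w y * D y ^ 2 ∂μ) ≤ ∫ y, w y * D y ^ 3 ∂μ := by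
  set W := ∫ y, w y ∂μ with hWd
  set a1 := ∫ y, w y * D y ∂μ with h1
  set a2 := ∫ y, w y * D y ^ 2 ∂μ with h2
  set a3 := ∫ y, w y * D y ^ 3 ∂μ with h3
  set l := a1 / W with hl
  have ha1 : 0 ≤ a1 := integral_nonneg fun y => mul_nonneg (hw y) (hD y)
  have hl0 : 0 ≤ l := div_nonneg ha1 hW.le
  have hlW : l * W = a1 := by rw [hl]; field_simp
  constructor
  · have e : ∫ y, w y * (D y - l) ^ 2 ∂μ = a2 - 2 * l * a1 + l ^ 2 * W := by
      have : ∀ y, w y * (D y - l) ^ 2 = (w y * D y ^ 2 - 2 * l * (w y * D y)) + l ^ 2 * w y := by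
        intro y; ring
      simp_rw [this]
      rw [integral_add (isub i2 (i1.const_mul _)) (i0.const_mul _), integral_sub i2 (i1.const_mul _),
        integral_const_mul, integral_const_mul]
    have p : 0 ≤ ∫ y, w y * (D y - l) ^ 2 ∂μ :=
      integral_nonneg fun y => mul_nonneg (hw y) (sq_nonneg _)
    rw [e, ← hlW] at p
    rw [← hlW]; nlinarith
  · have e : ∫ y, w y * ((D y + l) * (D y - l) ^ 2) ∂μ = a3 - l * a2 - l ^ 2 * a1 + l ^ 3 * W := by
      have : ∀ y, w y * ((D y + l) * (D y - l) ^ 2) =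
          (w y * D y ^ 3 - l * (w y * D y ^ 2) - l ^ 2 * (w y * D y)) + l ^ 3 * w y := by
        intro y; ring
      simp_rw [this]
      rw [integral_add (isub (isub i3 (i2.const_mul _)) (i1.const_mul _)) (i0.const_mul _),
        integral_sub (isub i3 (i2.const_mul _)) (i1.const_mul _), integral_sub i3 (i2.const_mul _),
        integral_const_mul, integral_const_mul, integral_const_mul]
    have p : 0 ≤ ∫ y, w y * ((D y + l) * (D y - l) ^ 2) ∂μ :=
      integral_nonneg fun y => mul_nonneg (hw y) (mul_nonneg (add_nonneg (hD y) hl0) (sq_nonneg _))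
    rw [e, ← hlW] at p
    nlinarith

theorem favre_avg {α : Type*} [MeasurableSpace α] {μ : Measure α} {w D U : α → ℝ} {p : ℝ}
    (hw : ∀ y, 0 ≤ w y)
    (i0 : Integrable w μ) (i1 : Integrable (fun y => w y * D y) μ)
    (iU : Integrable (fun y => w y * U y) μ) (hUD : ∀ y, |U y - p| ≤ D y)
    (hW : 0 < ∫ y, w y ∂μ) :
    |(∫ y, w y * U y ∂μ) / (∫ y, w y ∂μ) - p| ≤ (∫ y, w y * D y ∂μ) / (∫ y, w y ∂μ) := by
  have e : (∫ y, w y * U y ∂μ) / (∫ y, w y ∂μ) - p = (∫ y, w y * (U y - p) ∂μ) / (∫ y, w y ∂μ) := by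
    have : ∀ y, w y * (U y - p) = w y * U y - p * w y := by intro y; ring
    simp_rw [this]
    rw [integral_sub iU (i0.const_mul _), integral_const_mul]
    field_simp
  rw [e, abs_div, abs_of_pos hW]
  gcongr
  refine (abs_integral_le_integral_abs).trans (integral_mono_of_nonneg
    (Filter.Eventually.of_forall fun y => abs_nonneg _) i1 (Filter.Eventually.of_forall fun y => ?_))
  change |w y * (U y - p)| ≤ w y * D y
  rw [abs_mul, abs_of_nonneg (hw y)]
  exact mul_le_mul_of_nonneg_left (hUD y) (hw y)

theorem favre {α : Type*} [MeasurableSpace α] {μ : Measure α} {w D U U' k : α → ℝ} {p p' A : ℝ}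
    (hw : ∀ y, 0 ≤ w y) (hD : ∀ y, 0 ≤ D y)
    (i0 : Integrable w μ) (i1 : Integrable (fun y => w y * D y) μ)
    (i2 : Integrable (fun y => w y * D y ^ 2) μ) (i3 : Integrable (fun y => w y * D y ^ 3) μ)
    (iU : Integrable (fun y => w y * U y) μ) (iU' : Integrable (fun y => w y * U' y) μ)
    (iUU : Integrable (fun y => w y * U y * U' y) μ)
    (ik : Integrable k μ) (ikU : Integrable (fun y => k y * U' y) μ)
    (hU : ∀ y, |U y - p| ≤ D y) (hU' : ∀ y, |U' y - p'| ≤ D y) (hk : ∀ y, |k y| ≤ A * w y)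
    (hA : 0 ≤ A)
    (hW : 0 < ∫ y, w y ∂μ) {V : ℝ} (hV : V = (∫ y, w y * U' y ∂μ) / (∫ y, w y ∂μ)) :
    |(-∫ y, k y * U' y ∂μ + V * ∫ y, k y ∂μ) / (∫ y, w y ∂μ) *
      (V * (∫ y, w y * U y ∂μ) - ∫ y, w y * U y * U' y ∂μ)| ≤ 4 * A * ∫ y, w y * D y ^ 3 ∂μ := by
  obtain ⟨m1, m2⟩ := favre_mom hw hD i0 i1 i2 i3 hW
  have hav := favre_avg hw i0 i1 iU' hU' hW
  rw [← hV] at hav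
  set W := ∫ y, w y ∂μ with hWd
  set a1 := ∫ y, w y * D y ∂μ with h1
  set a2 := ∫ y, w y * D y ^ 2 ∂μ with h2
  set a3 := ∫ y, w y * D y ^ 3 ∂μ with h3
  set l := a1 / W with hl
  have ha1 : 0 ≤ a1 := integral_nonneg fun y => mul_nonneg (hw y) (hD y)
  have hl0 : 0 ≤ l := div_nonneg ha1 hW.le
  have hlW : l * W = a1 := by rw [hl]; field_simp
  have hUV : ∀ y, |U' y - V| ≤ D y + l := by
    intro y
    have : U' y - V = (U' y - p') - (V - p') := by ring
    rw [this]
    exact (abs_sub _ _).trans (add_le_add (hU' y) hav)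
  have hb : |-∫ y, k y * U' y ∂μ + V * ∫ y, k y ∂μ| ≤ 2 * A * a1 := by
    have e : -∫ y, k y * U' y ∂μ + V * ∫ y, k y ∂μ = -∫ y, k y * (U' y - V) ∂μ := by
      have : ∀ y, k y * (U' y - V) = k y * U' y - V * k y := by intro y; ring
      simp_rw [this]
      rw [integral_sub ikU (ik.const_mul _), integral_const_mul]
      ring
    rw [e, abs_neg]
    have e2 : 2 * A * a1 = ∫ y, A * (w y * D y + l * w y) ∂μ := by
      rw [integral_const_mul, integral_add i1 (i0.const_mul _), integral_const_mul, hlW]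
      ring
    rw [e2]
    refine (abs_integral_le_integral_abs).trans (integral_mono_of_nonneg
      (Filter.Eventually.of_forall fun y => abs_nonneg _) ((i1.add (i0.const_mul _)).const_mul _)
      (Filter.Eventually.of_forall fun y => ?_))
    change |k y * (U' y - V)| ≤ A * (w y * D y + l * w y)
    rw [abs_mul]
    calc _ ≤ (A * w y) * (D y + l) :=
          mul_le_mul (hk y) (hUV y) (abs_nonneg _) (mul_nonneg hA (hw y))
      _ = _ := by ring
  have hT : |V * (∫ y, w y * U y ∂μ) - ∫ y, w y * U y * U' y ∂μ| ≤ 2 * a2 := by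
    have e : V * (∫ y, w y * U y ∂μ) - ∫ y, w y * U y * U' y ∂μ =
        -∫ y, w y * (U y - p) * (U' y - V) ∂μ := by
      have : ∀ y, w y * (U y - p) * (U' y - V) =
          (w y * U y * U' y - V * (w y * U y)) - (p * (w y * U' y) - (p * V) * w y) := by
        intro y; ring
      simp_rw [this]
      have hVW : V * W = ∫ y, w y * U' y ∂μ := by rw [hV]; field_simp
      rw [integral_sub (isub iUU (iU.const_mul _)) (isub (iU'.const_mul _) (i0.const_mul _)),
        integral_sub iUU (iU.const_mul _), integral_sub (iU'.const_mul _) (i0.const_mul _),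
        integral_const_mul, integral_const_mul, integral_const_mul, ← hVW]
      ring
    rw [e, abs_neg]
    have e2 : ∫ y, (w y * D y ^ 2 + l * (w y * D y)) ∂μ = a2 + l * a1 := by
      rw [integral_add i2 (i1.const_mul _), integral_const_mul]
    calc _ ≤ ∫ y, (w y * D y ^ 2 + l * (w y * D y)) ∂μ := by
          refine (abs_integral_le_integral_abs).trans (integral_mono_of_nonneg
            (Filter.Eventually.of_forall fun y => abs_nonneg _) (i2.add (i1.const_mul _))
            (Filter.Eventually.of_forall fun y => ?_))
          change |w y * (U y - p) * (U' y - V)| ≤ (w y * D y ^ 2 + l * (w y * D y))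
          rw [abs_mul, abs_mul, abs_of_nonneg (hw y)]
          calc _ ≤ (w y * D y) * (D y + l) :=
                mul_le_mul (mul_le_mul_of_nonneg_left (hU y) (hw y)) (hUV y) (abs_nonneg _)
                  (mul_nonneg (hw y) (hD y))
            _ = _ := by ring
      _ ≤ _ := by rw [e2]; linarith
  rw [abs_mul, abs_div, abs_of_pos hW]
  calc _ ≤ (2 * A * a1) / W * (2 * a2) := by gcongr
    _ = 4 * A * (l * a2) := by rw [hl]; ring
    _ ≤ _ := by gcongr

theorem fatou_l1 {α : Type*} [MeasurableSpace α] {μ : Measure α} {F : ℕ → α → ℝ} {g : α → ℝ}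
    (hF : ∀ k, Measurable (F k)) (hg : Measurable g)
    (h2 : Filter.Tendsto (fun k => ∫⁻ x, ‖F k x - g x‖ₑ ∂μ) Filter.atTop (nhds 0))
    {w : α → ℝ≥0∞} (hw : Measurable w) {A : ℝ≥0∞} (hA : ∀ k, ∫⁻ x, ‖F k x‖ₑ * w x ∂μ ≤ A)
    (hwt : ∀ᵐ x ∂μ, w x ≠ ∞) :
    ∫⁻ x, ‖g x‖ₑ * w x ∂μ ≤ A := by
  have hm : TendstoInMeasure μ F Filter.atTop g := by
    refine tendstoInMeasure_of_tendsto_eLpNorm (p := 1) one_ne_zero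
      (fun k => (hF k).aestronglyMeasurable) hg.aestronglyMeasurable ?_
    simpa only [eLpNorm_one_eq_lintegral_enorm, Pi.sub_apply] using h2
  obtain ⟨ns, hns, hae⟩ := hm.exists_seq_tendsto_ae
  calc ∫⁻ x, ‖g x‖ₑ * w x ∂μ = ∫⁻ x, Filter.liminf (fun k => ‖F (ns k) x‖ₑ * w x) Filter.atTop ∂μ := by
        apply lintegral_congr_ae
        filter_upwards [hae, hwt] with x hx hwx
        refine (Filter.Tendsto.liminf_eq ?_).symm
        exact ENNReal.Tendsto.mul_const (hx.enorm) (Or.inr hwx)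
    _ ≤ Filter.liminf (fun k => ∫⁻ x, ‖F (ns k) x‖ₑ * w x ∂μ) Filter.atTop :=
        lintegral_liminf_le fun k => (hF _).enorm.mul hw
    _ ≤ A := by
        refine (Filter.liminf_le_liminf (v := fun _ => A) (Filter.Eventually.of_forall fun k => hA (ns k))).trans ?_
        simp

section BV
variable {c q al γ : ℝ} {r : (Fin d → ℝ) → ℝ} {u : (Fin d → ℝ) → Fin d → ℝ}
    {G : Fin d → (Fin d → ℝ) → ℝ} {R B : ℝ≥0∞}

theorem Slice.rPI (S : Slice c q al r u G R B) (P : Par γ c q al) : PI r :=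
  PI.mk' S.rm S.rp ((holder_10 _ S.rm.enorm.aemeasurable q P.hq).trans_lt
    (S.rR.trans_lt S.RT.lt_top))

theorem Slice.bv_m (S : Slice c q al r u G R B) (P : Par γ c q al) (m : ℕ) (h : Fin d → ℝ)
    {w : (Fin d → ℝ) → ℝ≥0∞} (hw : Measurable w) (hwp : Per w) :
    ∫⁻ x, ‖mol (ep m) r (x + h) - mol (ep m) r x‖ₑ * w x ∂(cubeVol d) ≤
      d * (ENNReal.ofReal (sg h) * (R * nLp (cubeVol d) (ENNReal.ofReal q) w)) := by
  have hr := S.rPI P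
  set k := cen h with hk
  have e1 : ∀ x, ‖mol (ep m) r (x + h) - mol (ep m) r x‖ₑ ≤
      ∑ i : Fin d, ∫⁻ s in Set.Icc (0 : ℝ) 1, ENNReal.ofReal (sg h) * lmol (ep m) (G i) (x + s • k) := by
    intro x
    have hd : ∀ s : ℝ, HasDerivAt (fun s : ℝ => mol (ep m) r (x + s • k))
        (∑ i, k i * mol (ep m) (G i) (x + s • k)) s := by
      intro s
      have := mol_hasDerivAt (ep_pos m) hr x k s
      simpa only [S.grad] using this
    have hcont : Continuous (fun s : ℝ => ∑ i, k i * mol (ep m) (G i) (x + s • k)) := by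
      refine continuous_finsetSum _ fun i _ => continuous_const.mul ?_
      exact (mol_continuous (ep m) (S.GP i)).comp (by fun_prop)
    have hftc := intervalIntegral.integral_eq_sub_of_hasDerivAt (a := 0) (b := 1)
      (fun s _ => hd s) (hcont.intervalIntegrable _ _)
    rw [intervalIntegral.integral_of_le zero_le_one, integral_Icc_eq_integral_Ioc.symm] at hftc
    simp only [one_smul, zero_smul, add_zero] at hftc
    rw [← (mol_per (ep m) S.rp).cenf x h, ← hk, ← hftc]
    refine (enorm_integral_le_lintegral_enorm _).trans ?_
    rw [← lintegral_finsetSum']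
    · apply lintegral_mono
      intro s
      refine (enorm_sum_le _ _).trans (Finset.sum_le_sum fun i _ => ?_)
      rw [enorm_mul]
      gcongr
      · rw [Real.enorm_eq_ofReal_abs]
        exact ENNReal.ofReal_le_ofReal (cen_abs_le_sg h i)
      · exact mol_enorm_le _ _ _
    · intro i _
      have : Measurable (fun s : ℝ => lmol (ep m) (G i) (x + s • k)) :=
        (lmol_meas (ep m) (S.GP i).meas).comp (by fun_prop)
      exact (this.const_mul _).aemeasurable
  have hm2 : ∀ i, Measurable (fun z : (Fin d → ℝ) × ℝ => ENNReal.ofReal (sg h) *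
      lmol (ep m) (G i) (z.1 + z.2 • k)) := fun i => by
    have : Measurable (fun z : (Fin d → ℝ) × ℝ => lmol (ep m) (G i) (z.1 + z.2 • k)) :=
      (lmol_meas (ep m) (S.GP i).meas).comp (by fun_prop)
    exact this.const_mul _
  have hm1 : ∀ i, Measurable (fun x : (Fin d → ℝ) => ∫⁻ s in Set.Icc (0 : ℝ) 1,
      ENNReal.ofReal (sg h) * lmol (ep m) (G i) (x + s • k)) := fun i =>
    (hm2 i).lintegral_prod_right'
  calc _ ≤ ∫⁻ x, ∑ i : Fin d, (∫⁻ s in Set.Icc (0 : ℝ) 1,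
          ENNReal.ofReal (sg h) * lmol (ep m) (G i) (x + s • k)) * w x ∂(cubeVol d) := by
        apply lintegral_mono
        intro x
        dsimp only
        rw [← Finset.sum_mul]
        gcongr
        exact e1 x
    _ = ∑ i : Fin d, ∫⁻ x, (∫⁻ s in Set.Icc (0 : ℝ) 1,
          ENNReal.ofReal (sg h) * lmol (ep m) (G i) (x + s • k)) * w x ∂(cubeVol d) :=
        lintegral_finsetSum _ fun i _ => (hm1 i).mul hw
    _ ≤ ∑ i : Fin d, ENNReal.ofReal (sg h) * (R * nLp (cubeVol d) (ENNReal.ofReal q) w) := by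
        apply Finset.sum_le_sum
        intro i _
        have e2 : ∀ x, (∫⁻ s in Set.Icc (0 : ℝ) 1,
            ENNReal.ofReal (sg h) * lmol (ep m) (G i) (x + s • k)) * w x =
            ∫⁻ s in Set.Icc (0 : ℝ) 1, ENNReal.ofReal (sg h) * lmol (ep m) (G i) (x + s • k) * w x := by
          intro x
          rw [lintegral_mul_const]
          have : Measurable (fun s : ℝ => lmol (ep m) (G i) (x + s • k)) :=
            (lmol_meas (ep m) (S.GP i).meas).comp (by fun_prop)
          exact this.const_mul _
        simp_rw [e2]
        rw [lintegral_lintegral_swap ((hm2 i).mul (hw.comp measurable_fst)).aemeasurable]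
        calc _ ≤ ∫⁻ s in Set.Icc (0 : ℝ) 1, ENNReal.ofReal (sg h) * (R * nLp (cubeVol d) (ENNReal.ofReal q) w) := by
              apply lintegral_mono
              intro s
              dsimp only
              simp_rw [mul_assoc]
              rw [lintegral_const_mul]
              · gcongr
                refine (lmol_pair P.hq (S.GP i).meas (S.GP i).per (s • k) hw hwp).trans ?_
                gcongr
                exact S.GR i
              · exact ((lmol_meas (ep m) (S.GP i).meas).comp (measurable_id.add_const _)).mul hw
          _ = _ := by simp
    _ = _ := by simp

theorem Slice.bv (S : Slice c q al r u G R B) (P : Par γ c q al) (h : Fin d → ℝ)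
    {w : (Fin d → ℝ) → ℝ≥0∞} (hw : Measurable w) (hwp : Per w) (hwt : ∀ᵐ x ∂(cubeVol d), w x ≠ ∞) :
    ∫⁻ x, ‖r (x + h) - r x‖ₑ * w x ∂(cubeVol d) ≤
      d * (ENNReal.ofReal (sg h) * (R * nLp (cubeVol d) (ENNReal.ofReal q) w)) := by
  have hr := S.rPI P
  have hmm : ∀ m, Measurable (mol (ep m) r) := fun m => (mol_continuous _ hr).measurable
  refine fatou_l1 (F := fun m x => mol (ep m) r (x + h) - mol (ep m) r x)
    (g := fun x => r (x + h) - r x)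
    (fun m => ((hmm m).comp (measurable_id.add_const h)).sub (hmm m))
    ((S.rm.comp (measurable_id.add_const h)).sub S.rm) ?_ hw (fun m => S.bv_m P m h hw hwp) hwt
  have h0 := mol_tendsto hr
  have h1 : Filter.Tendsto (fun n => (∫⁻ x, ‖mol (ep n) r x - r x‖ₑ ∂(cubeVol d)) +
      ∫⁻ x, ‖mol (ep n) r x - r x‖ₑ ∂(cubeVol d)) Filter.atTop (nhds 0) := by
    simpa using h0.add h0
  refine tendsto_of_tendsto_of_tendsto_of_le_of_le tendsto_const_nhds h1 (fun n => zero_le) fun n => ?_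
  have hp := lint_shift (f := fun x => ‖mol (ep n) r x - r x‖ₑ)
    ((mol_per _ S.rp).comp2 S.rp (fun a b => ‖a - b‖ₑ)) h
  have hm : Measurable (fun x => ‖mol (ep n) r x - r x‖ₑ) := ((hmm n).sub S.rm).enorm
  dsimp only
  conv_rhs => rw [← hp]
  rw [hp]
  nth_rewrite 1 [← hp]
  rw [← lintegral_add_right _ hm]
  apply lintegral_mono
  intro x
  dsimp only
  have : mol (ep n) r (x + h) - mol (ep n) r x - (r (x + h) - r x) =
    (mol (ep n) r (x + h) - r (x + h)) - (mol (ep n) r x - r x) := by ring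
  rw [this]
  exact enorm_sub_le
end BV

section comm
variable {c q al γ : ℝ} {r : (Fin d → ℝ) → ℝ} {u : (Fin d → ℝ) → Fin d → ℝ}
    {G : Fin d → (Fin d → ℝ) → ℝ} {R B : ℝ≥0∞}

theorem enorm_coord (v : Fin d → ℝ) (i : Fin d) : ‖v i‖ₑ ≤ ‖v‖ₑ := by
  have := norm_le_pi_norm v i
  rw [← ofReal_norm, ← ofReal_norm]
  exact ENNReal.ofReal_le_ofReal this

theorem Slice.ui_m (S : Slice c q al r u G R B) (i : Fin d) : Measurable (fun x => u x i) :=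
  (measurable_pi_apply i).comp S.um

theorem Slice.ui_p (S : Slice c q al r u G R B) (i : Fin d) : Per (fun x => u x i) :=
  S.up.comp (fun v => v i)

theorem Slice.uPI (S : Slice c q al r u G R B) (P : Par γ c q al) (i : Fin d) :
    PI (fun x => u x i) :=
  PI.mk' (S.ui_m i) (S.ui_p i) (by
    refine lt_of_le_of_lt ?_ S.BT.lt_top
    refine (lintegral_mono fun x => enorm_coord (u x) i).trans ?_
    exact (holder_01 _ S.um.enorm.aemeasurable q P.hq).trans S.uB)

theorem Slice.fu_lint (S : Slice c q al r u G R B) (P : Par γ c q al) {f : (Fin d → ℝ) → ℝ}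
    (hf : Measurable f) (hfR : nLp (cubeVol d) (div3Exp q) (fun x => ‖f x‖ₑ) ≤ R) (i : Fin d) :
    ∫⁻ x, ‖f x * u x i‖ₑ ∂(cubeVol d) ≤ R * B := by
  calc _ ≤ ∫⁻ x, ‖f x‖ₑ * ‖u x‖ₑ ∂(cubeVol d) := by
        apply lintegral_mono
        intro x
        dsimp only
        rw [enorm_mul]
        gcongr
        exact enorm_coord (u x) i
    _ ≤ _ := holder_11 _ hf.enorm.aemeasurable S.um.enorm.aemeasurable q P.hq
    _ ≤ _ := by gcongr; exact S.uB

theorem Slice.fuPI (S : Slice c q al r u G R B) (P : Par γ c q al) {f : (Fin d → ℝ) → ℝ}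
    (hf : Measurable f) (hfp : Per f) (hfR : nLp (cubeVol d) (div3Exp q) (fun x => ‖f x‖ₑ) ≤ R)
    (i : Fin d) : PI (fun x => f x * u x i) :=
  PI.mk' (hf.mul (S.ui_m i)) (hfp.comp2 (S.ui_p i) (fun a b => a * b))
    ((S.fu_lint P hf hfR i).trans_lt (ENNReal.mul_lt_top S.RT.lt_top S.BT.lt_top))

theorem mol_osc (ε : ℝ) (i : Fin d) (x : Fin d → ℝ) (h : PI (fun x => u x i)) :
    ‖mol ε (fun x => u x i) x - u x i‖ₑ ≤ osc ε u x := by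
  rw [mol_sub_self ε h x]
  refine (enorm_integral_le_lintegral_enorm _).trans (lintegral_mono fun y => ?_)
  dsimp only
  rw [enorm_mul, Real.enorm_of_nonneg (ker_pos ε y).le]
  gcongr
  exact enorm_coord (u (x + y) - u x) i

/-- second commutator -/
theorem Slice.comm2 (S : Slice c q al r u G R B) (P : Par γ c q al) {ε : ℝ} (hε : 0 < ε)
    {f : (Fin d → ℝ) → ℝ} (hf : PI f)
    (hfR : nLp (cubeVol d) (div3Exp q) (fun x => ‖f x‖ₑ) ≤ R) (i : Fin d) :
    ∫⁻ x, ‖mol ε f x * mol ε (fun x => u x i) x - mol ε (fun x => f x * u x i) x‖ₑ ∂(cubeVol d) ≤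
      2 * (R * B * (ENNReal.ofReal ε ^ al * ENNReal.ofReal (1 + d))) := by
  have hu := S.uPI P i
  have hfu := S.fuPI P hf.meas hf.per hfR i
  have e : ∀ x, ‖mol ε f x * mol ε (fun x => u x i) x - mol ε (fun x => f x * u x i) x‖ₑ ≤
      lmol ε f x * osc ε u x + ∫⁻ y, ENNReal.ofReal (ker ε y) * (‖f (x + y)‖ₑ * ‖u (x + y) - u x‖ₑ)
      ∂(cubeVol d) := by
    intro x
    have e1 : mol ε f x * mol ε (fun x => u x i) x - mol ε (fun x => f x * u x i) x =
        mol ε f x * (mol ε (fun x => u x i) x - u x i) -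
          ∫ y, ker ε y * (f (x + y) * (u (x + y) i - u x i)) ∂(cubeVol d) := by
      have : ∀ y, ker ε y * (f (x + y) * (u (x + y) i - u x i)) =
          ker ε y * (f (x + y) * u (x + y) i) - u x i * (ker ε y * f (x + y)) := by intro y; ring
      simp_rw [this]
      rw [integral_sub (kf_int ε hfu x) ((kf_int ε hf x).const_mul _), integral_const_mul]
      unfold mol
      ring
    rw [e1]
    refine enorm_sub_le.trans (add_le_add ?_ ?_)
    · rw [enorm_mul]
      exact mul_le_mul' (mol_enorm_le _ _ _) (mol_osc ε i x hu)
    · refine (enorm_integral_le_lintegral_enorm _).trans (lintegral_mono fun y => ?_)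
      dsimp only
      rw [enorm_mul, enorm_mul, Real.enorm_of_nonneg (ker_pos ε y).le]
      gcongr
      exact enorm_coord (u (x + y) - u x) i
  refine (lintegral_mono e).trans ?_
  rw [lintegral_add_left (f := fun x => lmol ε f x * osc ε u x) ((lmol_meas ε hf.meas).mul (S.osc_meas ε)), two_mul]
  refine add_le_add ?_ (S.mom1 P hε hf.meas hf.per hfR)
  refine S.osc_pair P hε (lmol_meas ε hf.meas) R fun w' h1 h2 _ => ?_
  have := lmol_pair (ε := ε) P.hq hf.meas hf.per 0 h1 h2
  simp only [add_zero] at this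
  refine this.trans ?_
  gcongr

/-- first commutator -/
theorem Slice.comm1 (S : Slice c q al r u G R B) (P : Par γ c q al) {ε : ℝ} (hε : 0 < ε) (i : Fin d) :
    ∫⁻ x, ‖mol ε (fun x => r x * u x i) x - mol ε r x * mol ε (fun x => u x i) x‖ₑ ∂(cubeVol d) ≤
      (d * ENNReal.ofReal (1 + d) * (1 + ENNReal.ofReal (1 + d))) *
        (R * B * ENNReal.ofReal ε ^ (1 + al)) := by
  have hu := S.uPI P i
  have hr := S.rPI P
  have hru := S.fuPI P S.rm S.rp S.rR i
  have hrD : Measurable (fun z : (Fin d → ℝ) × (Fin d → ℝ) => ‖r (z.1 + z.2) - r z.1‖ₑ) :=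
    ((S.rm.comp (measurable_fst.add measurable_snd)).sub (S.rm.comp measurable_fst)).enorm
  set o : (Fin d → ℝ) → ℝ≥0∞ := fun x => ∫⁻ y, ENNReal.ofReal (ker ε y) * ‖r (x + y) - r x‖ₑ ∂(cubeVol d) with ho
  have hom : Measurable o := Measurable.lintegral_prod_right'
    (f := fun z : (Fin d → ℝ) × (Fin d → ℝ) => ENNReal.ofReal (ker ε z.2) * ‖r (z.1 + z.2) - r z.1‖ₑ)
    (((ker_continuous ε).measurable.comp measurable_snd).ennreal_ofReal.mul hrD)
  have e : ∀ x, ‖mol ε (fun x => r x * u x i) x - mol ε r x * mol ε (fun x => u x i) x‖ₑ ≤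
      o x * osc ε u x + ∫⁻ y, ENNReal.ofReal (ker ε y) * (‖r (x + y) - r x‖ₑ * ‖u (x + y) - u x‖ₑ)
      ∂(cubeVol d) := by
    intro x
    have e1 : mol ε (fun x => r x * u x i) x - mol ε r x * mol ε (fun x => u x i) x =
        ∫ y, ker ε y * ((r (x + y) - r x) * (u (x + y) i - u x i)) ∂(cubeVol d) -
        (mol ε r x - r x) * (mol ε (fun x => u x i) x - u x i) := by
      have : ∀ y, ker ε y * ((r (x + y) - r x) * (u (x + y) i - u x i)) =
          (ker ε y * (r (x + y) * u (x + y) i) - u x i * (ker ε y * r (x + y))) -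
          (r x * (ker ε y * u (x + y) i) - (r x * u x i) * ker ε y) := by intro y; ring
      simp_rw [this]
      rw [integral_sub (isub (kf_int ε hru x) ((kf_int ε hr x).const_mul _))
        (isub ((kf_int ε hu x).const_mul _) ((ker_integrable ε).const_mul _)),
        integral_sub (kf_int ε hru x) ((kf_int ε hr x).const_mul _),
        integral_sub ((kf_int ε hu x).const_mul _) ((ker_integrable ε).const_mul _),
        integral_const_mul, integral_const_mul, integral_const_mul, ker_integral]
      unfold mol
      ring
    rw [e1]
    rw [add_comm]
    refine enorm_sub_le.trans (add_le_add ?_ ?_)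
    · refine (enorm_integral_le_lintegral_enorm _).trans (lintegral_mono fun y => ?_)
      dsimp only
      rw [enorm_mul, enorm_mul, Real.enorm_of_nonneg (ker_pos ε y).le]
      gcongr
      exact enorm_coord (u (x + y) - u x) i
    · rw [enorm_mul]
      refine mul_le_mul' ?_ (mol_osc ε i x hu)
      rw [mol_sub_self ε hr x]
      refine (enorm_integral_le_lintegral_enorm _).trans (lintegral_mono fun y => ?_)
      dsimp only
      rw [enorm_mul, Real.enorm_of_nonneg (ker_pos ε y).le]
  have hkm : ∀ s : ℝ, Measurable (fun y : Fin d → ℝ => ENNReal.ofReal (ker ε y) * ENNReal.ofReal (sg y) ^ s) :=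
    fun s => (ker_continuous ε).measurable.ennreal_ofReal.mul
          (sg_continuous.measurable.ennreal_ofReal.pow_const _)
  refine (lintegral_mono e).trans ?_
  rw [lintegral_add_left (f := fun x => o x * osc ε u x) (hom.mul (S.osc_meas ε))]
  have hε' : ENNReal.ofReal ε ≠ 0 := by simpa using hε
  have b1 : ∫⁻ x, o x * osc ε u x ∂(cubeVol d) ≤
      (d * (ENNReal.ofReal ε * ENNReal.ofReal (1 + d)) * R) * B * (ENNReal.ofReal ε ^ al * ENNReal.ofReal (1 + d)) := by
    refine S.osc_pair P hε hom _ fun w' h1 h2 h3 => ?_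
    have e2 : ∀ x, o x * w' x = ∫⁻ y, ENNReal.ofReal (ker ε y) * (‖r (x + y) - r x‖ₑ * w' x) ∂(cubeVol d) := by
      intro x
      rw [ho]
      dsimp only
      rw [← lintegral_mul_const]
      · congr 1; ext z; ring
      · exact (ker_continuous ε).measurable.ennreal_ofReal.mul
          ((S.rm.comp (measurable_id.const_add x)).sub measurable_const).enorm
    simp_rw [e2]
    rw [lint_swap ε (H := fun x y => ‖r (x + y) - r x‖ₑ * w' x)
      (hrD.mul (h1.comp measurable_fst))]
    calc _ ≤ ∫⁻ y, (d * (R * nLp (cubeVol d) (ENNReal.ofReal q) w')) *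
            (ENNReal.ofReal (ker ε y) * ENNReal.ofReal (sg y) ^ (1 : ℝ)) ∂(cubeVol d) := by
          apply lintegral_mono
          intro y
          dsimp only
          calc _ ≤ ENNReal.ofReal (ker ε y) * (d * (ENNReal.ofReal (sg y) * (R * nLp (cubeVol d) (ENNReal.ofReal q) w'))) := by
                gcongr
                exact S.bv P y h1 h2 (Filter.Eventually.of_forall h3)
            _ = _ := by rw [ENNReal.rpow_one]; ring
      _ ≤ (d * (R * nLp (cubeVol d) (ENNReal.ofReal q) w')) * (ENNReal.ofReal ε ^ (1 : ℝ) * ENNReal.ofReal (1 + d)) := by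
          rw [lintegral_const_mul _ (hkm 1)]
          gcongr
          exact ker_moment hε (by norm_num) (by norm_num)
      _ = _ := by rw [ENNReal.rpow_one]; ring
  have b2 : ∫⁻ x, ∫⁻ y, ENNReal.ofReal (ker ε y) * (‖r (x + y) - r x‖ₑ * ‖u (x + y) - u x‖ₑ)
      ∂(cubeVol d) ∂(cubeVol d) ≤ (d * R * B) * (ENNReal.ofReal ε ^ (1 + al) * ENNReal.ofReal (1 + d)) := by
    rw [lint_swap ε (H := fun x y => ‖r (x + y) - r x‖ₑ * ‖u (x + y) - u x‖ₑ) (hrD.mul S.Dm)]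
    calc _ ≤ ∫⁻ y, (d * R * B) * (ENNReal.ofReal (ker ε y) * ENNReal.ofReal (sg y) ^ (1 + al)) ∂(cubeVol d) := by
          apply lintegral_mono_ae
          filter_upwards [S.uS] with y hy
          calc _ ≤ ENNReal.ofReal (ker ε y) * (d * (ENNReal.ofReal (sg y) * (R * (B * ENNReal.ofReal (sg y) ^ al)))) := by
                gcongr
                refine (S.bv P y (S.Dmy y) (S.Dp y) (Filter.Eventually.of_forall fun x => enorm_ne_top)).trans ?_
                gcongr
            _ = _ := by
              rw [ENNReal.rpow_add_of_nonneg _ _ zero_le_one (by linarith [P.hal]), ENNReal.rpow_one]; ring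
      _ ≤ _ := by
          rw [lintegral_const_mul _ (hkm _)]
          gcongr
          exact ker_moment hε (by linarith [P.hal]) (by linarith [P.hal'])
  refine (add_le_add b1 b2).trans (le_of_eq ?_)
  rw [ENNReal.rpow_add_of_nonneg _ _ zero_le_one (by linarith [P.hal]), ENNReal.rpow_one]
  ring
end comm

/-! ### scalar functions -/

def tau (δ s : ℝ) : ℝ := s / (1 + δ * s)
def PP (γ δ s : ℝ) : ℝ := tau δ s ^ γ
def bb (γ δ s : ℝ) : ℝ := γ * tau δ s ^ (γ - 1) * (1 - δ * tau δ s) ^ 2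
def mm (γ δ s : ℝ) : ℝ := γ * tau δ s ^ (γ - 1) * (1 - δ * tau δ s) ^ 2 *
  ((γ - 1) * (1 - δ * tau δ s) - 2 * (δ * tau δ s))

section scal
variable {γ δ s : ℝ}

theorem tau_pos (hδ : 0 < δ) (hs : 0 < s) : 0 < tau δ s := by unfold tau; positivity
theorem tau_le (hδ : 0 < δ) (hs : 0 < s) : tau δ s ≤ s := by
  unfold tau
  rw [div_le_iff₀ (by positivity)]
  nlinarith [mul_pos hδ (mul_pos hs hs)]
theorem tau_le1 (hδ : 0 < δ) (hs : 0 < s) : δ * tau δ s ≤ 1 := by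
  unfold tau
  rw [← mul_div_assoc, div_le_iff₀ (by positivity)]
  linarith
theorem tau_le2 (hδ : 0 < δ) (hs : 0 < s) : tau δ s ≤ δ⁻¹ := by
  rw [← one_div, le_div_iff₀ hδ, mul_comm]
  exact tau_le1 hδ hs

theorem one_sub_tau (hδ : 0 < δ) (hs : 0 < s) : 1 - δ * tau δ s = (1 + δ * s)⁻¹ := by
  unfold tau
  have : 1 + δ * s ≠ 0 := by positivity
  field_simp
  ring

theorem tau_deriv (hδ : 0 < δ) (hs : 0 < s) : HasDerivAt (tau δ) ((1 - δ * tau δ s) ^ 2) s := by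
  have h0 : 1 + δ * s ≠ 0 := by positivity
  have h1 : HasDerivAt (fun s => 1 + δ * s) δ s := by
    simpa using ((hasDerivAt_id s).const_mul δ).const_add 1
  refine ((hasDerivAt_id s).div h1 h0).congr_deriv ?_
  rw [one_sub_tau hδ hs]
  simp only [id]
  field_simp
  ring

theorem PP_deriv (hδ : 0 < δ) (hs : 0 < s) : HasDerivAt (PP γ δ) (bb γ δ s) s := by
  refine ((tau_deriv hδ hs).rpow_const (p := γ) (Or.inl (tau_pos hδ hs).ne')).congr_deriv ?_
  unfold bb; ring

theorem bb_alg {A y z s : ℝ} (hy : 0 < y) (hz : 0 < z) (hs : s = y / z) :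
    γ * (z ^ 2 * (γ - 1) * (A / y)) * z ^ 2 + γ * A * (2 * z * -(δ * z ^ 2))
      = γ * A * z ^ 2 * ((γ - 1) * z - 2 * (δ * y)) / s := by
  subst hs
  field_simp
  ring

theorem bb_deriv (hδ : 0 < δ) (hs : 0 < s) : HasDerivAt (bb γ δ) (mm γ δ s / s) s := by
  have ht := tau_deriv hδ hs
  have h1 := (ht.rpow_const (p := γ - 1) (Or.inl (tau_pos hδ hs).ne')).const_mul γ
  have h2 : HasDerivAt (fun x => (1 - δ * tau δ x) ^ 2)
      (2 * (1 - δ * tau δ s) * (-(δ * (1 - δ * tau δ s) ^ 2))) s := by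
    have := (((ht.const_mul δ).const_sub 1).fun_pow 2)
    simpa using this
  have hp := tau_pos hδ hs
  have e : tau δ s = s * (1 - δ * tau δ s) := by
    rw [one_sub_tau hδ hs]; unfold tau; rfl
  have hpow : tau δ s ^ (γ - 1 - 1) = tau δ s ^ (γ - 1) / tau δ s := Real.rpow_sub_one hp.ne' _
  have hz0 : 0 < 1 - δ * tau δ s := by rw [one_sub_tau hδ hs]; positivity
  have hz : s = tau δ s / (1 - δ * tau δ s) := by
    rw [eq_div_iff hz0.ne']; exact e.symm
  have h3 : HasDerivAt (fun x => γ * tau δ x ^ (γ - 1) * (1 - δ * tau δ x) ^ 2) _ s := h1.fun_mul h2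
  refine h3.congr_deriv ?_
  rw [hpow]
  unfold mm
  exact bb_alg hp hz0 hz

theorem bb_bound (hγ : 1 < γ) (hδ : 0 < δ) (hs : 0 < s) :
    |bb γ δ s| ≤ γ * tau δ s ^ (γ - 1) := by
  have hp := tau_pos hδ hs
  have h1 := tau_le1 hδ hs
  have h2 : 0 < δ * tau δ s := by positivity
  have h3 : 0 ≤ tau δ s ^ (γ - 1) := Real.rpow_nonneg hp.le _
  unfold bb
  rw [abs_mul, abs_of_nonneg (mul_nonneg (by linarith) h3)]
  refine mul_le_of_le_one_right (mul_nonneg (by linarith) h3) ?_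
  rw [abs_of_nonneg (sq_nonneg _)]
  nlinarith

theorem mm_bound (hγ : 1 < γ) (hδ : 0 < δ) (hs : 0 < s) :
    |mm γ δ s| ≤ γ * (γ + 1) * tau δ s ^ (γ - 1) := by
  have hp := tau_pos hδ hs
  have h1 := tau_le1 hδ hs
  have h2 : 0 < δ * tau δ s := by positivity
  have h := bb_bound hγ hδ hs
  have e : mm γ δ s = bb γ δ s * ((γ - 1) * (1 - δ * tau δ s) - 2 * (δ * tau δ s)) := rfl
  rw [e, abs_mul]
  have h3 : |(γ - 1) * (1 - δ * tau δ s) - 2 * (δ * tau δ s)| ≤ γ + 1 := by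
    rw [abs_le]; constructor <;> nlinarith
  calc _ ≤ (γ * tau δ s ^ (γ - 1)) * (γ + 1) := by gcongr
    _ = _ := by ring

theorem tau_pow_le (p : ℝ) (hp : 0 ≤ p) (hδ : 0 < δ) (hs : 0 < s) :
    tau δ s ^ p ≤ s ^ p :=
  Real.rpow_le_rpow (tau_pos hδ hs).le (tau_le hδ hs) hp

theorem tau_pow_le2 (p : ℝ) (hp : 0 ≤ p) (hδ : 0 < δ) (hs : 0 < s) :
    tau δ s ^ p ≤ δ⁻¹ ^ p :=
  Real.rpow_le_rpow (tau_pos hδ hs).le (tau_le2 hδ hs) hp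

theorem tau_cont (hδ : 0 < δ) (hs : 0 < s) : ContinuousAt (tau δ) s :=
  (tau_deriv hδ hs).continuousAt

theorem PP_cont (hδ : 0 < δ) (hs : 0 < s) : ContinuousAt (PP γ δ) s :=
  (PP_deriv hδ hs).continuousAt

theorem bb_cont (hδ : 0 < δ) (hs : 0 < s) : ContinuousAt (bb γ δ) s :=
  (bb_deriv hδ hs).continuousAt

theorem mm_cont (hδ : 0 < δ) (hs : 0 < s) : ContinuousAt (mm γ δ) s := by
  have h := (tau_cont hδ hs).const_mul δ
  have h1 : ContinuousAt (fun s => 1 - δ * tau δ s) s := continuousAt_const.sub h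
  have h2 : ContinuousAt (fun s => (γ - 1) * (1 - δ * tau δ s) - 2 * (δ * tau δ s)) s :=
    (continuousAt_const.mul h1).sub (continuousAt_const.mul h)
  exact (bb_cont hδ hs).mul h2

theorem tau_meas : Measurable (tau δ) := by unfold tau; fun_prop
theorem PP_meas : Measurable (PP γ δ) := tau_meas.pow_const γ
theorem bb_meas : Measurable (bb γ δ) := by
  have h := tau_meas (δ := δ)
  have h1 : Measurable (fun s => tau δ s ^ (γ - 1)) := h.pow_const _
  unfold bb; fun_prop
theorem mm_meas : Measurable (mm γ δ) := by
  have h := tau_meas (δ := δ)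
  have h1 : Measurable (fun s => tau δ s ^ (γ - 1)) := h.pow_const _
  unfold mm; fun_prop

theorem tau_lim (s : ℝ) : Filter.Tendsto (fun n => tau (ep n) s) Filter.atTop (nhds s) := by
  have h : Filter.Tendsto (fun n => s / (1 + ep n * s)) Filter.atTop (nhds (s / (1 + 0 * s))) :=
    tendsto_const_nhds.div (tendsto_const_nhds.add (ep_tendsto.mul_const s)) (by simp)
  have e : s / (1 + 0 * s) = s := by simp
  rw [e] at h
  exact h

theorem dtau_lim (s : ℝ) : Filter.Tendsto (fun n => ep n * tau (ep n) s) Filter.atTop (nhds 0) := by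
  simpa using ep_tendsto.mul (tau_lim s)

theorem PP_lim (hs : 0 < s) : Filter.Tendsto (fun n => PP γ (ep n) s) Filter.atTop (nhds (s ^ γ)) :=
  (tau_lim s).rpow_const (Or.inl hs.ne')

theorem bb_lim (hs : 0 < s) :
    Filter.Tendsto (fun n => bb γ (ep n) s) Filter.atTop (nhds (γ * s ^ (γ - 1))) := by
  have h := (((tau_lim s).rpow_const (p := γ - 1) (Or.inl hs.ne')).const_mul γ).mul
    (((dtau_lim s).const_sub 1).pow 2)
  have e : γ * s ^ (γ - 1) * (1 - 0) ^ 2 = γ * s ^ (γ - 1) := by ring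
  rw [e] at h
  exact h

theorem mm_lim (hs : 0 < s) :
    Filter.Tendsto (fun n => mm γ (ep n) s) Filter.atTop (nhds (γ * (γ - 1) * s ^ (γ - 1))) := by
  have h := (bb_lim (γ := γ) hs).mul ((((dtau_lim s).const_sub 1).const_mul (γ - 1)).sub
    ((dtau_lim s).const_mul 2))
  have e : γ * s ^ (γ - 1) * ((γ - 1) * (1 - 0) - 2 * 0) = γ * (γ - 1) * s ^ (γ - 1) := by ring
  rw [e] at h
  exact h

theorem PP_lip (hγ : 1 < γ) {c : ℝ} (hc : 0 < c) (hδ : 0 < δ) {a b : ℝ} (ha : c ≤ a) (hb : c ≤ b) :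
    |PP γ δ a - PP γ δ b| ≤ γ * δ⁻¹ ^ (γ - 1) * |a - b| := by
  have := (convex_Ici c).norm_image_sub_le_of_norm_hasDerivWithin_le (f := PP γ δ) (f' := bb γ δ)
    (C := γ * δ⁻¹ ^ (γ - 1)) (x := b) (y := a)
    (fun x hx => (PP_deriv hδ (hc.trans_le hx)).hasDerivWithinAt)
    (fun x hx => by
      refine (bb_bound hγ hδ (hc.trans_le hx)).trans ?_
      have := tau_pow_le2 (γ - 1) (by linarith) hδ (hc.trans_le hx)
      gcongr) hb ha
  simpa using this

/-! kinetic functions -/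
def Aa (δ s : ℝ) : ℝ := Real.sqrt (1 + δ * s ^ 2)
def g0 (δ s : ℝ) : ℝ := (Aa δ s - 1) / δ
def g1 (δ s : ℝ) : ℝ := s / Aa δ s
def g2 (δ s : ℝ) : ℝ := 1 / Aa δ s ^ 3
def ps (δ s : ℝ) : ℝ := (1 / Aa δ s - 1) / δ

theorem Aa_ge (hδ : 0 < δ) (s : ℝ) : 1 ≤ Aa δ s := by
  unfold Aa
  rw [Real.one_le_sqrt]
  nlinarith [mul_nonneg hδ.le (sq_nonneg s)]
theorem Aa_sq (hδ : 0 < δ) (s : ℝ) : Aa δ s ^ 2 = 1 + δ * s ^ 2 := by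
  unfold Aa
  exact Real.sq_sqrt (by positivity)
theorem Aa_ge2 (hδ : 0 < δ) (s : ℝ) : Real.sqrt δ * |s| ≤ Aa δ s := by
  unfold Aa
  rw [← Real.sqrt_sq_eq_abs, ← Real.sqrt_mul hδ.le]
  apply Real.sqrt_le_sqrt
  linarith

theorem Aa_deriv (hδ : 0 < δ) (s : ℝ) : HasDerivAt (Aa δ) (δ * s / Aa δ s) s := by
  have h : HasDerivAt (fun s => 1 + δ * s ^ 2) (δ * (2 * s)) s := by
    simpa using ((hasDerivAt_pow 2 s).const_mul δ).const_add 1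
  refine (h.sqrt (by positivity)).congr_deriv ?_
  change δ * (2 * s) / (2 * Aa δ s) = _
  have := Aa_ge hδ s
  field_simp

theorem g0_deriv (hδ : 0 < δ) (s : ℝ) : HasDerivAt (g0 δ) (g1 δ s) s := by
  refine (((Aa_deriv hδ s).sub_const 1).div_const δ).congr_deriv ?_
  unfold g1
  have := Aa_ge hδ s
  field_simp

theorem g1_deriv (hδ : 0 < δ) (s : ℝ) : HasDerivAt (g1 δ) (g2 δ s) s := by
  have h0 : Aa δ s ≠ 0 := by have := Aa_ge hδ s; positivity
  refine ((hasDerivAt_id s).div (Aa_deriv hδ s) h0).congr_deriv ?_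
  unfold g2
  simp only [id]
  field_simp
  rw [Aa_sq hδ]; ring

theorem ps_deriv (hδ : 0 < δ) (s : ℝ) : HasDerivAt (ps δ) (-s * g2 δ s) s := by
  have h0 : Aa δ s ≠ 0 := by have := Aa_ge hδ s; positivity
  refine (((((hasDerivAt_const s (1 : ℝ)).div (Aa_deriv hδ s) h0).sub_const 1)).div_const δ).congr_deriv ?_
  unfold g2
  field_simp
  ring

theorem ps_eq (hδ : 0 < δ) (s : ℝ) : ps δ s = g0 δ s - s * g1 δ s := by
  have h0 : Aa δ s ≠ 0 := by have := Aa_ge hδ s; positivity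
  unfold ps g0 g1
  field_simp
  linear_combination (-1) * Aa_sq hδ s

theorem ps_bound (hδ : 0 < δ) (s : ℝ) : |ps δ s| ≤ δ⁻¹ := by
  have h := Aa_ge hδ s
  unfold ps
  rw [abs_div, abs_of_pos hδ, div_eq_mul_inv]
  refine mul_le_of_le_one_left (by positivity) ?_
  have h1 : 1 / Aa δ s ≤ 1 := by rw [div_le_one (by positivity)]; exact h
  have h2 : 0 ≤ 1 / Aa δ s := by positivity
  rw [abs_le]; constructor <;> linarith

theorem g1_bound (hδ : 0 < δ) (s : ℝ) : |g1 δ s| ≤ (Real.sqrt δ)⁻¹ := by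
  have h := Aa_ge hδ s
  have h' := Real.sqrt_pos.2 hδ
  unfold g1
  rw [abs_div, abs_of_pos (by linarith : 0 < Aa δ s), div_le_iff₀ (by linarith), ← div_eq_inv_mul,
    le_div_iff₀ h', mul_comm]
  exact Aa_ge2 hδ s

theorem g1_bound2 (hδ : 0 < δ) (s : ℝ) : |g1 δ s| ≤ |s| := by
  have h := Aa_ge hδ s
  unfold g1
  rw [abs_div, abs_of_pos (by linarith : 0 < Aa δ s)]
  exact div_le_self (abs_nonneg _) h

theorem g2_bound (hδ : 0 < δ) (s : ℝ) : |g2 δ s| ≤ 1 := by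
  have h := Aa_ge hδ s
  unfold g2
  rw [abs_of_nonneg (by positivity), div_le_one (by positivity)]
  exact one_le_pow₀ h

theorem g0_eq (hδ : 0 < δ) (s : ℝ) : g0 δ s = s ^ 2 / (1 + Aa δ s) := by
  have h := Aa_ge hδ s
  unfold g0
  rw [div_eq_div_iff hδ.ne' (by positivity)]
  linear_combination Aa_sq hδ s

theorem g0_bound (hδ : 0 < δ) (s : ℝ) : |g0 δ s| ≤ s ^ 2 := by
  have h := Aa_ge hδ s
  rw [g0_eq hδ, abs_of_nonneg (by positivity)]
  exact div_le_self (sq_nonneg _) (by linarith)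

theorem Aa_lim (s : ℝ) : Filter.Tendsto (fun n => Aa (ep n) s) Filter.atTop (nhds 1) := by
  have h : Filter.Tendsto (fun n => Real.sqrt (1 + ep n * s ^ 2)) Filter.atTop
      (nhds (Real.sqrt (1 + 0 * s ^ 2))) :=
    (tendsto_const_nhds.add (ep_tendsto.mul_const _)).sqrt
  have e : Real.sqrt (1 + 0 * s ^ 2) = 1 := by simp
  rw [e] at h
  exact h

theorem g0_lim (s : ℝ) : Filter.Tendsto (fun n => g0 (ep n) s) Filter.atTop (nhds (s ^ 2 / 2)) := by
  have h : Filter.Tendsto (fun n => s ^ 2 / (1 + Aa (ep n) s)) Filter.atTop (nhds (s ^ 2 / (1 + 1))) :=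
    tendsto_const_nhds.div (tendsto_const_nhds.add (Aa_lim s)) (by norm_num)
  norm_num at h
  exact h.congr fun n => (g0_eq (ep_pos n) s).symm

theorem g1_lim (s : ℝ) : Filter.Tendsto (fun n => g1 (ep n) s) Filter.atTop (nhds s) := by
  have h : Filter.Tendsto (fun n => s / Aa (ep n) s) Filter.atTop (nhds (s / 1)) :=
    tendsto_const_nhds.div (Aa_lim s) (by norm_num)
  rw [div_one] at h
  exact h

theorem g0_cont (hδ : 0 < δ) : Continuous (g0 δ) :=
  continuous_iff_continuousAt.2 fun s => (g0_deriv hδ s).continuousAt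
theorem g1_cont (hδ : 0 < δ) : Continuous (g1 δ) :=
  continuous_iff_continuousAt.2 fun s => (g1_deriv hδ s).continuousAt
theorem ps_cont (hδ : 0 < δ) : Continuous (ps δ) :=
  continuous_iff_continuousAt.2 fun s => (ps_deriv hδ s).continuousAt
theorem g2_cont (hδ : 0 < δ) : Continuous (g2 δ) := by
  have hA : Continuous (Aa δ) := continuous_iff_continuousAt.2 fun s => (Aa_deriv hδ s).continuousAt
  refine continuous_const.div (hA.pow 3) fun s => ?_
  have := Aa_ge hδ s
  positivity

/-- kinetic energy density -/
def FK (δ r m : ℝ) : ℝ := r * g0 δ (m / r)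

theorem FK_deriv (hδ : 0 < δ) (f₁ f₂ : ℝ → ℝ) (b₁ b₂ t : ℝ) (h1 : HasDerivAt f₁ b₁ t)
    (h2 : HasDerivAt f₂ b₂ t) (h : f₁ t ≠ 0) :
    HasDerivAt (fun s => FK δ (f₁ s) (f₂ s))
      (ps δ (f₂ t / f₁ t) * b₁ + g1 δ (f₂ t / f₁ t) * b₂) t := by
  have h3 := (h2.div h1 h)
  have h4 := h1.mul ((g0_deriv hδ (f₂ t / f₁ t)).comp t h3)
  refine h4.congr_deriv ?_
  rw [ps_eq hδ]
  simp only [Function.comp_apply, Pi.div_apply]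
  field_simp
  ring

theorem FK_lip (hδ : 0 < δ) {c : ℝ} (hc : 0 < c) (r m r' m' : ℝ) (hr : c ≤ r) (hr' : c ≤ r') :
    |FK δ r m - FK δ r' m'| ≤ (δ⁻¹ + (Real.sqrt δ)⁻¹) * |r - r'| + (δ⁻¹ + (Real.sqrt δ)⁻¹) * |m - m'| := by
  have h1 : |FK δ r m - FK δ r' m| ≤ δ⁻¹ * |r - r'| := by
    have := (convex_Ici c).norm_image_sub_le_of_norm_hasDerivWithin_le (f := fun r => FK δ r m)
      (f' := fun r => ps δ (m / r)) (C := δ⁻¹) (x := r') (y := r)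
      (fun x hx => by
        have hx0 : x ≠ 0 := (hc.trans_le hx).ne'
        have := FK_deriv hδ (fun x => x) (fun _ => m) 1 0 x (hasDerivAt_id x) (hasDerivAt_const x m) hx0
        simpa using this.hasDerivWithinAt)
      (fun x hx => ps_bound hδ _) hr' hr
    simpa using this
  have h2 : |FK δ r' m - FK δ r' m'| ≤ (Real.sqrt δ)⁻¹ * |m - m'| := by
    have := (convex_univ).norm_image_sub_le_of_norm_hasDerivWithin_le (f := fun m => FK δ r' m)
      (f' := fun m => g1 δ (m / r')) (C := (Real.sqrt δ)⁻¹) (x := m') (y := m)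
      (fun x hx => by
        have hx0 : r' ≠ 0 := (hc.trans_le hr').ne'
        have := FK_deriv hδ (fun _ => r') (fun x => x) 0 1 x (hasDerivAt_const x r') (hasDerivAt_id x) hx0
        exact (by simpa using this : HasDerivAt (fun m => FK δ r' m) (g1 δ (x / r')) x).hasDerivWithinAt)
      (fun x hx => g1_bound hδ _) (Set.mem_univ _) (Set.mem_univ _)
    simpa using this
  have h3 : FK δ r m - FK δ r' m' = (FK δ r m - FK δ r' m) + (FK δ r' m - FK δ r' m') := by ring
  rw [h3]
  refine (abs_add_le _ _).trans ((add_le_add h1 h2).trans ?_)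
  have := Real.sqrt_pos.2 hδ
  gcongr <;> simp <;> positivity

theorem FK_zero (hδ : 0 < δ) (r : ℝ) : FK δ r 0 = 0 := by
  unfold FK g0 Aa; simp

theorem FK_meas (hδ : 0 < δ) : Measurable (fun z : ℝ × ℝ => FK δ z.1 z.2) := by
  have := (g0_cont hδ).measurable
  unfold FK; fun_prop
end scal

theorem cont_l1 {α : Type*} [MeasurableSpace α] {μ : Measure α} [IsFiniteMeasure μ]
    {A B : ℕ → α → ℝ} {A' B' : α → ℝ} (hA : ∀ k, Measurable (A k)) (hA' : Measurable A')
    (hB : ∀ k, Measurable (B k)) (hB' : Measurable B')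
    (lA : Filter.Tendsto (fun k => ∫⁻ x, ‖A k x - A' x‖ₑ ∂μ) Filter.atTop (nhds 0))
    (lB : Filter.Tendsto (fun k => ∫⁻ x, ‖B k x - B' x‖ₑ ∂μ) Filter.atTop (nhds 0))
    {c M : ℝ} (cA : ∀ k x, c ≤ A k x) (cA' : ∀ x, c ≤ A' x)
    {h : ℝ → ℝ → ℝ} (hm : Measurable (fun z : ℝ × ℝ => h z.1 z.2))
    (hM : ∀ a b, c ≤ a → |h a b| ≤ M)
    (hc : ∀ a b, c ≤ a → ContinuousAt (fun z : ℝ × ℝ => h z.1 z.2) (a, b)) :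
    Filter.Tendsto (fun k => ∫⁻ x, ‖h (A k x) (B k x) - h (A' x) (B' x)‖ₑ ∂μ) Filter.atTop (nhds 0) := by
  have tim : ∀ (F : ℕ → α → ℝ) (g : α → ℝ), (∀ k, Measurable (F k)) → Measurable g →
      Filter.Tendsto (fun k => ∫⁻ x, ‖F k x - g x‖ₑ ∂μ) Filter.atTop (nhds 0) →
      TendstoInMeasure μ F Filter.atTop g := by
    intro F g hF hg h2
    refine tendstoInMeasure_of_tendsto_eLpNorm (p := 1) one_ne_zero
      (fun k => (hF k).aestronglyMeasurable) hg.aestronglyMeasurable ?_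
    simpa only [eLpNorm_one_eq_lintegral_enorm, Pi.sub_apply] using h2
  apply Filter.tendsto_of_subseq_tendsto
  intro ns hns
  obtain ⟨m1, hm1, ae1⟩ := (tim _ _ (fun k => hA (ns k)) hA' (lA.comp hns)).exists_seq_tendsto_ae
  obtain ⟨m2, hm2, ae2⟩ := (tim _ _ (fun k => hB (ns (m1 k))) hB'
    (lB.comp (hns.comp hm1.tendsto_atTop))).exists_seq_tendsto_ae
  refine ⟨fun k => m1 (m2 k), ?_⟩
  have hmeas : ∀ (f g : α → ℝ), Measurable f → Measurable g → Measurable (fun x => h (f x) (g x)) :=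
    fun f g hf hg => hm.comp (hf.prodMk hg)
  have key := tendsto_lintegral_of_dominated_convergence (μ := μ)
    (F := fun k x => ‖h (A (ns (m1 (m2 k))) x) (B (ns (m1 (m2 k))) x) - h (A' x) (B' x)‖ₑ)
    (f := fun _ => 0) (fun _ => ENNReal.ofReal (M + M))
    (fun k => ((hmeas _ _ (hA _) (hB _)).sub (hmeas _ _ hA' hB')).enorm)
    (fun k => Filter.Eventually.of_forall fun x => by
      change ‖_‖ₑ ≤ _
      rw [Real.enorm_eq_ofReal_abs]
      exact ENNReal.ofReal_le_ofReal ((abs_sub _ _).trans (add_le_add (hM _ _ (cA _ _)) (hM _ _ (cA' _)))))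
    (by simp [ENNReal.mul_eq_top])
    (by
      filter_upwards [ae1, ae2] with x h1 h2
      have h3 : Filter.Tendsto (fun k => A (ns (m1 (m2 k))) x) Filter.atTop (nhds (A' x)) :=
        h1.comp hm2.tendsto_atTop
      have h4 := (hc (A' x) (B' x) (cA' x)).tendsto.comp (h3.prodMk_nhds h2)
      have h5 := (h4.sub_const (h (A' x) (B' x))).enorm
      simpa using h5)
  simpa using key

/-! ### pressure identity on a slice -/

theorem l1_mul_bdd {α : Type*} [MeasurableSpace α] {μ : Measure α} {F : ℕ → α → ℝ} {F' k : α → ℝ}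
    (C : ℝ) (hk : ∀ x, |k x| ≤ C)
    (h : Filter.Tendsto (fun n => ∫⁻ x, ‖F n x - F' x‖ₑ ∂μ) Filter.atTop (nhds 0)) :
    Filter.Tendsto (fun n => ∫⁻ x, ‖k x * F n x - k x * F' x‖ₑ ∂μ) Filter.atTop (nhds 0) := by
  have h1 : Filter.Tendsto (fun n => ENNReal.ofReal C * ∫⁻ x, ‖F n x - F' x‖ₑ ∂μ) Filter.atTop
      (nhds 0) := by
    have := ENNReal.Tendsto.const_mul (a := ENNReal.ofReal C) h (Or.inr ENNReal.ofReal_ne_top)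
    simpa using this
  refine tendsto_of_tendsto_of_tendsto_of_le_of_le tendsto_const_nhds h1 (fun _ => zero_le) ?_
  intro n
  dsimp only
  rw [← lintegral_const_mul' _ _ ENNReal.ofReal_ne_top]
  refine lintegral_mono fun x => ?_
  rw [← mul_sub, enorm_mul, Real.enorm_eq_ofReal_abs (k x)]
  gcongr
  exact hk x

theorem dmol_of_deriv {ε : ℝ} (hε : 0 < ε) (j : Fin d) {f f' : (Fin d → ℝ) → ℝ} (hf : Continuous f)
    (hfp : Per f) (hf' : Continuous f') (hfp' : Per f')
    (hd : ∀ y, HasDerivAt (fun s : ℝ => f (y + s • (Pi.single j (1:ℝ) : Fin d → ℝ))) (f' y) 0)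
    (x : Fin d → ℝ) : dmol ε j f x = mol ε f' x := by
  obtain ⟨C, hC0, hC⟩ := per_bdd hf hfp
  obtain ⟨C', hC0', hC'⟩ := per_bdd hf' hfp'
  have hk : Continuous (fun y => ker ε (y - x)) := (ker_continuous ε).comp (by fun_prop)
  have hdk : Continuous (fun y => dker ε j (y - x)) := (dker_continuous ε j).comp (by fun_prop)
  have kp : Per (fun y : Fin d → ℝ => ker ε (y - x)) := Per.shiftsub (ker_periodic ε) x
  have dkp : Per (fun y : Fin d → ℝ => dker ε j (y - x)) := Per.shiftsub (dker_periodic ε j) x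
  have c1 : Continuous (fun y => f y * ker ε (y - x)) := hf.mul hk
  have c2 : Continuous (fun y => ker ε (y - x) * f' y + dker ε j (y - x) * f y) :=
    (hk.mul hf').add (hdk.mul hf)
  have p1 : Per (fun y => f y * ker ε (y - x)) := hfp.comp2 kp (fun a b => a * b)
  have p2 : Per (fun y => ker ε (y - x) * f' y + dker ε j (y - x) * f y) :=
    (kp.comp2 hfp' (fun a b => a * b)).comp2 (dkp.comp2 hfp (fun a b => a * b)) (fun a b => a + b)
  obtain ⟨D, _, hD⟩ := per_bdd c1 p1
  obtain ⟨D', _, hD'⟩ := per_bdd c2 p2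
  have key := ibp_zero (Pi.single j (1:ℝ) : Fin d → ℝ) c1.measurable p1 D hD c2.measurable D' hD' (by
    intro y
    have h1 := ker_line hε j (y - x)
    have h2 : HasDerivAt (fun s : ℝ => ker ε (y + s • (Pi.single j (1:ℝ) : Fin d → ℝ) - x))
        (dker ε j (y - x)) 0 := by
      refine h1.congr_of_eventuallyEq (Filter.Eventually.of_forall fun s => ?_)
      dsimp only
      congr 1
      abel
    have h3 := (hd y).fun_mul h2
    simp only [zero_smul, add_zero] at h3
    refine h3.congr_deriv ?_
    ring)
  have fP : PI f := PI.bdd hf.measurable hfp C hC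
  have fP' : PI f' := PI.bdd hf'.measurable hfp' C' hC'
  rw [integral_add (kf_int' ε fP' x) (dkf_int' hε j fP x)] at key
  rw [mol_eq ε hfp', dmol]
  linarith

section pres
variable {c q al γ : ℝ} {r : (Fin d → ℝ) → ℝ} {u : (Fin d → ℝ) → Fin d → ℝ}
    {G : Fin d → (Fin d → ℝ) → ℝ} {R B : ℝ≥0∞}

theorem Slice.pow_w (S : Slice c q al r u G R B) (P : Par γ c q al) {f : (Fin d → ℝ) → ℝ}
    (hf : Measurable f) (hfR : nLp (cubeVol d) (div3Exp q) (fun x => ‖f x‖ₑ) ≤ R) :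
    ∫⁻ x, ‖f x‖ₑ ^ γ * ‖u x‖ₑ ∂(cubeVol d) ≤ R ^ γ * B := by
  refine (holder_g1 (cubeVol d) hf.enorm.aemeasurable S.um.enorm.aemeasurable γ q P.hγ P.hq P.hq').trans ?_
  have := P.hγ
  gcongr
  exact S.uB

theorem Slice.pow_1 (_S : Slice c q al r u G R B) (P : Par γ c q al) {f : (Fin d → ℝ) → ℝ}
    (hf : Measurable f) (hfR : nLp (cubeVol d) (div3Exp q) (fun x => ‖f x‖ₑ) ≤ R) :
    ∫⁻ x, ‖f x‖ₑ ^ γ ∂(cubeVol d) ≤ R ^ γ := by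
  have hγ := P.hγ
  have h := holder_gen (cubeVol d) hf.enorm.aemeasurable (g := fun _ => 1) aemeasurable_const q γ 0 P.hq
    (by linarith) le_rfl (by have := gamma_exp P.hγ P.hq'; linarith)
  simp at h
  refine h.trans ?_
  gcongr

theorem young_el {a g : ℝ} (hγ : 1 < γ) (ha : 0 < a) :
    ‖a ^ (γ - 1) * g‖ₑ ≤ ‖a‖ₑ ^ γ + ‖g‖ₑ ^ γ := by
  rw [Real.enorm_eq_ofReal_abs, Real.enorm_eq_ofReal_abs a, Real.enorm_eq_ofReal_abs g,
    ENNReal.ofReal_rpow_of_nonneg (abs_nonneg _) (by linarith),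
    ENNReal.ofReal_rpow_of_nonneg (abs_nonneg _) (by linarith),
    ← ENNReal.ofReal_add (by positivity) (by positivity)]
  apply ENNReal.ofReal_le_ofReal
  rw [abs_mul, abs_of_nonneg (Real.rpow_nonneg ha.le _), abs_of_pos ha]
  have e : ∀ x : ℝ, 0 < x → x ^ γ = x ^ (γ - 1) * x := fun x hx => by
    rw [Real.rpow_sub_one hx.ne']; field_simp
  rcases le_total |g| a with h | h
  · have : 0 ≤ |g| ^ γ := by positivity
    rw [e a ha]
    have : a ^ (γ - 1) * |g| ≤ a ^ (γ - 1) * a := by gcongr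
    linarith
  · have h0 : 0 < |g| := ha.trans_le h
    have : 0 ≤ a ^ γ := by positivity
    rw [e _ h0]
    have : a ^ (γ - 1) * |g| ≤ |g| ^ (γ - 1) * |g| := by
      gcongr
    linarith

/-- pressure gradient (without kappa) -/
def Qg (γ : ℝ) (r : (Fin d → ℝ) → ℝ) (g : (Fin d → ℝ) → ℝ) (x : Fin d → ℝ) : ℝ :=
  γ * (r x ^ (γ - 1) * g x)

theorem Slice.rpos (S : Slice c q al r u G R B) (P : Par γ c q al) (x : Fin d → ℝ) : 0 < r x :=
  P.hc.trans_le (S.rc x)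

theorem Slice.rgPI (S : Slice c q al r u G R B) (P : Par γ c q al) : PI (fun x => r x ^ γ) := by
  refine PI.mk' (S.rm.pow_const γ) (S.rp.comp (fun a => a ^ γ)) ?_
  have hγ := P.hγ
  refine lt_of_le_of_lt (b := ∫⁻ x, ‖r x‖ₑ ^ γ ∂(cubeVol d)) (lintegral_mono fun x => ?_)
    ((S.pow_1 P S.rm S.rR).trans_lt (ENNReal.rpow_lt_top_of_nonneg (by linarith) S.RT))
  have := S.rpos P x
  rw [Real.enorm_of_nonneg (by positivity), Real.enorm_of_nonneg this.le,
    ENNReal.ofReal_rpow_of_nonneg this.le (by linarith)]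

theorem Slice.Qm (S : Slice c q al r u G R B) (i : Fin d) : Measurable (Qg γ r (G i)) :=
  ((S.rm.pow_const (γ - 1)).mul (S.GP i).meas).const_mul γ

theorem Slice.Qp (S : Slice c q al r u G R B) (i : Fin d) : Per (Qg γ r (G i)) :=
  S.rp.comp2 (S.GP i).per (fun a b => γ * (a ^ (γ - 1) * b))

theorem Slice.Q_le (S : Slice c q al r u G R B) (P : Par γ c q al) (i : Fin d) (x : Fin d → ℝ) :
    ‖Qg γ r (G i) x‖ₑ ≤ ENNReal.ofReal γ * (‖r x‖ₑ ^ γ + ‖G i x‖ₑ ^ γ) := by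
  have hγ := P.hγ
  unfold Qg
  rw [enorm_mul, Real.enorm_of_nonneg (by linarith : 0 ≤ γ)]
  gcongr
  exact young_el hγ (S.rpos P x)

theorem Slice.QPI (S : Slice c q al r u G R B) (P : Par γ c q al) (i : Fin d) : PI (Qg γ r (G i)) := by
  have hγ := P.hγ
  refine PI.mk' (S.Qm i) (S.Qp i) ?_
  refine (lintegral_mono (S.Q_le P i)).trans_lt ?_
  rw [lintegral_const_mul' _ _ ENNReal.ofReal_ne_top, lintegral_add_left (S.rm.enorm.pow_const γ)]
  refine ENNReal.mul_lt_top ENNReal.ofReal_lt_top (ENNReal.add_lt_top.2 ⟨?_, ?_⟩)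
  · exact (S.pow_1 P S.rm S.rR).trans_lt (ENNReal.rpow_lt_top_of_nonneg (by linarith) S.RT)
  · exact (S.pow_1 P (S.GP i).meas (S.GR i)).trans_lt (ENNReal.rpow_lt_top_of_nonneg (by linarith) S.RT)

theorem Slice.Qu (S : Slice c q al r u G R B) (P : Par γ c q al) (i : Fin d) :
    ∫⁻ x, ‖Qg γ r (G i) x‖ₑ * ‖u x‖ₑ ∂(cubeVol d) ≤ ENNReal.ofReal γ * (2 * (R ^ γ * B)) := by
  calc _ ≤ ∫⁻ x, ENNReal.ofReal γ * (‖r x‖ₑ ^ γ * ‖u x‖ₑ + ‖G i x‖ₑ ^ γ * ‖u x‖ₑ) ∂(cubeVol d) := by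
        refine lintegral_mono fun x => ?_
        dsimp only
        rw [← add_mul, ← mul_assoc]
        gcongr
        exact S.Q_le P i x
    _ ≤ _ := by
        rw [lintegral_const_mul' _ _ ENNReal.ofReal_ne_top,
          lintegral_add_left (f := fun x => ‖r x‖ₑ ^ γ * ‖u x‖ₑ) ((S.rm.enorm.pow_const γ).mul S.um.enorm), two_mul]
        gcongr
        · exact S.pow_w P S.rm S.rR
        · exact S.pow_w P (S.GP i).meas (S.GR i)

theorem Slice.QuPI (S : Slice c q al r u G R B) (P : Par γ c q al) (i j : Fin d) :
    PI (fun x => Qg γ r (G i) x * u x j) := by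
  have hγ := P.hγ
  refine PI.mk' ((S.Qm i).mul (S.ui_m j)) ((S.Qp i).comp2 (S.ui_p j) (fun a b => a * b)) ?_
  refine (lintegral_mono (g := fun x => ‖Qg γ r (G i) x‖ₑ * ‖u x‖ₑ) fun x => ?_).trans_lt
    ((S.Qu P i).trans_lt ?_)
  · dsimp only
    rw [enorm_mul]
    gcongr
    exact enorm_coord _ _
  · exact ENNReal.mul_lt_top ENNReal.ofReal_lt_top (ENNReal.mul_lt_top (by simp)
      (ENNReal.mul_lt_top (ENNReal.rpow_lt_top_of_nonneg (by linarith) S.RT) S.BT.lt_top))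

theorem Slice.bbG_le (S : Slice c q al r u G R B) (P : Par γ c q al) {δ : ℝ} (hδ : 0 < δ) (i : Fin d)
    (x : Fin d → ℝ) : |bb γ δ (r x) * G i x| ≤ |Qg γ r (G i) x| := by
  have hγ := P.hγ
  have hr := S.rpos P x
  unfold Qg
  have h1 : |bb γ δ (r x)| ≤ |γ * r x ^ (γ - 1)| := by
    refine (bb_bound hγ hδ hr).trans (le_trans ?_ (le_abs_self _))
    have := tau_pow_le (γ - 1) (by linarith) hδ hr
    gcongr
  rw [abs_mul, ← mul_assoc, abs_mul (γ * _)]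
  exact mul_le_mul_of_nonneg_right h1 (abs_nonneg _)

theorem Slice.Wge (S : Slice c q al r u G R B) (P : Par γ c q al) (ε : ℝ) (x : Fin d → ℝ) :
    c ≤ mol ε r x := le_mol ε (S.rPI P) c S.rc x

theorem PP_bound {δ s : ℝ} (hγ : 1 < γ) (hδ : 0 < δ) (hs : 0 < s) : |PP γ δ s| ≤ δ⁻¹ ^ γ := by
  unfold PP
  rw [abs_of_nonneg (Real.rpow_nonneg (tau_pos hδ hs).le _)]
  exact tau_pow_le2 γ (by linarith) hδ hs

theorem bb_bound2 {δ s : ℝ} (hγ : 1 < γ) (hδ : 0 < δ) (hs : 0 < s) :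
    |bb γ δ s| ≤ γ * δ⁻¹ ^ (γ - 1) :=
  (bb_bound hγ hδ hs).trans (mul_le_mul_of_nonneg_left (tau_pow_le2 (γ - 1) (by linarith) hδ hs)
    (by linarith))

theorem mm_bound2 {δ s : ℝ} (hγ : 1 < γ) (hδ : 0 < δ) (hs : 0 < s) :
    |mm γ δ s| ≤ γ * (γ + 1) * δ⁻¹ ^ (γ - 1) :=
  (mm_bound hγ hδ hs).trans (mul_le_mul_of_nonneg_left (tau_pow_le2 (γ - 1) (by linarith) hδ hs)
    (by nlinarith))

/-- one variable version of `cont_l1` for `h (mol r)` -/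
theorem Slice.l1W (S : Slice c q al r u G R B) (P : Par γ c q al) {h : ℝ → ℝ} (M : ℝ)
    (hm : Measurable h) (hM : ∀ a, 0 < a → |h a| ≤ M) (hc : ∀ a, 0 < a → ContinuousAt h a) :
    Filter.Tendsto (fun k => ∫⁻ x, ‖h (mol (ep k) r x) - h (r x)‖ₑ ∂(cubeVol d)) Filter.atTop (nhds 0) := by
  have hl := mol_tendsto (S.rPI P)
  exact cont_l1 (A := fun k => mol (ep k) r) (A' := r) (B := fun k => mol (ep k) r) (B' := r)
    (fun k => (mol_continuous _ (S.rPI P)).measurable) S.rm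
    (fun k => (mol_continuous _ (S.rPI P)).measurable) S.rm hl hl
    (fun k x => S.Wge P _ x) S.rc (h := fun a _ => h a) (hm.comp measurable_fst)
    (fun a _ ha => hM a (P.hc.trans_le ha))
    (fun a b ha => (hc a (P.hc.trans_le ha)).comp (f := fun z : ℝ × ℝ => z.1) (x := (a, b)) continuousAt_fst)

theorem Slice.hW_cont (S : Slice c q al r u G R B) (P : Par γ c q al) (ε : ℝ) {h : ℝ → ℝ}
    (hc : ∀ a, 0 < a → ContinuousAt h a) : Continuous (fun x => h (mol ε r x)) := by
  rw [continuous_iff_continuousAt]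
  intro x
  exact (hc _ (P.hc.trans_le (S.Wge P ε x))).comp (f := fun x => mol ε r x)
    (mol_continuous ε (S.rPI P)).continuousAt

theorem Slice.hW_deriv (S : Slice c q al r u G R B) (P : Par γ c q al) {ε : ℝ} (hε : 0 < ε) {h h' : ℝ → ℝ}
    (hc : ∀ a, 0 < a → HasDerivAt h (h' a) a) (x : Fin d → ℝ) (j : Fin d) :
    HasDerivAt (fun s : ℝ => h (mol ε r (x + s • (Pi.single j (1:ℝ) : Fin d → ℝ))))
      (h' (mol ε r x) * dmol ε j r x) 0 := by
  have h1 := mol_hasDerivAt_i hε (S.rPI P) x j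
  have h2 := hc _ (P.hc.trans_le (S.Wge P ε x))
  have h3 : HasDerivAt h (h' (mol ε r x)) (mol ε r (x + (0:ℝ) • (Pi.single j (1:ℝ) : Fin d → ℝ))) := by
    simpa using h2
  exact HasDerivAt.comp (0:ℝ) h3 h1

theorem Slice.pres_δ (S : Slice c q al r u G R B) (P : Par γ c q al) {δ : ℝ} (hδ : 0 < δ) (n : ℕ)
    (j : Fin d) (x : Fin d → ℝ) :
    dmol (ep n) j (fun y => PP γ δ (r y)) x = mol (ep n) (fun y => bb γ δ (r y) * G j y) x := by
  have hγ := P.hγ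
  have hr := fun x => S.rpos P x
  have hp : 0 < ep n := ep_pos n
  have hWp : ∀ m x, 0 < mol (ep m) r x := fun m x => P.hc.trans_le (S.Wge P _ x)
  have rP := S.rPI P
  have e : ∀ m, dmol (ep n) j (fun y => PP γ δ (mol (ep m) r y)) x =
      mol (ep n) (fun y => bb γ δ (mol (ep m) r y) * mol (ep m) (G j) y) x := by
    intro m
    apply dmol_of_deriv hp j
    · exact S.hW_cont P _ (fun a ha => PP_cont hδ ha)
    · exact (mol_per _ S.rp).comp _
    · exact (S.hW_cont P _ (fun a ha => bb_cont hδ ha)).mul (mol_continuous _ (S.GP j))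
    · exact (mol_per _ S.rp).comp2 (mol_per _ (S.GP j).per) (fun a b => bb γ δ a * b)
    · intro y
      rw [← S.grad]
      exact S.hW_deriv P (ep_pos m) (fun a ha => PP_deriv hδ ha) y j
  have dkc : Continuous (fun y => dker (ep n) j (y - x)) := (dker_continuous _ j).comp (by fun_prop)
  have l1 : Filter.Tendsto (fun m => dmol (ep n) j (fun y => PP γ δ (mol (ep m) r y)) x) Filter.atTop
      (nhds (dmol (ep n) j (fun y => PP γ δ (r y)) x)) := by
    have b := bl_tendsto (cubeVol d) (fun m y => PP γ δ (mol (ep m) r y)) (fun y => PP γ δ (r y))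
      (fun _ y => dker (ep n) j (y - x)) (fun y => dker (ep n) j (y - x)) (δ⁻¹ ^ γ)
      (fun m => (PP_meas.comp (mol_continuous _ rP).measurable).aestronglyMeasurable)
      (PP_meas.comp S.rm).aestronglyMeasurable (fun m y => PP_bound hγ hδ (hWp m y))
      (fun _ => bdd_integrable dkc.aestronglyMeasurable _ (fun y => dker_le hp j _))
      (bdd_integrable dkc.aestronglyMeasurable _ (fun y => dker_le hp j _))
      (S.l1W P (δ⁻¹ ^ γ) PP_meas (fun a ha => PP_bound hγ hδ ha) (fun a ha => PP_cont hδ ha))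
      (by simp)
    have b' := b.neg
    simp only [dmol]
    simpa only [mul_comm] using b'
  have l2 : Filter.Tendsto (fun m => mol (ep n) (fun y => bb γ δ (mol (ep m) r y) * mol (ep m) (G j) y) x)
      Filter.atTop (nhds (mol (ep n) (fun y => bb γ δ (r y) * G j y) x)) := by
    have b := bl_tendsto (cubeVol d) (fun m y => bb γ δ (mol (ep m) r y)) (fun y => bb γ δ (r y))
      (fun m y => ker (ep n) (y - x) * mol (ep m) (G j) y) (fun y => ker (ep n) (y - x) * G j y)
      (γ * δ⁻¹ ^ (γ - 1))
      (fun m => (bb_meas.comp (mol_continuous _ rP).measurable).aestronglyMeasurable)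
      (bb_meas.comp S.rm).aestronglyMeasurable (fun m y => bb_bound2 hγ hδ (hWp m y))
      (fun m => kf_int' _ (mol_PI _ (S.GP j)) x)
      (kf_int' _ (S.GP j) x)
      (S.l1W P (γ * δ⁻¹ ^ (γ - 1)) bb_meas (fun a ha => bb_bound2 hγ hδ ha) (fun a ha => bb_cont hδ ha))
      (l1_mul_bdd (((kN (ep n))⁻¹) ^ d) (fun y => by
        rw [abs_of_pos (ker_pos _ _)]; exact ker_le _ _) (mol_tendsto (S.GP j)))
    have e1 : ∀ m, mol (ep n) (fun y => bb γ δ (mol (ep m) r y) * mol (ep m) (G j) y) x =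
        ∫ y, bb γ δ (mol (ep m) r y) * (ker (ep n) (y - x) * mol (ep m) (G j) y) ∂(cubeVol d) := by
      intro m
      rw [mol_eq]
      · congr 1; ext y; ring
      · exact (mol_per _ S.rp).comp2 (mol_per _ (S.GP j).per) (fun a b => bb γ δ a * b)
    have e2 : mol (ep n) (fun y => bb γ δ (r y) * G j y) x =
        ∫ y, bb γ δ (r y) * (ker (ep n) (y - x) * G j y) ∂(cubeVol d) := by
      rw [mol_eq]
      · congr 1; ext y; ring
      · exact S.rp.comp2 (S.GP j).per (fun a b => bb γ δ a * b)
    simp only [e1, e2]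
    exact b
  simp only [e] at l1
  exact tendsto_nhds_unique l1 l2

/-- derivative of the mollified pressure -/
theorem Slice.pres (S : Slice c q al r u G R B) (P : Par γ c q al) (n : ℕ)
    (j : Fin d) (x : Fin d → ℝ) :
    dmol (ep n) j (fun y => r y ^ γ) x = mol (ep n) (Qg γ r (G j)) x := by
  have hγ := P.hγ
  have hr := fun x => S.rpos P x
  have hp : 0 < ep n := ep_pos n
  have dkc : Continuous (fun y => dker (ep n) j (y - x)) := (dker_continuous _ j).comp (by fun_prop)
  have kc : Continuous (fun y => ker (ep n) (y - x)) := (ker_continuous _).comp (by fun_prop)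
  have l1 : Filter.Tendsto (fun m => dmol (ep n) j (fun y => PP γ (ep m) (r y)) x) Filter.atTop
      (nhds (dmol (ep n) j (fun y => r y ^ γ) x)) := by
    simp only [dmol]
    refine Filter.Tendsto.neg ?_
    refine tendsto_integral_of_dominated_convergence (fun y => |dker (ep n) j (y - x) * r y ^ γ|)
      (fun m => (dkc.measurable.mul (PP_meas.comp S.rm)).aestronglyMeasurable)
      (dkf_int' hp j (S.rgPI P) x).abs (fun m => Filter.Eventually.of_forall fun y => ?_)
      (Filter.Eventually.of_forall fun y => ?_)
    · rw [Real.norm_eq_abs, abs_mul, abs_mul]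
      gcongr
      unfold PP
      exact Real.rpow_nonneg (tau_pos (ep_pos m) (hr y)).le _
      exact tau_pow_le γ (by linarith) (ep_pos m) (hr y)
    · exact (PP_lim (hr y)).const_mul _
  have l2 : Filter.Tendsto (fun m => mol (ep n) (fun y => bb γ (ep m) (r y) * G j y) x)
      Filter.atTop (nhds (mol (ep n) (Qg γ r (G j)) x)) := by
    have e2 : ∀ m, mol (ep n) (fun y => bb γ (ep m) (r y) * G j y) x =
        ∫ y, ker (ep n) (y - x) * (bb γ (ep m) (r y) * G j y) ∂(cubeVol d) := by
      intro m
      rw [mol_eq]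
      exact S.rp.comp2 (S.GP j).per (fun a b => bb γ (ep m) a * b)
    simp only [e2]
    rw [mol_eq _ (S.Qp j)]
    refine tendsto_integral_of_dominated_convergence (fun y => |ker (ep n) (y - x) * Qg γ r (G j) y|)
      (fun m => (kc.measurable.mul ((bb_meas.comp S.rm).mul (S.GP j).meas)).aestronglyMeasurable)
      (kf_int' _ (S.QPI P j) x).abs (fun m => Filter.Eventually.of_forall fun y => ?_)
      (Filter.Eventually.of_forall fun y => ?_)
    · rw [Real.norm_eq_abs, abs_mul, abs_mul (ker _ _) (Qg _ _ _ _)]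
      exact mul_le_mul_of_nonneg_left (S.bbG_le P (ep_pos m) j y) (abs_nonneg _)
    · have := (((bb_lim (γ := γ) (hr y)).mul_const (G j y))).const_mul (ker (ep n) (y - x))
      unfold Qg
      rw [← mul_assoc γ]
      exact this
  have e := fun m => S.pres_δ P (ep_pos m) n j x
  simp only [e] at l1
  exact tendsto_nhds_unique l1 l2

end pres

/-! ### kinetic energy on a slice -/

section kin
variable {c q al γ : ℝ} {r : (Fin d → ℝ) → ℝ} {u : (Fin d → ℝ) → Fin d → ℝ}
    {G : Fin d → (Fin d → ℝ) → ℝ} {R B : ℝ≥0∞}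

theorem per_int {f : (Fin d → ℝ) → ℝ} (hf : Continuous f) (hp : Per f) : Integrable f (cubeVol d) := by
  obtain ⟨C, _, hC⟩ := per_bdd hf hp
  exact bdd_integrable hf.aestronglyMeasurable C hC

theorem ibp_cont {f f' : (Fin d → ℝ) → ℝ} (e : Fin d → ℝ) (hf : Continuous f) (hfp : Per f)
    (hf' : Continuous f') (hfp' : Per f')
    (hd : ∀ x, HasDerivAt (fun s : ℝ => f (x + s • e)) (f' x) 0) :
    ∫ x, f' x ∂(cubeVol d) = 0 := by
  obtain ⟨C, _, hC⟩ := per_bdd hf hfp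
  obtain ⟨C', _, hC'⟩ := per_bdd hf' hfp'
  exact ibp_zero e hf.measurable hfp C hC hf'.measurable C' hC' hd

theorem Slice.ruPI (S : Slice c q al r u G R B) (P : Par γ c q al) (i : Fin d) :
    PI (fun x => r x * u x i) := S.fuPI P S.rm S.rp S.rR i

theorem Slice.ru2 (S : Slice c q al r u G R B) (P : Par γ c q al) :
    ∫⁻ x, ‖r x‖ₑ * ‖u x‖ₑ ^ (2 : ℝ) ∂(cubeVol d) ≤ R * B ^ (2 : ℝ) := by
  have h := holder_gen (cubeVol d) S.rm.enorm.aemeasurable S.um.enorm.aemeasurable q 1 2 P.hq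
    (by norm_num) (by norm_num) (by linarith)
  simp only [ENNReal.rpow_one, measure_univ, ENNReal.one_rpow, mul_one] at h
  refine h.trans ?_
  gcongr
  · exact S.rR
  · exact S.uB

theorem Slice.ru3 (S : Slice c q al r u G R B) (P : Par γ c q al) :
    ∫⁻ x, ‖r x‖ₑ * ‖u x‖ₑ ^ (3 : ℝ) ∂(cubeVol d) ≤ R * B ^ (3 : ℝ) := by
  refine (holder_31 (cubeVol d) S.rm.enorm.aemeasurable S.um.enorm.aemeasurable q P.hq).trans ?_
  gcongr
  · exact S.rR
  · exact S.uB

theorem Slice.RB3 (S : Slice c q al r u G R B) : R * B ^ (3 : ℝ) < ∞ :=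
  ENNReal.mul_lt_top S.RT.lt_top (ENNReal.rpow_lt_top_of_nonneg (by norm_num) S.BT)

theorem Slice.B_le (S : Slice c q al r u G R B) {s : ℝ} (hs : s ≤ 3) : B ^ s ≤ B ^ (3 : ℝ) :=
  ENNReal.rpow_le_rpow_of_exponent_le S.B1 hs

theorem Slice.ruu_lint (S : Slice c q al r u G R B) (P : Par γ c q al) (i j : Fin d) :
    ∫⁻ x, ‖r x * u x i * u x j‖ₑ ∂(cubeVol d) ≤ R * B ^ (3 : ℝ) := by
  refine (lintegral_mono fun x => ?_).trans ((S.ru2 P).trans (by gcongr R * ?_; exact S.B_le (s := 2) (by norm_num)))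
  dsimp only
  rw [enorm_mul, enorm_mul, mul_assoc]
  have : ‖u x‖ₑ ^ (2 : ℝ) = ‖u x‖ₑ * ‖u x‖ₑ := by
    rw [ENNReal.rpow_two, sq]
  rw [this]
  gcongr <;> exact enorm_coord _ _

theorem Slice.ruuPI (S : Slice c q al r u G R B) (P : Par γ c q al) (i j : Fin d) :
    PI (fun x => r x * u x i * u x j) :=
  PI.mk' ((S.rm.mul (S.ui_m i)).mul (S.ui_m j))
    ((S.rp.comp2 (S.ui_p i) (fun a b => a * b)).comp2 (S.ui_p j) (fun a b => a * b))
    ((S.ruu_lint P i j).trans_lt S.RB3)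

theorem Slice.ru3PI (S : Slice c q al r u G R B) (P : Par γ c q al) :
    PI (fun x => r x * ‖u x‖ ^ 3) := by
  refine PI.mk' (S.rm.mul (S.um.norm.pow_const 3)) (S.rp.comp2 S.up (fun a b => a * ‖b‖ ^ 3)) ?_
  refine lt_of_le_of_lt (lintegral_mono fun x => ?_) ((S.ru3 P).trans_lt S.RB3)
  dsimp only
  rw [enorm_mul]
  gcongr
  rw [enorm_pow, enorm_norm]
  exact (by norm_num : (3:ℝ) = ((3:ℕ):ℝ)) ▸ (ENNReal.rpow_natCast _ 3).symm.le

/-- Favre velocity -/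
def VV (ε : ℝ) (r : (Fin d → ℝ) → ℝ) (u : (Fin d → ℝ) → Fin d → ℝ) (j : Fin d) (x : Fin d → ℝ) : ℝ :=
  mol ε (fun x => r x * u x j) x / mol ε r x

/-- its derivative -/
def dVV (ε : ℝ) (r : (Fin d → ℝ) → ℝ) (u : (Fin d → ℝ) → Fin d → ℝ) (i j : Fin d) (x : Fin d → ℝ) : ℝ :=
  (dmol ε i (fun x => r x * u x j) x - VV ε r u j x * dmol ε i r x) / mol ε r x

theorem Slice.VV_cont (S : Slice c q al r u G R B) (P : Par γ c q al) (ε : ℝ) (j : Fin d) :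
    Continuous (VV ε r u j) :=
  (mol_continuous ε (S.ruPI P j)).div (mol_continuous ε (S.rPI P))
    (fun x => (P.hc.trans_le (S.Wge P ε x)).ne')

theorem Slice.VV_per (S : Slice c q al r u G R B) (P : Par γ c q al) (ε : ℝ) (j : Fin d) :
    Per (VV ε r u j) :=
  (mol_per ε (S.ruPI P j).per).comp2 (mol_per ε S.rp) (fun a b => a / b)

theorem Slice.dVV_cont (S : Slice c q al r u G R B) (P : Par γ c q al) {ε : ℝ} (hε : 0 < ε)
    (i j : Fin d) : Continuous (dVV ε r u i j) :=
  ((dmol_continuous hε i (S.ruPI P j)).sub ((S.VV_cont P ε j).mul (dmol_continuous hε i (S.rPI P)))).div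
    (mol_continuous ε (S.rPI P)) (fun x => (P.hc.trans_le (S.Wge P ε x)).ne')

theorem Slice.dVV_per (S : Slice c q al r u G R B) (P : Par γ c q al) (ε : ℝ) (i j : Fin d) :
    Per (dVV ε r u i j) :=
  ((dmol_per ε i (S.ruPI P j).per).comp2 ((S.VV_per P ε j).comp2 (dmol_per ε i S.rp)
    (fun a b => a * b)) (fun a b => a - b)).comp2 (mol_per ε S.rp) (fun a b => a / b)

theorem Slice.VV_deriv (S : Slice c q al r u G R B) (P : Par γ c q al) {ε : ℝ} (hε : 0 < ε)
    (i j : Fin d) (x : Fin d → ℝ) :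
    HasDerivAt (fun s : ℝ => VV ε r u j (x + s • (Pi.single i (1:ℝ) : Fin d → ℝ))) (dVV ε r u i j x) 0 := by
  have h1 := mol_hasDerivAt_i hε (S.ruPI P j) x i
  have h2 := mol_hasDerivAt_i hε (S.rPI P) x i
  have h0 := (P.hc.trans_le (S.Wge P ε x)).ne'
  have h3 := h1.fun_div h2 (by simpa using h0)
  simp only [zero_smul, add_zero] at h3
  refine h3.congr_deriv ?_
  unfold dVV VV
  field_simp

theorem Slice.comp_deriv (S : Slice c q al r u G R B) (P : Par γ c q al) {ε : ℝ} (hε : 0 < ε)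
    {h : ℝ → ℝ} {h' : ℝ → ℝ} (hh : ∀ s, HasDerivAt h (h' s) s) (i j : Fin d) (x : Fin d → ℝ) :
    HasDerivAt (fun s : ℝ => h (VV ε r u j (x + s • (Pi.single i (1:ℝ) : Fin d → ℝ))))
      (h' (VV ε r u j x) * dVV ε r u i j x) 0 := by
  have h1 := S.VV_deriv P hε i j x
  have h3 : HasDerivAt h (h' (VV ε r u j x)) (VV ε r u j (x + (0:ℝ) • (Pi.single i (1:ℝ) : Fin d → ℝ))) := by
    simpa using hh (VV ε r u j x)
  exact HasDerivAt.comp (0:ℝ) h3 h1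

theorem Slice.kin_ibp (S : Slice c q al r u G R B) (P : Par γ c q al) {ε δ : ℝ} (hε : 0 < ε) (hδ : 0 < δ)
    (i j : Fin d) :
    ∫ x, (ps δ (VV ε r u j x) * dmol ε i (fun x => r x * u x i) x +
      g1 δ (VV ε r u j x) * dmol ε i (fun x => r x * u x i * u x j) x) ∂(cubeVol d) =
    ∫ x, g2 δ (VV ε r u j x) * (dVV ε r u i j x * (VV ε r u j x * mol ε (fun x => r x * u x i) x
      - mol ε (fun x => r x * u x i * u x j) x)) ∂(cubeVol d) := by
  have cV := S.VV_cont P ε j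
  have cdV := S.dVV_cont P hε i j
  have cN := mol_continuous ε (S.ruPI P i)
  have cT := mol_continuous ε (S.ruuPI P i j)
  have cdN := dmol_continuous hε i (S.ruPI P i)
  have cdT := dmol_continuous hε i (S.ruuPI P i j)
  have pV := S.VV_per P ε j
  have pdV := S.dVV_per P ε i j
  have pN := mol_per ε (S.ruPI P i).per
  have pT := mol_per ε (S.ruuPI P i j).per
  have pdN := dmol_per ε i (S.ruPI P i).per
  have pdT := dmol_per ε i (S.ruuPI P i j).per
  have cps := (ps_cont hδ).comp cV
  have cg1 := (g1_cont hδ).comp cV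
  have cg2 := (g2_cont hδ).comp cV
  simp only [Function.comp_def] at cps cg1 cg2
  have c1 : Continuous (fun x => ps δ (VV ε r u j x) * dmol ε i (fun x => r x * u x i) x +
      g1 δ (VV ε r u j x) * dmol ε i (fun x => r x * u x i * u x j) x) :=
    (cps.mul cdN).add (cg1.mul cdT)
  have p1 : Per (fun x => ps δ (VV ε r u j x) * dmol ε i (fun x => r x * u x i) x +
      g1 δ (VV ε r u j x) * dmol ε i (fun x => r x * u x i * u x j) x) :=
    (pV.comp2 pdN (fun a b => ps δ a * b)).comp2 (pV.comp2 pdT (fun a b => g1 δ a * b)) (fun a b => a + b)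
  have c2 : Continuous (fun x => g2 δ (VV ε r u j x) * (dVV ε r u i j x *
      (VV ε r u j x * mol ε (fun x => r x * u x i) x - mol ε (fun x => r x * u x i * u x j) x))) :=
    cg2.mul (cdV.mul ((cV.mul cN).sub cT))
  have p2 : Per (fun x => g2 δ (VV ε r u j x) * (dVV ε r u i j x *
      (VV ε r u j x * mol ε (fun x => r x * u x i) x - mol ε (fun x => r x * u x i * u x j) x))) :=
    pV.comp2 (pdV.comp2 ((pV.comp2 pN (fun a b => a * b)).comp2 pT (fun a b => a - b)) (fun a b => a * b))
      (fun a b => g2 δ a * b)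
  rw [← sub_eq_zero, ← integral_sub (per_int c1 p1) (per_int c2 p2)]
  refine ibp_cont (Pi.single i (1:ℝ) : Fin d → ℝ)
    (f := fun x => ps δ (VV ε r u j x) * mol ε (fun x => r x * u x i) x +
      g1 δ (VV ε r u j x) * mol ε (fun x => r x * u x i * u x j) x)
    ((cps.mul cN).add (cg1.mul cT))
    ((pV.comp2 pN (fun a b => ps δ a * b)).comp2 (pV.comp2 pT (fun a b => g1 δ a * b)) (fun a b => a + b))
    (c1.sub c2) (p1.comp2 p2 (fun a b => a - b)) ?_
  intro x
  have h1 := (S.comp_deriv P hε (ps_deriv hδ) i j x).fun_mul (mol_hasDerivAt_i hε (S.ruPI P i) x i)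
  have h2 := (S.comp_deriv P hε (g1_deriv hδ) i j x).fun_mul (mol_hasDerivAt_i hε (S.ruuPI P i j) x i)
  have h3 := h1.fun_add h2
  simp only [zero_smul, add_zero] at h3
  refine h3.congr_deriv ?_
  ring

theorem cube_ineq {a b : ℝ} (ha : 0 ≤ a) (hb : 0 ≤ b) : (a + b) ^ 3 ≤ 4 * a ^ 3 + 4 * b ^ 3 := by
  nlinarith [mul_nonneg (add_nonneg ha hb) (sq_nonneg (a - b))]

theorem pow_le_one_add {D : ℝ} (hD : 0 ≤ D) (k : ℕ) (hk : k ≤ 3) : D ^ k ≤ 1 + D ^ 3 := by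
  rcases le_total D 1 with h | h
  · have := pow_le_one₀ (n := k) hD h
    have : 0 ≤ D ^ 3 := by positivity
    linarith
  · have := pow_le_pow_right₀ h hk
    linarith

theorem Slice.wD (S : Slice c q al r u G R B) (P : Par γ c q al) (ε : ℝ) (x : Fin d → ℝ)
    (k : ℕ) (hk : k ≤ 3) :
    Integrable (fun y => ker ε y * r (x + y) * ‖u (x + y) - u x‖ ^ k) (cubeVol d) := by
  have h1 := kf_int ε (((S.rPI P).const_mul (1 + 4 * ‖u x‖ ^ 3)).add ((S.ru3PI P).const_mul 4)) x
  refine h1.mono' ?_ (Filter.Eventually.of_forall fun y => ?_)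
  · have := S.rm.comp (measurable_const_add x)
    have h' := S.um.comp (measurable_const_add x)
    have := (ker_continuous ε (d := d)).measurable
    exact ((this.mul (S.rm.comp (measurable_const_add x))).mul
      ((h'.sub_const (u x)).norm.pow_const k)).aestronglyMeasurable
  · have hr := S.rpos P (x + y)
    have hk0 := ker_pos ε y
    have h2 := pow_le_one_add (norm_nonneg (u (x + y) - u x)) k hk
    have h3 : ‖u (x + y) - u x‖ ^ 3 ≤ 4 * ‖u (x + y)‖ ^ 3 + 4 * ‖u x‖ ^ 3 :=
      (pow_le_pow_left₀ (norm_nonneg _) (norm_sub_le _ _) 3).trans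
        (cube_ineq (norm_nonneg _) (norm_nonneg _))
    rw [Real.norm_eq_abs, abs_of_nonneg (by positivity)]
    calc ker ε y * r (x + y) * ‖u (x + y) - u x‖ ^ k
        ≤ ker ε y * r (x + y) * (1 + (4 * ‖u (x + y)‖ ^ 3 + 4 * ‖u x‖ ^ 3)) := by
          gcongr; linarith
      _ = _ := by ring

theorem abs_coord_le (v : Fin d → ℝ) (i : Fin d) : |v i| ≤ ‖v‖ := norm_le_pi_norm v i

theorem Slice.flux_pt (S : Slice c q al r u G R B) (P : Par γ c q al) {ε : ℝ} (hε : 0 < ε)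
    (i j : Fin d) (x : Fin d → ℝ) :
    |dVV ε r u i j x * (VV ε r u j x * mol ε (fun x => r x * u x i) x
      - mol ε (fun x => r x * u x i * u x j) x)| ≤
    4 * (2 * Real.pi / ε) * ∫ y, ker ε y * r (x + y) * ‖u (x + y) - u x‖ ^ 3 ∂(cubeVol d) := by
  have hW := P.hc.trans_le (S.Wge P ε x)
  have e1 : ∀ y, ker ε y * (r (x + y) * u (x + y) j) = ker ε y * r (x + y) * u (x + y) j := fun y => by ring
  have e2 : ∀ y, ker ε y * (r (x + y) * u (x + y) i) = ker ε y * r (x + y) * u (x + y) i := fun y => by ring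
  have e3 : ∀ y, ker ε y * (r (x + y) * u (x + y) i * u (x + y) j) =
    ker ε y * r (x + y) * u (x + y) i * u (x + y) j := fun y => by ring
  have e4 : ∀ y, dker ε i y * (r (x + y) * u (x + y) j) = dker ε i y * r (x + y) * u (x + y) j :=
    fun y => by ring
  have f := favre (μ := cubeVol d) (w := fun y => ker ε y * r (x + y))
    (D := fun y => ‖u (x + y) - u x‖) (U := fun y => u (x + y) i) (U' := fun y => u (x + y) j)
    (k := fun y => dker ε i y * r (x + y)) (p := u x i) (p' := u x j) (A := 2 * Real.pi / ε)
    (fun y => mul_nonneg (ker_pos _ _).le (S.rpos P _).le) (fun y => norm_nonneg _)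
    (kf_int ε (S.rPI P) x) (by simpa using S.wD P ε x 1 (by norm_num)) (S.wD P ε x 2 (by norm_num))
    (S.wD P ε x 3 le_rfl)
    (by simpa only [e2] using kf_int ε (S.ruPI P i) x)
    (by simpa only [e1] using kf_int ε (S.ruPI P j) x)
    (by simpa only [e3] using kf_int ε (S.ruuPI P i j) x)
    (dkf_int hε i (S.rPI P) x)
    (by simpa only [e4] using dkf_int hε i (S.ruPI P j) x)
    (fun y => by simpa using abs_coord_le (u (x + y) - u x) i)
    (fun y => by simpa using abs_coord_le (u (x + y) - u x) j)
    (fun y => by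
      rw [abs_mul, abs_of_pos (S.rpos P _), ← mul_assoc]
      exact mul_le_mul_of_nonneg_right (dker_bound hε i y) (S.rpos P _).le)
    (by positivity) hW (V := VV ε r u j x) (by
      unfold VV mol
      simp only [e1])
  have e5 : dVV ε r u i j x = (-∫ y, dker ε i y * r (x + y) * u (x + y) j ∂(cubeVol d)
      + VV ε r u j x * ∫ y, dker ε i y * r (x + y) ∂(cubeVol d)) /
      ∫ y, ker ε y * r (x + y) ∂(cubeVol d) := by
    unfold dVV
    rw [dmol_eq ε i (S.ruPI P j).per, dmol_eq ε i S.rp]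
    simp only [e4]
    rw [mul_neg, sub_neg_eq_add]
    rfl
  rw [e5]
  unfold mol
  simp only [e2, e3]
  exact f

theorem eps_div {ε C s : ℝ} (hε : 0 < ε) (hC : 0 ≤ C) :
    ENNReal.ofReal (C / ε) * ENNReal.ofReal ε ^ s = ENNReal.ofReal C * ENNReal.ofReal ε ^ (s - 1) := by
  rw [ENNReal.ofReal_rpow_of_pos hε, ENNReal.ofReal_rpow_of_pos hε,
    ← ENNReal.ofReal_mul (by positivity), ← ENNReal.ofReal_mul hC, Real.rpow_sub_one hε.ne']
  congr 1
  ring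

theorem Slice.flux_le (S : Slice c q al r u G R B) (P : Par γ c q al) {ε δ : ℝ} (hε : 0 < ε) (hδ : 0 < δ)
    (i j : Fin d) :
    ‖∫ x, (ps δ (VV ε r u j x) * dmol ε i (fun x => r x * u x i) x +
      g1 δ (VV ε r u j x) * dmol ε i (fun x => r x * u x i * u x j) x) ∂(cubeVol d)‖ₑ ≤
    ENNReal.ofReal (8 * Real.pi) * ENNReal.ofReal ε ^ (3 * al - 1) *
      (ENNReal.ofReal (1 + d) * (R * B ^ (3 : ℝ))) := by
  rw [S.kin_ibp P hε hδ]
  refine (enorm_integral_le_lintegral_enorm _).trans ?_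
  calc _ ≤ ∫⁻ x, ENNReal.ofReal (8 * Real.pi / ε) * ∫⁻ y, ENNReal.ofReal (ker ε y) *
        (‖r (x + y)‖ₑ * ‖u (x + y) - u x‖ₑ ^ (3 : ℝ)) ∂(cubeVol d) ∂(cubeVol d) := by
        refine lintegral_mono fun x => ?_
        dsimp only
        rw [Real.enorm_eq_ofReal_abs]
        have h1 := S.flux_pt P hε i j x
        have h2 := g2_bound hδ (VV ε r u j x)
        have h3 : |g2 δ (VV ε r u j x) * (dVV ε r u i j x * (VV ε r u j x * mol ε (fun x => r x * u x i) x
          - mol ε (fun x => r x * u x i * u x j) x))| ≤ 8 * Real.pi / ε *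
            ∫ y, ker ε y * r (x + y) * ‖u (x + y) - u x‖ ^ 3 ∂(cubeVol d) := by
          rw [abs_mul]
          calc _ ≤ 1 * _ := mul_le_mul_of_nonneg_right h2 (abs_nonneg _)
            _ ≤ _ := by rw [one_mul]; refine h1.trans (le_of_eq ?_); ring
        refine (ENNReal.ofReal_le_ofReal h3).trans ?_
        rw [ENNReal.ofReal_mul (by positivity)]
        gcongr
        refine (ENNReal.ofReal_le_ofReal (le_abs_self _)).trans ?_
        rw [← Real.enorm_eq_ofReal_abs]
        refine (enorm_integral_le_lintegral_enorm _).trans (le_of_eq (lintegral_congr fun y => ?_))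
        rw [enorm_mul, enorm_mul, Real.enorm_of_nonneg (ker_pos _ _).le, enorm_pow, enorm_norm, mul_assoc]
        congr 2
        exact (by norm_num : (3:ℝ) = ((3:ℕ):ℝ)) ▸ (ENNReal.rpow_natCast _ 3).symm
    _ ≤ ENNReal.ofReal (8 * Real.pi / ε) * (R * B ^ (3 : ℝ) *
          (ENNReal.ofReal ε ^ (3 * al) * ENNReal.ofReal (1 + d))) := by
        rw [lintegral_const_mul' _ _ ENNReal.ofReal_ne_top]
        gcongr
        exact S.mom3 P hε
    _ = (ENNReal.ofReal (8 * Real.pi / ε) * ENNReal.ofReal ε ^ (3 * al)) *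
          (ENNReal.ofReal (1 + d) * (R * B ^ (3 : ℝ))) := by ring
    _ = _ := by rw [eps_div hε (by positivity)]

end kin

/-! ### slice limits, kinetic part -/

section kinlim
variable {c q al γ : ℝ} {r : (Fin d → ℝ) → ℝ} {u : (Fin d → ℝ) → Fin d → ℝ}
    {G : Fin d → (Fin d → ℝ) → ℝ} {R B : ℝ≥0∞}

theorem ep_le_one (n : ℕ) : ep n ≤ 1 := by
  unfold ep
  rw [div_le_one (by positivity)]
  have : (0:ℝ) ≤ n := Nat.cast_nonneg n
  linarith

theorem ep_rpow_le (s : ℝ) (hs : 0 ≤ s) (n : ℕ) : ENNReal.ofReal (ep n) ^ s ≤ 1 :=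
  ENNReal.rpow_le_one (by simpa using ENNReal.ofReal_le_ofReal (ep_le_one n)) hs

/-- regularized kinetic power -/
def kinA (κ γ δ ε : ℝ) (j : Fin d) (r : (Fin d → ℝ) → ℝ) (u : (Fin d → ℝ) → Fin d → ℝ) : ℝ :=
  ∫ x, (ps δ (VV ε r u j x) * (∑ i, dmol ε i (fun x => r x * u x i) x) +
    g1 δ (VV ε r u j x) * ((∑ i, dmol ε i (fun x => r x * u x i * u x j) x) +
      κ * dmol ε j (fun x => r x ^ γ) x)) ∂(cubeVol d)

theorem Slice.kinA_eq (S : Slice c q al r u G R B) (P : Par γ c q al) {δ : ℝ} (hδ : 0 < δ) (κ : ℝ)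
    (n : ℕ) (j : Fin d) :
    kinA κ γ δ (ep n) j r u = (∑ i, ∫ x, (ps δ (VV (ep n) r u j x) * dmol (ep n) i (fun x => r x * u x i) x +
      g1 δ (VV (ep n) r u j x) * dmol (ep n) i (fun x => r x * u x i * u x j) x) ∂(cubeVol d))
      + κ * ∫ x, g1 δ (VV (ep n) r u j x) * mol (ep n) (Qg γ r (G j)) x ∂(cubeVol d) := by
  have cV := S.VV_cont P (ep n) j
  have pV := S.VV_per P (ep n) j
  have cps := (ps_cont hδ).comp cV
  have cg1 := (g1_cont hδ).comp cV
  simp only [Function.comp_def] at cps cg1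
  have i1 : ∀ i, Integrable (fun x => ps δ (VV (ep n) r u j x) * dmol (ep n) i (fun x => r x * u x i) x +
      g1 δ (VV (ep n) r u j x) * dmol (ep n) i (fun x => r x * u x i * u x j) x) (cubeVol d) := fun i =>
    per_int ((cps.mul (dmol_continuous (ep_pos n) i (S.ruPI P i))).add
      (cg1.mul (dmol_continuous (ep_pos n) i (S.ruuPI P i j))))
      ((pV.comp2 (dmol_per (ep n) i (S.ruPI P i).per) (fun a b => ps δ a * b)).comp2
        (pV.comp2 (dmol_per (ep n) i (S.ruuPI P i j).per) (fun a b => g1 δ a * b)) (fun a b => a + b))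
  have i2 : Integrable (fun x => g1 δ (VV (ep n) r u j x) * mol (ep n) (Qg γ r (G j)) x) (cubeVol d) :=
    per_int (cg1.mul (mol_continuous (ep n) (S.QPI P j)))
      (pV.comp2 (mol_per (ep n) (S.Qp j)) (fun a b => g1 δ a * b))
  rw [← integral_finsetSum _ (fun i _ => i1 i), ← integral_const_mul, ← integral_add
    (integrable_finsetSum _ (fun i _ => i1 i)) (i2.const_mul κ)]
  unfold kinA
  refine integral_congr_ae (Filter.Eventually.of_forall fun x => ?_)
  dsimp only
  rw [S.pres P n j x, Finset.sum_add_distrib, ← Finset.mul_sum, ← Finset.mul_sum]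
  ring

theorem Slice.Q_lint (S : Slice c q al r u G R B) (P : Par γ c q al) (i : Fin d) :
    ∫⁻ x, ‖Qg γ r (G i) x‖ₑ ∂(cubeVol d) ≤ ENNReal.ofReal γ * (2 * (R ^ γ * B)) := by
  calc _ ≤ ∫⁻ x, ENNReal.ofReal γ * (‖r x‖ₑ ^ γ + ‖G i x‖ₑ ^ γ) ∂(cubeVol d) :=
        lintegral_mono fun x => S.Q_le P i x
    _ = ENNReal.ofReal γ * ((∫⁻ x, ‖r x‖ₑ ^ γ ∂(cubeVol d)) + ∫⁻ x, ‖G i x‖ₑ ^ γ ∂(cubeVol d)) := by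
        rw [lintegral_const_mul' _ _ ENNReal.ofReal_ne_top,
          lintegral_add_left (f := fun x => ‖r x‖ₑ ^ γ) (S.rm.enorm.pow_const γ)]
    _ ≤ ENNReal.ofReal γ * (R ^ γ + R ^ γ) := by
        gcongr
        · exact S.pow_1 P S.rm S.rR
        · exact S.pow_1 P (S.GP i).meas (S.GR i)
    _ ≤ _ := by
        rw [← two_mul]
        gcongr
        exact le_mul_of_one_le_right zero_le S.B1

/-- constant in the bound -/
def CK (d : ℕ) (κ γ δ : ℝ) : ℝ≥0∞ :=
  d * (ENNReal.ofReal (8 * Real.pi) * ENNReal.ofReal (1 + d)) +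
    ‖κ‖ₑ * (ENNReal.ofReal ((Real.sqrt δ)⁻¹) * (ENNReal.ofReal γ * 2))

theorem CK_ne (d : ℕ) (κ γ δ : ℝ) : CK d κ γ δ ≠ ∞ := by
  unfold CK
  refine ENNReal.add_ne_top.2 ⟨?_, ?_⟩
  · exact ENNReal.mul_ne_top (ENNReal.natCast_ne_top d) (ENNReal.mul_ne_top ENNReal.ofReal_ne_top ENNReal.ofReal_ne_top)
  · exact ENNReal.mul_ne_top enorm_ne_top (ENNReal.mul_ne_top ENNReal.ofReal_ne_top
      (ENNReal.mul_ne_top ENNReal.ofReal_ne_top (by norm_num)))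

theorem enorm_le_of_abs {a C : ℝ} (h : |a| ≤ C) : ‖a‖ₑ ≤ ENNReal.ofReal C := by
  rw [Real.enorm_eq_ofReal_abs]; exact ENNReal.ofReal_le_ofReal h

theorem enorm_sum_le' {ι : Type*} (s : Finset ι) (f : ι → ℝ) : ‖∑ i ∈ s, f i‖ₑ ≤ ∑ i ∈ s, ‖f i‖ₑ := by
  classical
  induction s using Finset.induction_on with
  | empty => simp
  | insert a s ha ih =>
    rw [Finset.sum_insert ha, Finset.sum_insert ha]
    exact (enorm_add_le _ _).trans (by gcongr)

theorem Slice.flux_sum (S : Slice c q al r u G R B) (P : Par γ c q al) {δ : ℝ} (hδ : 0 < δ)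
    (n : ℕ) (j : Fin d) :
    ‖∑ i, ∫ x, (ps δ (VV (ep n) r u j x) * dmol (ep n) i (fun x => r x * u x i) x +
      g1 δ (VV (ep n) r u j x) * dmol (ep n) i (fun x => r x * u x i * u x j) x) ∂(cubeVol d)‖ₑ ≤
     d * (ENNReal.ofReal (8 * Real.pi) * ENNReal.ofReal (1 + d)) * (R * B ^ (3:ℝ)) *
      ENNReal.ofReal (ep n) ^ (3 * al - 1) := by
  refine (enorm_sum_le' _ _).trans ((Finset.sum_le_sum fun i _ => S.flux_le P (ep_pos n) hδ i j).trans ?_)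
  rw [Finset.sum_const, Finset.card_univ, Fintype.card_fin, nsmul_eq_mul]
  refine le_of_eq ?_
  ring

theorem Slice.kinA_bound (S : Slice c q al r u G R B) (P : Par γ c q al) {δ : ℝ} (hδ : 0 < δ) (κ : ℝ)
    (n : ℕ) (j : Fin d) :
    ‖kinA κ γ δ (ep n) j r u‖ₑ ≤ CK d κ γ δ * (R * B ^ (3:ℝ) + R ^ γ * B) := by
  rw [S.kinA_eq P hδ κ n j]
  refine (enorm_add_le _ _).trans ?_
  have h1 : ‖∑ i, ∫ x, (ps δ (VV (ep n) r u j x) * dmol (ep n) i (fun x => r x * u x i) x +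
      g1 δ (VV (ep n) r u j x) * dmol (ep n) i (fun x => r x * u x i * u x j) x) ∂(cubeVol d)‖ₑ ≤
      d * (ENNReal.ofReal (8 * Real.pi) * ENNReal.ofReal (1 + d)) * (R * B ^ (3:ℝ)) := by
    refine (S.flux_sum P hδ n j).trans ?_
    exact mul_le_of_le_one_right zero_le (ep_rpow_le _ (by linarith [P.hal]) n)
  have h2 : ‖κ * ∫ x, g1 δ (VV (ep n) r u j x) * mol (ep n) (Qg γ r (G j)) x ∂(cubeVol d)‖ₑ ≤
      ‖κ‖ₑ * (ENNReal.ofReal ((Real.sqrt δ)⁻¹) * (ENNReal.ofReal γ * 2)) * (R ^ γ * B) := by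
    rw [enorm_mul, mul_assoc]
    gcongr
    refine (enorm_integral_le_lintegral_enorm _).trans ?_
    calc _ ≤ ∫⁻ x, ENNReal.ofReal ((Real.sqrt δ)⁻¹) * ‖mol (ep n) (Qg γ r (G j)) x‖ₑ ∂(cubeVol d) := by
          refine lintegral_mono fun x => ?_
          dsimp only
          rw [enorm_mul]
          gcongr
          exact enorm_le_of_abs (g1_bound hδ _)
      _ ≤ ENNReal.ofReal ((Real.sqrt δ)⁻¹) * (ENNReal.ofReal γ * (2 * (R ^ γ * B))) := by
          rw [lintegral_const_mul' _ _ ENNReal.ofReal_ne_top]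
          gcongr
          exact (mol_L1 _ (S.Qm j) (S.Qp j)).trans (S.Q_lint P j)
      _ = _ := by ring
  refine (add_le_add h1 h2).trans ?_
  unfold CK
  rw [add_mul]
  gcongr
  · exact le_self_add
  · exact le_add_self

theorem Slice.g1_lim' (S : Slice c q al r u G R B) (P : Par γ c q al) {δ : ℝ} (hδ : 0 < δ) (j : Fin d) :
    Filter.Tendsto (fun n => ∫ x, g1 δ (VV (ep n) r u j x) * mol (ep n) (Qg γ r (G j)) x ∂(cubeVol d))
      Filter.atTop (nhds (∫ x, g1 δ (u x j) * Qg γ r (G j) x ∂(cubeVol d))) := by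
  have h := cont_l1 (μ := cubeVol d) (A := fun k => mol (ep k) r) (B := fun k => mol (ep k) (fun x => r x * u x j))
    (fun k => (mol_continuous _ (S.rPI P)).measurable) S.rm
    (fun k => (mol_continuous _ (S.ruPI P j)).measurable) (S.ruPI P j).meas
    (mol_tendsto (S.rPI P)) (mol_tendsto (S.ruPI P j)) (c := c) (M := (Real.sqrt δ)⁻¹)
    (fun k x => S.Wge P _ x) S.rc (h := fun a b => g1 δ (b / a))
    ((g1_cont hδ).measurable.comp (measurable_snd.div measurable_fst))
    (fun a b _ => g1_bound hδ _)
    (fun a b ha => (g1_cont hδ).continuousAt.comp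
      (continuousAt_snd.div continuousAt_fst (P.hc.trans_le ha).ne'))
  have e : ∀ x, r x * u x j / r x = u x j := fun x => by
    have := (S.rpos P x).ne'
    field_simp
  simp only [e] at h
  refine bl_tendsto (cubeVol d) (fun n x => g1 δ (VV (ep n) r u j x)) (fun x => g1 δ (u x j))
    (fun n => mol (ep n) (Qg γ r (G j))) (Qg γ r (G j)) (Real.sqrt δ)⁻¹ ?_ ?_ ?_ ?_ (S.QPI P j).int h
    (mol_tendsto (S.QPI P j))
  · exact fun n => ((g1_cont hδ).comp (S.VV_cont P _ j)).aestronglyMeasurable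
  · exact ((g1_cont hδ).measurable.comp (S.ui_m j)).aestronglyMeasurable
  · exact fun n x => g1_bound hδ _
  · exact fun n => (mol_PI _ (S.QPI P j)).int

theorem enorm_tendsto_zero {f : ℕ → ℝ} {g : ℕ → ℝ≥0∞} (h : ∀ n, ‖f n‖ₑ ≤ g n)
    (hg : Filter.Tendsto g Filter.atTop (nhds 0)) : Filter.Tendsto f Filter.atTop (nhds 0) := by
  have := tendsto_of_tendsto_of_tendsto_of_le_of_le tendsto_const_nhds hg (fun n => zero_le) h
  rw [tendsto_zero_iff_norm_tendsto_zero]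
  have h2 := (ENNReal.tendsto_toReal (by norm_num : (0:ℝ≥0∞) ≠ ∞)).comp this
  simpa [Function.comp_def] using h2

theorem Slice.kinA_lim (S : Slice c q al r u G R B) (P : Par γ c q al) {δ : ℝ} (hδ : 0 < δ) (κ : ℝ) (j : Fin d) :
    Filter.Tendsto (fun n => kinA κ γ δ (ep n) j r u)
      Filter.atTop (nhds (κ * ∫ x, g1 δ (u x j) * Qg γ r (G j) x ∂(cubeVol d))) := by
  simp only [S.kinA_eq P hδ κ _ j]
  have h1 := enorm_tendsto_zero (fun n => S.flux_sum P hδ n j) (by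
    have := ENNReal.Tendsto.const_mul (a := d * (ENNReal.ofReal (8 * Real.pi) * ENNReal.ofReal (1 + d)) * (R * B ^ (3:ℝ)))
      (ep_rpow (3 * al - 1) (by linarith [P.hal])) (Or.inr ?_)
    · simpa using this
    · exact ENNReal.mul_ne_top (ENNReal.mul_ne_top (ENNReal.natCast_ne_top d)
        (ENNReal.mul_ne_top ENNReal.ofReal_ne_top ENNReal.ofReal_ne_top)) S.RB3.ne)
  have := h1.add ((S.g1_lim' P hδ j).const_mul κ)
  rw [zero_add] at this
  exact this

theorem FK_abs {δ : ℝ} (hδ : 0 < δ) {a m : ℝ} (ha : 0 < a) :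
    |FK δ a m| ≤ (δ⁻¹ + (Real.sqrt δ)⁻¹) * |m| := by
  have := FK_lip hδ ha a m a 0 le_rfl le_rfl
  rw [FK_zero hδ] at this
  simpa using this

/-- regularized kinetic energy -/
def kinE (δ ε : ℝ) (j : Fin d) (r : (Fin d → ℝ) → ℝ) (u : (Fin d → ℝ) → Fin d → ℝ) : ℝ :=
  ∫ x, FK δ (mol ε r x) (mol ε (fun x => r x * u x j) x) ∂(cubeVol d)

theorem Slice.ru_lint (S : Slice c q al r u G R B) (P : Par γ c q al) (i : Fin d) :
    ∫⁻ x, ‖r x * u x i‖ₑ ∂(cubeVol d) ≤ R * B ^ (3:ℝ) := by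
  refine (S.fu_lint P S.rm S.rR i).trans ?_
  gcongr R * ?_
  simpa using S.B_le (s := 1) (by norm_num)

theorem Slice.kinE_bound (S : Slice c q al r u G R B) (P : Par γ c q al) {δ : ℝ} (hδ : 0 < δ) (ε : ℝ) (j : Fin d) :
    ‖kinE δ ε j r u‖ₑ ≤ ENNReal.ofReal (δ⁻¹ + (Real.sqrt δ)⁻¹) * (R * B ^ (3:ℝ)) := by
  refine (enorm_integral_le_lintegral_enorm _).trans ?_
  calc _ ≤ ∫⁻ x, ENNReal.ofReal (δ⁻¹ + (Real.sqrt δ)⁻¹) * ‖mol ε (fun x => r x * u x j) x‖ₑ ∂(cubeVol d) := by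
        refine lintegral_mono fun x => ?_
        dsimp only
        rw [Real.enorm_eq_ofReal_abs, Real.enorm_eq_ofReal_abs, ← ENNReal.ofReal_mul (by positivity)]
        exact ENNReal.ofReal_le_ofReal (FK_abs hδ (P.hc.trans_le (S.Wge P _ x)))
    _ ≤ _ := by
        rw [lintegral_const_mul' _ _ ENNReal.ofReal_ne_top]
        gcongr
        exact (mol_L1 _ (S.ruPI P j).meas (S.ruPI P j).per).trans (S.ru_lint P j)

theorem Slice.FK_cont (S : Slice c q al r u G R B) (P : Par γ c q al) {δ : ℝ} (hδ : 0 < δ) (ε : ℝ) (j : Fin d) :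
    Continuous (fun x => FK δ (mol ε r x) (mol ε (fun x => r x * u x j) x)) :=
  (mol_continuous ε (S.rPI P)).mul ((g0_cont hδ).comp (S.VV_cont P ε j))

theorem Slice.rg0_int (S : Slice c q al r u G R B) (P : Par γ c q al) {δ : ℝ} (hδ : 0 < δ) (j : Fin d) :
    Integrable (fun x => r x * g0 δ (u x j)) (cubeVol d) := by
  refine (S.ruuPI P j j).int.mono (S.rm.mul ((g0_cont hδ).measurable.comp (S.ui_m j))).aestronglyMeasurable
    (Filter.Eventually.of_forall fun x => ?_)
  rw [Real.norm_eq_abs, Real.norm_eq_abs, abs_mul, mul_assoc, abs_mul]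
  refine mul_le_mul_of_nonneg_left ((g0_bound hδ _).trans ?_) (abs_nonneg _)
  rw [sq]; exact le_abs_self _

theorem Slice.kinE_lim (S : Slice c q al r u G R B) (P : Par γ c q al) {δ : ℝ} (hδ : 0 < δ) (j : Fin d) :
    Filter.Tendsto (fun n => kinE δ (ep n) j r u) Filter.atTop
      (nhds (∫ x, r x * g0 δ (u x j) ∂(cubeVol d))) := by
  have e : ∀ x, FK δ (r x) (r x * u x j) = r x * g0 δ (u x j) := fun x => by
    have := (S.rpos P x).ne'
    unfold FK
    congr 2
    field_simp
  rw [← tendsto_sub_nhds_zero_iff]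
  have hlim := ENNReal.Tendsto.const_mul (a := ENNReal.ofReal (δ⁻¹ + (Real.sqrt δ)⁻¹))
    ((mol_tendsto (S.rPI P)).add (mol_tendsto (S.ruPI P j))) (Or.inr ENNReal.ofReal_ne_top)
  rw [add_zero, mul_zero] at hlim
  refine enorm_tendsto_zero (fun n => ?_) hlim
  have i1 := per_int (S.FK_cont P hδ (ep n) j) ((mol_per (ep n) S.rp).comp2 (mol_per (ep n) (S.ruPI P j).per)
    (fun a b => FK δ a b))
  unfold kinE
  rw [← integral_sub i1 (S.rg0_int P hδ j)]
  refine (enorm_integral_le_lintegral_enorm _).trans ?_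
  have hm1 : Measurable (fun x => ‖mol (ep n) r x - r x‖ₑ) :=
    ((mol_continuous _ (S.rPI P)).measurable.sub S.rm).enorm
  rw [← lintegral_add_left hm1, ← lintegral_const_mul' _ _ ENNReal.ofReal_ne_top]
  refine lintegral_mono fun x => ?_
  dsimp only
  rw [← e x, Real.enorm_eq_ofReal_abs, Real.enorm_eq_ofReal_abs, Real.enorm_eq_ofReal_abs,
    ← ENNReal.ofReal_add (abs_nonneg _) (abs_nonneg _), ← ENNReal.ofReal_mul (by positivity), mul_add]
  exact ENNReal.ofReal_le_ofReal (FK_lip hδ P.hc _ _ _ _ (S.Wge P _ x) (S.rc x))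

theorem Slice.rg0_bound (S : Slice c q al r u G R B) (P : Par γ c q al) {δ : ℝ} (hδ : 0 < δ) (j : Fin d) :
    ‖∫ x, r x * g0 δ (u x j) ∂(cubeVol d)‖ₑ ≤ R * B ^ (3:ℝ) := by
  refine (enorm_integral_le_lintegral_enorm _).trans ((lintegral_mono fun x => ?_).trans (S.ruu_lint P j j))
  dsimp only
  rw [Real.enorm_eq_ofReal_abs, Real.enorm_eq_ofReal_abs]
  refine ENNReal.ofReal_le_ofReal ?_
  rw [abs_mul, mul_assoc, abs_mul]
  refine mul_le_mul_of_nonneg_left ((g0_bound hδ _).trans ?_) (abs_nonneg _)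
  rw [sq]; exact le_abs_self _

theorem Slice.rg0_lim (S : Slice c q al r u G R B) (P : Par γ c q al) (j : Fin d) :
    Filter.Tendsto (fun n => ∫ x, r x * g0 (ep n) (u x j) ∂(cubeVol d)) Filter.atTop
      (nhds (∫ x, r x * (u x j ^ 2 / 2) ∂(cubeVol d))) := by
  refine tendsto_integral_of_dominated_convergence (fun x => ‖r x * u x j * u x j‖)
    (fun n => (S.rm.mul ((g0_cont (ep_pos n)).measurable.comp (S.ui_m j))).aestronglyMeasurable)
    (S.ruuPI P j j).int.norm (fun n => Filter.Eventually.of_forall fun x => ?_)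
    (Filter.Eventually.of_forall fun x => (g0_lim _).const_mul _)
  rw [Real.norm_eq_abs, Real.norm_eq_abs, abs_mul, mul_assoc, abs_mul]
  refine mul_le_mul_of_nonneg_left ((g0_bound (ep_pos n) _).trans ?_) (abs_nonneg _)
  rw [sq]; exact le_abs_self _

theorem Slice.g1Q_bound (S : Slice c q al r u G R B) (P : Par γ c q al) {δ : ℝ} (hδ : 0 < δ) (j : Fin d) :
    ‖∫ x, g1 δ (u x j) * Qg γ r (G j) x ∂(cubeVol d)‖ₑ ≤ ENNReal.ofReal γ * (2 * (R ^ γ * B)) := by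
  refine (enorm_integral_le_lintegral_enorm _).trans ((lintegral_mono fun x => ?_).trans (S.Qu P j))
  dsimp only
  rw [enorm_mul, mul_comm]
  gcongr
  refine le_trans ?_ (enorm_coord (u x) j)
  rw [Real.enorm_eq_ofReal_abs, Real.enorm_eq_ofReal_abs]
  exact ENNReal.ofReal_le_ofReal (g1_bound2 hδ _)

theorem Slice.g1Q_lim (S : Slice c q al r u G R B) (P : Par γ c q al) (j : Fin d) :
    Filter.Tendsto (fun n => ∫ x, g1 (ep n) (u x j) * Qg γ r (G j) x ∂(cubeVol d)) Filter.atTop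
      (nhds (∫ x, Qg γ r (G j) x * u x j ∂(cubeVol d))) := by
  refine tendsto_integral_of_dominated_convergence (fun x => ‖Qg γ r (G j) x * u x j‖)
    (fun n => (((g1_cont (ep_pos n)).measurable.comp (S.ui_m j)).mul (S.Qm j)).aestronglyMeasurable)
    (S.QuPI P j j).int.norm (fun n => Filter.Eventually.of_forall fun x => ?_)
    (Filter.Eventually.of_forall fun x => ?_)
  · rw [Real.norm_eq_abs, Real.norm_eq_abs, abs_mul, abs_mul, mul_comm]
    exact mul_le_mul_of_nonneg_left (g1_bound2 (ep_pos n) _) (abs_nonneg _)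
  · have := (g1_lim (u x j)).mul_const (Qg γ r (G j) x)
    rw [mul_comm (u x j)] at this
    exact this

end kinlim

/-! ### slice limits, internal energy -/

section intlim
variable {c q al γ : ℝ} {r : (Fin d → ℝ) → ℝ} {u : (Fin d → ℝ) → Fin d → ℝ}
    {G : Fin d → (Fin d → ℝ) → ℝ} {R B : ℝ≥0∞}

theorem per_int' {f : (Fin d → ℝ) → ℝ} (hp : Per f) (hf : Continuous f) : Integrable f (cubeVol d) :=
  per_int hf hp

/-- regularized power of the pressure -/
def intA (γ δ ε : ℝ) (r : (Fin d → ℝ) → ℝ) (u : (Fin d → ℝ) → Fin d → ℝ) : ℝ :=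
  ∫ x, bb γ δ (mol ε r x) * (∑ i, dmol ε i (fun x => r x * u x i) x) ∂(cubeVol d)

/-- bound for `mm` -/
def MM (γ δ : ℝ) : ℝ := γ * (γ + 1) * δ⁻¹ ^ (γ - 1)

theorem MM_nonneg {δ : ℝ} (hγ : 1 < γ) (hδ : 0 < δ) : 0 ≤ MM γ δ := by
  unfold MM; positivity

theorem Slice.int_ibp (S : Slice c q al r u G R B) (P : Par γ c q al) {δ ε : ℝ} (hε : 0 < ε) (hδ : 0 < δ)
    (i : Fin d) :
    ∫ x, bb γ δ (mol ε r x) * dmol ε i (fun x => r x * u x i) x ∂(cubeVol d) =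
    - ∫ x, (mm γ δ (mol ε r x) / mol ε r x * dmol ε i r x) * mol ε (fun x => r x * u x i) x ∂(cubeVol d) := by
  have cW := mol_continuous ε (S.rPI P)
  have cb := S.hW_cont P ε (h := bb γ δ) (fun a ha => bb_cont hδ ha)
  have cm := S.hW_cont P ε (h := mm γ δ) (fun a ha => mm_cont hδ ha)
  have cN := mol_continuous ε (S.ruPI P i)
  have cdN := dmol_continuous hε i (S.ruPI P i)
  have cdW := dmol_continuous hε i (S.rPI P)
  have pW := mol_per ε S.rp
  have pN := mol_per ε (S.ruPI P i).per
  have pdN := dmol_per ε i (S.ruPI P i).per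
  have pdW := dmol_per ε i S.rp
  have c1 := cb.mul cdN
  have p1 := pW.comp2 pdN (fun a b => bb γ δ a * b)
  have c2 := ((cm.div cW (fun x => (P.hc.trans_le (S.Wge P ε x)).ne')).mul cdW).mul cN
  have p2 := (pW.comp2 pdW (fun a b => mm γ δ a / a * b)).comp2 pN (fun a b => a * b)
  rw [eq_neg_iff_add_eq_zero, ← integral_add (per_int' p1 c1) (per_int' p2 c2)]
  refine ibp_cont (Pi.single i (1:ℝ) : Fin d → ℝ)
    (f := fun x => bb γ δ (mol ε r x) * mol ε (fun x => r x * u x i) x)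
    (cb.mul cN) (pW.comp2 pN (fun a b => bb γ δ a * b)) (c1.add c2) (p1.comp2 p2 (fun a b => a + b)) ?_
  intro x
  have h1 := (S.hW_deriv P hε (h := bb γ δ) (h' := fun a => mm γ δ a / a) (fun a ha => bb_deriv hδ ha) x i).fun_mul
    (mol_hasDerivAt_i hε (S.ruPI P i) x i)
  simp only [zero_smul, add_zero] at h1
  refine h1.congr_deriv ?_
  ring

/-- error term -/
def errI (γ δ ε : ℝ) (i : Fin d) (r : (Fin d → ℝ) → ℝ) (u : (Fin d → ℝ) → Fin d → ℝ) : ℝ :=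
  ∫ x, (mm γ δ (mol ε r x) / mol ε r x * dmol ε i r x) *
    (mol ε (fun x => r x * u x i) x - mol ε r x * mol ε (fun x => u x i) x) ∂(cubeVol d)

theorem Slice.intA_eq (S : Slice c q al r u G R B) (P : Par γ c q al) {δ : ℝ} (hδ : 0 < δ) (n : ℕ) :
    intA γ δ (ep n) r u = - ∑ i, (errI γ δ (ep n) i r u +
      ∫ x, mm γ δ (mol (ep n) r x) * (mol (ep n) (G i) x * mol (ep n) (fun x => u x i) x) ∂(cubeVol d)) := by
  set ε := ep n with hεd
  have hε : 0 < ε := ep_pos n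
  have cW := mol_continuous ε (S.rPI P)
  have cb := S.hW_cont P ε (h := bb γ δ) (fun a ha => bb_cont hδ ha)
  have cm := S.hW_cont P ε (h := mm γ δ) (fun a ha => mm_cont hδ ha)
  have pW := mol_per ε S.rp
  unfold intA
  simp only [Finset.mul_sum]
  rw [integral_finsetSum _ (fun i _ => per_int' (pW.comp2 (dmol_per ε i (S.ruPI P i).per) (fun a b => bb γ δ a * b))
    (cb.mul (dmol_continuous hε i (S.ruPI P i)))), ← Finset.sum_neg_distrib]
  refine Finset.sum_congr rfl fun i _ => ?_
  rw [S.int_ibp P hε hδ i]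
  congr 1
  unfold errI
  have cN := mol_continuous ε (S.ruPI P i)
  have cu := mol_continuous ε (S.uPI P i)
  have cG := mol_continuous ε (S.GP i)
  have cdW := dmol_continuous hε i (S.rPI P)
  have pN := mol_per ε (S.ruPI P i).per
  have pu := mol_per ε (S.ui_p i)
  have pG := mol_per ε (S.GP i).per
  have pdW := dmol_per ε i S.rp
  have c1 := ((cm.div cW (fun x => (P.hc.trans_le (S.Wge P ε x)).ne')).mul cdW).mul (cN.sub (cW.mul cu))
  have p1 := (pW.comp2 pdW (fun a b => mm γ δ a / a * b)).comp2
    (pN.comp2 (pW.comp2 pu (fun a b => a * b)) (fun a b => a - b)) (fun a b => a * b)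
  have c2 := cm.mul (cG.mul cu)
  have p2 := pW.comp2 (pG.comp2 pu (fun a b => a * b)) (fun a b => mm γ δ a * b)
  rw [← integral_add (per_int' p1 c1) (per_int' p2 c2)]
  refine integral_congr_ae (Filter.Eventually.of_forall fun x => ?_)
  dsimp only
  have h0 := (P.hc.trans_le (S.Wge P ε x)).ne'
  rw [← S.grad n i x, ← hεd]
  field_simp
  ring

/-- constant -/
def C1 (d : ℕ) : ℝ≥0∞ := d * ENNReal.ofReal (1 + d) * (1 + ENNReal.ofReal (1 + d))

theorem C1_ne (d : ℕ) : C1 d ≠ ∞ := by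
  unfold C1
  exact ENNReal.mul_ne_top (ENNReal.mul_ne_top (ENNReal.natCast_ne_top d) ENNReal.ofReal_ne_top)
    (ENNReal.add_ne_top.2 ⟨by norm_num, ENNReal.ofReal_ne_top⟩)

theorem Slice.err_le (S : Slice c q al r u G R B) (P : Par γ c q al) {δ : ℝ} (hδ : 0 < δ) (n : ℕ) (i : Fin d) :
    ‖errI γ δ (ep n) i r u‖ₑ ≤ ENNReal.ofReal (MM γ δ * (2 * Real.pi)) * C1 d * (R * B) *
      ENNReal.ofReal (ep n) ^ al := by
  have hM := MM_nonneg P.hγ hδ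
  have hε := ep_pos n
  refine (enorm_integral_le_lintegral_enorm _).trans ?_
  calc _ ≤ ∫⁻ x, ENNReal.ofReal (MM γ δ * (2 * Real.pi) / ep n) *
        ‖mol (ep n) (fun x => r x * u x i) x - mol (ep n) r x * mol (ep n) (fun x => u x i) x‖ₑ ∂(cubeVol d) := by
        refine lintegral_mono fun x => ?_
        dsimp only
        rw [enorm_mul]
        gcongr
        refine enorm_le_of_abs ?_
        have hW := P.hc.trans_le (S.Wge P (ep n) x)
        have h1 := mm_bound2 (γ := γ) P.hγ hδ hW
        have h2 := dmol_le_mol hε i (S.rPI P) x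
        have e : (fun x => |r x|) = r := funext fun x => abs_of_pos (S.rpos P x)
        rw [e] at h2
        rw [abs_mul, abs_div, abs_of_pos hW]
        calc _ ≤ MM γ δ / mol (ep n) r x * (2 * Real.pi / ep n * mol (ep n) r x) := by
              refine mul_le_mul ?_ h2 (abs_nonneg _) (by positivity)
              exact div_le_div_of_nonneg_right h1 hW.le
          _ = _ := by field_simp
    _ ≤ ENNReal.ofReal (MM γ δ * (2 * Real.pi) / ep n) * (C1 d * (R * B * ENNReal.ofReal (ep n) ^ (1 + al))) := by
        rw [lintegral_const_mul' _ _ ENNReal.ofReal_ne_top]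
        gcongr
        exact S.comm1 P hε i
    _ = (ENNReal.ofReal (MM γ δ * (2 * Real.pi) / ep n) * ENNReal.ofReal (ep n) ^ (1 + al)) * C1 d * (R * B) := by ring
    _ = _ := by
        rw [eps_div hε (by positivity)]
        rw [show 1 + al - 1 = al by ring]
        ring

theorem Slice.RB_le (S : Slice c q al r u G R B) : R * B ≤ R * B ^ (3:ℝ) := by
  gcongr R * ?_
  simpa using S.B_le (s := 1) (by norm_num)

theorem Slice.Gu_l1 (S : Slice c q al r u G R B) (P : Par γ c q al) (i : Fin d) :
    Filter.Tendsto (fun n => ∫⁻ x, ‖mol (ep n) (G i) x * mol (ep n) (fun x => u x i) x - G i x * u x i‖ₑ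
      ∂(cubeVol d)) Filter.atTop (nhds 0) := by
  have hGu := S.fuPI P (S.GP i).meas (S.GP i).per (S.GR i) i
  have h1 := ENNReal.Tendsto.const_mul (a := 2 * (R * B * ENNReal.ofReal (1 + d)))
    (ep_rpow al (by linarith [P.hal])) (Or.inr (ENNReal.mul_ne_top (by norm_num)
      (ENNReal.mul_ne_top (ENNReal.mul_ne_top S.RT S.BT) ENNReal.ofReal_ne_top)))
  have h2 := h1.add (mol_tendsto hGu)
  rw [mul_zero, add_zero] at h2
  refine tendsto_of_tendsto_of_tendsto_of_le_of_le tendsto_const_nhds h2 (fun n => zero_le) (fun n => ?_)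
  have h3 := S.comm2 P (ep_pos n) (S.GP i) (S.GR i) i
  dsimp only
  calc _ ≤ ∫⁻ x, (‖mol (ep n) (G i) x * mol (ep n) (fun x => u x i) x - mol (ep n) (fun x => G i x * u x i) x‖ₑ +
        ‖mol (ep n) (fun x => G i x * u x i) x - G i x * u x i‖ₑ) ∂(cubeVol d) := by
        refine lintegral_mono fun x => ?_
        dsimp only
        refine le_trans (le_of_eq ?_) (enorm_add_le _ _)
        congr 1; ring
    _ = _ := lintegral_add_left ((((mol_continuous _ (S.GP i)).mul (mol_continuous _ (S.uPI P i))).sub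
        (mol_continuous _ hGu)).measurable.enorm) _
    _ ≤ _ := by
        gcongr
        refine h3.trans (le_of_eq ?_)
        ring

theorem Slice.Gu_bd (S : Slice c q al r u G R B) (P : Par γ c q al) (n : ℕ) (i : Fin d) :
    ∫⁻ x, ‖mol (ep n) (G i) x * mol (ep n) (fun x => u x i) x‖ₑ ∂(cubeVol d) ≤
      (2 * ENNReal.ofReal (1 + d) + 1) * (R * B) := by
  have hGu := S.fuPI P (S.GP i).meas (S.GP i).per (S.GR i) i
  have h3 := S.comm2 P (ep_pos n) (S.GP i) (S.GR i) i
  calc _ ≤ ∫⁻ x, (‖mol (ep n) (G i) x * mol (ep n) (fun x => u x i) x - mol (ep n) (fun x => G i x * u x i) x‖ₑ +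
        ‖mol (ep n) (fun x => G i x * u x i) x‖ₑ) ∂(cubeVol d) := by
        refine lintegral_mono fun x => ?_
        dsimp only
        refine le_trans (le_of_eq ?_) (enorm_add_le _ _)
        congr 1; ring
    _ = _ := lintegral_add_left ((((mol_continuous _ (S.GP i)).mul (mol_continuous _ (S.uPI P i))).sub
        (mol_continuous _ hGu)).measurable.enorm) _
    _ ≤ 2 * (R * B * (1 * ENNReal.ofReal (1 + d))) + R * B := by
        refine add_le_add (h3.trans ?_) ((mol_L1 _ hGu.meas hGu.per).trans (S.fu_lint P (S.GP i).meas (S.GR i) i))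
        gcongr
        exact ep_rpow_le _ (by linarith [P.hal]) n
    _ = _ := by ring

theorem Slice.main_bd (S : Slice c q al r u G R B) (P : Par γ c q al) {δ : ℝ} (hδ : 0 < δ) (n : ℕ) (i : Fin d) :
    ‖∫ x, mm γ δ (mol (ep n) r x) * (mol (ep n) (G i) x * mol (ep n) (fun x => u x i) x) ∂(cubeVol d)‖ₑ ≤
      ENNReal.ofReal (MM γ δ) * ((2 * ENNReal.ofReal (1 + d) + 1) * (R * B)) := by
  refine (enorm_integral_le_lintegral_enorm _).trans ?_
  calc _ ≤ ∫⁻ x, ENNReal.ofReal (MM γ δ) * ‖mol (ep n) (G i) x * mol (ep n) (fun x => u x i) x‖ₑ ∂(cubeVol d) := by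
        refine lintegral_mono fun x => ?_
        dsimp only
        rw [enorm_mul]
        gcongr
        exact enorm_le_of_abs (mm_bound2 (γ := γ) P.hγ hδ (P.hc.trans_le (S.Wge P (ep n) x)))
    _ ≤ _ := by
        rw [lintegral_const_mul' _ _ ENNReal.ofReal_ne_top]
        gcongr
        exact S.Gu_bd P n i

/-- constant in the bound -/
def CI (d : ℕ) (γ δ : ℝ) : ℝ≥0∞ := d * (ENNReal.ofReal (MM γ δ * (2 * Real.pi)) * C1 d +
  ENNReal.ofReal (MM γ δ) * (2 * ENNReal.ofReal (1 + d) + 1))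

theorem CI_ne (d : ℕ) (γ δ : ℝ) : CI d γ δ ≠ ∞ := by
  unfold CI
  refine ENNReal.mul_ne_top (ENNReal.natCast_ne_top d) (ENNReal.add_ne_top.2 ⟨?_, ?_⟩)
  · exact ENNReal.mul_ne_top ENNReal.ofReal_ne_top (C1_ne d)
  · exact ENNReal.mul_ne_top ENNReal.ofReal_ne_top (ENNReal.add_ne_top.2
      ⟨ENNReal.mul_ne_top (by norm_num) ENNReal.ofReal_ne_top, by norm_num⟩)

theorem Slice.intA_bound (S : Slice c q al r u G R B) (P : Par γ c q al) {δ : ℝ} (hδ : 0 < δ) (n : ℕ) :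
    ‖intA γ δ (ep n) r u‖ₑ ≤ CI d γ δ * (R * B ^ (3:ℝ)) := by
  rw [S.intA_eq P hδ n, enorm_neg]
  have hi : ∀ i : Fin d, ‖errI γ δ (ep n) i r u +
      ∫ x, mm γ δ (mol (ep n) r x) * (mol (ep n) (G i) x * mol (ep n) (fun x => u x i) x) ∂(cubeVol d)‖ₑ ≤
      (ENNReal.ofReal (MM γ δ * (2 * Real.pi)) * C1 d +
        ENNReal.ofReal (MM γ δ) * (2 * ENNReal.ofReal (1 + d) + 1)) * (R * B) := fun i => by
    refine (enorm_add_le _ _).trans ?_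
    rw [add_mul, mul_assoc (ENNReal.ofReal (MM γ δ))]
    refine add_le_add ((S.err_le P hδ n i).trans ?_) (S.main_bd P hδ n i)
    exact mul_le_of_le_one_right zero_le (ep_rpow_le _ (by linarith [P.hal]) n)
  refine (enorm_sum_le' _ _).trans ((Finset.sum_le_sum fun i _ => hi i).trans ?_)
  rw [Finset.sum_const, Finset.card_univ, Fintype.card_fin, nsmul_eq_mul, ← mul_assoc]
  unfold CI
  exact mul_le_mul' le_rfl S.RB_le

theorem Slice.intA_lim (S : Slice c q al r u G R B) (P : Par γ c q al) {δ : ℝ} (hδ : 0 < δ) :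
    Filter.Tendsto (fun n => intA γ δ (ep n) r u) Filter.atTop
      (nhds (-∑ i, ∫ x, mm γ δ (r x) * (G i x * u x i) ∂(cubeVol d))) := by
  simp only [S.intA_eq P hδ]
  refine (tendsto_finsetSum _ fun i _ => ?_).neg
  have h1 := enorm_tendsto_zero (fun n => S.err_le P hδ n i) (by
    have := ENNReal.Tendsto.const_mul (a := ENNReal.ofReal (MM γ δ * (2 * Real.pi)) * C1 d * (R * B))
      (ep_rpow al (by linarith [P.hal])) (Or.inr (ENNReal.mul_ne_top
        (ENNReal.mul_ne_top ENNReal.ofReal_ne_top (C1_ne d)) (ENNReal.mul_ne_top S.RT S.BT)))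
    simpa using this)
  have hGu := S.fuPI P (S.GP i).meas (S.GP i).per (S.GR i) i
  have h2 := bl_tendsto (cubeVol d) (fun n x => mm γ δ (mol (ep n) r x)) (fun x => mm γ δ (r x))
    (fun n x => mol (ep n) (G i) x * mol (ep n) (fun x => u x i) x) (fun x => G i x * u x i) (MM γ δ)
    (fun n => (mm_meas.comp (mol_continuous _ (S.rPI P)).measurable).aestronglyMeasurable)
    (mm_meas.comp S.rm).aestronglyMeasurable
    (fun n x => mm_bound2 (γ := γ) P.hγ hδ (P.hc.trans_le (S.Wge P (ep n) x)))
    (fun n => per_int ((mol_continuous _ (S.GP i)).mul (mol_continuous _ (S.uPI P i)))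
      ((mol_per _ (S.GP i).per).comp2 (mol_per _ (S.ui_p i)) (fun a b => a * b)))
    hGu.int (S.l1W P (MM γ δ) mm_meas (fun a ha => mm_bound2 P.hγ hδ ha) (fun a ha => mm_cont hδ ha))
    (S.Gu_l1 P i)
  have := h1.add h2
  rw [zero_add] at this
  exact this

theorem Slice.mmGu_le (S : Slice c q al r u G R B) (P : Par γ c q al) {δ : ℝ} (hδ : 0 < δ) (i : Fin d) (x : Fin d → ℝ) :
    |mm γ δ (r x) * (G i x * u x i)| ≤ (γ + 1) * |Qg γ r (G i) x * u x i| := by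
  have hr := S.rpos P x
  have hγ := P.hγ
  have h1 : |mm γ δ (r x)| ≤ γ * (γ + 1) * r x ^ (γ - 1) := (mm_bound P.hγ hδ hr).trans
    (mul_le_mul_of_nonneg_left (tau_pow_le _ (by linarith) hδ hr) (by positivity))
  have h2 : |Qg γ r (G i) x * u x i| = γ * r x ^ (γ - 1) * |G i x * u x i| := by
    unfold Qg
    rw [show γ * (r x ^ (γ - 1) * G i x) * u x i = (γ * r x ^ (γ - 1)) * (G i x * u x i) by ring, abs_mul,
      abs_of_pos (by positivity)]
  rw [h2, abs_mul]
  refine (mul_le_mul_of_nonneg_right h1 (abs_nonneg _)).trans (le_of_eq ?_)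
  ring

theorem Slice.mmGu_bound (S : Slice c q al r u G R B) (P : Par γ c q al) {δ : ℝ} (hδ : 0 < δ) (i : Fin d) :
    ‖∫ x, mm γ δ (r x) * (G i x * u x i) ∂(cubeVol d)‖ₑ ≤
      ENNReal.ofReal (γ + 1) * (ENNReal.ofReal γ * (2 * (R ^ γ * B))) := by
  have hγ := P.hγ
  refine (enorm_integral_le_lintegral_enorm _).trans ?_
  calc _ ≤ ∫⁻ x, ENNReal.ofReal (γ + 1) * (‖Qg γ r (G i) x‖ₑ * ‖u x‖ₑ) ∂(cubeVol d) := by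
        refine lintegral_mono fun x => ?_
        dsimp only
        refine (enorm_le_of_abs (S.mmGu_le P hδ i x)).trans ?_
        rw [ENNReal.ofReal_mul (by positivity), ← Real.enorm_eq_ofReal_abs, enorm_mul]
        gcongr
        exact enorm_coord _ _
    _ ≤ _ := by
        rw [lintegral_const_mul' _ _ ENNReal.ofReal_ne_top]
        gcongr
        exact S.Qu P i

theorem Slice.mmGu_lim (S : Slice c q al r u G R B) (P : Par γ c q al) (i : Fin d) :
    Filter.Tendsto (fun n => ∫ x, mm γ (ep n) (r x) * (G i x * u x i) ∂(cubeVol d)) Filter.atTop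
      (nhds ((γ - 1) * ∫ x, Qg γ r (G i) x * u x i ∂(cubeVol d))) := by
  rw [← integral_const_mul]
  refine tendsto_integral_of_dominated_convergence (fun x => (γ + 1) * |Qg γ r (G i) x * u x i|)
    (fun n => ((mm_meas.comp S.rm).mul ((S.GP i).meas.mul (S.ui_m i))).aestronglyMeasurable)
    ((S.QuPI P i i).int.abs.const_mul _) (fun n => Filter.Eventually.of_forall fun x => S.mmGu_le P (ep_pos n) i x)
    (Filter.Eventually.of_forall fun x => ?_)
  have := (mm_lim (γ := γ) (S.rpos P x)).mul_const (G i x * u x i)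
  unfold Qg
  rw [show (γ - 1) * (γ * (r x ^ (γ - 1) * G i x) * u x i) = γ * (γ - 1) * r x ^ (γ - 1) * (G i x * u x i) by ring]
  exact this

/-- regularized internal energy -/
def intE (γ δ ε : ℝ) (r : (Fin d → ℝ) → ℝ) : ℝ := ∫ x, PP γ δ (mol ε r x) ∂(cubeVol d)

theorem Slice.intE_bound (S : Slice c q al r u G R B) (P : Par γ c q al) {δ : ℝ} (hδ : 0 < δ) (ε : ℝ) :
    ‖intE γ δ ε r‖ₑ ≤ ENNReal.ofReal (δ⁻¹ ^ γ) := by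
  refine (enorm_integral_le_lintegral_enorm _).trans ?_
  calc _ ≤ ∫⁻ x, ENNReal.ofReal (δ⁻¹ ^ γ) ∂(cubeVol d) :=
        lintegral_mono fun x => enorm_le_of_abs (PP_bound P.hγ hδ (P.hc.trans_le (S.Wge P ε x)))
    _ = _ := by simp

theorem Slice.PPr_int (S : Slice c q al r u G R B) (P : Par γ c q al) {δ : ℝ} (hδ : 0 < δ) :
    Integrable (fun x => PP γ δ (r x)) (cubeVol d) :=
  bdd_integrable (PP_meas.comp S.rm).aestronglyMeasurable _ (fun x => PP_bound P.hγ hδ (S.rpos P x))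

theorem Slice.intE_lim (S : Slice c q al r u G R B) (P : Par γ c q al) {δ : ℝ} (hδ : 0 < δ) :
    Filter.Tendsto (fun n => intE γ δ (ep n) r) Filter.atTop (nhds (∫ x, PP γ δ (r x) ∂(cubeVol d))) := by
  rw [← tendsto_sub_nhds_zero_iff]
  refine enorm_tendsto_zero (fun n => ?_) (S.l1W P (h := PP γ δ) (δ⁻¹ ^ γ) PP_meas
    (fun a ha => PP_bound P.hγ hδ ha) (fun a ha => PP_cont hδ ha))
  unfold intE
  rw [← integral_sub (bdd_integrable (f := fun x => PP γ δ (mol (ep n) r x)) (PP_meas.comp (mol_continuous _ (S.rPI P)).measurable).aestronglyMeasurable _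
    (fun x => PP_bound P.hγ hδ (P.hc.trans_le (S.Wge P (ep n) x)))) (S.PPr_int P hδ)]
  exact enorm_integral_le_lintegral_enorm _

theorem PP_le {δ s : ℝ} (hγ : 1 < γ) (hδ : 0 < δ) (hs : 0 < s) : |PP γ δ s| ≤ s ^ γ := by
  unfold PP
  rw [abs_of_nonneg (Real.rpow_nonneg (tau_pos hδ hs).le _)]
  exact tau_pow_le _ (by linarith) hδ hs

theorem Slice.PPr_bound (S : Slice c q al r u G R B) (P : Par γ c q al) {δ : ℝ} (hδ : 0 < δ) :
    ‖∫ x, PP γ δ (r x) ∂(cubeVol d)‖ₑ ≤ R ^ γ * B := by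
  refine (enorm_integral_le_lintegral_enorm _).trans ?_
  have h1 : R ^ γ ≤ R ^ γ * B := le_mul_of_one_le_right zero_le S.B1
  refine le_trans (lintegral_mono fun x => ?_) ((S.pow_1 P S.rm S.rR).trans h1)
  dsimp only
  refine (enorm_le_of_abs (PP_le P.hγ hδ (S.rpos P x))).trans (le_of_eq ?_)
  rw [Real.enorm_of_nonneg (S.rpos P x).le, ENNReal.ofReal_rpow_of_pos (S.rpos P x)]

theorem Slice.PPr_lim (S : Slice c q al r u G R B) (P : Par γ c q al) :
    Filter.Tendsto (fun n => ∫ x, PP γ (ep n) (r x) ∂(cubeVol d)) Filter.atTop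
      (nhds (∫ x, r x ^ γ ∂(cubeVol d))) :=
  tendsto_integral_of_dominated_convergence (fun x => r x ^ γ)
    (fun n => (PP_meas.comp S.rm).aestronglyMeasurable)
    (S.rgPI P).int (fun n => Filter.Eventually.of_forall fun x => PP_le P.hγ (ep_pos n) (S.rpos P x))
    (Filter.Eventually.of_forall fun x => PP_lim (S.rpos P x))

end intlim

/-! ### assembly in time -/

section assembly

/-- everything we need about the (corrected) solution -/
structure Good (c q al γ κ T : ℝ) (ρ : ℝ → (Fin d → ℝ) → ℝ) (v : ℝ → (Fin d → ℝ) → Fin d → ℝ)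
    (G : Fin d → ℝ → (Fin d → ℝ) → ℝ) (R B : ℝ → ℝ≥0∞) (K : ℝ) : Prop where
  T0 : 0 < T
  P : Par γ c q al
  ρm : Measurable (Function.uncurry ρ)
  vm : Measurable (Function.uncurry v)
  Gm : ∀ i, Measurable (Function.uncurry (G i))
  S : ∀ t, Slice c q al (ρ t) (v t) (fun i => G i t) (R t) (B t)
  K0 : 0 ≤ K
  k1 : ∀ t, ∫ x, |ρ t x| ∂(cubeVol d) ≤ K
  k2 : ∀ t j, ∫ x, |ρ t x * v t x j| ∂(cubeVol d) ≤ K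
  k3 : ∀ t i j, ∫ x, |ρ t x * v t x i * v t x j| ∂(cubeVol d) ≤ K
  k4 : ∀ t, ∫ x, |ρ t x ^ γ| ∂(cubeVol d) ≤ K
  fin : ∫⁻ t in Set.Ioo 0 T, (R t * B t ^ (3:ℝ) + R t ^ γ * B t) < ∞
  mass : ∀ χ, IsTT T χ → ∀ ε, 0 < ε → ∀ x, ∫ t in Set.Ioo 0 T, deriv χ t * mol ε (ρ t) x =
    ∫ t in Set.Ioo 0 T, χ t * ∑ i, dmol ε i (fun y => ρ t y * v t y i) x
  mom : ∀ χ, IsTT T χ → ∀ ε, 0 < ε → ∀ x j,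
    ∫ t in Set.Ioo 0 T, deriv χ t * mol ε (fun y => ρ t y * v t y j) x =
    ∫ t in Set.Ioo 0 T, χ t * ((∑ i, dmol ε i (fun y => ρ t y * v t y i * v t y j) x) +
      κ * dmol ε j (fun y => ρ t y ^ γ) x)

theorem fub {T C : ℝ} {H : ℝ → (Fin d → ℝ) → ℝ} (hm : Measurable (Function.uncurry H))
    (hC : ∀ t x, |H t x| ≤ C) :
    ∫ x, (∫ t in Set.Ioo 0 T, H t x) ∂(cubeVol d) = ∫ t in Set.Ioo 0 T, ∫ x, H t x ∂(cubeVol d) := by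
  refine (integral_integral_swap ?_).symm
  refine Integrable.mono' (g := fun _ => C) (integrable_const C) hm.aestronglyMeasurable
    (Filter.Eventually.of_forall fun z => hC z.1 z.2)

theorem int_meas {H : ℝ → (Fin d → ℝ) → ℝ} (hm : Measurable (Function.uncurry H)) :
    Measurable (fun t => ∫ x, H t x ∂(cubeVol d)) :=
  (hm.stronglyMeasurable.integral_prod_right (f := H)).measurable

variable {c q al γ κ T K : ℝ} {ρ : ℝ → (Fin d → ℝ) → ℝ} {v : ℝ → (Fin d → ℝ) → Fin d → ℝ}
    {G : Fin d → ℝ → (Fin d → ℝ) → ℝ} {R B : ℝ → ℝ≥0∞}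

theorem Good.vim (H : Good c q al γ κ T ρ v G R B K) (i : Fin d) :
    Measurable (fun z : ℝ × (Fin d → ℝ) => v z.1 z.2 i) := (measurable_pi_apply i).comp H.vm

theorem Good.ρvm (H : Good c q al γ κ T ρ v G R B K) (i : Fin d) :
    Measurable (Function.uncurry (fun t x => ρ t x * v t x i)) := H.ρm.mul (H.vim i)

theorem Good.ρvvm (H : Good c q al γ κ T ρ v G R B K) (i j : Fin d) :
    Measurable (Function.uncurry (fun t x => ρ t x * v t x i * v t x j)) := (H.ρm.mul (H.vim i)).mul (H.vim j)

theorem Good.ργm (H : Good c q al γ κ T ρ v G R B K) :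
    Measurable (Function.uncurry (fun t x => ρ t x ^ γ)) := H.ρm.pow_const γ

/-- kernel bound -/
def kd (d : ℕ) (ε : ℝ) : ℝ := ((kN ε)⁻¹) ^ d

theorem kd_nonneg (d : ℕ) (ε : ℝ) (h : 0 ≤ kN ε) : 0 ≤ kd d ε := by unfold kd; positivity

theorem Good.b1 (H : Good c q al γ κ T ρ v G R B K) (ε : ℝ) (h : 0 ≤ kN ε) (t : ℝ) (x : Fin d → ℝ) :
    |mol ε (ρ t) x| ≤ kd d ε * K :=
  (mol_bdd ε ((H.S t).rPI H.P) x).trans (mul_le_mul_of_nonneg_left (H.k1 t) (kd_nonneg d ε h))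

theorem Good.b2 (H : Good c q al γ κ T ρ v G R B K) (ε : ℝ) (h : 0 ≤ kN ε) (t : ℝ) (x : Fin d → ℝ) (j : Fin d) :
    |mol ε (fun y => ρ t y * v t y j) x| ≤ kd d ε * K :=
  (mol_bdd ε ((H.S t).ruPI H.P j) x).trans (mul_le_mul_of_nonneg_left (H.k2 t j) (kd_nonneg d ε h))

/-- derivative bound -/
def KD (d : ℕ) (ε K : ℝ) : ℝ := 2 * Real.pi / ε * (kd d ε * K)

theorem Good.b3 (H : Good c q al γ κ T ρ v G R B K) {ε : ℝ} (hε : 0 < ε) (h : 0 ≤ kN ε) (t : ℝ)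
    (x : Fin d → ℝ) (i : Fin d) :
    |dmol ε i (fun y => ρ t y * v t y i) x| ≤ KD d ε K :=
  (dmol_bdd hε i ((H.S t).ruPI H.P i) x).trans (mul_le_mul_of_nonneg_left
    (mul_le_mul_of_nonneg_left (H.k2 t i) (kd_nonneg d ε h)) (by positivity))

theorem Good.b4 (H : Good c q al γ κ T ρ v G R B K) {ε : ℝ} (hε : 0 < ε) (h : 0 ≤ kN ε) (t : ℝ)
    (x : Fin d → ℝ) (i j : Fin d) :
    |dmol ε i (fun y => ρ t y * v t y i * v t y j) x| ≤ KD d ε K :=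
  (dmol_bdd hε i ((H.S t).ruuPI H.P i j) x).trans (mul_le_mul_of_nonneg_left
    (mul_le_mul_of_nonneg_left (H.k3 t i j) (kd_nonneg d ε h)) (by positivity))

theorem Good.b5 (H : Good c q al γ κ T ρ v G R B K) {ε : ℝ} (hε : 0 < ε) (h : 0 ≤ kN ε) (t : ℝ)
    (x : Fin d → ℝ) (j : Fin d) :
    |dmol ε j (fun y => ρ t y ^ γ) x| ≤ KD d ε K :=
  (dmol_bdd hε j ((H.S t).rgPI H.P) x).trans (mul_le_mul_of_nonneg_left
    (mul_le_mul_of_nonneg_left (H.k4 t) (kd_nonneg d ε h)) (by positivity))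

theorem sum_abs_le {f : Fin d → ℝ} {C : ℝ} (h : ∀ i, |f i| ≤ C) : |∑ i, f i| ≤ d * C := by
  refine (Finset.abs_sum_le_sum_abs _ _).trans ((Finset.sum_le_sum fun i _ => h i).trans (le_of_eq ?_))
  simp

theorem Good.b6 (H : Good c q al γ κ T ρ v G R B K) {ε : ℝ} (hε : 0 < ε) (h : 0 ≤ kN ε) (t : ℝ)
    (x : Fin d → ℝ) (j : Fin d) :
    |(∑ i, dmol ε i (fun y => ρ t y * v t y i * v t y j) x) + κ * dmol ε j (fun y => ρ t y ^ γ) x| ≤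
      d * KD d ε K + |κ| * KD d ε K := by
  refine (abs_add_le _ _).trans (add_le_add (sum_abs_le fun i => H.b4 hε h t x i j) ?_)
  rw [abs_mul]
  exact mul_le_mul_of_nonneg_left (H.b5 hε h t x j) (abs_nonneg _)

theorem Good.m1 (H : Good c q al γ κ T ρ v G R B K) (ε : ℝ) :
    Measurable (fun z : ℝ × (Fin d → ℝ) => ∑ i, dmol ε i (fun y => ρ z.1 y * v z.1 y i) z.2) :=
  Finset.measurable_fun_sum _ fun i _ => dmol_meas ε i (H.ρvm i)

theorem Good.m2 (H : Good c q al γ κ T ρ v G R B K) (ε : ℝ) (j : Fin d) :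
    Measurable (fun z : ℝ × (Fin d → ℝ) => (∑ i, dmol ε i (fun y => ρ z.1 y * v z.1 y i * v z.1 y j) z.2)
      + κ * dmol ε j (fun y => ρ z.1 y ^ γ) z.2) :=
  (Finset.measurable_fun_sum _ fun i _ => dmol_meas ε i (H.ρvvm i j)).add
    (measurable_const.mul (dmol_meas ε j H.ργm))

theorem Good.mV (H : Good c q al γ κ T ρ v G R B K) (ε : ℝ) (j : Fin d) :
    Measurable (fun z : ℝ × (Fin d → ℝ) => VV ε (ρ z.1) (v z.1) j z.2) :=
  (mol_meas ε (H.ρvm j)).div (mol_meas ε H.ρm)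

theorem kN_nonneg (n : ℕ) : 0 ≤ kN (ep n) := (kN_pos _).le

/-- integrand of kinA -/
def kinI (κ γ δ ε : ℝ) (j : Fin d) (r : (Fin d → ℝ) → ℝ) (u : (Fin d → ℝ) → Fin d → ℝ) (x : Fin d → ℝ) : ℝ :=
  ps δ (VV ε r u j x) * (∑ i, dmol ε i (fun x => r x * u x i) x) +
    g1 δ (VV ε r u j x) * ((∑ i, dmol ε i (fun x => r x * u x i * u x j) x) +
      κ * dmol ε j (fun x => r x ^ γ) x)

theorem Good.kinI_meas (H : Good c q al γ κ T ρ v G R B K) {δ : ℝ} (hδ : 0 < δ) (ε : ℝ) (j : Fin d) :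
    Measurable (Function.uncurry fun t x => kinI κ γ δ ε j (ρ t) (v t) x) :=
  (((ps_cont hδ).measurable.comp (H.mV ε j)).mul (H.m1 ε)).add
    (((g1_cont hδ).measurable.comp (H.mV ε j)).mul (H.m2 ε j))

theorem Good.FK_meas' (H : Good c q al γ κ T ρ v G R B K) {δ : ℝ} (hδ : 0 < δ) (ε : ℝ) (j : Fin d) :
    Measurable (Function.uncurry fun t x => FK δ (mol ε (ρ t) x) (mol ε (fun x => ρ t x * v t x j) x)) :=
  (FK_meas hδ).comp ((mol_meas ε H.ρm).prodMk (mol_meas ε (H.ρvm j)))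

theorem Good.kin_eq (H : Good c q al γ κ T ρ v G R B K) {δ : ℝ} (hδ : 0 < δ) (n : ℕ) (j : Fin d)
    {φ : ℝ → ℝ} (hφ : IsTT T φ) :
    ∫ t in Set.Ioo 0 T, deriv φ t * kinE δ (ep n) j (ρ t) (v t) =
      ∫ t in Set.Ioo 0 T, φ t * kinA κ γ δ (ep n) j (ρ t) (v t) := by
  set ε := ep n with hεd
  have hε : 0 < ε := ep_pos n
  have hk : 0 ≤ kN ε := kN_nonneg n
  have hkd := kd_nonneg d ε hk
  have hKD : 0 ≤ KD d ε K := by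
    have := H.K0
    unfold KD; positivity
  have hL0 : 0 ≤ δ⁻¹ + (Real.sqrt δ)⁻¹ := by positivity
  have pt : ∀ x, ∫ t in Set.Ioo 0 T, deriv φ t * FK δ (mol ε (ρ t) x) (mol ε (fun x => ρ t x * v t x j) x) =
      ∫ t in Set.Ioo 0 T, φ t * kinI κ γ δ ε j (ρ t) (v t) x := fun x => by
    have h := time_chain H.T0 (u₁ := fun t => mol ε (ρ t) x) (u₂ := fun t => mol ε (fun x => ρ t x * v t x j) x)
      (a₁ := fun t => -∑ i, dmol ε i (fun y => ρ t y * v t y i) x)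
      (a₂ := fun t => -((∑ i, dmol ε i (fun y => ρ t y * v t y i * v t y j) x) +
        κ * dmol ε j (fun y => ρ t y ^ γ) x))
      ((mol_meas ε H.ρm).comp (measurable_id.prodMk measurable_const))
      ((mol_meas ε (H.ρvm j)).comp (measurable_id.prodMk measurable_const))
      ((H.m1 ε).comp (measurable_id.prodMk measurable_const)).neg
      ((H.m2 ε j).comp (measurable_id.prodMk measurable_const)).neg
      (K := kd d ε * K + (d * KD d ε K + |κ| * KD d ε K)) (c := c)
      (fun t => (H.b1 ε hk t x).trans (by have : 0 ≤ d * KD d ε K + |κ| * KD d ε K := by positivity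
                                          linarith))
      (fun t => (H.b2 ε hk t x j).trans (by have : 0 ≤ d * KD d ε K + |κ| * KD d ε K := by positivity
                                            linarith))
      (fun t => by
        rw [abs_neg]
        refine (sum_abs_le fun i => H.b3 hε hk t x i).trans ?_
        have h1 : 0 ≤ |κ| * KD d ε K := by positivity
        have h2 : 0 ≤ kd d ε * K := mul_nonneg hkd H.K0
        linarith)
      (fun t => by
        rw [abs_neg]
        refine (H.b6 hε hk t x j).trans ?_
        have h2 : 0 ≤ kd d ε * K := mul_nonneg hkd H.K0
        linarith)
      (fun t => (H.S t).Wge H.P ε x)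
      (fun χ hχ => by
        rw [H.mass χ hχ ε hε x, ← integral_neg]
        simp)
      (fun χ hχ => by
        rw [H.mom χ hχ ε hε x j, ← integral_neg]
        simp only [mul_neg, neg_neg])
      (FK δ) (fun r m => ps δ (m / r)) (fun r m => g1 δ (m / r)) hL0
      (fun r m r' m' hr hr' => FK_lip hδ H.P.hc r m r' m' hr hr')
      (fun f₁ f₂ b₁ b₂ t h1 h2 hh => FK_deriv hδ f₁ f₂ b₁ b₂ t h1 h2 (H.P.hc.trans_le hh).ne') hφ
    rw [h, ← integral_neg]
    refine integral_congr_ae (Filter.Eventually.of_forall fun t => ?_)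
    dsimp only
    unfold kinI VV
    ring
  obtain ⟨C, hC0, hC⟩ := hφ.bound
  obtain ⟨C', hC0', hC'⟩ := hφ.deriv.bound
  have e1 := fub (T := T) (C := C' * ((δ⁻¹ + (Real.sqrt δ)⁻¹) * (kd d ε * K)))
    (H := fun t x => deriv φ t * FK δ (mol ε (ρ t) x) (mol ε (fun x => ρ t x * v t x j) x))
    ((hφ.deriv.cont.measurable.comp measurable_fst).mul (H.FK_meas' hδ ε j)) (fun t x => by
      rw [abs_mul]
      refine mul_le_mul (hC' t) ?_ (abs_nonneg _) hC0'
      exact (FK_abs hδ (H.P.hc.trans_le ((H.S t).Wge H.P ε x))).trans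
        (mul_le_mul_of_nonneg_left (H.b2 ε hk t x j) hL0))
  have e2 := fub (T := T) (C := C * (δ⁻¹ * (d * KD d ε K) + (Real.sqrt δ)⁻¹ * (d * KD d ε K + |κ| * KD d ε K)))
    (H := fun t x => φ t * kinI κ γ δ ε j (ρ t) (v t) x)
    ((hφ.cont.measurable.comp measurable_fst).mul (H.kinI_meas hδ ε j)) (fun t x => by
      rw [abs_mul]
      refine mul_le_mul (hC t) ?_ (abs_nonneg _) hC0
      unfold kinI
      refine (abs_add_le _ _).trans ?_
      rw [abs_mul, abs_mul]
      refine add_le_add (mul_le_mul (ps_bound hδ _) (sum_abs_le fun i => H.b3 hε hk t x i) (abs_nonneg _)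
        (by positivity)) (mul_le_mul (g1_bound hδ _) (H.b6 hε hk t x j) (abs_nonneg _) (by positivity)))
  simp only [pt] at e1
  rw [e2] at e1
  simp only [integral_const_mul] at e1
  exact e1.symm

theorem Good.int_eq (H : Good c q al γ κ T ρ v G R B K) {δ : ℝ} (hδ : 0 < δ) (n : ℕ)
    {φ : ℝ → ℝ} (hφ : IsTT T φ) :
    ∫ t in Set.Ioo 0 T, deriv φ t * intE γ δ (ep n) (ρ t) =
      ∫ t in Set.Ioo 0 T, φ t * intA γ δ (ep n) (ρ t) (v t) := by
  set ε := ep n with hεd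
  have hε : 0 < ε := ep_pos n
  have hk : 0 ≤ kN ε := kN_nonneg n
  have hkd := kd_nonneg d ε hk
  have hγ := H.P.hγ
  have hKD : 0 ≤ KD d ε K := by
    have := H.K0
    unfold KD; positivity
  have hL0 : 0 ≤ γ * δ⁻¹ ^ (γ - 1) := by positivity
  have h2 : 0 ≤ kd d ε * K := mul_nonneg hkd H.K0
  have pt : ∀ x, ∫ t in Set.Ioo 0 T, deriv φ t * PP γ δ (mol ε (ρ t) x) =
      ∫ t in Set.Ioo 0 T, φ t * (bb γ δ (mol ε (ρ t) x) * ∑ i, dmol ε i (fun y => ρ t y * v t y i) x) := fun x => by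
    have h := time_chain H.T0 (u₁ := fun t => mol ε (ρ t) x) (u₂ := fun t => 0)
      (a₁ := fun t => -∑ i, dmol ε i (fun y => ρ t y * v t y i) x)
      (a₂ := fun t => 0)
      ((mol_meas ε H.ρm).comp (measurable_id.prodMk measurable_const))
      measurable_const
      ((H.m1 ε).comp (measurable_id.prodMk measurable_const)).neg
      measurable_const
      (K := kd d ε * K + d * KD d ε K) (c := c)
      (fun t => (H.b1 ε hk t x).trans (by have : 0 ≤ d * KD d ε K := by positivity
                                          linarith))
      (fun t => by rw [abs_zero]; positivity)
      (fun t => by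
        rw [abs_neg]
        refine (sum_abs_le fun i => H.b3 hε hk t x i).trans ?_
        linarith)
      (fun t => by rw [abs_zero]; positivity)
      (fun t => (H.S t).Wge H.P ε x)
      (fun χ hχ => by
        rw [H.mass χ hχ ε hε x, ← integral_neg]
        simp)
      (fun χ hχ => by simp)
      (fun r _ => PP γ δ r) (fun r _ => bb γ δ r) (fun _ _ => 0) hL0
      (fun r m r' m' hr hr' => (PP_lip hγ H.P.hc hδ hr hr').trans (le_add_of_nonneg_right (by positivity)))
      (fun f₁ f₂ b₁ b₂ t h1 h2 hh => by
        have hx := (PP_deriv (γ := γ) hδ (H.P.hc.trans_le hh)).comp t h1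
        exact hx.congr_deriv (by ring)) hφ
    rw [h, ← integral_neg]
    refine integral_congr_ae (Filter.Eventually.of_forall fun t => ?_)
    dsimp only
    ring
  obtain ⟨C, hC0, hC⟩ := hφ.bound
  obtain ⟨C', hC0', hC'⟩ := hφ.deriv.bound
  have e1 := fub (T := T) (C := C' * (δ⁻¹ ^ γ))
    (H := fun t x => deriv φ t * PP γ δ (mol ε (ρ t) x))
    ((hφ.deriv.cont.measurable.comp measurable_fst).mul (PP_meas.comp (mol_meas ε H.ρm))) (fun t x => by
      rw [abs_mul]
      exact mul_le_mul (hC' t) (PP_bound hγ hδ (H.P.hc.trans_le ((H.S t).Wge H.P ε x))) (abs_nonneg _) hC0')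
  have e2 := fub (T := T) (C := C * (γ * δ⁻¹ ^ (γ - 1) * (d * KD d ε K)))
    (H := fun t x => φ t * (bb γ δ (mol ε (ρ t) x) * ∑ i, dmol ε i (fun y => ρ t y * v t y i) x))
    ((hφ.cont.measurable.comp measurable_fst).mul ((bb_meas.comp (mol_meas ε H.ρm)).mul (H.m1 ε))) (fun t x => by
      rw [abs_mul]
      refine mul_le_mul (hC t) ?_ (abs_nonneg _) hC0
      rw [abs_mul]
      exact mul_le_mul (bb_bound2 hγ hδ (H.P.hc.trans_le ((H.S t).Wge H.P ε x)))
        (sum_abs_le fun i => H.b3 hε hk t x i) (abs_nonneg _) hL0)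
  simp only [pt] at e1
  rw [e2] at e1
  simp only [integral_const_mul] at e1
  exact e1.symm

/-- the dominating function -/
theorem Good.dct (H : Good c q al γ κ T ρ v G R B K) {χ : ℝ → ℝ} (hχ : IsTT T χ) {A : ℕ → ℝ → ℝ} {A' : ℝ → ℝ}
    (hm : ∀ n, Measurable (A n)) {C : ℝ≥0∞} (hC : C ≠ ∞)
    (hb : ∀ n t, ‖A n t‖ₑ ≤ C * (R t * B t ^ (3:ℝ) + R t ^ γ * B t))
    (hl : ∀ t, Filter.Tendsto (fun n => A n t) Filter.atTop (nhds (A' t))) :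
    Filter.Tendsto (fun n => ∫ t in Set.Ioo 0 T, χ t * A n t) Filter.atTop
      (nhds (∫ t in Set.Ioo 0 T, χ t * A' t)) := by
  obtain ⟨M, hM0, hM⟩ := hχ.bound
  refine dct_nm _ (fun t => ENNReal.ofReal M * (C * (R t * B t ^ (3:ℝ) + R t ^ γ * B t))) ?_ _ _
    (fun n => (hχ.cont.measurable.mul (hm n)).aestronglyMeasurable)
    (fun n => Filter.Eventually.of_forall fun t => ?_)
    (Filter.Eventually.of_forall fun t => (hl t).const_mul _)
  · rw [lintegral_const_mul' _ _ ENNReal.ofReal_ne_top, lintegral_const_mul' _ _ hC]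
    exact ENNReal.mul_lt_top ENNReal.ofReal_lt_top (ENNReal.mul_lt_top hC.lt_top H.fin)
  · rw [enorm_mul]
    exact mul_le_mul' (enorm_le_of_abs (hM t)) (hb n t)

end assembly

/-! ### passing to the limit in time -/

section assembly2

variable {c q al γ κ T K : ℝ} {ρ : ℝ → (Fin d → ℝ) → ℝ} {v : ℝ → (Fin d → ℝ) → Fin d → ℝ}
    {G : Fin d → ℝ → (Fin d → ℝ) → ℝ} {R B : ℝ → ℝ≥0∞}

theorem Good.tint (H : Good c q al γ κ T ρ v G R B K) {χ : ℝ → ℝ} (hχ : IsTT T χ) {A : ℝ → ℝ}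
    (hm : Measurable A) {C : ℝ≥0∞} (hC : C ≠ ∞)
    (hb : ∀ t, ‖A t‖ₑ ≤ C * (R t * B t ^ (3:ℝ) + R t ^ γ * B t)) :
    IntegrableOn (fun t => χ t * A t) (Set.Ioo 0 T) := by
  obtain ⟨M, hM0, hM⟩ := hχ.bound
  refine ⟨(hχ.cont.measurable.mul hm).aestronglyMeasurable, ?_⟩
  refine lt_of_le_of_lt (lintegral_mono
    (g := fun t => ENNReal.ofReal M * (C * (R t * B t ^ (3:ℝ) + R t ^ γ * B t))) fun t => ?_) ?_
  · dsimp only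
    rw [enorm_mul]
    exact mul_le_mul' (enorm_le_of_abs (hM t)) (hb t)
  · rw [lintegral_const_mul' _ _ ENNReal.ofReal_ne_top, lintegral_const_mul' _ _ hC]
    exact ENNReal.mul_lt_top ENNReal.ofReal_lt_top (ENNReal.mul_lt_top hC.lt_top H.fin)

theorem Good.le1 (C : ℝ≥0∞) (a b : ℝ≥0∞) : C * a ≤ C * (a + b) := by gcongr; exact le_self_add
theorem Good.le2 (C : ℝ≥0∞) (a b : ℝ≥0∞) : C * b ≤ C * (a + b) := by gcongr; exact le_add_self

theorem Good.D1 (H : Good c q al γ κ T ρ v G R B K) (t : ℝ) : 1 ≤ R t * B t ^ (3:ℝ) + R t ^ γ * B t := by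
  have h1 : 1 ≤ R t * B t ^ (3:ℝ) := by
    have := mul_le_mul' (H.S t).R1 (ENNReal.one_le_rpow (H.S t).B1 (by norm_num : (0:ℝ) < 3))
    rwa [one_mul] at this
  exact h1.trans le_self_add

theorem Good.Qm2 (H : Good c q al γ κ T ρ v G R B K) (j : Fin d) :
    Measurable (Function.uncurry fun t x => Qg γ (ρ t) (G j t) x) :=
  measurable_const.mul ((H.ρm.pow_const (γ - 1)).mul (H.Gm j))

theorem Good.kin_lim1 (H : Good c q al γ κ T ρ v G R B K) {δ : ℝ} (hδ : 0 < δ) (j : Fin d)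
    {φ : ℝ → ℝ} (hφ : IsTT T φ) :
    ∫ t in Set.Ioo 0 T, deriv φ t * ∫ x, ρ t x * g0 δ (v t x j) ∂(cubeVol d) =
      ∫ t in Set.Ioo 0 T, φ t * (κ * ∫ x, g1 δ (v t x j) * Qg γ (ρ t) (G j t) x ∂(cubeVol d)) := by
  have l1 := H.dct hφ.deriv (A := fun n t => kinE δ (ep n) j (ρ t) (v t))
    (fun n => int_meas (H.FK_meas' hδ (ep n) j)) ENNReal.ofReal_ne_top
    (fun n t => ((H.S t).kinE_bound H.P hδ (ep n) j).trans (Good.le1 _ _ _))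
    (fun t => (H.S t).kinE_lim H.P hδ j)
  have l2 := H.dct hφ (A := fun n t => kinA κ γ δ (ep n) j (ρ t) (v t))
    (fun n => int_meas (H.kinI_meas hδ (ep n) j)) (CK_ne d κ γ δ)
    (fun n t => (H.S t).kinA_bound H.P hδ κ n j)
    (fun t => (H.S t).kinA_lim H.P hδ κ j)
  refine tendsto_nhds_unique l1 (l2.congr fun n => ?_)
  exact (H.kin_eq hδ n j hφ).symm

theorem Good.kin_fin (H : Good c q al γ κ T ρ v G R B K) (j : Fin d)
    {φ : ℝ → ℝ} (hφ : IsTT T φ) :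
    ∫ t in Set.Ioo 0 T, deriv φ t * ∫ x, ρ t x * (v t x j ^ 2 / 2) ∂(cubeVol d) =
      ∫ t in Set.Ioo 0 T, φ t * (κ * ∫ x, Qg γ (ρ t) (G j t) x * v t x j ∂(cubeVol d)) := by
  have l1 := H.dct hφ.deriv (A := fun n t => ∫ x, ρ t x * g0 (ep n) (v t x j) ∂(cubeVol d))
    (fun n => int_meas (H.ρm.mul ((g0_cont (ep_pos n)).measurable.comp (H.vim j)))) (C := 1) ENNReal.one_ne_top
    (fun n t => ((H.S t).rg0_bound H.P (ep_pos n) j).trans (by rw [one_mul]; exact le_self_add))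
    (fun t => (H.S t).rg0_lim H.P j)
  have l2 := H.dct hφ (A := fun n t => κ * ∫ x, g1 (ep n) (v t x j) * Qg γ (ρ t) (G j t) x ∂(cubeVol d))
    (fun n => measurable_const.mul
      (int_meas (((g1_cont (ep_pos n)).measurable.comp (H.vim j)).mul (H.Qm2 j))))
    (C := ‖κ‖ₑ * (ENNReal.ofReal γ * 2)) (by finiteness)
    (fun n t => by
      rw [enorm_mul, mul_assoc]
      refine mul_le_mul' le_rfl (((H.S t).g1Q_bound H.P (ep_pos n) j).trans ?_)
      rw [← mul_assoc]
      exact Good.le2 _ _ _)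
    (fun t => ((H.S t).g1Q_lim H.P j).const_mul κ)
  refine tendsto_nhds_unique l1 (l2.congr fun n => ?_)
  exact (H.kin_lim1 (ep_pos n) j hφ).symm

theorem Good.int_lim1 (H : Good c q al γ κ T ρ v G R B K) {δ : ℝ} (hδ : 0 < δ)
    {φ : ℝ → ℝ} (hφ : IsTT T φ) :
    ∫ t in Set.Ioo 0 T, deriv φ t * ∫ x, PP γ δ (ρ t x) ∂(cubeVol d) =
      ∫ t in Set.Ioo 0 T, φ t * (-∑ i, ∫ x, mm γ δ (ρ t x) * (G i t x * v t x i) ∂(cubeVol d)) := by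
  have l1 := H.dct hφ.deriv (A := fun n t => intE γ δ (ep n) (ρ t))
    (fun n => int_meas (PP_meas.comp (mol_meas (ep n) H.ρm))) (C := ENNReal.ofReal (δ⁻¹ ^ γ)) ENNReal.ofReal_ne_top
    (fun n t => ((H.S t).intE_bound H.P hδ (ep n)).trans (le_mul_of_one_le_right (zero_le) (H.D1 t)))
    (fun t => (H.S t).intE_lim H.P hδ)
  have l2 := H.dct hφ (A := fun n t => intA γ δ (ep n) (ρ t) (v t))
    (fun n => int_meas ((bb_meas.comp (mol_meas (ep n) H.ρm)).mul (H.m1 (ep n)))) (CI_ne d γ δ)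
    (fun n t => ((H.S t).intA_bound H.P hδ n).trans (Good.le1 _ _ _))
    (fun t => (H.S t).intA_lim H.P hδ)
  refine tendsto_nhds_unique l1 (l2.congr fun n => ?_)
  exact (H.int_eq hδ n hφ).symm

theorem Good.int_fin (H : Good c q al γ κ T ρ v G R B K)
    {φ : ℝ → ℝ} (hφ : IsTT T φ) :
    ∫ t in Set.Ioo 0 T, deriv φ t * ∫ x, ρ t x ^ γ ∂(cubeVol d) =
      ∫ t in Set.Ioo 0 T, φ t * (-∑ i, (γ - 1) * ∫ x, Qg γ (ρ t) (G i t) x * v t x i ∂(cubeVol d)) := by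
  have l1 := H.dct hφ.deriv (A := fun n t => ∫ x, PP γ (ep n) (ρ t x) ∂(cubeVol d))
    (fun n => int_meas (PP_meas.comp H.ρm)) (C := 1) ENNReal.one_ne_top
    (fun n t => ((H.S t).PPr_bound H.P (ep_pos n)).trans (by rw [one_mul]; exact le_add_self))
    (fun t => (H.S t).PPr_lim H.P)
  have l2 := H.dct hφ
    (A := fun n t => -∑ i, ∫ x, mm γ (ep n) (ρ t x) * (G i t x * v t x i) ∂(cubeVol d))
    (fun n => (Finset.measurable_fun_sum _ fun i _ =>
      int_meas ((mm_meas.comp H.ρm).mul ((H.Gm i).mul (H.vim i)))).neg)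
    (C := ∑ _i : Fin d, ENNReal.ofReal (γ + 1) * (ENNReal.ofReal γ * 2)) (ENNReal.sum_ne_top.2 fun _ _ => by finiteness)
    (fun n t => by
      rw [enorm_neg, Finset.sum_mul]
      refine (enorm_sum_le _ _).trans (Finset.sum_le_sum fun i _ => ?_)
      refine ((H.S t).mmGu_bound H.P (ep_pos n) i).trans ?_
      rw [← mul_assoc, ← mul_assoc, mul_assoc (ENNReal.ofReal (γ + 1))]
      exact Good.le2 _ _ _)
    (fun t => (tendsto_finsetSum _ fun i _ => (H.S t).mmGu_lim H.P i).neg)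
  refine tendsto_nhds_unique l1 (l2.congr fun n => ?_)
  exact (H.int_lim1 (ep_pos n) hφ).symm

theorem Good.Qv_tint (H : Good c q al γ κ T ρ v G R B K) {φ : ℝ → ℝ} (hφ : IsTT T φ) (j : Fin d) :
    IntegrableOn (fun t => φ t * ∫ x, Qg γ (ρ t) (G j t) x * v t x j ∂(cubeVol d)) (Set.Ioo 0 T) := by
  refine H.tint hφ (int_meas ((H.Qm2 j).mul (H.vim j))) (C := ENNReal.ofReal γ * 2) (by finiteness) fun t => ?_
  refine (enorm_integral_le_lintegral_enorm _).trans ((lintegral_mono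
    (g := fun x => ‖Qg γ (ρ t) (G j t) x‖ₑ * ‖v t x‖ₑ) fun x => ?_).trans (((H.S t).Qu H.P j).trans ?_))
  · dsimp only
    rw [enorm_mul]
    gcongr
    exact enorm_le_iff_norm_le.2 (norm_le_pi_norm (v t x) j)
  · rw [← mul_assoc]
    exact Good.le2 _ _ _

theorem Good.bd_tint {A φ : ℝ → ℝ} {K T : ℝ} (hφ : IsTT T φ) (hm : Measurable A) (hb : ∀ t, |A t| ≤ K) :
    IntegrableOn (fun t => φ t * A t) (Set.Ioo 0 T) := by
  obtain ⟨M, hM0, hM⟩ := hφ.bound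
  refine Integrable.mono' (g := fun _ => M * K) (integrable_const _)
    (hφ.cont.measurable.mul hm).aestronglyMeasurable (Filter.Eventually.of_forall fun t => ?_)
  rw [Real.norm_eq_abs, abs_mul]
  exact mul_le_mul (hM t) (hb t) (abs_nonneg _) hM0

theorem Good.v2_int (H : Good c q al γ κ T ρ v G R B K) (t : ℝ) (j : Fin d) :
    Integrable (fun x => ρ t x * (v t x j ^ 2 / 2)) (cubeVol d) := by
  refine (((H.S t).ruuPI H.P j j).int.div_const 2).congr (Filter.Eventually.of_forall fun x => ?_)
  dsimp only
  ring

theorem Good.energy (H : Good c q al γ (kappa γ) T ρ v G R B K) (t : ℝ) :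
    energyAt d γ ρ v t = (∑ j, ∫ x, ρ t x * (v t x j ^ 2 / 2) ∂(cubeVol d)) +
      kappa γ / (γ - 1) * ∫ x, ρ t x ^ γ ∂(cubeVol d) := by
  rw [← integral_finsetSum _ (fun j _ => H.v2_int t j), ← integral_const_mul,
    ← integral_add (f := fun x => ∑ j, ρ t x * (v t x j ^ 2 / 2))
      (integrable_finsetSum _ fun j _ => H.v2_int t j) (((H.S t).rgPI H.P).int.const_mul _)]
  refine integral_congr_ae (Filter.Eventually.of_forall fun x => ?_)
  dsimp only
  have : euNorm (v t x) ^ 2 = ∑ j, v t x j ^ 2 := by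
    unfold euNorm
    exact Real.sq_sqrt (Finset.sum_nonneg fun i _ => sq_nonneg _)
  rw [this, Finset.mul_sum]
  congr 1
  exact Finset.sum_congr rfl fun j _ => by ring

theorem Good.conclusion (H : Good c q al γ (kappa γ) T ρ v G R B K) {φ : ℝ → ℝ} (hφ : IsTT T φ) :
    ∫ t in Set.Ioo 0 T, deriv φ t * energyAt d γ ρ v t = 0 := by
  have hγ : γ - 1 ≠ 0 := by have := H.P.hγ; linarith
  have mk : ∀ j, Measurable (fun t => ∫ x, ρ t x * (v t x j ^ 2 / 2) ∂(cubeVol d)) := fun j =>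
    int_meas (H.ρm.mul (((H.vim j).pow_const 2).div_const 2))
  have bk : ∀ j t, |∫ x, ρ t x * (v t x j ^ 2 / 2) ∂(cubeVol d)| ≤ K := fun j t => by
    refine (abs_integral_le_integral_abs).trans ((integral_mono (H.v2_int t j).abs
      ((H.S t).ruuPI H.P j j).int.abs fun x => ?_).trans (H.k3 t j j))
    have e : ρ t x * (v t x j ^ 2 / 2) = (ρ t x * v t x j * v t x j) * (1/2) := by ring
    dsimp only
    rw [e, abs_mul, abs_of_pos (by norm_num : (0:ℝ) < 1/2)]
    have := abs_nonneg (ρ t x * v t x j * v t x j)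
    linarith
  have e : ∀ t, deriv φ t * energyAt d γ ρ v t =
      (∑ j, deriv φ t * ∫ x, ρ t x * (v t x j ^ 2 / 2) ∂(cubeVol d)) +
      kappa γ / (γ - 1) * (deriv φ t * ∫ x, ρ t x ^ γ ∂(cubeVol d)) := fun t => by
    rw [H.energy t, mul_add, Finset.mul_sum]; ring
  simp only [e]
  have i1 : ∀ j, IntegrableOn (fun t => deriv φ t * ∫ x, ρ t x * (v t x j ^ 2 / 2) ∂(cubeVol d)) (Set.Ioo 0 T) :=
    fun j => Good.bd_tint hφ.deriv (mk j) (bk j)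
  have i2 : IntegrableOn (fun t => deriv φ t * ∫ x, ρ t x ^ γ ∂(cubeVol d)) (Set.Ioo 0 T) :=
    Good.bd_tint hφ.deriv (int_meas H.ργm) (fun t => abs_integral_le_integral_abs.trans (H.k4 t))
  rw [integral_add (f := fun t => ∑ j, deriv φ t * ∫ x, ρ t x * (v t x j ^ 2 / 2) ∂(cubeVol d))
    (integrable_finsetSum _ fun j _ => i1 j) (i2.const_mul _), integral_finsetSum _ (fun j _ => i1 j),
    integral_const_mul, H.int_fin hφ]
  simp only [H.kin_fin _ hφ]
  have e2 : ∀ t, φ t * (-∑ i, (γ - 1) * ∫ x, Qg γ (ρ t) (G i t) x * v t x i ∂(cubeVol d)) =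
      -(γ - 1) * ∑ i, φ t * ∫ x, Qg γ (ρ t) (G i t) x * v t x i ∂(cubeVol d) := fun t => by
    rw [← Finset.mul_sum, ← Finset.mul_sum]; ring
  have e3 : ∀ j t, φ t * (kappa γ * ∫ x, Qg γ (ρ t) (G j t) x * v t x j ∂(cubeVol d)) =
      kappa γ * (φ t * ∫ x, Qg γ (ρ t) (G j t) x * v t x j ∂(cubeVol d)) := fun j t => by ring
  simp only [e2, e3, integral_const_mul]
  rw [integral_finsetSum _ (fun j _ => H.Qv_tint hφ j), ← Finset.mul_sum]
  field_simp
  ring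

end assembly2

/-! ### base regularity of the corrected solution and the mollified equations -/

section base

structure Base (c γ K : ℝ) (ρ : ℝ → (Fin d → ℝ) → ℝ) (v : ℝ → (Fin d → ℝ) → Fin d → ℝ) : Prop where
  hc : 0 < c
  hγ : 1 < γ
  K0 : 0 ≤ K
  ρm : Measurable (Function.uncurry ρ)
  vm : Measurable (Function.uncurry v)
  ρp : ∀ t, Per (ρ t)
  vp : ∀ t, Per (v t)
  rc : ∀ t x, c ≤ ρ t x
  e1 : ∀ t, ∫⁻ x, ‖ρ t x ^ γ‖ₑ ∂(cubeVol d) ≤ ENNReal.ofReal K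
  e2 : ∀ t, ∫⁻ x, ‖ρ t x * euNorm (v t x) ^ 2‖ₑ ∂(cubeVol d) ≤ ENNReal.ofReal K

variable {c γ K T κ : ℝ} {ρ : ℝ → (Fin d → ℝ) → ℝ} {v : ℝ → (Fin d → ℝ) → Fin d → ℝ}

theorem euNorm_meas : Measurable (euNorm : (Fin d → ℝ) → ℝ) := by
  unfold euNorm
  fun_prop

theorem euNorm_nonneg (x : Fin d → ℝ) : 0 ≤ euNorm x := Real.sqrt_nonneg _

theorem Base.ρ0 (H : Base c γ K ρ v) (t : ℝ) (x : Fin d → ℝ) : 0 < ρ t x := H.hc.trans_le (H.rc t x)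

theorem Base.slm (H : Base c γ K ρ v) (t : ℝ) : Measurable (ρ t) := H.ρm.comp measurable_prodMk_left
theorem Base.slv (H : Base c γ K ρ v) (t : ℝ) : Measurable (v t) := H.vm.comp measurable_prodMk_left
theorem Base.vim (H : Base c γ K ρ v) (j : Fin d) : Measurable (Function.uncurry fun t x => v t x j) :=
  (measurable_pi_apply j).comp H.vm

theorem Base.dom (H : Base c γ K ρ v) (t : ℝ) {f : (Fin d → ℝ) → ℝ} (hm : Measurable f) (hp : Per f)
    (hf : ∀ x, |f x| ≤ 1 + ρ t x ^ γ + ρ t x * euNorm (v t x) ^ 2) :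
    PI f ∧ ∫ x, |f x| ∂(cubeVol d) ≤ 1 + K + K := by
  have h : ∫⁻ x, ‖f x‖ₑ ∂(cubeVol d) ≤ ENNReal.ofReal (1 + K + K) := by
    calc _ ≤ ∫⁻ x, (1 + ‖ρ t x ^ γ‖ₑ + ‖ρ t x * euNorm (v t x) ^ 2‖ₑ) ∂(cubeVol d) := by
          refine lintegral_mono fun x => ?_
          have h1 : 0 ≤ ρ t x ^ γ := Real.rpow_nonneg (H.ρ0 t x).le _
          have h2 : 0 ≤ ρ t x * euNorm (v t x) ^ 2 := mul_nonneg (H.ρ0 t x).le (sq_nonneg _)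
          refine (enorm_le_of_abs (hf x)).trans ?_
          rw [Real.enorm_eq_ofReal h1, Real.enorm_eq_ofReal h2, ENNReal.ofReal_add (by positivity) h2,
            ENNReal.ofReal_add zero_le_one h1, ENNReal.ofReal_one]
      _ ≤ 1 + ENNReal.ofReal K + ENNReal.ofReal K := by
          have m1 : Measurable fun x => ‖ρ t x ^ γ‖ₑ := ((H.slm t).pow_const γ).enorm
          rw [lintegral_add_left (f := fun x => 1 + ‖ρ t x ^ γ‖ₑ) (measurable_const.add m1),
            lintegral_add_left (f := fun x => 1) measurable_const]
          gcongr
          · simp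
          · exact H.e1 t
          · exact H.e2 t
      _ = _ := by
          have := H.K0
          rw [ENNReal.ofReal_add (by positivity) this, ENNReal.ofReal_add zero_le_one this, ENNReal.ofReal_one]
  have hPI := PI.mk' hm hp (h.trans_lt ENNReal.ofReal_lt_top)
  refine ⟨hPI, ?_⟩
  have := H.K0
  rw [integral_eq_lintegral_of_nonneg_ae (Filter.Eventually.of_forall fun x => abs_nonneg _)
    hm.abs.aestronglyMeasurable]
  refine ENNReal.toReal_le_of_le_ofReal (by positivity) (le_trans (le_of_eq ?_) h)
  refine lintegral_congr fun x => ?_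
  rw [← Real.enorm_eq_ofReal (abs_nonneg _), Real.enorm_abs]

theorem le_one_add_rpow {s γ : ℝ} (hs : 0 ≤ s) (hγ : 1 < γ) : s ≤ 1 + s ^ γ := by
  rcases le_total s 1 with h | h
  · have := Real.rpow_nonneg hs γ
    linarith
  · have := Real.rpow_le_rpow_of_exponent_le h hγ.le
    rw [Real.rpow_one] at this
    linarith

theorem Base.k1 (H : Base c γ K ρ v) (t : ℝ) : PI (ρ t) ∧ ∫ x, |ρ t x| ∂(cubeVol d) ≤ 1 + K + K := by
  refine H.dom t (H.slm t) (H.ρp t) fun x => ?_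
  rw [abs_of_pos (H.ρ0 t x)]
  have h2 : 0 ≤ ρ t x * euNorm (v t x) ^ 2 := mul_nonneg (H.ρ0 t x).le (sq_nonneg _)
  have := le_one_add_rpow (H.ρ0 t x).le H.hγ
  linarith

theorem Base.k2 (H : Base c γ K ρ v) (t : ℝ) (j : Fin d) :
    PI (fun x => ρ t x * v t x j) ∧ ∫ x, |ρ t x * v t x j| ∂(cubeVol d) ≤ 1 + K + K := by
  refine H.dom t ((H.slm t).mul ((measurable_pi_apply j).comp (H.slv t)))
    ((H.ρp t).comp2 (H.vp t) fun a b => a * b j) fun x => ?_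
  rw [abs_mul, abs_of_pos (H.ρ0 t x)]
  have h1 := abs_le_euNorm (v t x) j
  have h3 : |v t x j| ≤ 1 + euNorm (v t x) ^ 2 := by nlinarith [sq_nonneg (euNorm (v t x) - 1), euNorm_nonneg (v t x)]
  have := le_one_add_rpow (H.ρ0 t x).le H.hγ
  have h4 := mul_le_mul_of_nonneg_left h3 (H.ρ0 t x).le
  linarith

theorem Base.k3 (H : Base c γ K ρ v) (t : ℝ) (i j : Fin d) :
    PI (fun x => ρ t x * v t x i * v t x j) ∧ ∫ x, |ρ t x * v t x i * v t x j| ∂(cubeVol d) ≤ 1 + K + K := by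
  refine H.dom t (((H.slm t).mul ((measurable_pi_apply i).comp (H.slv t))).mul ((measurable_pi_apply j).comp (H.slv t)))
    ((H.ρp t).comp2 (H.vp t) fun a b => a * b i * b j) fun x => ?_
  rw [abs_mul, abs_mul, abs_of_pos (H.ρ0 t x), mul_assoc]
  have h1 := mul_le_mul (abs_le_euNorm (v t x) i) (abs_le_euNorm (v t x) j) (abs_nonneg _) (euNorm_nonneg _)
  rw [← sq] at h1
  have h4 := mul_le_mul_of_nonneg_left h1 (H.ρ0 t x).le
  have := Real.rpow_nonneg (H.ρ0 t x).le γ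
  linarith

theorem Base.k4 (H : Base c γ K ρ v) (t : ℝ) :
    PI (fun x => ρ t x ^ γ) ∧ ∫ x, |ρ t x ^ γ| ∂(cubeVol d) ≤ 1 + K + K := by
  refine H.dom t ((H.slm t).pow_const γ) ((H.ρp t).comp fun a => a ^ γ) fun x => ?_
  have h1 := Real.rpow_nonneg (H.ρ0 t x).le γ
  rw [abs_of_nonneg h1]
  have h2 : 0 ≤ ρ t x * euNorm (v t x) ^ 2 := mul_nonneg (H.ρ0 t x).le (sq_nonneg _)
  linarith

theorem tf_ic {χ : ℝ → ℝ} (h : IsTT T χ) (ε : ℝ) (x : Fin d → ℝ) :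
    IsTestFunctionIC T (fun s y => χ s * ker ε (y - x)) where
  smooth := by
    have e2 : ContDiff ℝ (⊤ : ℕ∞) (fun z : ℝ × (Fin d → ℝ) => ker ε (z.2 - x)) :=
      (ker_contDiff ε).comp (contDiff_snd.sub contDiff_const)
    exact (h.1.comp contDiff_fst).mul e2
  periodic := fun t y n => by
    have e2 := Per.shiftsub (ker_periodic ε : Per (ker ε : (Fin d → ℝ) → ℝ)) x y n
    simp only at e2 ⊢
    rw [e2]
  supp := by
    obtain ⟨-, a, b, ha, hb, h⟩ := h
    refine ⟨(b + T) / 2, by linarith, fun t y ht => ?_⟩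
    rw [h t fun h => by have := h.2; linarith]
    simp

theorem pdX_one {χ : ℝ → ℝ} {ε : ℝ} (hε : 0 < ε) (x : Fin d → ℝ) (i : Fin d) (t : ℝ) (y : Fin d → ℝ) :
    pderivX i (fun s y => χ s * ker ε (y - x)) t y = χ t * dker ε i (y - x) := by
  have := pdX_sum (χ₀ := fun _ => 0) (χ := χ) hε hε x x i t y
  simpa using this

theorem pdT_one {χ : ℝ → ℝ} (ε : ℝ) (x : Fin d → ℝ) (t : ℝ) (y : Fin d → ℝ) :
    pderivT (fun s y => χ s * ker ε (y - x)) t y = deriv χ t * ker ε (y - x) := by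
  unfold pderivT
  simp

theorem dmol_eq' (ε : ℝ) (i : Fin d) {f : (Fin d → ℝ) → ℝ} (hf : Per f) (x : Fin d → ℝ) :
    ∫ y, dker ε i (y - x) * f y ∂(cubeVol d) = - dmol ε i f x := by
  rw [dmol_eq ε i hf, neg_neg, conv_eq (dker_periodic ε i) hf]

theorem Base.mass_in (H : Base c γ K ρ v) (a b : ℝ) {ε : ℝ} (hε : 0 < ε) (t : ℝ) (x : Fin d → ℝ) :
    ∫ y, (ρ t y * (a * ker ε (y - x)) + ρ t y * ∑ i, v t y i * (b * dker ε i (y - x))) ∂(cubeVol d) =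
      a * mol ε (ρ t) x - b * ∑ i, dmol ε i (fun y => ρ t y * v t y i) x := by
  have e : ∀ y, ρ t y * (a * ker ε (y - x)) + ρ t y * ∑ i, v t y i * (b * dker ε i (y - x)) =
      a * (ker ε (y - x) * ρ t y) + b * ∑ i, dker ε i (y - x) * (ρ t y * v t y i) := fun y => by
    rw [Finset.mul_sum, Finset.mul_sum]
    congr 1
    · ring
    · exact Finset.sum_congr rfl fun i _ => by ring
  simp only [e]
  have i1 := kf_int' ε (H.k1 t).1 x
  have i2 := fun i => dkf_int' hε i (H.k2 t i).1 x
  rw [integral_add (f := fun y => a * (ker ε (y - x) * ρ t y)) (i1.const_mul a)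
    ((integrable_finsetSum _ fun i _ => i2 i).const_mul b), integral_const_mul, integral_const_mul,
    integral_finsetSum _ (fun i _ => i2 i), mol_eq ε (H.ρp t)]
  simp only [dmol_eq' ε _ (H.k2 t _).1.per, Finset.sum_neg_distrib]
  ring

theorem Base.mom_in (H : Base c γ K ρ v) (κ a b : ℝ) {ε : ℝ} (hε : 0 < ε) (t : ℝ) (x : Fin d → ℝ) (j : Fin d)
    (e : Fin d → ℝ) (he : ∀ j', e j' = if j' = j then 1 else 0) :
    ∫ y, ((∑ j', ρ t y * v t y j' * (e j' * a * ker ε (y - x))) +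
        (∑ i, ∑ j', ρ t y * v t y i * v t y j' * (e j' * b * dker ε i (y - x))) +
        κ * ρ t y ^ γ * ∑ j', e j' * b * dker ε j' (y - x)) ∂(cubeVol d) =
      a * mol ε (fun y => ρ t y * v t y j) x - b * ((∑ i, dmol ε i (fun y => ρ t y * v t y i * v t y j) x) +
        κ * dmol ε j (fun y => ρ t y ^ γ) x) := by
  have e : ∀ y, (∑ j', ρ t y * v t y j' * (e j' * a * ker ε (y - x))) +
        (∑ i, ∑ j', ρ t y * v t y i * v t y j' * (e j' * b * dker ε i (y - x))) +
        κ * ρ t y ^ γ * ∑ j', e j' * b * dker ε j' (y - x) =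
      a * (ker ε (y - x) * (ρ t y * v t y j)) + (b * ∑ i, dker ε i (y - x) * (ρ t y * v t y i * v t y j) +
        (b * κ) * (dker ε j (y - x) * ρ t y ^ γ)) := fun y => by
    simp only [he, ite_mul, one_mul, zero_mul, mul_ite, mul_zero, Finset.sum_ite_eq', Finset.mem_univ, if_true]
    rw [Finset.mul_sum, add_assoc]
    congr 1
    · ring
    · congr 1
      · exact Finset.sum_congr rfl fun i _ => by ring
      · ring
  simp only [e]
  have i1 := kf_int' ε (H.k2 t j).1 x
  have i2 := fun i => dkf_int' hε i (H.k3 t i j).1 x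
  have i3 := dkf_int' hε j (H.k4 t).1 x
  have i2' := (integrable_finsetSum Finset.univ fun i _ => i2 i).const_mul b
  rw [integral_add (f := fun y => a * (ker ε (y - x) * (ρ t y * v t y j))) (i1.const_mul a)
    (g := fun y => b * ∑ i, dker ε i (y - x) * (ρ t y * v t y i * v t y j) +
        (b * κ) * (dker ε j (y - x) * ρ t y ^ γ)) (i2'.add (i3.const_mul (b * κ))),
    integral_add (f := fun y => b * ∑ i, dker ε i (y - x) * (ρ t y * v t y i * v t y j)) i2' (i3.const_mul (b * κ)),
    integral_const_mul, integral_const_mul, integral_const_mul,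
    integral_finsetSum _ (fun i _ => i2 i), mol_eq ε (H.k2 t j).1.per]
  simp only [dmol_eq' ε _ (H.k3 t _ _).1.per, dmol_eq' ε _ (H.k4 t).1.per, Finset.sum_neg_distrib]
  ring

theorem tint_mol {f : ℝ → (Fin d → ℝ) → ℝ} {M : ℝ} (hf : Measurable (Function.uncurry f))
    (h : ∀ t, PI (f t) ∧ ∫ x, |f t x| ∂(cubeVol d) ≤ M) {χ : ℝ → ℝ} (hχ : IsTT T χ) (ε : ℝ)
    (x : Fin d → ℝ) : IntegrableOn (fun t => χ t * mol ε (f t) x) (Set.Ioo 0 T) :=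
  Good.bd_tint hχ ((mol_meas ε hf).comp (measurable_id.prodMk measurable_const)) fun t =>
    (mol_bdd ε (h t).1 x).trans (mul_le_mul_of_nonneg_left (h t).2 (kd_nonneg d ε (kN_pos _).le))

theorem tint_dmol {f : ℝ → (Fin d → ℝ) → ℝ} {M : ℝ} (hf : Measurable (Function.uncurry f))
    (h : ∀ t, PI (f t) ∧ ∫ x, |f t x| ∂(cubeVol d) ≤ M) {χ : ℝ → ℝ} (hχ : IsTT T χ) {ε : ℝ} (hε : 0 < ε)
    (i : Fin d) (x : Fin d → ℝ) : IntegrableOn (fun t => χ t * dmol ε i (f t) x) (Set.Ioo 0 T) :=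
  by
  have hm : Measurable (fun t => dmol ε i (f t) x) := by
    have h0 : Measurable (fun t : ℝ => (t, x)) := measurable_id.prodMk measurable_const
    have h1 := (dmol_meas ε i hf).comp h0
    exact h1
  refine Good.bd_tint (K := 2 * Real.pi / ε * (((kN ε)⁻¹) ^ d * M)) hχ hm fun t => ?_
  have h1 : ((kN ε)⁻¹) ^ d * ∫ y, |f t y| ∂(cubeVol d) ≤ ((kN ε)⁻¹) ^ d * M :=
    mul_le_mul_of_nonneg_left (h t).2 (kd_nonneg d ε (kN_pos _).le)
  exact (dmol_bdd hε i (h t).1 x).trans (mul_le_mul_of_nonneg_left h1 (by positivity))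


theorem Base.mass (H : Base c γ K ρ v) {ρ' : ℝ → (Fin d → ℝ) → ℝ} {v' : ℝ → (Fin d → ℝ) → Fin d → ℝ}
    {ρ₀ : (Fin d → ℝ) → ℝ} {v₀ : (Fin d → ℝ) → Fin d → ℝ} (W : IsWeakSolution d T γ ρ' v' ρ₀ v₀)
    (he : ∀ᵐ t ∂(volume.restrict (Set.Ioo 0 T)), ∀ᵐ x ∂(cubeVol d), ρ' t x = ρ t x ∧ v' t x = v t x)
    {χ : ℝ → ℝ} (hχ : IsTT T χ) {ε : ℝ} (hε : 0 < ε) (x : Fin d → ℝ) :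
    ∫ t in Set.Ioo 0 T, deriv χ t * mol ε (ρ t) x =
      ∫ t in Set.Ioo 0 T, χ t * ∑ i, dmol ε i (fun y => ρ t y * v t y i) x := by
  have h := W.mass _ (tf_ic hχ ε x)
  have h0 : χ 0 = 0 := hχ.zero (Or.inl le_rfl)
  simp only [h0, zero_mul, mul_zero, integral_zero, add_zero, pdX_one hε, pdT_one] at h
  have h2 : ∫ t in Set.Ioo 0 T, (deriv χ t * mol ε (ρ t) x -
      χ t * ∑ i, dmol ε i (fun y => ρ t y * v t y i) x) = 0 := by
    refine Eq.trans (integral_congr_ae ?_) h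
    filter_upwards [he] with t ht
    rw [← H.mass_in (deriv χ t) (χ t) hε t x]
    refine integral_congr_ae ?_
    filter_upwards [ht] with y hy
    simp only [hy.1, hy.2]
  have j2 : IntegrableOn (fun t => χ t * ∑ i, dmol ε i (fun y => ρ t y * v t y i) x) (Set.Ioo 0 T) := by
    simp only [Finset.mul_sum]
    exact integrable_finsetSum _ fun i _ => tint_dmol (H.ρm.mul (H.vim i)) (fun t => H.k2 t i) hχ hε i x
  rw [integral_sub (f := fun t => deriv χ t * mol ε (ρ t) x) (tint_mol H.ρm H.k1 hχ.deriv ε x) j2] at h2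
  linarith

theorem Base.mom (H : Base c γ K ρ v) {ρ' : ℝ → (Fin d → ℝ) → ℝ} {v' : ℝ → (Fin d → ℝ) → Fin d → ℝ}
    {ρ₀ : (Fin d → ℝ) → ℝ} {v₀ : (Fin d → ℝ) → Fin d → ℝ} (W : IsWeakSolution d T γ ρ' v' ρ₀ v₀)
    (he : ∀ᵐ t ∂(volume.restrict (Set.Ioo 0 T)), ∀ᵐ x ∂(cubeVol d), ρ' t x = ρ t x ∧ v' t x = v t x)
    {χ : ℝ → ℝ} (hχ : IsTT T χ) {ε : ℝ} (hε : 0 < ε) (x : Fin d → ℝ) (j : Fin d) :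
    ∫ t in Set.Ioo 0 T, deriv χ t * mol ε (fun y => ρ t y * v t y j) x =
      ∫ t in Set.Ioo 0 T, χ t * ((∑ i, dmol ε i (fun y => ρ t y * v t y i * v t y j) x) +
        kappa γ * dmol ε j (fun y => ρ t y ^ γ) x) := by
  let e : Fin d → ℝ := fun j' => if j' = j then 1 else 0
  have hχ' : ∀ j', IsTT T (fun s => e j' * χ s) := fun j' => hχ.smul _
  have h := W.momentum (fun s y j' => (fun s => e j' * χ s) s * ker ε (y - x)) (fun j' => tf_ic (hχ' j') ε x)
  have h0 : χ 0 = 0 := hχ.zero (Or.inl le_rfl)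
  have pX : ∀ i j' t y, pderivX i (fun s y => (fun s => e j' * χ s) s * ker ε (y - x)) t y =
    e j' * χ t * dker ε i (y - x) := fun i j' t y => pdX_one hε x i t y
  have pT : ∀ j' t y, pderivT (fun s y => (fun s => e j' * χ s) s * ker ε (y - x)) t y =
    e j' * deriv χ t * ker ε (y - x) := fun j' t y => by
      rw [pdT_one (χ := fun s => e j' * χ s)]
      simp
  simp only [h0, zero_mul, mul_zero, integral_zero, add_zero, Finset.sum_const_zero] at h
  simp only [pX, pT] at h
  have h2 : ∫ t in Set.Ioo 0 T, (deriv χ t * mol ε (fun y => ρ t y * v t y j) x -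
      χ t * ((∑ i, dmol ε i (fun y => ρ t y * v t y i * v t y j) x) +
        kappa γ * dmol ε j (fun y => ρ t y ^ γ) x)) = 0 := by
    refine Eq.trans (integral_congr_ae ?_) h
    filter_upwards [he] with t ht
    rw [← H.mom_in (kappa γ) (deriv χ t) (χ t) hε t x j e (fun j' => rfl)]
    refine integral_congr_ae ?_
    filter_upwards [ht] with y hy
    simp only [hy.1, hy.2]
  have j2 : IntegrableOn (fun t => χ t * ((∑ i, dmol ε i (fun y => ρ t y * v t y i * v t y j) x) +
        kappa γ * dmol ε j (fun y => ρ t y ^ γ) x)) (Set.Ioo 0 T) := by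
    simp only [mul_add, Finset.mul_sum]
    refine Integrable.add (f := fun t => ∑ i, χ t * dmol ε i (fun y => ρ t y * v t y i * v t y j) x) ?_ ?_
    · exact integrable_finsetSum _ fun i _ =>
        tint_dmol ((H.ρm.mul (H.vim i)).mul (H.vim j)) (fun t => H.k3 t i j) hχ hε i x
    · have := (tint_dmol (H.ρm.pow_const γ) H.k4 hχ hε j x).const_mul (kappa γ)
      refine this.congr (Filter.Eventually.of_forall fun t => ?_)
      dsimp only
      ring
  rw [integral_sub (f := fun t => deriv χ t * mol ε (fun y => ρ t y * v t y j) x)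
    (tint_mol (H.ρm.mul (H.vim j)) (fun t => H.k2 t j) hχ.deriv ε x) j2] at h2
  linarith

end base

/-! ### removal of exceptional times -/

section cut

theorem nLp_add_fin {α : Type*} [MeasurableSpace α] (μ : Measure α) {p : ℝ≥0∞} (hp : 1 ≤ p)
    {F G : α → ℝ≥0∞} (hF : Measurable F) (hG : Measurable G) (h1 : nLp μ p F < ∞)
    (h2 : nLp μ p G < ∞) : nLp μ p (fun x => F x + G x) < ∞ := by
  unfold nLp at *
  split_ifs with h
  · rw [if_pos h] at h1 h2
    exact (ENNReal.essSup_add_le F G).trans_lt (ENNReal.add_lt_top.2 ⟨h1, h2⟩)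
  · rw [if_neg h] at h1 h2
    have hs : 1 ≤ p.toReal := by
      have := ENNReal.toReal_mono h hp
      simpa using this
    exact (ENNReal.lintegral_Lp_add_le hF.aemeasurable hG.aemeasurable hs).trans_lt
      (ENNReal.add_lt_top.2 ⟨h1, h2⟩)

theorem nLp_cmul_fin {α : Type*} [MeasurableSpace α] (μ : Measure α) {p : ℝ≥0∞}
    {F : α → ℝ≥0∞} {a : ℝ≥0∞} (ha : a ≠ ∞) (h1 : nLp μ p F < ∞) :
    nLp μ p (fun x => a * F x) < ∞ := by
  unfold nLp at *
  split_ifs with h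
  · rw [if_pos h] at h1
    rw [ENNReal.essSup_const_mul]
    exact ENNReal.mul_lt_top ha.lt_top h1
  · rw [if_neg h] at h1
    have hs : 0 ≤ p.toReal := ENNReal.toReal_nonneg
    have e : ∀ x, (a * F x) ^ p.toReal = a ^ p.toReal * F x ^ p.toReal :=
      fun x => ENNReal.mul_rpow_of_nonneg _ _ hs
    have ht : a ^ p.toReal ≠ ∞ := ENNReal.rpow_ne_top_of_nonneg hs ha
    simp_rw [e]
    rw [lintegral_const_mul' _ _ ht, ENNReal.mul_rpow_of_nonneg _ _ (by positivity)]
    exact ENNReal.mul_lt_top (ENNReal.rpow_lt_top_of_nonneg (by positivity) ht) h1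

theorem nLp_const_fin {α : Type*} [MeasurableSpace α] (μ : Measure α) [IsFiniteMeasure μ] {p : ℝ≥0∞}
    {a : ℝ≥0∞} (ha : a ≠ ∞) : nLp μ p (fun _ => a) < ∞ := by
  unfold nLp
  split_ifs with h
  · exact (essSup_le_of_ae_le a (Filter.Eventually.of_forall fun _ => le_rfl)).trans_lt ha.lt_top
  · rw [lintegral_const]
    have hs : 0 ≤ p.toReal := ENNReal.toReal_nonneg
    exact ENNReal.rpow_lt_top_of_nonneg (by positivity)
      (ENNReal.mul_ne_top (ENNReal.rpow_ne_top_of_nonneg hs ha) (measure_ne_top _ _))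

theorem nLp_sum_fin {α ι : Type*} [MeasurableSpace α] (μ : Measure α) [IsFiniteMeasure μ]
    {p : ℝ≥0∞} (hp : 1 ≤ p) (s : Finset ι)
    {F : ι → α → ℝ≥0∞} (hF : ∀ i, Measurable (F i)) (h1 : ∀ i, nLp μ p (F i) < ∞) :
    nLp μ p (fun x => ∑ i ∈ s, F i x) < ∞ := by
  classical
  induction s using Finset.induction_on with
  | empty => simpa using nLp_const_fin μ (p := p) (a := 0) ENNReal.zero_ne_top
  | insert a s ha ih =>
    simp_rw [Finset.sum_insert ha]
    exact nLp_add_fin μ hp (hF a) (Finset.measurable_fun_sum s fun i _ => hF i) (h1 a) ih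

theorem exists_null {μ : Measure ℝ} {P : ℝ → Prop} (h : ∀ᵐ t ∂μ, P t) :
    ∃ N : Set ℝ, MeasurableSet N ∧ (∀ t, t ∉ N → P t) ∧ ∀ᵐ t ∂μ, t ∉ N := by
  refine ⟨toMeasurable μ {t | ¬ P t}, measurableSet_toMeasurable _ _, fun t ht => ?_, ?_⟩
  · by_contra hP
    exact ht (subset_toMeasurable μ _ hP)
  · rw [ae_iff] at h ⊢
    simp only [not_not]
    exact (measure_toMeasurable _).trans h

open Classical in
def cutρ (N : Set ℝ) (c : ℝ) (ρ : ℝ → (Fin d → ℝ) → ℝ) (t : ℝ) (x : Fin d → ℝ) : ℝ :=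
  if t ∈ N then c else max (ρ t x) c

open Classical in
def cutf {β : Type*} (N : Set ℝ) (b : β) (v : ℝ → (Fin d → ℝ) → β) (t : ℝ) (x : Fin d → ℝ) : β :=
  if t ∈ N then b else v t x

theorem cutf_meas {β : Type*} [MeasurableSpace β] {N : Set ℝ} (hN : MeasurableSet N) (b : β)
    {v : ℝ → (Fin d → ℝ) → β} (hv : Measurable (Function.uncurry v)) :
    Measurable (Function.uncurry (cutf N b v)) := by
  classical
  have h : MeasurableSet {z : ℝ × (Fin d → ℝ) | z.1 ∈ N} := measurable_fst hN
  exact Measurable.ite h measurable_const hv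

theorem cutρ_meas {N : Set ℝ} (hN : MeasurableSet N) (c : ℝ)
    {ρ : ℝ → (Fin d → ℝ) → ℝ} (hv : Measurable (Function.uncurry ρ)) :
    Measurable (Function.uncurry (cutρ N c ρ)) := by
  classical
  have h : MeasurableSet {z : ℝ × (Fin d → ℝ) | z.1 ∈ N} := measurable_fst hN
  exact Measurable.ite h measurable_const (hv.max measurable_const)

theorem cutf_in {β : Type*} {N : Set ℝ} {b : β} {v : ℝ → (Fin d → ℝ) → β} {t : ℝ} (h : t ∈ N) :
    cutf N b v t = fun _ => b := by
  funext x; exact if_pos h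

theorem cutf_out {β : Type*} {N : Set ℝ} {b : β} {v : ℝ → (Fin d → ℝ) → β} {t : ℝ} (h : t ∉ N) :
    cutf N b v t = v t := by
  funext x; exact if_neg h

theorem cutρ_in {N : Set ℝ} {c : ℝ} {v : ℝ → (Fin d → ℝ) → ℝ} {t : ℝ} (h : t ∈ N) :
    cutρ N c v t = fun _ => c := by
  funext x; exact if_pos h

theorem cutρ_out {N : Set ℝ} {c : ℝ} {v : ℝ → (Fin d → ℝ) → ℝ} {t : ℝ} (h : t ∉ N) :
    cutρ N c v t = fun x => max (v t x) c := by
  funext x; exact if_neg h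

/-- the admissible times -/
structure Adm (c γ K : ℝ) (r : (Fin d → ℝ) → ℝ) (u : (Fin d → ℝ) → Fin d → ℝ) : Prop where
  lo : ∀ᵐ x ∂(cubeVol d), c ≤ r x
  e1 : ∫⁻ x, ‖r x ^ γ‖ₑ ∂(cubeVol d) ≤ ENNReal.ofReal K
  e2 : ∫⁻ x, ‖r x * euNorm (u x) ^ 2‖ₑ ∂(cubeVol d) ≤ ENNReal.ofReal K

variable {c γ K T : ℝ} {ρ : ℝ → (Fin d → ℝ) → ℝ} {v : ℝ → (Fin d → ℝ) → Fin d → ℝ}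

theorem Adm.eq {r : (Fin d → ℝ) → ℝ} {u : (Fin d → ℝ) → Fin d → ℝ} (H : Adm c γ K r u) :
    ∀ᵐ x ∂(cubeVol d), max (r x) c = r x := by
  filter_upwards [H.lo] with x hx using max_eq_left hx

theorem base_cut {N : Set ℝ} (hN : MeasurableSet N) (hc : 0 < c) (hγ : 1 < γ) (hK : c ^ γ ≤ K)
    (hρ : Measurable (Function.uncurry ρ)) (hv : Measurable (Function.uncurry v))
    (hρp : ∀ t, Per (ρ t)) (hvp : ∀ t, Per (v t))
    (hA : ∀ t, t ∉ N → Adm c γ K (ρ t) (v t)) : Base c γ K (cutρ N c ρ) (cutf N 0 v) where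
  hc := hc
  hγ := hγ
  K0 := (Real.rpow_nonneg hc.le _).trans hK
  ρm := cutρ_meas hN c hρ
  vm := cutf_meas hN 0 hv
  ρp := fun t => by
    by_cases h : t ∈ N
    · rw [cutρ_in h]; exact fun _ _ => rfl
    · rw [cutρ_out h]; exact (hρp t).comp (fun s => max s c)
  vp := fun t => by
    by_cases h : t ∈ N
    · rw [cutf_in h]; exact fun _ _ => rfl
    · rw [cutf_out h]; exact hvp t
  rc := fun t x => by
    by_cases h : t ∈ N
    · rw [cutρ_in h]
    · rw [cutρ_out h]; exact le_max_right _ _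
  e1 := fun t => by
    by_cases h : t ∈ N
    · rw [cutρ_in h]
      simp only [lintegral_const, measure_univ, mul_one]
      rw [Real.enorm_eq_ofReal (Real.rpow_nonneg hc.le _)]
      exact ENNReal.ofReal_le_ofReal hK
    · rw [cutρ_out h]
      refine le_trans (le_of_eq (lintegral_congr_ae ?_)) (hA t h).e1
      filter_upwards [(hA t h).eq] with x hx
      simp only [hx]
  e2 := fun t => by
    by_cases h : t ∈ N
    · rw [cutρ_in h, cutf_in h]
      have : euNorm (0 : Fin d → ℝ) = 0 := by simp [euNorm]
      simp [this]
    · rw [cutρ_out h, cutf_out h]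
      refine le_trans (le_of_eq (lintegral_congr_ae ?_)) (hA t h).e2
      filter_upwards [(hA t h).eq] with x hx
      simp only [hx]

theorem cut_eq {N : Set ℝ} {μ : Measure ℝ} (hN : ∀ᵐ t ∂μ, t ∉ N)
    (hA : ∀ t, t ∉ N → Adm c γ K (ρ t) (v t)) :
    ∀ᵐ t ∂μ, ∀ᵐ x ∂(cubeVol d), ρ t x = cutρ N c ρ t x ∧ v t x = cutf N 0 v t x := by
  filter_upwards [hN] with t ht
  rw [cutρ_out ht, cutf_out ht]
  filter_upwards [(hA t ht).eq] with x hx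
  exact ⟨hx.symm, rfl⟩

theorem adm_ae {ρ₀ : (Fin d → ℝ) → ℝ} {v₀ : (Fin d → ℝ) → Fin d → ℝ}
    (W : IsWeakSolution d T γ ρ v ρ₀ v₀) (hlow : ∀ᵐ z ∂(spaceTime d T), c ≤ ρ z.1 z.2) (hc : 0 < c) :
    ∃ K, c ^ γ ≤ K ∧ ∀ᵐ t ∂(volume.restrict (Set.Ioo 0 T)), Adm c γ K (ρ t) (v t) := by
  have h1 := W.pressure_int
  have h2 := W.kinetic_int
  unfold MemLpLq LpLqNorm timeLpOn at h1 h2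
  rw [if_pos rfl] at h1 h2
  set M1 := essSup (fun t => eLpNorm (fun x => ρ t x ^ γ) 1 (cubeVol d)) (volume.restrict (Set.Ioo 0 T)) with hM1
  set M2 := essSup (fun t => eLpNorm (fun x => ρ t x * euNorm (v t x) ^ 2) 1 (cubeVol d)) (volume.restrict (Set.Ioo 0 T)) with hM2
  have hc0 : 0 ≤ c ^ γ := Real.rpow_nonneg hc.le _
  have p1 : 0 ≤ M1.toReal := ENNReal.toReal_nonneg
  have p2 : 0 ≤ M2.toReal := ENNReal.toReal_nonneg
  refine ⟨c ^ γ + M1.toReal + M2.toReal, by linarith, ?_⟩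
  have hl := Measure.ae_ae_of_ae_prod hlow
  filter_upwards [hl, ENNReal.ae_le_essSup (μ := volume.restrict (Set.Ioo 0 T)) (fun t => eLpNorm (fun x => ρ t x ^ γ) 1 (cubeVol d)),
    ENNReal.ae_le_essSup (μ := volume.restrict (Set.Ioo 0 T)) (fun t => eLpNorm (fun x => ρ t x * euNorm (v t x) ^ 2) 1 (cubeVol d))]
    with t a1 a2 a3
  rw [eLpNorm_one_eq_lintegral_enorm] at a2 a3
  refine ⟨a1, a2.trans ?_, a3.trans ?_⟩
  · exact (ENNReal.ofReal_toReal h1.ne).symm.le.trans (ENNReal.ofReal_le_ofReal (by linarith))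
  · exact (ENNReal.ofReal_toReal h2.ne).symm.le.trans (ENNReal.ofReal_le_ofReal (by linarith))

theorem dmol_const {ε : ℝ} (hε : 0 < ε) (i : Fin d) (a : ℝ) (x : Fin d → ℝ) :
    dmol ε i (fun _ => a) x = 0 := by
  have h := mol_hasDerivAt_i hε (PI_const a) x i
  simp only [mol_const] at h
  exact h.unique (hasDerivAt_const _ _)

theorem weak_congr {N : Set ℝ} {i : Fin d} {g : ℝ → (Fin d → ℝ) → ℝ}
    (he : ∀ᵐ t ∂(volume.restrict (Set.Ioo 0 T)), ∀ᵐ x ∂(cubeVol d), ρ t x = cutρ N c ρ t x ∧ v t x = cutf N 0 v t x)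
    (h : HasWeakDerivX T i ρ g) : HasWeakDerivX T i (cutρ N c ρ) g := by
  intro φ hφ
  rw [← h φ hφ]
  refine integral_congr_ae ?_
  filter_upwards [he] with t ht
  refine integral_congr_ae ?_
  have ht' : ∀ᵐ x ∂(volume.restrict (unitCube d)), ρ t x = cutρ N c ρ t x ∧ v t x = cutf N 0 v t x := ht
  filter_upwards [ht'] with x hx
  rw [hx.1]

end cut

/-! ### the final reduction -/

section final

def Rf (q : ℝ) (ρ : ℝ → (Fin d → ℝ) → ℝ) (G : Fin d → ℝ → (Fin d → ℝ) → ℝ) (t : ℝ) : ℝ≥0∞ :=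
  1 + nLp (cubeVol d) (div3Exp q) (fun x => ‖ρ t x‖ₑ) +
    ∑ i, nLp (cubeVol d) (div3Exp q) (fun x => ‖G i t x‖ₑ)

def Bs (q al : ℝ) (v : ℝ → (Fin d → ℝ) → Fin d → ℝ) (t : ℝ) : ℝ≥0∞ :=
  essSup (fun y => nLp (cubeVol d) (ENNReal.ofReal q) (fun x => ‖v t (x + y) - v t x‖ₑ) /
    ENNReal.ofReal (sg y) ^ al) (cubeVol d)

def Bf (q al : ℝ) (v : ℝ → (Fin d → ℝ) → Fin d → ℝ) (t : ℝ) : ℝ≥0∞ :=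
  1 + nLp (cubeVol d) (ENNReal.ofReal q) (fun x => ‖v t x‖ₑ) + Bs q al v t

variable {c γ K T q al : ℝ} {ρ : ℝ → (Fin d → ℝ) → ℝ} {v : ℝ → (Fin d → ℝ) → Fin d → ℝ}
  {G : Fin d → ℝ → (Fin d → ℝ) → ℝ}

theorem nf_meas (p : ℝ≥0∞) (hρ : Measurable (Function.uncurry ρ)) :
    Measurable (fun t => nLp (cubeVol d) p (fun x => ‖ρ t x‖ₑ)) :=
  nLp_meas (cubeVol d) p (F := fun t x => ‖ρ t x‖ₑ) hρ.enorm

theorem nv_meas (p : ℝ≥0∞) (hρ : Measurable (Function.uncurry v)) :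
    Measurable (fun t => nLp (cubeVol d) p (fun x => ‖v t x‖ₑ)) :=
  nLp_meas (cubeVol d) p (F := fun t x => ‖v t x‖ₑ) hρ.enorm

theorem Rf_meas (hρ : Measurable (Function.uncurry ρ)) (hG : ∀ i, Measurable (Function.uncurry (G i))) :
    Measurable (Rf q ρ G) :=
  (measurable_const.add (nf_meas _ hρ)).add (Finset.measurable_fun_sum _ fun i _ => nf_meas _ (hG i))

theorem Bs_meas (hv : Measurable (Function.uncurry v)) : Measurable (Bs q al v) := by
  refine essSup_meas (cubeVol d) (F := fun t y =>
    nLp (cubeVol d) (ENNReal.ofReal q) (fun x => ‖v t (x + y) - v t x‖ₑ) /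
      ENNReal.ofReal (sg y) ^ al) ?_
  have h1 : Measurable (fun z : ℝ × (Fin d → ℝ) =>
      nLp (cubeVol d) (ENNReal.ofReal q) (fun x => ‖v z.1 (x + z.2) - v z.1 x‖ₑ)) := by
    refine nLp_meas (cubeVol d) _ (F := fun (z : ℝ × (Fin d → ℝ)) x => ‖v z.1 (x + z.2) - v z.1 x‖ₑ) ?_
    have m1 : Measurable (fun w : (ℝ × (Fin d → ℝ)) × (Fin d → ℝ) => (w.1.1, w.2 + w.1.2)) := by fun_prop
    have m2 : Measurable (fun w : (ℝ × (Fin d → ℝ)) × (Fin d → ℝ) => (w.1.1, w.2)) := by fun_prop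
    have n1 := hv.comp m1
    have n2 := hv.comp m2
    exact (n1.sub n2).enorm
  have h2 : Measurable (fun z : ℝ × (Fin d → ℝ) => ENNReal.ofReal (sg z.2) ^ al) :=
    ((sg_continuous.measurable.comp measurable_snd).ennreal_ofReal).pow_const al
  exact h1.div h2

theorem Bf_meas (hv : Measurable (Function.uncurry v)) : Measurable (Bf q al v) :=
  (measurable_const.add (nv_meas _ hv)).add (Bs_meas hv)

theorem Bs_le {α : ℝ} (hal : 0 < al) (h : al ≤ α) (hq : 3 ≤ q) {t : ℝ} (hp : Per (v t)) :
    Bs q al v t ≤ ENNReal.ofReal ((d + 1 : ℝ) ^ α) * besovNorm α (ENNReal.ofReal q) (v t) := by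
  refine essSup_le_of_ae_le _ (Filter.Eventually.of_forall fun y => ?_)
  have hq0 : ENNReal.ofReal q ≠ 0 := by
    rw [Ne, ENNReal.ofReal_eq_zero, not_le]; linarith
  exact ENNReal.div_le_of_le_mul (besov_shift hal h _ hq0 hp y)

theorem slice_good (hq : 3 ≤ q) {t : ℝ} {α : ℝ} (hal : 0 < al) (hα : al ≤ α)
    (rm : Measurable (ρ t)) (rp : Per (ρ t)) (rc : ∀ x, c ≤ ρ t x)
    (um : Measurable (v t)) (up : Per (v t)) (GP : ∀ i, PI (G i t))
    (hR : Rf q ρ G t ≠ ∞) (hB : Bf q al v t ≠ ∞)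
    (grad : ∀ n i x, dmol (ep n) i (ρ t) x = mol (ep n) (G i t) x) :
    Slice c q al (ρ t) (v t) (fun i => G i t) (Rf q ρ G t) (Bf q al v t) where
  rm := rm
  rp := rp
  rc := rc
  um := um
  up := up
  GP := GP
  rR := by unfold Rf; exact le_add_right le_add_self
  GR := fun i => by
    unfold Rf
    refine le_add_left ?_
    exact Finset.single_le_sum (f := fun i => nLp (cubeVol d) (div3Exp q) (fun x => ‖G i t x‖ₑ))
      (fun _ _ => bot_le) (Finset.mem_univ i)
  uB := by unfold Bf; exact le_add_right le_add_self
  uS := by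
    filter_upwards [ENNReal.ae_le_essSup (μ := cubeVol d) (fun y =>
      nLp (cubeVol d) (ENNReal.ofReal q) (fun x => ‖v t (x + y) - v t x‖ₑ) /
        ENNReal.ofReal (sg y) ^ al)] with y hy
    have hq0 : ENNReal.ofReal q ≠ 0 := by
      rw [Ne, ENNReal.ofReal_eq_zero, not_le]; linarith
    have hs := besov_shift hal hα _ hq0 up y
    have ht : ENNReal.ofReal (sg y) ^ al ≠ ∞ := ENNReal.rpow_ne_top_of_nonneg hal.le ENNReal.ofReal_ne_top
    by_cases h0 : ENNReal.ofReal (sg y) ^ al = 0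
    · rw [h0, mul_zero] at hs ⊢
      exact hs
    · have h1 := (ENNReal.div_le_iff h0 ht).1 hy
      refine h1.trans ?_
      gcongr
      exact le_add_self
  R1 := by unfold Rf; exact le_add_right le_self_add
  RT := hR
  B1 := by unfold Bf; exact le_add_right le_self_add
  BT := hB
  grad := grad

theorem slice_const (hq : 3 ≤ q) (hc : 0 < c) :
    Slice c q al (fun _ : Fin d → ℝ => c) (fun _ => (0 : Fin d → ℝ)) (fun _ _ => 0)
      (1 + nLp (cubeVol d) (div3Exp q) (fun _ => ENNReal.ofReal c)) 1 where
  rm := measurable_const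
  rp := fun _ _ => rfl
  rc := fun _ => le_rfl
  um := measurable_const
  up := fun _ _ => rfl
  GP := fun _ => PI_const 0
  rR := by
    simp only [Real.enorm_eq_ofReal hc.le]
    exact le_add_self
  GR := fun i => by
    refine le_trans (nLp_mono_ae _ _ (Filter.Eventually.of_forall fun x => ?_)) le_add_self
    simp
  uB := by
    have h3 : 0 < q := by linarith
    simp [nLp, ENNReal.toReal_ofReal h3.le, h3]
  uS := by
    have h3 : 0 < q := by linarith
    simp [nLp, ENNReal.toReal_ofReal h3.le, h3]
  R1 := le_self_add
  RT := ENNReal.add_ne_top.2 ⟨ENNReal.one_ne_top, (nLp_const_fin _ ENNReal.ofReal_ne_top).ne⟩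
  B1 := le_rfl
  BT := ENNReal.one_ne_top
  grad := fun n i x => by rw [dmol_const (ep_pos n), mol_const]

end final

theorem main_red
    (d : ℕ) (T : ℝ) (hT : 0 < T) (γ : ℝ) (hγ : 1 < γ)
    (α : ℝ) (hα : 1 / 3 < α)
    (p q : ℝ) (hp3 : 3 ≤ p) (hq3 : 3 ≤ q)
    (hp : p ≤ (3 * γ - 1) / (γ - 1)) (hq : q ≤ (3 * γ - 1) / (γ - 1))
    (ρ : ℝ → (Fin d → ℝ) → ℝ) (v : ℝ → (Fin d → ℝ) → Fin d → ℝ)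
    (ρ₀ : (Fin d → ℝ) → ℝ) (v₀ : (Fin d → ℝ) → Fin d → ℝ)
    (hsol : IsWeakSolution d T γ ρ v ρ₀ v₀)
    (c : ℝ) (hc : 0 < c)
    (hlow : ∀ᵐ z ∂(spaceTime d T), c ≤ ρ z.1 z.2)
    (hρ : MemLpLq T (div3Exp p) (div3Exp q) ρ)
    (hgradρ : GradInLpLq T (div3Exp p) (div3Exp q) ρ)
    (hv : MemLpBesov T (ENNReal.ofReal p) α (ENNReal.ofReal q) v)
    (φ : ℝ → ℝ) (hφ : IsTT T φ) :
    ∫ t in Set.Ioo 0 T, deriv φ t * energyAt d γ ρ v t = 0 := by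
  classical
  have hq0 : ENNReal.ofReal q ≠ 0 := by
    rw [Ne, ENNReal.ofReal_eq_zero, not_le]; linarith
  have hp1 : 1 ≤ ENNReal.ofReal p := by
    rw [ENNReal.one_le_ofReal]; linarith
  set μ : Measure ℝ := volume.restrict (Set.Ioo 0 T) with hμ
  have hfm : IsFiniteMeasure μ := by
    rw [hμ]; infer_instance
  obtain ⟨al, hal1, hal2, halα⟩ : ∃ al : ℝ, 1 / 3 < al ∧ al ≤ 1 / 2 ∧ al ≤ α :=
    ⟨min α (1 / 2), lt_min hα (by norm_num), min_le_right _ _, min_le_left _ _⟩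
  have hal0 : 0 < al := by linarith
  obtain ⟨K, hK, hadm⟩ := adm_ae hsol hlow hc
  -- first cut
  obtain ⟨N1, hN1m, hN1, hN1e⟩ := exists_null hadm
  have B1 : Base c γ K (cutρ N1 c ρ) (cutf N1 0 v) :=
    base_cut hN1m hc hγ hK hsol.rho_meas hsol.v_meas hsol.rho_periodic hsol.v_periodic hN1
  have E1 := cut_eq hN1e hN1
  obtain ⟨g, hg, hgL⟩ := hgradρ
  have hgL' : nLp μ (div3Exp p) (fun t => eLpNorm (g t) (div3Exp q) (cubeVol d)) < ∞ := hgL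
  have hρL' : nLp μ (div3Exp p) (fun t => eLpNorm (ρ t) (div3Exp q) (cubeVol d)) < ∞ := hρ
  have hvL' : nLp μ (ENNReal.ofReal p) (fun t => besovNorm α (ENNReal.ofReal q) (v t)) < ∞ := hv
  have hgi : ∀ i, nLp μ (div3Exp p)
      (fun t => nLp (cubeVol d) (div3Exp q) (fun x => ‖g t x i‖ₑ)) < ∞ := by
    intro i
    refine (nLp_mono_ae _ _ (Filter.Eventually.of_forall fun t => ?_)).trans_lt hgL'
    rw [eLpNorm_eq_nLp _ _ (div3Exp_ne_zero q)]
    refine nLp_mono_ae _ _ (Filter.Eventually.of_forall fun x => ?_)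
    rw [enorm_le_iff_norm_le]
    exact norm_le_pi_norm (g t x) i
  have hG : ∀ i, ∃ G : ℝ → (Fin d → ℝ) → ℝ, Measurable (Function.uncurry G) ∧ (∀ t, Per (G t)) ∧
      ∀ᵐ t ∂μ, PI (G t) ∧
        (∀ n x, dmol (ep n) i (cutρ N1 c ρ t) x = mol (ep n) (G t) x) ∧
        ∀ᵐ x ∂(cubeVol d), ‖G t x‖ₑ ≤ ‖g t x i‖ₑ := fun i =>
    meas_grad hT B1.ρm (fun t => (B1.k1 t).1) (fun t => (B1.k1 t).2) (weak_congr E1 (hg i)) hq3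
      (lint_fin_of_nLp μ (one_le_div3Exp p) (hgi i))
  choose G hGm hGp hGe using hG
  -- norms
  have hRm : Measurable (Rf q (cutρ N1 c ρ) G) := Rf_meas B1.ρm hGm
  have hBm : Measurable (Bf q al v) := Bf_meas hsol.v_meas
  have hRfin : nLp μ (div3Exp p) (Rf q (cutρ N1 c ρ) G) < ∞ := by
    have hp1 := one_le_div3Exp p
    refine nLp_add_fin μ hp1 (measurable_const.add (nf_meas _ B1.ρm))
      (Finset.measurable_fun_sum _ fun i _ => nf_meas _ (hGm i)) ?_ ?_
    · refine nLp_add_fin μ hp1 measurable_const (nf_meas _ B1.ρm) (nLp_const_fin μ ENNReal.one_ne_top) ?_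
      refine (nLp_mono_ae _ _ ?_).trans_lt hρL'
      filter_upwards [E1] with t ht
      rw [eLpNorm_eq_nLp _ _ (div3Exp_ne_zero q)]
      refine nLp_mono_ae _ _ ?_
      filter_upwards [ht] with x hx
      rw [hx.1]
    · refine nLp_sum_fin μ hp1 _ (fun i => nf_meas _ (hGm i)) fun i => ?_
      refine (nLp_mono_ae _ _ ?_).trans_lt (hgi i)
      filter_upwards [hGe i] with t ht
      exact nLp_mono_ae _ _ ht.2.2
  have hBfin : nLp μ (ENNReal.ofReal p) (Bf q al v) < ∞ := by
    refine nLp_add_fin μ hp1 (measurable_const.add (nv_meas _ hsol.v_meas)) (Bs_meas hsol.v_meas) ?_ ?_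
    · refine nLp_add_fin μ hp1 measurable_const (nv_meas _ hsol.v_meas)
        (nLp_const_fin μ ENNReal.one_ne_top) ?_
      refine (nLp_mono_ae _ _ (Filter.Eventually.of_forall fun t => ?_)).trans_lt hvL'
      rw [← eLpNorm_eq_nLp _ _ hq0]
      exact le_self_add
    · refine (nLp_mono_ae _ _ (Filter.Eventually.of_forall fun t => ?_)).trans_lt
        (nLp_cmul_fin μ (a := ENNReal.ofReal ((d + 1 : ℝ) ^ α)) ENNReal.ofReal_ne_top hvL')
      exact Bs_le hal0 halα hq3 (hsol.v_periodic t)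
  have hRae := ae_lt_top hRm (lint_fin_of_nLp μ (one_le_div3Exp p) hRfin).ne
  have hBae := ae_lt_top hBm (lint_fin_of_nLp μ hp1 hBfin).ne
  -- second cut
  have hall : ∀ᵐ t ∂μ, t ∉ N1 ∧ (∀ i, PI (G i t) ∧
        (∀ n x, dmol (ep n) i (cutρ N1 c ρ t) x = mol (ep n) (G i t) x)) ∧
        Rf q (cutρ N1 c ρ) G t < ∞ ∧ Bf q al v t < ∞ := by
    filter_upwards [hN1e, ae_all_iff.2 hGe, hRae, hBae] with t a1 a2 a3 a4
    exact ⟨a1, fun i => ⟨(a2 i).1, (a2 i).2.1⟩, a3, a4⟩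
  obtain ⟨N2, hN2m, hN2, hN2e⟩ := exists_null hall
  have hA2 : ∀ t, t ∉ N2 → Adm c γ K (ρ t) (v t) := fun t ht => hN1 t (hN2 t ht).1
  have B2 : Base c γ K (cutρ N2 c ρ) (cutf N2 0 v) :=
    base_cut hN2m hc hγ hK hsol.rho_meas hsol.v_meas hsol.rho_periodic hsol.v_periodic hA2
  have E2 := cut_eq hN2e hA2
  have e12 : ∀ t, t ∉ N2 → cutρ N2 c ρ t = cutρ N1 c ρ t := fun t ht => by
    rw [cutρ_out ht, cutρ_out (hN2 t ht).1]
  set C0 : ℝ≥0∞ := 1 + nLp (cubeVol d) (div3Exp q) (fun _ => ENNReal.ofReal c) with hC0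
  let R : ℝ → ℝ≥0∞ := fun t => if t ∈ N2 then C0 else Rf q (cutρ N1 c ρ) G t
  let B : ℝ → ℝ≥0∞ := fun t => if t ∈ N2 then 1 else Bf q al v t
  let G2 : Fin d → ℝ → (Fin d → ℝ) → ℝ := fun i => cutf N2 0 (G i)
  have hRm2 : Measurable R := Measurable.ite hN2m measurable_const hRm
  have hBm2 : Measurable B := Measurable.ite hN2m measurable_const hBm
  have hS : ∀ t, Slice c q al (cutρ N2 c ρ t) (cutf N2 0 v t) (fun i => G2 i t) (R t) (B t) := by
    intro t
    by_cases ht : t ∈ N2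
    · have h := slice_const (d := d) (al := al) hq3 hc
      have e1 : (fun i => G2 i t) = fun (_ : Fin d) (_ : Fin d → ℝ) => (0:ℝ) := by
        funext i; exact cutf_in ht
      have e2 : R t = C0 := if_pos ht
      have e3 : B t = 1 := if_pos ht
      rw [cutρ_in ht, cutf_in ht, e1, e2, e3]
      exact h
    · have e1 : (fun i => G2 i t) = fun i => G i t := by
        funext i; exact cutf_out ht
      have e2 : R t = Rf q (cutρ N1 c ρ) G t := if_neg ht
      have e3 : B t = Bf q al v t := if_neg ht
      obtain ⟨a1, a2, a3, a4⟩ := hN2 t ht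
      rw [e12 t ht, cutf_out ht, e1, e2, e3]
      exact slice_good hq3 hal0 halα (B1.slm t) (B1.ρp t) (B1.rc t)
        (hsol.v_meas.comp measurable_prodMk_left) (hsol.v_periodic t) (fun i => (a2 i).1) a3.ne a4.ne
        (fun n i x => (a2 i).2 n x)
  have hRfin2 : nLp μ (div3Exp p) R < ∞ := by
    refine (nLp_mono_ae _ _ ?_).trans_lt hRfin
    filter_upwards [hN2e] with t ht
    exact (if_neg ht).le
  have hBfin2 : nLp μ (ENNReal.ofReal p) B < ∞ := by
    refine (nLp_mono_ae _ _ ?_).trans_lt hBfin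
    filter_upwards [hN2e] with t ht
    exact (if_neg ht).le
  have f1 := time_fin μ hRm2 (fun t => (hS t).R1) (fun t => (hS t).RT) p 1 3 hp3 zero_le_one
    (by norm_num) (by linarith) hRfin2 hBfin2
  have f2 := time_fin μ hRm2 (fun t => (hS t).R1) (fun t => (hS t).RT) p γ 1 hp3 (by linarith)
    one_pos (gamma_exp hγ hp) hRfin2 hBfin2
  simp only [ENNReal.rpow_one] at f1 f2
  have H : Good c q al γ (kappa γ) T (cutρ N2 c ρ) (cutf N2 0 v) G2 R B (1 + K + K) :=
    { T0 := hT
      P := ⟨hγ, hc, hq3, hq, hal1, hal2⟩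
      ρm := B2.ρm
      vm := B2.vm
      Gm := fun i => cutf_meas hN2m 0 (hGm i)
      S := hS
      K0 := by have := B2.K0; positivity
      k1 := fun t => (B2.k1 t).2
      k2 := fun t j => (B2.k2 t j).2
      k3 := fun t i j => (B2.k3 t i j).2
      k4 := fun t => (B2.k4 t).2
      fin := by
        rw [lintegral_add_left (f := fun t => R t * B t ^ (3:ℝ)) (hRm2.mul (hBm2.pow_const _))]
        exact ENNReal.add_lt_top.2 ⟨f1, f2⟩
      mass := fun χ hχ ε hε x => B2.mass hsol E2 hχ hε x
      mom := fun χ hχ ε hε x j => B2.mom hsol E2 hχ hε x j }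
  refine Eq.trans (integral_congr_ae ?_) (H.conclusion hφ)
  filter_upwards [E2] with t ht
  have : energyAt d γ ρ v t = energyAt d γ (cutρ N2 c ρ) (cutf N2 0 v) t := by
    unfold energyAt
    refine integral_congr_ae ?_
    have ht' : ∀ᵐ x ∂(volume.restrict (unitCube d)),
      ρ t x = cutρ N2 c ρ t x ∧ v t x = cutf N2 0 v t x := ht
    filter_upwards [ht'] with x hx
    rw [← hx.1, ← hx.2]
  rw [this]

/-- **Corollary (1)** of Theorem 1.1: local energy conservation for
`3 ≤ p,q ≤ (3γ-1)/(γ-1)`, with `ρ, ∂ₜρ, ∇ρ ∈ L^{p/(p-3)}(0,T;L^{q/(q-3)})`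
(read as `L^∞` when `p = 3` resp. `q = 3`) and `v ∈ L^p(0,T;B^α_{q,∞})`, `α > 1/3`. -/
theorem local_energy_conservation_corollary_one
    (d : ℕ) (hd : 2 ≤ d) (T : ℝ) (hT : 0 < T) (γ : ℝ) (hγ : 1 < γ)
    (α : ℝ) (hα : 1 / 3 < α)
    (p q : ℝ) (hp3 : 3 ≤ p) (hq3 : 3 ≤ q)
    (hp : p ≤ (3 * γ - 1) / (γ - 1)) (hq : q ≤ (3 * γ - 1) / (γ - 1))
    (ρ : ℝ → (Fin d → ℝ) → ℝ) (v : ℝ → (Fin d → ℝ) → Fin d → ℝ)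
    (ρ₀ : (Fin d → ℝ) → ℝ) (v₀ : (Fin d → ℝ) → Fin d → ℝ)
    (hsol : IsWeakSolution d T γ ρ v ρ₀ v₀)
    (c : ℝ) (hc : 0 < c)
    (hlow : ∀ᵐ z ∂(spaceTime d T), c ≤ ρ z.1 z.2)
    (hρ : MemLpLq T (div3Exp p) (div3Exp q) ρ)
    (hdtρ : DtInLpLq T (div3Exp p) (div3Exp q) ρ)
    (hgradρ : GradInLpLq T (div3Exp p) (div3Exp q) ρ)
    (hv : MemLpBesov T (ENNReal.ofReal p) α (ENNReal.ofReal q) v) :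
    ∀ φ : ℝ → ℝ, ContDiff ℝ (⊤ : ℕ∞) φ →
      (∃ a b : ℝ, 0 < a ∧ b < T ∧ ∀ t, t ∉ Set.Icc a b → φ t = 0) →
      ∫ t in Set.Ioo 0 T, deriv φ t * energyAt d γ ρ v t = 0 := by
  intro φ h1 h2
  exact main_red d T hT γ hγ α hα p q hp3 hq3 hp hq ρ v ρ₀ v₀ hsol c hc hlow hρ hgradρ hv φ ⟨h1, h2⟩

end CompressibleEuler
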